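/- For every ε > 0 there exists a constant C = C(ε) > 0 with the following property: for every primitive positive-definite quaternary integer-valued quadratic form Q with discriminant D(Q) and level N(Q), and every positive integer n that satisfies the strong local solubility condition for Q and n ≥ C · max{ N(Q)^(5/2+ε) · D(Q)^(5/4+ε), N(Q)^(3+ε) · D(Q)^(1+ε) }, the integer n is represented by Q, i.e. there exists x ∈ ℤ⁴ with Q(x) = n. -/

import Mathlib

open scoped BigOperators

/-- Value of the quadratic form with Gram matrix `A` (symmetric, even diagonal)
over any commutative ring: `Q(x) = ∑ (aᵢᵢ/2) xᵢ² + ∑_{i<j} aᵢⱼ xᵢ xⱼ`. -/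
def Qval {R : Type*} [CommRing R] (A : Matrix (Fin 4) (Fin 4) ℤ) (x : Fin 4 → R) : R :=
  (∑ i, ((A i i / 2 : ℤ) : R) * x i ^ 2) +
    ∑ i, ∑ j ∈ Finset.Ioi i, ((A i j : ℤ) : R) * (x i * x j)

/-- `A` is the Gram matrix of an integer-valued quadratic form. -/
def IsGram (A : Matrix (Fin 4) (Fin 4) ℤ) : Prop :=
  A.IsSymm ∧ ∀ i, 2 ∣ A i i

/-- The form is primitive: the gcd of its coefficients is 1. -/
def IsPrimitiveQF (A : Matrix (Fin 4) (Fin 4) ℤ) : Prop :=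
  ∀ d : ℤ, (∀ i, d ∣ A i i / 2) → (∀ i j, i ≠ j → d ∣ A i j) → IsUnit d

/-- The form is positive definite. -/
def PosDefQF (A : Matrix (Fin 4) (Fin 4) ℤ) : Prop :=
  (A.map (Int.cast : ℤ → ℝ)).PosDef

/-- `N` is the level of the form with Gram matrix `A`: the smallest positive integer
such that `N • A⁻¹` has integer entries and even diagonal. -/
def IsLevel (A : Matrix (Fin 4) (Fin 4) ℤ) (N : ℕ) : Prop :=
  0 < N ∧
    (∃ B : Matrix (Fin 4) (Fin 4) ℤ,
      B.map (Int.cast : ℤ → ℚ) = (N : ℚ) • (A.map (Int.cast : ℤ → ℚ))⁻¹ ∧ ∀ i, 2 ∣ B i i) ∧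
    ∀ M : ℕ, 0 < M →
      (∃ B : Matrix (Fin 4) (Fin 4) ℤ,
        B.map (Int.cast : ℤ → ℚ) = (M : ℚ) • (A.map (Int.cast : ℤ → ℚ))⁻¹ ∧ ∀ i, 2 ∣ B i i) →
      N ≤ M

/-- `n` is represented by the form over `ℤ`. -/
def Represented (A : Matrix (Fin 4) (Fin 4) ℤ) (n : ℕ) : Prop :=
  ∃ x : Fin 4 → ℤ, Qval A x = (n : ℤ)

/-- `n` is locally represented: representable over `ℤ_p` for every prime `p`. -/
def LocallyRepresented (A : Matrix (Fin 4) (Fin 4) ℤ) (n : ℕ) : Prop :=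
  ∀ (p : ℕ) [Fact p.Prime], ∃ x : Fin 4 → ℤ_[p], Qval A x = (n : ℤ_[p])

/-- Number of solutions of `Q(x) ≡ n mod p^k`. -/
noncomputable def localCount (A : Matrix (Fin 4) (Fin 4) ℤ) (p n k : ℕ) : ℕ :=
  Nat.card {x : Fin 4 → ZMod (p ^ k) // Qval A x = (n : ZMod (p ^ k))}

/-- The local density `β_p(Q;n)` exists and is at least `c`. -/
def DensityBound (A : Matrix (Fin 4) (Fin 4) ℤ) (p n : ℕ) (c : ℝ) : Prop :=
  ∃ β : ℝ,
    Filter.Tendsto (fun k => (localCount A p n k : ℝ) / (p : ℝ) ^ (3 * k))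
      Filter.atTop (nhds β) ∧ c ≤ β


/-- `n` satisfies the strong local solubility condition for the form with Gram matrix `A`. -/
def StrongLocalSolubility (A : Matrix (Fin 4) (Fin 4) ℤ) (n : ℕ) : Prop :=
  LocallyRepresented A n ∧
    ∀ p : ℕ, p.Prime →
      ∃ x : Fin 4 → ℤ,
        Qval A x ≡ (n : ℤ) [ZMOD (p : ℤ) ^ (if p = 2 then 3 else 1)] ∧
        ¬ ∀ i, (p : ℤ) ∣ A.mulVec x i


set_option linter.all false

namespace Step
open Polynomial

variable {F : Type*} [Field F]

/-- weight bound -/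
def Wt (p : ℕ) (P : F[X][X]) (W : ℕ) : Prop :=
  ∀ j k, W < p * k + j → (P.coeff j).coeff k = 0

lemma Wt.sum {p W : ℕ} {ι : Type*} (s : Finset ι) (P : ι → F[X][X])
    (h : ∀ i ∈ s, Wt p (P i) W) : Wt p (∑ i ∈ s, P i) W := by
  intro j k hjk
  rw [finset_sum_coeff, finset_sum_coeff]
  exact Finset.sum_eq_zero fun i hi => h i hi j k hjk

lemma Wt.mono {p W W' : ℕ} {P : F[X][X]} (h : Wt p P W) (hW : W ≤ W') : Wt p P W' :=
  fun j k hjk => h j k (by omega)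

lemma Wt.add {p W : ℕ} {P Q : F[X][X]} (h : Wt p P W) (h' : Wt p Q W) : Wt p (P + Q) W := by
  intro j k hjk
  rw [coeff_add, coeff_add, h j k hjk, h' j k hjk, add_zero]

lemma Wt.monomial {p j : ℕ} {f : F[X]} {W : ℕ} (h : p * f.natDegree + j ≤ W) :
    Wt p (monomial j f) W := by
  intro j' k hjk
  rw [coeff_monomial]
  split_ifs with hj
  · subst hj
    apply coeff_eq_zero_of_natDegree_lt
    by_contra hc
    push Not at hc
    have := Nat.mul_le_mul_left p hc
    omega
  · simp

/-- the reduction (times `X`) modulo `y^p = y + x + b/x + δ`, on `y`-degree at most `2 * p - 2`. -/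
noncomputable def Red (p : ℕ) (b δ : F) (P : F[X][X]) (j : ℕ) : F[X] :=
  X * P.coeff j + (if j = 0 then 0 else X * P.coeff (p + j - 1)) +
    (X ^ 2 + C δ * X + C b) * P.coeff (p + j)

lemma Red_sum (p : ℕ) (b δ : F) {ι : Type*} (s : Finset ι) (P : ι → F[X][X]) (j : ℕ) :
    Red p b δ (∑ i ∈ s, P i) j = ∑ i ∈ s, Red p b δ (P i) j := by
  unfold Red
  simp only [finset_sum_coeff, Finset.mul_sum, Finset.sum_add_distrib]
  congr 2
  split_ifs <;> simp

lemma Red_add (p : ℕ) (b δ : F) (P Q : F[X][X]) (j : ℕ) :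
    Red p b δ (P + Q) j = Red p b δ P j + Red p b δ Q j := by
  unfold Red
  simp only [coeff_add, mul_add]
  split_ifs <;> ring

lemma Red_smul (p : ℕ) (b δ : F) (c : F) (P : F[X][X]) (j : ℕ) :
    Red p b δ (C (C c) * P) j = C c * Red p b δ P j := by
  unfold Red
  simp only [coeff_C_mul]
  split_ifs <;> ring

lemma Red_coeff {p : ℕ} (b δ : F) {P : F[X][X]} {W : ℕ} (hp : 1 ≤ p) (h : Wt p P W) (j k : ℕ)
    (hjk : W + p < p * k + j) : (Red p b δ P j).coeff k = 0 := by
  unfold Red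
  have key : ∀ j' k', k ≤ k' + 2 → W < p * k' + j' → (P.coeff j').coeff k' = 0 :=
    fun j' k' _ h' => h j' k' h'
  simp only [coeff_add]
  have h1 : (X * P.coeff j).coeff k = 0 := by
    rcases k with _ | k
    · simp
    · rw [coeff_X_mul]
      apply h; nlinarith
  have h2 : ((if j = 0 then 0 else X * P.coeff (p + j - 1)) : F[X]).coeff k = 0 := by
    split_ifs with hj
    · simp
    · rcases k with _ | k
      · simp
      · rw [coeff_X_mul]
        apply h
        have : p * (k+1) = p * k + p := by ring
        omega
  have h3 : ((X ^ 2 + C δ * X + C b) * P.coeff (p + j)).coeff k = 0 := by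
    have : (X ^ 2 + C δ * X + C b) * P.coeff (p + j) =
      X * (X * P.coeff (p+j)) + C δ * (X * P.coeff (p+j)) + C b * P.coeff (p+j) := by ring
    rw [this, coeff_add, coeff_add, coeff_C_mul, coeff_C_mul]
    have a0 : ∀ k', k ≤ k' + 2 → (P.coeff (p+j)).coeff k' = 0 := by
      intro k' hk'
      apply h
      have : p * k ≤ p * (k' + 2) := Nat.mul_le_mul_left p hk'
      have e : p * (k' + 2) = p * k' + 2 * p := by ring
      omega
    have a1 : ∀ k', k ≤ k' + 1 → (X * P.coeff (p+j)).coeff k' = 0 := by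
      intro k' hk'
      rcases k' with _ | k'
      · simp
      · rw [coeff_X_mul]; exact a0 _ (by omega)
    have a2 : (X * (X * P.coeff (p+j))).coeff k = 0 := by
      rcases k with _ | k
      · simp
      · rw [coeff_X_mul]; exact a1 _ (by omega)
    rw [a2, a1 k (by omega), a0 k (by omega)]; simp
  rw [h1, h2, h3]; simp

lemma Red_eval {p : ℕ} (b δ : F) (P : F[X][X]) (hp : 1 ≤ p) (hP : ∀ j, 2 * p - 1 ≤ j → P.coeff j = 0)
    (x y : F) (hx : x ≠ 0) (hy : y ^ p = y + (x + b / x + δ)) :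
    ∑ j ∈ Finset.range p, (Red p b δ P j).eval x * y ^ j = x * P.evalEval x y := by
  have e1 : P.evalEval x y = ∑ j ∈ Finset.range (p + p), (P.coeff j).eval x * y ^ j := by
    have hdeg : P.natDegree < p + p := by
      by_contra hc
      push Not at hc
      have := hP P.natDegree (by omega)
      rw [coeff_natDegree, leadingCoeff_eq_zero] at this
      rw [this] at hc; simp at hc; omega
    unfold evalEval
    rw [eval_eq_sum_range' hdeg, eval_finset_sum]
    simp
  rw [e1, Finset.sum_range_add, mul_add, Finset.mul_sum, Finset.mul_sum]
  have e2 : ∀ j, x * ((P.coeff (p + j)).eval x * y ^ (p + j)) =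
      x * (P.coeff (p+j)).eval x * y ^ (j+1) + (x^2 + δ * x + b) * (P.coeff (p+j)).eval x * y ^ j := by
    intro j
    rw [pow_add, hy, pow_succ]
    field_simp
    ring
  simp_rw [e2, Finset.sum_add_distrib]
  have e3 : ∑ j ∈ Finset.range p, x * (P.coeff (p+j)).eval x * y ^ (j+1) =
     ∑ j ∈ Finset.range p, (if j = 0 then 0 else x * (P.coeff (p + j - 1)).eval x) * y ^ j := by
    obtain ⟨m, rfl⟩ : ∃ m, p = m + 1 := ⟨p - 1, by omega⟩
    rw [Finset.sum_range_succ, Finset.sum_range_succ' _ m]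
    rw [hP (m + 1 + m) (by omega)]
    simp
  rw [e3, ← Finset.sum_add_distrib, ← Finset.sum_add_distrib]
  apply Finset.sum_congr rfl
  intro j _
  unfold Red
  split_ifs <;> simp <;> ring

/-- `x^e * g(x)` -/
noncomputable def Pg (p l : ℕ) (b δ : F) : F[X] :=
  ∑ i ∈ Finset.range (l + 1), (X ^ (p ^ l + p ^ i) + C (b ^ p ^ i) * X ^ (p ^ l - p ^ i) +
    C (δ ^ p ^ i) * X ^ (p ^ l))

lemma Pg_eval {p l : ℕ} [Fact p.Prime] [CharP F p] (b δ x y : F) (hx : x ≠ 0)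
    (hy : y ^ p = y + (x + b / x + δ)) :
    (Pg p l b δ).eval x = x ^ (p ^ l) * (y ^ p ^ (l + 1) - y) := by
  have h1 : ∀ k, y ^ p ^ k - y = ∑ i ∈ Finset.range k, (x + b / x + δ) ^ p ^ i := by
    intro k
    induction k with
    | zero => simp
    | succ k ih =>
      rw [Finset.sum_range_succ, ← ih, pow_succ' , pow_mul, hy, add_pow_char_pow]
      ring
  rw [h1, Pg, eval_finset_sum, Finset.mul_sum]
  apply Finset.sum_congr rfl
  intro i hi
  have hle : p ^ i ≤ p ^ l := Nat.pow_le_pow_right (Fact.out : p.Prime).pos (by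
    have := Finset.mem_range.1 hi; omega)
  rw [add_pow_char_pow, add_pow_char_pow, div_pow]
  obtain ⟨m, hm⟩ := Nat.exists_eq_add_of_le hle
  have : p ^ l - p ^ i = m := by omega
  simp [this, hm, pow_add]
  have := pow_ne_zero (p ^ i) hx
  field_simp

lemma Pg_lead {p l : ℕ} (hp : 2 ≤ p) (b δ : F) : (Pg p l b δ - X ^ (2 * p ^ l)).degree < ((2 * p ^ l : ℕ) : WithBot ℕ) := by
  unfold Pg
  rw [Finset.sum_range_succ]
  have e : ∀ (a : F[X]) (b c : F[X]), a + (X ^ (p^l + p^l) + b + c) - X ^ (2 * p^l) = a + (b + c) := by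
    intro a b c; rw [← two_mul]; ring
  rw [e]
  have hpos : 0 < p ^ l := by positivity
  have s1 : ∀ (c : F) (k : ℕ), k < 2 * p ^ l → (C c * X ^ k : F[X]).degree < ((2 * p ^ l : ℕ) : WithBot ℕ) :=
    fun c k hk => lt_of_le_of_lt (degree_C_mul_X_pow_le k c) (by exact_mod_cast hk)
  have s2 : ∀ (u v : F[X]), u.degree < ((2 * p ^ l : ℕ) : WithBot ℕ) → v.degree < ((2 * p ^ l : ℕ) : WithBot ℕ) →
      (u + v).degree < ((2 * p ^ l : ℕ) : WithBot ℕ) := fun u v hu hv =>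
    lt_of_le_of_lt (degree_add_le u v) (max_lt hu hv)
  apply s2
  · have hlt : ∀ i ∈ Finset.range l, (X ^ (p ^ l + p ^ i) + C (b ^ p ^ i) * X ^ (p ^ l - p ^ i) +
      C (δ ^ p ^ i) * X ^ (p ^ l) : F[X]).degree < ((2 * p ^ l : ℕ) : WithBot ℕ) := by
      intro i hi
      have : p ^ i < p ^ l := Nat.pow_lt_pow_right (by omega) (Finset.mem_range.1 hi)
      apply s2
      apply s2
      · rw [degree_X_pow]; exact_mod_cast (by omega : p^l + p^i < 2 * p^l)
      · exact s1 _ _ (by omega)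
      · exact s1 _ _ (by omega)
    refine lt_of_le_of_lt (degree_sum_le _ _) ?_
    rw [Finset.sup_lt_iff (by exact_mod_cast WithBot.bot_lt_coe _)]
    exact hlt
  · exact s2 _ _ (s1 _ _ (by omega)) (s1 _ _ (by omega))


lemma Pg_natDegree {p l : ℕ} (hp : 2 ≤ p) (b δ : F) : (Pg p l b δ).natDegree = 2 * p ^ l ∧ (Pg p l b δ).Monic := by
  have h := Pg_lead hp b δ (l := l)
  have e : Pg p l b δ = X ^ (2 * p ^ l) + (Pg p l b δ - X ^ (2 * p ^ l)) := by ring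
  constructor
  · rw [e, natDegree_add_eq_left_of_degree_lt (by rwa [degree_X_pow]), natDegree_X_pow]
  · rw [e]; exact monic_X_pow_add h

noncomputable def gen (p l : ℕ) (b δ : F) (r jy j : ℕ) : F[X][X] :=
  ∑ k ∈ Finset.range (j + 1), monomial (k + jy)
    ((X ^ (r + (p ^ (l + 1) - (j - k) * p ^ l)) * Pg p l b δ ^ (j - k)) * C ((j.choose k : ℕ) : F))

lemma gen_term_le {p l r jy j k : ℕ} (hp : 2 ≤ p) (b δ : F) (hj : j < p) (hk : k ≤ j) :
    p * ((X ^ (r + (p ^ (l + 1) - (j - k) * p ^ l)) * Pg p l b δ ^ (j - k)) *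
      C ((j.choose k : ℕ) : F)).natDegree + k * p ^ (l + 1) ≤ p * r + p * p ^ (l + 1) + p ^ (l + 1) * j := by
  have h1 := natDegree_mul_C_le (X ^ (r + (p ^ (l + 1) - (j - k) * p ^ l)) * Pg p l b δ ^ (j - k))
    ((j.choose k : ℕ) : F)
  have h2 := natDegree_mul_le (p := (X ^ (r + (p ^ (l + 1) - (j - k) * p ^ l)) : F[X]))
    (q := Pg p l b δ ^ (j - k))
  rw [natDegree_X_pow, natDegree_pow, (Pg_natDegree hp b δ).1] at h2
  have h3 : (j - k) * p ^ l ≤ p ^ (l + 1) := by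
    rw [pow_succ, mul_comm]; exact Nat.mul_le_mul_left _ (by omega)
  obtain ⟨m, rfl⟩ := Nat.exists_eq_add_of_le hk
  have e : k + m - k = m := by omega
  rw [e] at h1 h2 h3 ⊢
  have h4 : p * ((X ^ (r + (p ^ (l + 1) - m * p ^ l)) * Pg p l b δ ^ m) *
      C (((k+m).choose k : ℕ) : F)).natDegree ≤ p * (r + (p ^ (l + 1) - m * p ^ l) + m * (2 * p ^ l)) :=
    Nat.mul_le_mul_left _ (h1.trans h2)
  have h5 : r + (p ^ (l + 1) - m * p ^ l) + m * (2 * p ^ l) = r + p ^ (l+1) + m * p ^ l := by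
    have : m * (2 * p ^ l) = m * p^l + m * p^l := by ring
    omega
  rw [h5] at h4
  have : p * (r + p ^ (l+1) + m * p ^ l) = p * r + p * p ^ (l+1) + p ^ (l+1) * m := by ring
  nlinarith

lemma gen_wt {p l r jy j : ℕ} (hp : 2 ≤ p) (b δ : F) (hj : j < p) :
    Wt p (gen p l b δ r jy j) (p * r + jy + p * p ^ (l + 1) + p ^ (l + 1) * j) := by
  apply Wt.sum
  intro k hk
  have hk' : k ≤ j := by have := Finset.mem_range.1 hk; omega
  apply Wt.monomial
  have := gen_term_le (l := l) (r := r) (jy := jy) hp b δ hj hk'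
  have h1 : 1 ≤ p ^ (l+1) := Nat.one_le_pow _ _ (by omega)
  nlinarith

lemma gen_top {p l r jy j : ℕ} (hp : 2 ≤ p) (b δ : F) (hj : j < p) :
    ∃ R, gen p l b δ r jy j = monomial jy (X ^ (r + p ^ (l + 1) + j * p ^ l)) + R ∧
      Wt p R (p * r + jy + p * p ^ (l + 1) + p ^ (l + 1) * j - 1) := by
  have h1 : 1 < p ^ (l+1) := Nat.one_lt_pow (by omega) (by omega)
  have h3 : j * p ^ l ≤ p ^ (l + 1) := by
    rw [pow_succ, mul_comm]; exact Nat.mul_le_mul_left _ (by omega)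
  have hm : (X ^ (r + (p ^ (l + 1) - j * p ^ l)) * Pg p l b δ ^ j).Monic :=
    (monic_X_pow _).mul ((Pg_natDegree hp b δ).2.pow _)
  have hd : (X ^ (r + (p ^ (l + 1) - j * p ^ l)) * Pg p l b δ ^ j).natDegree =
      r + p ^ (l + 1) + j * p ^ l := by
    rw [Monic.natDegree_mul (monic_X_pow _) ((Pg_natDegree hp b δ).2.pow _), natDegree_X_pow,
      natDegree_pow, (Pg_natDegree hp b δ).1]
    have : j * (2 * p ^ l) = j * p^l + j * p^l := by ring
    omega
  refine ⟨monomial jy (X ^ (r + (p ^ (l + 1) - j * p ^ l)) * Pg p l b δ ^ j - X ^ (r + p ^ (l + 1) + j * p ^ l)) +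
    ∑ k ∈ Finset.range j, monomial (k + 1 + jy)
    ((X ^ (r + (p ^ (l + 1) - (j - (k + 1)) * p ^ l)) * Pg p l b δ ^ (j - (k + 1))) * C ((j.choose (k + 1) : ℕ) : F)), ?_, ?_⟩
  · unfold gen
    rw [Finset.sum_range_succ', map_sub]
    simp
    ring
  · apply Wt.add
    · intro j' k hjk
      rw [coeff_monomial]
      split_ifs with hjj
      · subst hjj
        have hk : r + p ^ (l + 1) + j * p ^ l ≤ k := by
          by_contra hc
          have : p * (k + 1) ≤ p * (r + p ^ (l + 1) + j * p ^ l) := Nat.mul_le_mul_left _ (by omega)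
          have e : p * (r + p ^ (l + 1) + j * p ^ l) = p * r + p * p ^ (l+1) + p ^ (l+1) * j := by ring
          have e2 : p * (k+1) = p * k + p := by ring
          omega
        rw [coeff_sub, coeff_X_pow]
        rcases hk.eq_or_lt with h | h
        · have := hm.coeff_natDegree
          rw [hd] at this
          rw [← h, this]; simp
        · rw [coeff_eq_zero_of_natDegree_lt (by rw [hd]; exact h), if_neg (by omega)]; simp
      · simp
    · apply Wt.sum
      intro k hk
      have hk' : k + 1 ≤ j := by have := Finset.mem_range.1 hk; omega
      apply Wt.monomial
      have := gen_term_le (l := l) (r := r) (jy := jy) hp b δ hj hk'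
      have h6 : k + 2 ≤ (k+1) * p ^ (l+1) := by nlinarith
      omega

lemma gen_deg {p l r jy j : ℕ} (b δ : F) (hj : j < p) (hjy : jy < p) (i : ℕ) (hi : 2 * p - 1 ≤ i) :
    (gen p l b δ r jy j).coeff i = 0 := by
  unfold gen
  rw [finset_sum_coeff]
  apply Finset.sum_eq_zero
  intro k hk
  have := Finset.mem_range.1 hk
  rw [coeff_monomial, if_neg (by omega)]

lemma gen_eval {p l r jy j : ℕ} [Fact p.Prime] [CharP F p] (b δ x y : F) (hx : x ≠ 0)
    (hy : y ^ p = y + (x + b / x + δ)) (hj : j < p) :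
    (gen p l b δ r jy j).evalEval x y = x ^ (r + p ^ (l + 1)) * y ^ jy * (y ^ p ^ (l + 1)) ^ j := by
  unfold gen
  have e : (y ^ p ^ (l+1)) = y + (y ^ p ^ (l+1) - y) := by ring
  rw [e, add_pow, evalEval_finset_sum, Finset.mul_sum]
  apply Finset.sum_congr rfl
  intro k hk
  have hk' := Finset.mem_range.1 hk
  have h3 : (j - k) * p ^ l ≤ p ^ (l + 1) := by
    rw [pow_succ, mul_comm]; exact Nat.mul_le_mul_left _ (by omega)
  obtain ⟨m, hm⟩ := Nat.exists_eq_add_of_le h3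
  simp only [evalEval, eval_monomial, eval_mul, eval_pow, eval_X, eval_C, Pg_eval b δ x y hx hy]
  have e1 : p ^ (l + 1) - (j - k) * p ^ l = m := by omega
  have e2 : x ^ (r + p ^ (l + 1)) = x ^ r * ((x ^ p ^ l) ^ (j - k) * x ^ m) := by
    rw [← pow_mul, ← pow_add, ← pow_add, hm, mul_comm (p ^ l)]
  rw [e1, mul_pow, e2]
  ring

theorem stepanov [Fintype F] (p l : ℕ) [Fact p.Prime] [CharP F p] (hl : 1 ≤ l) (hp3 : 3 ≤ p)
    (hcard : Fintype.card F = (p ^ (l + 1)) ^ 2) (b δ : F) (s : Finset F)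
    (hs : ∀ x ∈ s, x ≠ 0 ∧ ∃ y, y ^ p = y + (x + b / x + δ)) :
    p * s.card ≤ p ^ (l+1) * p ^ (l + 1) + 3 * p * p ^ (l + 1) + p := by
  classical
  set Q := p ^ (l + 1) with hQ
  set M := Q + 2 * p with hM
  have hp : 2 ≤ p := by omega
  have hpos : 0 < p := by omega
  have hQ3 : 3 < Q := by
    have : p ^ 2 ≤ p ^ (l+1) := Nat.pow_le_pow_right hpos (by omega)
    nlinarith
  set W := Q * (Q - 1) + (M - 1) + p * Q + p with hW
  -- the linear system
  let Hg : Fin Q × Fin M → F[X][X] := fun t =>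
    gen p l b δ ((t.1 / p) * Q + t.2 / p) (t.2 % p) (t.1 % p)
  let Gg : Fin Q × Fin M → F[X][X] := fun t =>
    gen p l b δ ((t.1 / p) + (t.2 / p) * Q) (t.1 % p) (t.2 % p)
  have hmod : ∀ a : ℕ, a % p < p := fun a => Nat.mod_lt _ hpos
  have hdm : ∀ a : ℕ, p * (a / p) + a % p = a := fun a => Nat.div_add_mod a p
  let Hc : (Fin Q × Fin M → F) → F[X][X] := fun d => ∑ t, C (C (d t)) * Hg t
  let L : (Fin Q × Fin M → F) →ₗ[F] (Fin (W + 1) → F) :=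
    { toFun := fun d w => ∑ t, d t * (Red p b δ (Hg t) (w % p)).coeff (w / p)
      map_add' := by
        intro d d'
        ext w
        simp [add_mul, Finset.sum_add_distrib]
      map_smul' := by
        intro c d
        ext w
        simp [Finset.mul_sum, mul_assoc] }
  have hdim : Module.finrank F (Fin (W + 1) → F) < Module.finrank F (Fin Q × Fin M → F) := by
    simp only [Module.finrank_fintype_fun_eq_card, Fintype.card_fin, Fintype.card_prod]
    obtain ⟨Q', hQ'⟩ : ∃ Q', Q = Q' + 4 := ⟨Q - 4, by omega⟩
    have : Q - 1 = Q' + 3 := by omega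
    rw [hW, hM, this, hQ']
    have : Q' + 4 + 2 * p - 1 = Q' + 3 + 2 * p := by omega
    rw [this]
    nlinarith
  obtain ⟨d, hd0, hdne⟩ : ∃ d, L d = 0 ∧ d ≠ 0 := by
    have := LinearMap.ker_ne_bot_of_finrank_lt (f := L) hdim
    obtain ⟨d, hd, hd'⟩ := (Submodule.ne_bot_iff _).1 this
    exact ⟨d, hd, hd'⟩
  have hHwt : ∀ t, Wt p (Hg t) (W - p) := by
    intro t
    refine (gen_wt hp b δ (hmod _)).mono ?_
    have h1 := hdm t.1
    have h2 := hdm t.2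
    have h3 : (t.1 : ℕ) ≤ Q - 1 := by omega
    have h4 : (t.2 : ℕ) ≤ M - 1 := by omega
    have h5 : Q * (t.1 : ℕ) ≤ Q * (Q - 1) := Nat.mul_le_mul_left _ h3
    have e : p * ((t.1 : ℕ) / p * Q + t.2 / p) + t.2 % p + p * p ^ (l + 1) + p ^ (l + 1) * (t.1 % p)
      = Q * (p * (t.1 / p) + t.1 % p) + (p * (t.2 / p) + t.2 % p) + p * Q := by rw [← hQ]; ring
    rw [e, h1, h2]
    omega
  have hH0 : ∀ j < p, ∑ t, C (d t) * Red p b δ (Hg t) j = 0 := by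
    intro j hj
    ext k
    rw [finset_sum_coeff, coeff_zero]
    simp_rw [coeff_C_mul]
    by_cases hk : p * k + j ≤ W
    · have := congrFun hd0 ⟨p * k + j, by omega⟩
      have e1 : (p * k + j) % p = j := by rw [Nat.mul_add_mod, Nat.mod_eq_of_lt hj]
      have e2 : (p * k + j) / p = k := by
        rw [Nat.mul_add_div hpos, Nat.div_eq_of_lt hj, add_zero]
      simpa [L, e1, e2] using this
    · apply Finset.sum_eq_zero
      intro t _
      rw [Red_coeff b δ (by omega) (hHwt t) j k (by omega), mul_zero]
  have hHeval : ∀ x y : F, x ≠ 0 → y ^ p = y + (x + b / x + δ) →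
      ∑ t, d t * (x ^ (((t.1 : ℕ) / p) * Q + t.2 / p + Q) * y ^ ((t.2 : ℕ) % p) * (y ^ Q) ^ ((t.1 : ℕ) % p)) = 0 := by
    intro x y hx hy
    have h1 : ∀ t, x * (d t * (x ^ (((t.1 : ℕ) / p) * Q + t.2 / p + Q) * y ^ ((t.2 : ℕ) % p) * (y ^ Q) ^ ((t.1 : ℕ) % p)))
        = ∑ j ∈ Finset.range p, (C (d t) * Red p b δ (Hg t) j).eval x * y ^ j := by
      intro t
      have := Red_eval b δ (Hg t) (by omega) (gen_deg b δ (hmod _) (hmod _)) x y hx hy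
      rw [gen_eval b δ x y hx hy (hmod _)] at this
      simp_rw [eval_mul, eval_C, mul_assoc, ← Finset.mul_sum, this]
      ring
    have h2 : x * ∑ t, d t * (x ^ (((t.1 : ℕ) / p) * Q + t.2 / p + Q) * y ^ ((t.2 : ℕ) % p) * (y ^ Q) ^ ((t.1 : ℕ) % p)) = 0 := by
      rw [Finset.mul_sum]
      simp_rw [h1]
      rw [Finset.sum_comm]
      apply Finset.sum_eq_zero
      intro j hj
      rw [← Finset.sum_mul, ← eval_finset_sum, hH0 j (Finset.mem_range.1 hj)]
      simp
    exact (mul_eq_zero.1 h2).resolve_left hx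
  -- Frobenius roots
  have hfrob : ∀ c : F, ∃ c', c' ^ Q = c := by
    intro c
    refine ⟨c ^ Q, ?_⟩
    rw [← pow_mul, ← pow_two, ← hcard, FiniteField.pow_card]
  choose c' hc' using fun t => hfrob (d t)
  have hsumQ : ∀ (f : Fin Q × Fin M → F), (∑ t, f t) ^ Q = ∑ t, f t ^ Q := fun f => sum_pow_char_pow ..
  have hGeval : ∀ x y : F, x ≠ 0 → y ^ p = y + (x + b / x + δ) →
      ∑ t, c' t * (Gg t).evalEval x y = 0 := by
    intro x y hx hy
    have hxQ : (x ^ Q) ^ Q = x := by rw [← pow_mul, ← pow_two, ← hcard, FiniteField.pow_card]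
    have hyQ : (y ^ Q) ^ Q = y := by rw [← pow_mul, ← pow_two, ← hcard, FiniteField.pow_card]
    have h1 : ∀ t, x ^ Q * (c' t * (Gg t).evalEval x y) ^ Q = x *
        (d t * (x ^ (((t.1 : ℕ) / p) * Q + t.2 / p + Q) * y ^ ((t.2 : ℕ) % p) * (y ^ Q) ^ ((t.1 : ℕ) % p))) := by
      intro t
      simp only [Gg]
      rw [gen_eval b δ x y hx hy (hmod _), mul_pow, hc', mul_pow, mul_pow, pow_right_comm _ _ Q,
        pow_right_comm _ _ Q, pow_right_comm _ _ Q, hyQ, ← hQ]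
      have : (x ^ Q) ^ ((t.1 : ℕ) / p + (t.2 : ℕ) / p * Q + Q) =
          x ^ ((t.1 : ℕ) / p * Q) * (x ^ ((t.2 : ℕ) / p) * x) := by
        rw [pow_add, pow_add, hxQ, ← pow_mul, mul_comm _ Q, mul_comm _ Q, pow_mul (x ^ Q) Q, hxQ]
        ring
      rw [this, pow_add, pow_add]
      ring
    have h2 : x ^ Q * (∑ t, c' t * (Gg t).evalEval x y) ^ Q = 0 := by
      rw [hsumQ, Finset.mul_sum]
      simp_rw [h1]
      rw [← Finset.mul_sum, hHeval x y hx hy, mul_zero]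
    have h3 := (mul_eq_zero.1 h2).resolve_left (pow_ne_zero _ hx)
    exact pow_eq_zero_iff (by omega) |>.1 h3
  -- the coefficient polynomials
  let R : ℕ → F[X] := fun j => ∑ t, C (c' t) * Red p b δ (Gg t) j
  have hzero : ∀ x ∈ s, ∀ j < p, (R j).eval x = 0 := by
    intro x hxs
    obtain ⟨hx, y, hy⟩ := hs x hxs
    -- polynomial in y of degree < p with p roots
    let S : F[X] := ∑ j ∈ Finset.range p, C ((R j).eval x) * X ^ j
    have hS : ∀ c : ZMod p, S.eval (y + (ZMod.castHom dvd_rfl F c)) = 0 := by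
      intro c
      have hy' : (y + ZMod.castHom dvd_rfl F c) ^ p = (y + ZMod.castHom dvd_rfl F c) + (x + b / x + δ) := by
        rw [add_pow_char, hy, ← map_pow, ZMod.pow_card]; ring
      set y' := y + ZMod.castHom dvd_rfl F c
      have h1 : S.eval y' = ∑ t, c' t * (∑ j ∈ Finset.range p, (Red p b δ (Gg t) j).eval x * y' ^ j) := by
        simp only [S, R, eval_finset_sum, eval_mul, eval_C, eval_pow, eval_X, Finset.sum_mul, Finset.mul_sum]
        rw [Finset.sum_comm]
        simp_rw [mul_assoc]
      rw [h1]
      have h2 : ∀ t, c' t * (∑ j ∈ Finset.range p, (Red p b δ (Gg t) j).eval x * y' ^ j) =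
          x * (c' t * (Gg t).evalEval x y') := by
        intro t
        rw [Red_eval b δ (Gg t) (by omega) (gen_deg b δ (hmod _) (hmod _)) x y' hx hy']
        ring
      simp_rw [h2]
      rw [← Finset.mul_sum, hGeval x y' hx hy', mul_zero]
    have hS0 : S = 0 := by
      apply eq_zero_of_natDegree_lt_card_of_eval_eq_zero S (f := fun c : ZMod p => y + ZMod.castHom dvd_rfl F c)
      · intro c c' h
        exact (ZMod.castHom dvd_rfl F).injective (add_left_cancel h)
      · exact hS
      · rw [ZMod.card]
        have : S.natDegree ≤ p - 1 := by
          apply natDegree_sum_le_of_forall_le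
          intro j hj
          refine (natDegree_C_mul_X_pow_le _ _).trans ?_
          have := Finset.mem_range.1 hj
          omega
        omega
    intro j hj
    have := congrArg (fun P => coeff P j) hS0
    simp only [S, finset_sum_coeff, coeff_C_mul, coeff_X_pow, coeff_zero] at this
    rw [Finset.sum_eq_single j] at this
    · simpa using this
    · intro i _ hij; simp [hij.symm]
    · intro h; exact absurd (Finset.mem_range.2 hj) h
  -- nonvanishing
  have hGwt : ∀ t : Fin Q × Fin M, Wt p (Gg t) ((t.1 : ℕ) + Q * t.2 + p * Q) := by
    intro t
    refine (gen_wt hp b δ (hmod _)).mono (le_of_eq ?_)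
    have h1 := hdm t.1
    have h2 := hdm t.2
    have e : p * ((t.1 : ℕ) / p + (t.2 : ℕ) / p * Q) + t.1 % p + p * p ^ (l + 1) + p ^ (l + 1) * (t.2 % p)
      = (p * (t.1 / p) + t.1 % p) + Q * (p * (t.2 / p) + t.2 % p) + p * Q := by rw [← hQ]; ring
    rw [e, h1, h2]
  have hRdeg : ∀ j, p * (R j).natDegree ≤ (Q - 1) + Q * (M - 1) + p * Q + p := by
    intro j
    by_cases hz : R j = 0
    · simp [hz]
    by_contra hcon
    push Not at hcon
    have hlead : (R j).coeff (R j).natDegree = 0 := by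
      simp only [R, finset_sum_coeff, coeff_C_mul]
      apply Finset.sum_eq_zero
      intro t _
      have h5 : Q * (t.2 : ℕ) ≤ Q * (M - 1) := Nat.mul_le_mul_left _ (by omega)
      rw [Red_coeff b δ (by omega) (hGwt t) j _, mul_zero]
      have := t.1.2
      simp only [R] at hcon
      omega
    rw [coeff_natDegree, leadingCoeff_eq_zero] at hlead
    exact hz hlead
  obtain ⟨j, hj, hRj⟩ : ∃ j < p, R j ≠ 0 := by
    have hne : (Finset.univ.filter fun t => c' t ≠ 0).Nonempty := by
      obtain ⟨t, ht⟩ := Function.ne_iff.1 hdne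
      refine ⟨t, ?_⟩
      simp only [Finset.mem_filter, Finset.mem_univ, true_and]
      intro h
      apply ht
      rw [← hc' t, h]
      simp; omega
    obtain ⟨t, ht, hmax⟩ := Finset.exists_max_image _ (fun t : Fin Q × Fin M => (t.1 : ℕ) + Q * t.2) hne
    simp only [Finset.mem_filter, Finset.mem_univ, true_and] at ht hmax
    refine ⟨(t.1 : ℕ) % p, hmod _, fun h0 => ht ?_⟩
    obtain ⟨Rm, hRm, hRmW⟩ := gen_top (l := l) (r := (t.1 : ℕ) / p + (t.2 : ℕ) / p * Q) (jy := (t.1 : ℕ) % p)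
      (j := (t.2 : ℕ) % p) hp b δ (hmod _)
    set m := (t.1 : ℕ) / p + (t.2 : ℕ) / p * Q + p ^ (l + 1) + ((t.2 : ℕ) % p) * p ^ l with hm
    have hWt : p * ((t.1 : ℕ) / p + (t.2 : ℕ) / p * Q) + t.1 % p + p * p ^ (l + 1) + p ^ (l + 1) * (t.2 % p)
        = (t.1 : ℕ) + Q * t.2 + p * Q := by
      have h1 := hdm t.1
      have h2 := hdm t.2
      have e : p * ((t.1 : ℕ) / p + (t.2 : ℕ) / p * Q) + t.1 % p + p * p ^ (l + 1) + p ^ (l + 1) * (t.2 % p)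
        = (p * (t.1 / p) + t.1 % p) + Q * (p * (t.2 / p) + t.2 % p) + p * Q := by rw [← hQ]; ring
      rw [e, h1, h2]
    have hmW : p * (m + 1) + (t.1 : ℕ) % p = (t.1 : ℕ) + Q * t.2 + p * Q + p := by
      have e : p ^ (l+1) = p ^ l * p := pow_succ _ _
      rw [← hWt, hm, e]; ring
    have hco := congrArg (fun P => coeff P (m + 1)) h0
    simp only [R, finset_sum_coeff, coeff_C_mul, coeff_zero] at hco
    rw [Finset.sum_eq_single t] at hco
    · have : (Red p b δ (Gg t) ((t.1 : ℕ) % p)).coeff (m + 1) = 1 := by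
        simp only [Gg]
        rw [hRm, Red_add, coeff_add, Red_coeff b δ (by omega) hRmW]
        · unfold Red
          have q1 := hmod (t.1 : ℕ)
          simp only [coeff_monomial]
          rw [if_neg (by omega : ¬ ((t.1 : ℕ) % p = p + (t.1 : ℕ) % p - 1)),
            if_neg (by omega : ¬ ((t.1 : ℕ) % p = p + (t.1 : ℕ) % p))]
          simp
        · rw [hWt, hmW]
          have : 0 < p * Q := by positivity
          omega
      rwa [this, mul_one] at hco
    · intro t' _ htt
      by_cases hct : c' t' = 0
      · rw [hct, zero_mul]
      have hle := hmax t' hct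
      rw [Red_coeff b δ (by omega) (hGwt t'), mul_zero]
      rw [hmW]
      rcases hle.eq_or_lt with h | h
      · exfalso
        apply htt
        have a1 := t.1.2
        have a2 := t'.1.2
        have b1 : (t'.1 : ℕ) = t.1 := by
          have := congrArg (· % Q) h
          simpa [Nat.mod_eq_of_lt a1, Nat.mod_eq_of_lt a2] using this
        have b2 : (t'.2 : ℕ) = t.2 := by
          rw [b1] at h
          exact Nat.eq_of_mul_eq_mul_left (by omega) (Nat.add_left_cancel h)
        exact Prod.ext (Fin.ext b1) (Fin.ext b2)
      · omega
    · simp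
  have hcount : s.card ≤ (R j).natDegree := by
    refine le_trans ?_ (card_roots' (R j))
    refine le_trans ?_ (Multiset.toFinset_card_le _)
    apply Finset.card_le_card
    intro x hx
    rw [Multiset.mem_toFinset, mem_roots hRj]
    exact hzero x hx j hj
  have h1 := Nat.mul_le_mul_left p hcount
  have h2 := hRdeg j
  have h3 : Q * (M - 1) ≤ Q * Q + 2 * p * Q - Q := by
    obtain ⟨Q', hQ'⟩ : ∃ Q', Q = Q' + 4 := ⟨Q - 4, by omega⟩
    have : M - 1 = Q' + 3 + 2 * p := by omega
    rw [this, hQ']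
    apply Nat.le_sub_of_add_le
    apply le_of_eq; ring
  have h4 : Q ≤ Q * Q := Nat.le_mul_self Q
  have h5 : 3 * p * Q = 2 * p * Q + p * Q := by ring
  omega

end Step

namespace Step
open Polynomial

lemma artin_schreier (p : ℕ) [Fact p.Prime] (L : Type*) [Field L] [Fintype L] [Algebra (ZMod p) L] (z : L)
    (hz : Algebra.trace (ZMod p) L z = 0) : ∃ y : L, y ^ p = y + z := by
  haveI : CharP L p := charP_of_injective_algebraMap (algebraMap (ZMod p) L).injective p
  let φ : L →ₗ[ZMod p] L := (FiniteField.frobeniusAlgHom (ZMod p) L).toLinearMap - LinearMap.id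
  have hφ : ∀ y, φ y = y ^ p - y := by
    intro y
    simp [φ, FiniteField.coe_frobeniusAlgHom, ZMod.card]
  have hker : LinearMap.ker φ = LinearMap.range (Algebra.linearMap (ZMod p) L) := by
    apply le_antisymm
    · intro y hy
      rw [LinearMap.mem_ker, hφ, sub_eq_zero] at hy
      classical
      by_contra hcon
      let P : L[X] := X ^ p - X
      have hp1 : 1 < p := (Fact.out : p.Prime).one_lt
      have hP0 : P ≠ 0 := FiniteField.X_pow_card_sub_X_ne_zero L hp1
      have hdeg : P.natDegree = p := FiniteField.X_pow_card_sub_X_natDegree_eq L hp1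
      have h1 : (insert y (Finset.univ.image (algebraMap (ZMod p) L))) ⊆ P.roots.toFinset := by
        intro w hw
        rw [Multiset.mem_toFinset, mem_roots hP0]
        rcases Finset.mem_insert.1 hw with h | h
        · simp [P, h, hy]
        · obtain ⟨c, _, rfl⟩ := Finset.mem_image.1 h
          simp [P, ← map_pow, ZMod.pow_card]
      have h2 := (Finset.card_le_card h1).trans ((Multiset.toFinset_card_le _).trans (card_roots' P))
      rw [hdeg, Finset.card_insert_of_notMem, Finset.card_image_of_injective _ (algebraMap (ZMod p) L).injective,
        Finset.card_univ, ZMod.card] at h2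
      · omega
      · intro h
        obtain ⟨c, _, hc⟩ := Finset.mem_image.1 h
        exact hcon ⟨c, hc⟩
    · rintro _ ⟨c, rfl⟩
      rw [LinearMap.mem_ker, hφ]
      simp [← map_pow, ZMod.pow_card]
  have hrange : LinearMap.range φ ≤ LinearMap.ker (Algebra.trace (ZMod p) L) := by
    rintro _ ⟨y, rfl⟩
    rw [LinearMap.mem_ker, hφ, map_sub, sub_eq_zero]
    have := Algebra.trace_eq_of_algEquiv (FiniteField.frobeniusAlgEquivOfAlgebraic (ZMod p) L) y
    simpa [ZMod.card] using this
  have hk1 : Module.finrank (ZMod p) (LinearMap.ker φ) = 1 := by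
    rw [hker, LinearMap.finrank_range_of_inj]
    · simp
    · exact (algebraMap (ZMod p) L).injective
  have e1 := LinearMap.finrank_range_add_finrank_ker φ
  have e2 := LinearMap.finrank_range_add_finrank_ker (Algebra.trace (ZMod p) L)
  have hsurj : Function.Surjective (Algebra.trace (ZMod p) L) := Algebra.trace_surjective (ZMod p) L
  rw [LinearMap.range_eq_top.2 hsurj, finrank_top] at e2
  simp at e2
  have heq := Submodule.eq_of_le_of_finrank_eq hrange (by omega)
  have : z ∈ LinearMap.range φ := by rw [heq]; exact hz
  obtain ⟨y, hy⟩ := this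
  refine ⟨y, ?_⟩
  rw [hφ] at hy
  rw [← hy]; ring

/-- Kloosterman sum over an extension -/
noncomputable def Kl (p : ℕ) [Fact p.Prime] (L : Type*) [Field L] [Fintype L] [DecidableEq L] [Algebra (ZMod p) L]
    (ψ : AddChar (ZMod p) ℂ) (b t : ZMod p) : ℂ :=
  ∑ x : L, if x = 0 then 0 else ψ (t * Algebra.trace (ZMod p) L (x + algebraMap (ZMod p) L b * x⁻¹))

lemma Kl_sum (p : ℕ) [Fact p.Prime] (L : Type*) [Field L] [Fintype L] [DecidableEq L] [Algebra (ZMod p) L]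
    (ψ : AddChar (ZMod p) ℂ) (hψ : ψ.IsPrimitive) (b : ZMod p) (l : ℕ) (hl : 1 ≤ l) (hp3 : 3 ≤ p)
    (hcard : Fintype.card L = (p ^ (l + 1)) ^ 2) :
    ∃ r : ℝ, ∑ t ∈ Finset.univ.filter (fun t : ZMod p => t ≠ 0), Kl p L ψ b t = r ∧
      - (4 * p ^ 2 * p ^ (l + 1) : ℝ) ≤ r := by
  haveI : CharP L p := charP_of_injective_algebraMap (algebraMap (ZMod p) L).injective p
  let f : L → ZMod p := fun x => Algebra.trace (ZMod p) L (x + algebraMap (ZMod p) L b * x⁻¹)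
  let S : ZMod p → Finset L := fun τ => Finset.univ.filter (fun x => x ≠ 0 ∧ f x = τ)
  have hS : ∀ τ, p * (S τ).card ≤ p ^ (l+1) * p ^ (l + 1) + 3 * p * p ^ (l + 1) + p := by
    intro τ
    obtain ⟨δ, hδ⟩ := Algebra.trace_surjective (ZMod p) L (-τ)
    apply stepanov (F := L) p l hl hp3 hcard (algebraMap (ZMod p) L b) δ
    intro x hx
    simp only [S, Finset.mem_filter, Finset.mem_univ, true_and] at hx
    refine ⟨hx.1, artin_schreier p L _ ?_⟩
    rw [map_add, hδ, div_eq_mul_inv]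
    have := hx.2
    simp only [f] at this
    rw [this]; ring
  have htot : ∑ τ, (S τ).card = Fintype.card L - 1 := by
    have h1 : (Finset.univ.filter (fun x : L => x ≠ 0)).card = ∑ τ, (S τ).card := by
      rw [Finset.card_eq_sum_card_fiberwise (f := f) (t := Finset.univ) (fun _ _ => Finset.mem_univ _)]
      apply Finset.sum_congr rfl
      intro τ _
      simp only [S, Finset.filter_filter]
    rw [← h1, Finset.filter_ne' , Finset.card_erase_of_mem (Finset.mem_univ _), Finset.card_univ]
  have hall : ∑ t : ZMod p, Kl p L ψ b t = p * (S 0).card := by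
    unfold Kl
    rw [Finset.sum_comm]
    have : ∀ x : L, ∑ t : ZMod p, (if x = 0 then 0 else ψ (t * Algebra.trace (ZMod p) L (x + algebraMap (ZMod p) L b * x⁻¹)))
        = if x ≠ 0 ∧ f x = 0 then (p : ℂ) else 0 := by
      intro x
      by_cases hx : x = 0
      · simp [hx]
      · simp only [hx, if_false, ne_eq, not_false_eq_true, true_and]
        have := AddChar.sum_mulShift (R' := ℂ) (f x) hψ
        simp only [f] at this ⊢
        rw [this, ZMod.card]
        split_ifs <;> simp
    simp_rw [this]
    rw [← Finset.sum_filter, Finset.sum_const, nsmul_eq_mul, mul_comm]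
  have h0 : Kl p L ψ b 0 = Fintype.card L - 1 := by
    unfold Kl
    simp only [zero_mul, AddChar.map_zero_eq_one]
    have hh : ∀ x : L, (if x = 0 then (0:ℂ) else 1) = if x ≠ 0 then 1 else 0 := by
      intro x; split_ifs <;> simp_all
    simp_rw [hh]
    rw [← Finset.sum_filter, Finset.sum_const, Finset.filter_ne', Finset.card_erase_of_mem (Finset.mem_univ _),
      Finset.card_univ, nsmul_eq_mul, Nat.cast_sub Fintype.card_pos]
    simp
  refine ⟨p * (S 0).card - (Fintype.card L - 1), ?_, ?_⟩
  · have := Finset.sum_filter_add_sum_filter_not Finset.univ (fun t : ZMod p => t ≠ 0) (fun t => Kl p L ψ b t)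
    rw [hall] at this
    have h2 : Finset.univ.filter (fun t : ZMod p => ¬ t ≠ 0) = {0} := by ext; simp
    rw [h2, Finset.sum_singleton, h0] at this
    push_cast
    rw [← this]; ring
  · have hsplit : ∑ τ, (S τ).card = (S 0).card + ∑ τ ∈ Finset.univ.erase 0, (S τ).card :=
      (Finset.add_sum_erase _ _ (Finset.mem_univ _)).symm
    have hb : ∑ τ ∈ Finset.univ.erase (0 : ZMod p), p * (S τ).card ≤
        ∑ τ ∈ Finset.univ.erase (0 : ZMod p), (p ^ (l+1) * p ^ (l + 1) + 3 * p * p ^ (l + 1) + p) :=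
      Finset.sum_le_sum fun τ _ => hS τ
    rw [Finset.sum_const, Finset.card_erase_of_mem (Finset.mem_univ _), Finset.card_univ, ZMod.card, smul_eq_mul,
      ← Finset.mul_sum] at hb
    set Q := p ^ (l + 1) with hQ
    set T := ∑ τ ∈ Finset.univ.erase (0 : ZMod p), (S τ).card
    have hp1 : 1 ≤ p := by omega
    have hc1 : 1 ≤ Fintype.card L := Fintype.card_pos
    have htotR : ((S 0).card : ℝ) + T = (Fintype.card L : ℝ) - 1 := by
      rw [hsplit] at htot
      have := congrArg (Nat.cast : ℕ → ℝ) htot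
      push_cast [Nat.cast_sub hc1] at this
      exact this
    have hbR : (p : ℝ) * T ≤ (p - 1) * (Q * Q + 3 * p * Q + p) := by
      have : ((p * T : ℕ) : ℝ) ≤ (((p - 1) * (Q * Q + 3 * p * Q + p) : ℕ) : ℝ) := by exact_mod_cast hb
      push_cast [Nat.cast_sub hp1] at this
      exact this
    have hcR : (Fintype.card L : ℝ) = Q * Q := by rw [hcard]; push_cast; ring
    have hQe : ((p : ℝ) ^ (l+1)) = Q := by rw [hQ]; push_cast; rfl
    rw [hQe]
    have hQ1 : (1 : ℝ) ≤ Q := by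
      rw [← hQe]; exact one_le_pow₀ (by exact_mod_cast hp1)
    have hpR : (3 : ℝ) ≤ p := by exact_mod_cast hp3
    have e1 : (p : ℝ) * (S 0).card = p * (Q * Q - 1) - p * T := by
      rw [← hcR, ← htotR]; ring
    rw [e1, hcR]
    nlinarith [mul_nonneg (sub_nonneg.2 hpR) (sub_nonneg.2 hQ1)]

end Step

namespace Step
open Polynomial

variable {p : ℕ} [Fact p.Prime]

noncomputable def lam (ψ : AddChar (ZMod p) ℂ) (b t : ZMod p) (h : (ZMod p)[X]) : ℂ :=
  if h.coeff 0 = 0 then 0 else ψ (- (t * (h.nextCoeff + b * (h.coeff 1 / h.coeff 0))))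

lemma lam_mul (ψ : AddChar (ZMod p) ℂ) (b t : ZMod p) {h g : (ZMod p)[X]} (hh : h.Monic) (hg : g.Monic) :
    lam ψ b t (h * g) = lam ψ b t h * lam ψ b t g := by
  unfold lam
  by_cases h0 : h.coeff 0 = 0
  · simp [h0, mul_coeff_zero]
  by_cases g0 : g.coeff 0 = 0
  · simp [g0, mul_coeff_zero]
  rw [if_neg h0, if_neg g0, if_neg (by rw [mul_coeff_zero]; exact mul_ne_zero h0 g0), ← AddChar.map_add_eq_mul,
    hh.nextCoeff_mul hg, mul_coeff_one, mul_coeff_zero]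
  congr 1
  field_simp
  ring

lemma lam_one (ψ : AddChar (ZMod p) ℂ) (b t : ZMod p) : lam ψ b t 1 = 1 := by
  unfold lam
  simp [coeff_one, nextCoeff]

lemma lam_pow (ψ : AddChar (ZMod p) ℂ) (b t : ZMod p) {h : (ZMod p)[X]} (hh : h.Monic) (e : ℕ) :
    lam ψ b t (h ^ e) = lam ψ b t h ^ e := by
  induction e with
  | zero => simp [lam_one]
  | succ e ih => rw [pow_succ, lam_mul ψ b t (hh.pow e) hh, ih, pow_succ]

noncomputable def mon (d : ℕ) (v : Fin d → ZMod p) : (ZMod p)[X] := X ^ d + ∑ i : Fin d, C (v i) * X ^ (i : ℕ)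

lemma mon_coeff {d : ℕ} (v : Fin d → ZMod p) (i : Fin d) : (mon d v).coeff i = v i := by
  unfold mon
  rw [coeff_add, finset_sum_coeff, coeff_X_pow, if_neg (by omega), zero_add, Finset.sum_eq_single i]
  · simp
  · intro j _ hj
    simp only [coeff_C_mul, coeff_X_pow]
    rw [if_neg (fun h => hj (Fin.ext h.symm)), mul_zero]
  · simp

lemma mon_deg {d : ℕ} (v : Fin d → ZMod p) : (∑ i : Fin d, C (v i) * X ^ (i : ℕ) : (ZMod p)[X]).degree < d := by
  refine lt_of_le_of_lt (degree_sum_le _ _) ?_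
  rw [Finset.sup_lt_iff (by exact_mod_cast WithBot.bot_lt_coe _)]
  intro i _
  exact lt_of_le_of_lt (degree_C_mul_X_pow_le _ _) (by exact_mod_cast i.2)

lemma mon_monic {d : ℕ} (v : Fin d → ZMod p) : (mon d v).Monic := monic_X_pow_add (mon_deg v)

lemma mon_natDegree {d : ℕ} (v : Fin d → ZMod p) : (mon d v).natDegree = d := by
  unfold mon
  rw [natDegree_add_eq_left_of_degree_lt (by rw [degree_X_pow]; exact mon_deg v), natDegree_X_pow]

lemma mon_inj {d : ℕ} : Function.Injective (mon (p := p) d) := by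
  intro v w h
  ext i
  rw [← mon_coeff v i, h, mon_coeff]

lemma mon_surj {d : ℕ} {h : (ZMod p)[X]} (hh : h.Monic) (hd : h.natDegree = d) :
    mon d (fun i => h.coeff i) = h := by
  ext k
  rcases lt_trichotomy k d with hk | hk | hk
  · exact mon_coeff (fun i : Fin d => h.coeff i) ⟨k, hk⟩
  · have h1 := (mon_monic (fun i : Fin d => h.coeff i)).coeff_natDegree
    have h2 := hh.coeff_natDegree
    rw [mon_natDegree] at h1
    rw [hd] at h2
    rw [hk, h1, h2]
  · rw [coeff_eq_zero_of_natDegree_lt (by rw [mon_natDegree]; exact hk), coeff_eq_zero_of_natDegree_lt (by omega)]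

open Classical in
noncomputable def Mo (p : ℕ) [Fact p.Prime] (d : ℕ) : Finset (ZMod p)[X] := Finset.univ.image (mon d)

lemma mem_Mo {d : ℕ} {h : (ZMod p)[X]} : h ∈ Mo p d ↔ h.Monic ∧ h.natDegree = d := by
  classical
  unfold Mo
  rw [Finset.mem_image]
  constructor
  · rintro ⟨v, _, rfl⟩
    exact ⟨mon_monic v, mon_natDegree v⟩
  · rintro ⟨h1, h2⟩
    exact ⟨_, Finset.mem_univ _, mon_surj h1 h2⟩

noncomputable def cc (ψ : AddChar (ZMod p) ℂ) (b t : ZMod p) (d : ℕ) : ℂ := ∑ h ∈ Mo p d, lam ψ b t h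

lemma cc_eq (ψ : AddChar (ZMod p) ℂ) (b t : ZMod p) (d : ℕ) :
    cc ψ b t d = ∑ v : Fin d → ZMod p, lam ψ b t (mon d v) := by
  classical
  unfold cc Mo
  rw [Finset.sum_image (fun _ _ _ _ h => mon_inj h)]

lemma cc_zero (ψ : AddChar (ZMod p) ℂ) (b t : ZMod p) : cc ψ b t 0 = 1 := by
  rw [cc_eq]
  simp [mon, lam_one]

lemma nextCoeff_mon {d : ℕ} (v : Fin (d+1) → ZMod p) : (mon (d+1) v).nextCoeff = v (Fin.last d) := by
  rw [nextCoeff_of_natDegree_pos (by rw [mon_natDegree]; omega), mon_natDegree]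
  exact mon_coeff v (Fin.last d)

lemma cc_one (ψ : AddChar (ZMod p) ℂ) (b t : ZMod p) :
    cc ψ b t 1 = ∑ x : ZMod p, if x = 0 then 0 else ψ (t * (x + b * x⁻¹)) := by
  rw [cc_eq]
  rw [← (Equiv.funUnique (Fin 1) (ZMod p)).symm.sum_comp, ← Equiv.sum_comp (Equiv.neg (ZMod p))]
  apply Finset.sum_congr rfl
  intro x _
  unfold lam
  have h0 := mon_coeff ((Equiv.funUnique (Fin 1) (ZMod p)).symm (-x)) 0
  have h1 : (mon 1 ((Equiv.funUnique (Fin 1) (ZMod p)).symm (-x))).coeff 1 = 1 := by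
    have := (mon_monic ((Equiv.funUnique (Fin 1) (ZMod p)).symm (-x))).coeff_natDegree
    rwa [mon_natDegree] at this
  simp only [Fin.val_zero] at h0
  rw [Equiv.neg_apply, h0, h1, nextCoeff_mon]
  simp only [Equiv.funUnique_symm_apply, uniqueElim_const, neg_eq_zero]
  split_ifs with hx
  · rfl
  · congr 1
    field_simp
    ring

lemma cc_two (ψ : AddChar (ZMod p) ℂ) (hψ : ψ.IsPrimitive) (b t : ZMod p) (hb : b ≠ 0) (ht : t ≠ 0) :
    cc ψ b t 2 = p := by
  rw [cc_eq, ← (finTwoArrowEquiv (ZMod p)).symm.sum_comp, Fintype.sum_prod_type]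
  have : ∀ v u : ZMod p, lam ψ b t (mon 2 ((finTwoArrowEquiv (ZMod p)).symm (v, u))) =
      if v = 0 then 0 else ψ (u * (- (t * (1 + b / v)))) := by
    intro v u
    unfold lam
    have h0 := mon_coeff ((finTwoArrowEquiv (ZMod p)).symm (v, u)) 0
    have h1 := mon_coeff ((finTwoArrowEquiv (ZMod p)).symm (v, u)) 1
    simp only [Fin.val_zero, Fin.val_one] at h0 h1
    rw [h0, h1, nextCoeff_mon]
    simp [finTwoArrowEquiv]
    split_ifs
    · rfl
    · congr 1; ring
  simp_rw [this]
  have h2 : ∀ v : ZMod p, ∑ u : ZMod p, (if v = 0 then 0 else ψ (u * (- (t * (1 + b / v))))) =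
      if v = -b then (p : ℂ) else 0 := by
    intro v
    by_cases hv : v = 0
    · simp [hv]
      exact fun h => absurd h hb
    · simp only [hv, if_false]
      rw [AddChar.sum_mulShift _ hψ, ZMod.card]
      have : (-(t * (1 + b / v)) = 0) ↔ v = -b := by
        rw [neg_eq_zero, mul_eq_zero, or_iff_right ht]
        constructor
        · intro h; field_simp at h; linear_combination h
        · intro h; subst h; field_simp; ring
      simp only [this]
      split_ifs <;> simp
  simp_rw [h2]
  simp

lemma cc_ge_three (ψ : AddChar (ZMod p) ℂ) (hψ : ψ.IsPrimitive) (b t : ZMod p) (ht : t ≠ 0) (d : ℕ) :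
    cc ψ b t (d + 3) = 0 := by
  rw [cc_eq, ← (Fin.snocEquiv (fun _ : Fin (d + 3) => ZMod p)).sum_comp, Fintype.sum_prod_type, Finset.sum_comm]
  apply Finset.sum_eq_zero
  intro v _
  have : ∀ u : ZMod p, lam ψ b t (mon (d+3) ((Fin.snocEquiv (fun _ : Fin (d + 3) => ZMod p)) (u, v))) =
     (if v 0 = 0 then 0 else ψ (-(t * (b * (v 1 / v 0))))) * ψ (u * (-t)) := by
    intro u
    unfold lam
    have h0 := mon_coeff ((Fin.snocEquiv (fun _ : Fin (d + 3) => ZMod p)) (u, v)) 0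
    have h1 := mon_coeff ((Fin.snocEquiv (fun _ : Fin (d + 3) => ZMod p)) (u, v)) 1
    have e0 : (Fin.snocEquiv (fun _ : Fin (d + 3) => ZMod p)) (u, v) 0 = v 0 := by
      have := Fin.snoc_castSucc (α := fun _ : Fin (d+3) => ZMod p) u v 0
      simpa [Fin.snocEquiv] using this
    have e1 : (Fin.snocEquiv (fun _ : Fin (d + 3) => ZMod p)) (u, v) 1 = v 1 := by
      have := Fin.snoc_castSucc (α := fun _ : Fin (d+3) => ZMod p) u v 1
      simpa [Fin.snocEquiv] using this
    rw [e0] at h0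
    rw [e1] at h1
    have hv1 : ((1 : Fin (d+3)) : ℕ) = 1 := by simp
    simp only [Fin.val_zero, hv1] at h0 h1
    rw [h0, h1, nextCoeff_mon]
    have e2 : (Fin.snocEquiv (fun _ : Fin (d + 3) => ZMod p)) (u, v) (Fin.last (d+2)) = u := by
      simp [Fin.snocEquiv]
    rw [e2]
    split_ifs
    · simp
    · rw [← AddChar.map_add_eq_mul]; congr 1; ring
  simp_rw [this]
  have h0 : ∑ u : ZMod p, ψ (u * (-t)) = 0 := by
    rw [AddChar.sum_mulShift _ hψ, if_neg (neg_ne_zero.2 ht)]; simp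
  rw [← Finset.mul_sum, h0, mul_zero]

end Step

namespace Step
open Polynomial

variable {p : ℕ} [Fact p.Prime]

lemma nextCoeff_minpoly_inv {K L : Type*} [Field K] [Field L] [Algebra K L] [FiniteDimensional K L] (x : L) (hx : x ≠ 0) :
    (minpoly K x⁻¹).nextCoeff = (minpoly K x).coeff 1 / (minpoly K x).coeff 0 := by
  set P := minpoly K x with hP
  have hIntg : IsIntegral K x := .of_finite K x
  have hIntg' : IsIntegral K x⁻¹ := .of_finite K _
  have h0 : P.coeff 0 ≠ 0 := minpoly.coeff_zero_ne_zero hIntg hx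
  have hdeg : 0 < P.natDegree := minpoly.natDegree_pos hIntg
  have hPm : P.Monic := minpoly.monic hIntg
  have htr : P.natTrailingDegree = 0 := by
    rw [natTrailingDegree_eq_zero]; exact Or.inr h0
  have hrd : P.reverse.natDegree = P.natDegree := by rw [reverse_natDegree, htr]; simp
  have hrl : P.reverse.leadingCoeff = P.coeff 0 := by
    rw [reverse_leadingCoeff, trailingCoeff, htr]
  have hR : (C (P.coeff 0)⁻¹ * P.reverse).Monic := by
    rw [Monic, leadingCoeff_mul, leadingCoeff_C, hrl, inv_mul_cancel₀ h0]
  have hRd : (C (P.coeff 0)⁻¹ * P.reverse).natDegree = P.natDegree := by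
    rw [natDegree_C_mul (inv_ne_zero h0), hrd]
  have hroot : aeval x⁻¹ (C (P.coeff 0)⁻¹ * P.reverse) = 0 := by
    letI : Invertible x := invertibleOfNonzero hx
    have := (eval₂_reverse_eq_zero_iff (algebraMap K L) x P).2 (minpoly.aeval K x)
    rw [invOf_eq_inv] at this
    rw [map_mul]
    rw [← aeval_def] at this
    rw [this, mul_zero]
  have hfr : (minpoly K x⁻¹).natDegree = P.natDegree := by
    rw [hP, ← IntermediateField.adjoin.finrank hIntg, ← IntermediateField.adjoin.finrank hIntg']
    have : IntermediateField.adjoin K {x⁻¹} = IntermediateField.adjoin K {x} := by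
      apply le_antisymm
      · rw [IntermediateField.adjoin_simple_le_iff]
        exact inv_mem (IntermediateField.mem_adjoin_simple_self K x)
      · rw [IntermediateField.adjoin_simple_le_iff]
        have := inv_mem (IntermediateField.mem_adjoin_simple_self K x⁻¹)
        rwa [inv_inv] at this
    rw [this]
  have heq : minpoly K x⁻¹ = C (P.coeff 0)⁻¹ * P.reverse := by
    have := eq_of_monic_of_dvd_of_natDegree_le (minpoly.monic hIntg') hR (minpoly.dvd K _ hroot) (by rw [hRd, hfr])
    exact this.symm
  rw [heq, nextCoeff_of_natDegree_pos (by rw [hRd]; exact hdeg), hRd, coeff_C_mul, coeff_reverse,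
    revAt_le (by omega), show P.natDegree - (P.natDegree - 1) = 1 by omega]
  field_simp

lemma term_eq (L : Type*) [Field L] [Fintype L] [DecidableEq L] [Algebra (ZMod p) L]
    (ψ : AddChar (ZMod p) ℂ) (b t : ZMod p) (x : L) :
    (if x = 0 then 0 else ψ (t * Algebra.trace (ZMod p) L (x + algebraMap (ZMod p) L b * x⁻¹))) =
      lam ψ b t (minpoly (ZMod p) x) ^ (Module.finrank (ZMod p) L / (minpoly (ZMod p) x).natDegree) := by
  have hIntg : IsIntegral (ZMod p) x := .of_finite _ x
  have hm : (minpoly (ZMod p) x).natDegree * Module.finrank (IntermediateField.adjoin (ZMod p) {x}) L =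
      Module.finrank (ZMod p) L := by
    rw [← IntermediateField.adjoin.finrank hIntg]
    exact Module.finrank_mul_finrank _ _ _
  have hd := minpoly.natDegree_pos hIntg
  have hm' : Module.finrank (ZMod p) L / (minpoly (ZMod p) x).natDegree =
      Module.finrank (IntermediateField.adjoin (ZMod p) {x}) L := by
    rw [← hm, Nat.mul_div_cancel_left _ hd]
  rw [hm']
  have hmpos : 0 < Module.finrank (IntermediateField.adjoin (ZMod p) {x}) L := Module.finrank_pos
  unfold lam
  by_cases hx : x = 0
  · have : (minpoly (ZMod p) x).coeff 0 = 0 := by rw [minpoly.coeff_zero_eq_zero hIntg]; exact hx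
    rw [if_pos hx, if_pos this, zero_pow hmpos.ne']
  · rw [if_neg hx, if_neg (minpoly.coeff_zero_ne_zero hIntg hx), ← AddChar.map_nsmul_eq_pow]
    congr 1
    have e : IntermediateField.adjoin (ZMod p) {x⁻¹} = IntermediateField.adjoin (ZMod p) {x} := by
      apply le_antisymm
      · rw [IntermediateField.adjoin_simple_le_iff]
        exact inv_mem (IntermediateField.mem_adjoin_simple_self _ x)
      · rw [IntermediateField.adjoin_simple_le_iff]
        have := inv_mem (IntermediateField.mem_adjoin_simple_self (ZMod p) x⁻¹)
        rwa [inv_inv] at this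
    rw [map_add, ← Algebra.smul_def, map_smul, trace_eq_finrank_mul_minpoly_nextCoeff,
      trace_eq_finrank_mul_minpoly_nextCoeff (ZMod p) x⁻¹, nextCoeff_minpoly_inv x hx, e, nsmul_eq_mul, smul_eq_mul]
    ring

lemma card_minpoly_eq (L : Type*) [Field L] [Fintype L] [DecidableEq L] [Algebra (ZMod p) L]
    (P : (ZMod p)[X]) (hP : P.Monic) (hirr : Irreducible P) (hdvd : P.natDegree ∣ Module.finrank (ZMod p) L) :
    (Finset.univ.filter (fun x : L => minpoly (ZMod p) x = P)).card = P.natDegree := by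
  classical
  have hsplit : Splits (P.map (algebraMap (ZMod p) L)) := by
    have h1 := FiniteField.splits_X_pow_card_sub_X p (K := L)
    refine Splits.of_dvd h1 ?_ ?_
    · exact Polynomial.map_ne_zero (FiniteField.X_pow_card_sub_X_ne_zero _ Fintype.one_lt_card)
    · apply Polynomial.map_dvd
      have := (Irreducible.natDegree_dvd_iff_dvd_X_pow_card_pow_sub_X hirr).1 hdvd
      have hc := Module.card_eq_pow_finrank (K := ZMod p) (V := L)
      rw [ZMod.card p] at hc
      rwa [Nat.card_zmod, ← hc] at this
  have hsep : P.Separable := PerfectField.separable_of_irreducible hirr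
  rw [← card_rootSet_eq_natDegree hsep hsplit, ← Set.toFinset_card]
  congr 1
  ext x
  rw [Finset.mem_filter, Set.mem_toFinset, mem_rootSet]
  constructor
  · rintro ⟨_, h⟩
    exact ⟨hP.ne_zero, by rw [← h]; exact minpoly.aeval _ _⟩
  · rintro ⟨_, h⟩
    exact ⟨Finset.mem_univ _, (minpoly.eq_of_irreducible_of_monic hirr h hP).symm⟩

open Classical in
/-- monic irreducibles of degree at most d -/
noncomputable def Ir (p : ℕ) [Fact p.Prime] (d : ℕ) : Finset (ZMod p)[X] :=
  ((Finset.range (d+1)).biUnion (Mo p)).filter Irreducible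

lemma mem_Ir {d : ℕ} {P : (ZMod p)[X]} : P ∈ Ir p d ↔ P.Monic ∧ P.natDegree ≤ d ∧ Irreducible P := by
  unfold Ir
  simp only [Finset.mem_filter, Finset.mem_biUnion, Finset.mem_range, mem_Mo]
  constructor
  · rintro ⟨⟨a, h1, h2, h4⟩, h3⟩; exact ⟨h2, by omega, h3⟩
  · rintro ⟨h1, h2, h3⟩; exact ⟨⟨_, by omega, h1, rfl⟩, h3⟩

lemma Kl_eq (L : Type*) [Field L] [Fintype L] [DecidableEq L] [Algebra (ZMod p) L]
    (ψ : AddChar (ZMod p) ℂ) (b t : ZMod p) (i d : ℕ) (hi : Module.finrank (ZMod p) L = i) (hid : i ≤ d) :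
    Kl p L ψ b t = ∑ P ∈ Ir p d, if P.natDegree ∣ i then (P.natDegree : ℂ) * lam ψ b t P ^ (i / P.natDegree) else 0 := by
  classical
  unfold Kl
  simp_rw [term_eq, hi]
  have hipos : 0 < i := by rw [← hi]; exact Module.finrank_pos
  have hdv : ∀ x : L, (minpoly (ZMod p) x).natDegree ∣ i := by
    intro x
    rw [← IntermediateField.adjoin.finrank (.of_finite _ x), ← hi]
    exact Dvd.intro _ (Module.finrank_mul_finrank _ (IntermediateField.adjoin (ZMod p) {x}) _)
  rw [← Finset.sum_fiberwise_of_maps_to (s := Finset.univ) (t := Ir p d) (g := fun x : L => minpoly (ZMod p) x)]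
  · apply Finset.sum_congr rfl
    intro P hP
    rw [mem_Ir] at hP
    split_ifs with hd
    · rw [← card_minpoly_eq L P hP.1 hP.2.2 (by rw [hi]; exact hd), card_minpoly_eq L P hP.1 hP.2.2 (by rw [hi]; exact hd)]
      rw [Finset.sum_congr rfl (g := fun _ => lam ψ b t P ^ (i / P.natDegree))]
      · rw [Finset.sum_const, card_minpoly_eq L P hP.1 hP.2.2 (by rw [hi]; exact hd), nsmul_eq_mul]
      · intro x hx
        rw [(Finset.mem_filter.1 hx).2]
    · apply Finset.sum_eq_zero
      intro x hx
      exact absurd ((Finset.mem_filter.1 hx).2 ▸ hdv x) hd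
  · intro x _
    have hIntg : IsIntegral (ZMod p) x := .of_finite _ x
    exact mem_Ir.2 ⟨minpoly.monic hIntg, (Nat.le_of_dvd hipos (hdv x)).trans hid, minpoly.irreducible hIntg⟩

open Classical in
lemma sum_dvd (ψ : AddChar (ZMod p) ℂ) (b t : ZMod p) (d : ℕ) (P : (ZMod p)[X]) (hP : P.Monic) :
    (∑ h ∈ Mo p d, if P ∣ h then lam ψ b t h else 0) =
      if P.natDegree ≤ d then lam ψ b t P * cc ψ b t (d - P.natDegree) else 0 := by
  classical
  split_ifs with hd
  · unfold cc
    rw [Finset.mul_sum, ← Finset.sum_filter]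
    symm
    apply Finset.sum_bij (fun g _ => P * g)
    · intro g hg
      rw [mem_Mo] at hg
      rw [Finset.mem_filter, mem_Mo]
      exact ⟨⟨hP.mul hg.1, by rw [hP.natDegree_mul hg.1, hg.2]; omega⟩, dvd_mul_right _ _⟩
    · intro g _ g' _ h
      exact mul_left_cancel₀ hP.ne_zero h
    · intro h hh
      rw [Finset.mem_filter, mem_Mo] at hh
      obtain ⟨⟨h1, h2⟩, g, rfl⟩ := hh
      have hg : g.Monic := hP.of_mul_monic_left h1
      refine ⟨g, mem_Mo.2 ⟨hg, ?_⟩, rfl⟩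
      rw [hP.natDegree_mul hg] at h2; omega
    · intro g hg
      rw [mem_Mo] at hg
      rw [lam_mul ψ b t hP hg.1]
  · apply Finset.sum_eq_zero
    intro h hh
    rw [mem_Mo] at hh
    rw [if_neg]
    intro hdv
    exact hd (hh.2 ▸ natDegree_le_of_dvd hdv hh.1.ne_zero)

open Classical in
lemma deg_factor (d : ℕ) (h : (ZMod p)[X]) (hh : h.Monic) (hd : h.natDegree = d) :
    ∑ P ∈ Ir p d, P.natDegree * ((Finset.Icc 1 d).filter (fun e => P ^ e ∣ h)).card = d := by
  classical
  have h0 := hh.ne_zero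
  have hprod : (UniqueFactorizationMonoid.normalizedFactors h).prod = h := by
    rw [UniqueFactorizationMonoid.prod_normalizedFactors_eq, hh.normalize_eq_self]
    exact h0
  have hdeg : ((UniqueFactorizationMonoid.normalizedFactors h).map natDegree).sum = d := by
    rw [← hd]
    conv_rhs => rw [← hprod]
    rw [natDegree_multiset_prod_of_monic]
    intro P hP
    exact ((Polynomial.mem_normalizedFactors_iff h0).1 hP).2.1
  rw [Finset.sum_multiset_map_count] at hdeg
  conv_rhs => rw [← hdeg]
  symm
  have hmem : ∀ P ∈ UniqueFactorizationMonoid.normalizedFactors h, P.Monic := by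
    intro P hP
    exact ((Polynomial.mem_normalizedFactors_iff h0).1 hP).2.1
  have hsub : (UniqueFactorizationMonoid.normalizedFactors h).toFinset ⊆ Ir p d := by
    intro P hP
    rw [Multiset.mem_toFinset] at hP
    exact mem_Ir.2 ⟨hmem P hP, hd ▸ natDegree_le_of_dvd (UniqueFactorizationMonoid.dvd_of_mem_normalizedFactors hP) h0,
      UniqueFactorizationMonoid.irreducible_of_normalized_factor P hP⟩
  rw [Finset.sum_subset hsub]
  · apply Finset.sum_congr rfl
    intro P hP
    rw [mem_Ir] at hP
    rw [smul_eq_mul, mul_comm]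
    congr 1
    have key : ∀ e, P ^ e ∣ h ↔ e ≤ Multiset.count P (UniqueFactorizationMonoid.normalizedFactors h) := by
      intro e
      rw [pow_dvd_iff_le_emultiplicity, UniqueFactorizationMonoid.emultiplicity_eq_count_normalizedFactors hP.2.2 h0,
        hP.1.normalize_eq_self]
      exact_mod_cast Iff.rfl
    have hle : Multiset.count P (UniqueFactorizationMonoid.normalizedFactors h) ≤ d := by
      have := (key _).2 le_rfl
      have := natDegree_le_of_dvd this h0
      rw [hP.1.natDegree_pow, hd] at this
      have := hP.2.2.natDegree_pos
      nlinarith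
    have : (Finset.Icc 1 d).filter (fun e => P ^ e ∣ h) = Finset.Icc 1 (Multiset.count P (UniqueFactorizationMonoid.normalizedFactors h)) := by
      ext e
      simp only [Finset.mem_filter, Finset.mem_Icc, key]
      omega
    rw [this]; simp
  · intro P _ hP
    rw [Multiset.mem_toFinset] at hP
    rw [Multiset.count_eq_zero_of_notMem hP, zero_smul]

lemma newton (ψ : AddChar (ZMod p) ℂ) (b t : ZMod p) (d : ℕ) (K : ℕ → ℂ)
    (hK : ∀ i, 1 ≤ i → i ≤ d → K i = ∑ P ∈ Ir p d, if P.natDegree ∣ i then (P.natDegree : ℂ) * lam ψ b t P ^ (i / P.natDegree) else 0) :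
    d * cc ψ b t d = ∑ i ∈ Finset.Icc 1 d, cc ψ b t (d - i) * K i := by
  classical
  have h1 : d * cc ψ b t d = ∑ P ∈ Ir p d, ∑ e ∈ Finset.Icc 1 d, (P.natDegree : ℂ) *
      (if e * P.natDegree ≤ d then lam ψ b t P ^ e * cc ψ b t (d - e * P.natDegree) else 0) := by
    calc d * cc ψ b t d = ∑ h ∈ Mo p d, ((∑ P ∈ Ir p d, P.natDegree * ((Finset.Icc 1 d).filter (fun e => P ^ e ∣ h)).card : ℕ) : ℂ) * lam ψ b t h := by
          unfold cc
          rw [Finset.mul_sum]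
          apply Finset.sum_congr rfl
          intro h hh
          rw [mem_Mo] at hh
          rw [deg_factor d h hh.1 hh.2]
      _ = ∑ h ∈ Mo p d, ∑ P ∈ Ir p d, ∑ e ∈ Finset.Icc 1 d, (P.natDegree : ℂ) * (if P ^ e ∣ h then lam ψ b t h else 0) := by
          apply Finset.sum_congr rfl
          intro h hh
          push_cast
          rw [Finset.sum_mul]
          apply Finset.sum_congr rfl
          intro P hP
          rw [← Finset.mul_sum, mul_assoc, ← Finset.sum_filter, Finset.sum_const, nsmul_eq_mul]
      _ = ∑ P ∈ Ir p d, ∑ e ∈ Finset.Icc 1 d, (P.natDegree : ℂ) * ∑ h ∈ Mo p d, (if P ^ e ∣ h then lam ψ b t h else 0) := by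
          rw [Finset.sum_comm]
          apply Finset.sum_congr rfl
          intro P hP
          rw [Finset.sum_comm]
          apply Finset.sum_congr rfl
          intro e _
          rw [Finset.mul_sum]
      _ = _ := by
          apply Finset.sum_congr rfl
          intro P hP
          apply Finset.sum_congr rfl
          intro e _
          rw [mem_Ir] at hP
          rw [sum_dvd ψ b t d (P ^ e) (hP.1.pow e), hP.1.natDegree_pow, lam_pow ψ b t hP.1]
  rw [h1]
  have h2 : ∑ i ∈ Finset.Icc 1 d, cc ψ b t (d - i) * K i = ∑ P ∈ Ir p d, ∑ i ∈ Finset.Icc 1 d,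
      if P.natDegree ∣ i then (P.natDegree : ℂ) * (lam ψ b t P ^ (i / P.natDegree) * cc ψ b t (d - i)) else 0 := by
    rw [Finset.sum_comm]
    apply Finset.sum_congr rfl
    intro i hi
    rw [Finset.mem_Icc] at hi
    rw [hK i hi.1 hi.2, Finset.mul_sum]
    apply Finset.sum_congr rfl
    intro P _
    split_ifs
    · ring
    · simp
  rw [h2]
  apply Finset.sum_congr rfl
  intro P hP
  rw [mem_Ir] at hP
  have hpos := hP.2.2.natDegree_pos
  rw [← Finset.sum_filter]
  have h3 : ∀ e, (P.natDegree : ℂ) *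
      (if e * P.natDegree ≤ d then lam ψ b t P ^ e * cc ψ b t (d - e * P.natDegree) else 0) =
      if e * P.natDegree ≤ d then (P.natDegree : ℂ) * (lam ψ b t P ^ e * cc ψ b t (d - e * P.natDegree)) else 0 := by
    intro e; split_ifs <;> simp
  simp_rw [h3]
  rw [← Finset.sum_filter]
  apply Finset.sum_bij (fun e _ => e * P.natDegree)
  · intro e he
    simp only [Finset.mem_filter, Finset.mem_Icc] at he ⊢
    exact ⟨⟨by nlinarith [he.1.1], he.2⟩, Dvd.intro_left _ rfl⟩
  · intro e _ e' _ h
    exact Nat.eq_of_mul_eq_mul_right hpos h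
  · intro i hi
    simp only [Finset.mem_filter, Finset.mem_Icc] at hi
    obtain ⟨⟨h1, h2⟩, e, rfl⟩ := hi
    refine ⟨e, ?_, mul_comm _ _⟩
    simp only [Finset.mem_filter, Finset.mem_Icc]
    refine ⟨⟨?_, ?_⟩, by rw [mul_comm]; exact h2⟩
    · by_contra h; have : e = 0 := by omega
      subst this; simp at h1
    · nlinarith
  · intro e _
    rw [Nat.mul_div_cancel _ hpos]

end Step

namespace Step
open Polynomial

variable {p : ℕ} [Fact p.Prime]

open Classical in
noncomputable def KG (ψ : AddChar (ZMod p) ℂ) (b t : ZMod p) (i : ℕ) : ℂ :=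
  if h : i = 0 then 0 else
    haveI : Fintype (GaloisField p i) := Fintype.ofFinite _
    Kl p (GaloisField p i) ψ b t

lemma KG_eq (ψ : AddChar (ZMod p) ℂ) (b t : ZMod p) (d i : ℕ) (hi : 1 ≤ i) (hid : i ≤ d) :
    KG ψ b t i = ∑ P ∈ Ir p d, if P.natDegree ∣ i then (P.natDegree : ℂ) * lam ψ b t P ^ (i / P.natDegree) else 0 := by
  classical
  unfold KG
  rw [dif_neg (by omega)]
  haveI : Fintype (GaloisField p i) := Fintype.ofFinite _
  convert Kl_eq (GaloisField p i) ψ b t i d (GaloisField.finrank p (by omega)) hid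

lemma KG_newton (ψ : AddChar (ZMod p) ℂ) (b t : ZMod p) (d : ℕ) :
    d * cc ψ b t d = ∑ i ∈ Finset.Icc 1 d, cc ψ b t (d - i) * KG ψ b t i :=
  newton ψ b t d _ (fun i h1 h2 => KG_eq ψ b t d i h1 h2)

lemma KG_one (ψ : AddChar (ZMod p) ℂ) (b t : ZMod p) : KG ψ b t 1 = cc ψ b t 1 := by
  have := KG_newton ψ b t 1
  simp [cc_zero] at this
  exact this.symm

lemma KG_two (ψ : AddChar (ZMod p) ℂ) (hψ : ψ.IsPrimitive) (b t : ZMod p) (hb : b ≠ 0) (ht : t ≠ 0) :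
    KG ψ b t 2 = 2 * p - cc ψ b t 1 ^ 2 := by
  have := KG_newton ψ b t 2
  rw [cc_two ψ hψ b t hb ht, show Finset.Icc 1 2 = {1, 2} from rfl, Finset.sum_pair (by norm_num), KG_one] at this
  simp [cc_zero] at this
  linear_combination -this

lemma KG_rec (ψ : AddChar (ZMod p) ℂ) (hψ : ψ.IsPrimitive) (b t : ZMod p) (hb : b ≠ 0) (ht : t ≠ 0) (d : ℕ) :
    KG ψ b t (d + 3) = - cc ψ b t 1 * KG ψ b t (d+2) - p * KG ψ b t (d + 1) := by
  have h := KG_newton ψ b t (d+3)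
  rw [cc_ge_three ψ hψ b t ht d, Finset.sum_Icc_succ_top (by omega), Finset.sum_Icc_succ_top (by omega),
    Finset.sum_Icc_succ_top (by omega)] at h
  rw [Finset.sum_eq_zero] at h
  · rw [show d + 3 - (d + 2 + 1) = 0 by omega, show d + 3 - (d + 1 + 1) = 1 by omega, show d + 3 - (d + 1) = 2 by omega,
      cc_zero, cc_two ψ hψ b t hb ht] at h
    linear_combination -h
  · intro i hi
    rw [Finset.mem_Icc] at hi
    rw [show d + 3 - i = (d - i) + 3 by omega, cc_ge_three ψ hψ b t ht, zero_mul]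

lemma KG_closed (ψ : AddChar (ZMod p) ℂ) (hψ : ψ.IsPrimitive) (b t : ZMod p) (hb : b ≠ 0) (ht : t ≠ 0) (α β : ℂ)
    (h1 : α + β = - cc ψ b t 1) (h2 : α * β = p) (d : ℕ) :
    KG ψ b t (d + 1) = - (α ^ (d+1) + β ^ (d+1)) := by
  have h1' : cc ψ b t 1 = - (α + β) := by rw [h1]; ring
  induction d using Nat.strong_induction_on with
  | _ d ih =>
    match d with
    | 0 => rw [KG_one, h1']; ring
    | 1 => rw [KG_two ψ hψ b t hb ht, h1', ← h2]; ring
    | (d+2) =>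
      rw [KG_rec ψ hψ b t hb ht, ih (d+1) (by omega), ih d (by omega), h1', ← h2]; ring

lemma cc_one_real (ψ : AddChar (ZMod p) ℂ) (b t : ZMod p) : (starRingEnd ℂ) (cc ψ b t 1) = cc ψ b t 1 := by
  rw [cc_one, map_sum, ← Equiv.sum_comp (Equiv.neg (ZMod p))]
  apply Finset.sum_congr rfl
  intro x _
  simp only [Equiv.neg_apply, neg_eq_zero]
  split_ifs with hx
  · simp
  · rw [← AddChar.map_neg_eq_conj, inv_neg]; congr 1; ring

/-- there exist roots; each power sum of even exponent is real and bounded below -/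
lemma roots_exist (k : ℝ) (p : ℝ) (hp : 0 < p) : ∃ α β : ℂ, α + β = k ∧ α * β = p ∧
    ∀ m : ℕ, ∃ s : ℝ, α ^ (2 * m) + β ^ (2 * m) = s ∧ -(2 * p ^ m) ≤ s ∧ (4 * p < k ^ 2 → (k ^ 2 / 2 - p) ^ m ≤ s) := by
  by_cases h : 4 * p < k ^ 2
  · set r := Real.sqrt (k ^ 2 - 4 * p) with hr
    have hr2 : r ^ 2 = k ^ 2 - 4 * p := Real.sq_sqrt (by linarith)
    have hr0 : 0 ≤ r := Real.sqrt_nonneg _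
    refine ⟨((k + r) / 2 : ℝ), ((k - r)/2 : ℝ), ?_, ?_, ?_⟩
    · push_cast; ring
    · rw [← Complex.ofReal_mul]; congr 1; nlinarith
    · intro m
      refine ⟨((k + r) / 2) ^ (2 * m) + ((k - r) / 2) ^ (2 * m), by push_cast; ring, ?_, ?_⟩
      · rw [pow_mul, pow_mul]
        have := pow_pos hp m
        have e1 : 0 ≤ (((k + r) / 2) ^ 2) ^ m := by positivity
        have e2 : 0 ≤ (((k - r) / 2) ^ 2) ^ m := by positivity
        linarith
      · intro _
        rw [pow_mul, pow_mul]
        rcases le_total 0 k with hk | hk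
        · have : (k ^ 2 / 2 - p) ^ m ≤ (((k + r) / 2) ^ 2) ^ m := by
            apply pow_le_pow_left₀ (by linarith)
            nlinarith [mul_nonneg hk hr0]
          have h3 : 0 ≤ (((k - r) / 2) ^ 2) ^ m := by positivity
          linarith
        · have : (k ^ 2 / 2 - p) ^ m ≤ (((k - r) / 2) ^ 2) ^ m := by
            apply pow_le_pow_left₀ (by linarith)
            nlinarith [mul_nonneg (neg_nonneg.2 hk) hr0]
          have h3 : 0 ≤ (((k + r) / 2) ^ 2) ^ m := by positivity
          linarith
  · push Not at h
    set r := Real.sqrt (4 * p - k ^ 2) with hr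
    have hr2 : r ^ 2 = 4 * p - k ^ 2 := Real.sq_sqrt (by linarith)
    set z : ℂ := ⟨k / 2, r / 2⟩ with hz
    have hn : Complex.normSq z = p := by
      rw [hz, Complex.normSq_mk]; nlinarith
    refine ⟨z, (starRingEnd ℂ) z, ?_, ?_, ?_⟩
    · rw [Complex.add_conj, hz]; push_cast; ring
    · rw [Complex.mul_conj, hn]
    · intro m
      refine ⟨2 * (z ^ (2 * m)).re, ?_, ?_, fun h' => absurd h' (not_lt.2 h)⟩
      · rw [← map_pow, Complex.add_conj]
      · have h1 : |(z ^ (2 * m)).re| ≤ p ^ m := by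
          refine (Complex.abs_re_le_norm _).trans ?_
          rw [norm_pow, pow_mul, ← Complex.normSq_eq_norm_sq, hn]
        have := neg_abs_le (z ^ (2 * m)).re
        linarith

theorem weil (hp3 : 3 ≤ p) (ψ : AddChar (ZMod p) ℂ) (hψ : ψ.IsPrimitive) (b t : ZMod p) (hb : b ≠ 0) (ht : t ≠ 0) :
    ‖∑ x : ZMod p, if x = 0 then 0 else ψ (t * (x + b * x⁻¹))‖ ≤ 2 * Real.sqrt p := by
  classical
  rw [← cc_one]
  have hpr : (0:ℝ) < p := by exact_mod_cast (by omega : 0 < p)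
  have hreal : ∀ t, ∃ k : ℝ, cc ψ b t 1 = k := fun t => ⟨_, (Complex.conj_eq_iff_re.1 (cc_one_real ψ b t)).symm⟩
  choose k hk using hreal
  have hroots := fun t => roots_exist (-(k t)) p hpr
  choose α β hab hab' hs using hroots
  choose s hs1 hs2 hs3 using hs
  have hKG : ∀ t, t ≠ 0 → ∀ m, KG ψ b t (2 * (m + 1)) = - (s t (m + 1) : ℂ) := by
    intro t ht m
    have := KG_closed ψ hψ b t hb ht (α t) (β t) (by rw [hab, hk]; push_cast; rfl) (by rw [hab']; push_cast; rfl) (2 * m + 1)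
    rw [show 2 * m + 1 + 1 = 2 * (m + 1) by ring] at this
    rw [this, hs1]
  have hsum : ∀ l : ℕ, 1 ≤ l → ∑ t ∈ Finset.univ.filter (fun t : ZMod p => t ≠ 0), s t (l + 1) ≤ 4 * p ^ 2 * p ^ (l + 1) := by
    intro l hl
    haveI : Fintype (GaloisField p (2 * (l + 1))) := Fintype.ofFinite _
    obtain ⟨r, hr1, hr2⟩ := Kl_sum p (GaloisField p (2 * (l+1))) ψ hψ b l hl hp3 (by
      rw [← Nat.card_eq_fintype_card, GaloisField.card p _ (by omega)]; ring)
    have : (∑ t ∈ Finset.univ.filter (fun t : ZMod p => t ≠ 0), (s t (l + 1) : ℂ)) = -r := by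
      rw [← hr1, ← Finset.sum_neg_distrib]
      apply Finset.sum_congr rfl
      intro t ht
      have h1 := hKG t (Finset.mem_filter.1 ht).2 l
      unfold KG at h1
      rw [dif_neg (by omega)] at h1
      rw [eq_neg_iff_add_eq_zero, add_comm, ← eq_neg_iff_add_eq_zero, ← h1]
      congr
      exact Subsingleton.elim _ _
    have h2 : (∑ t ∈ Finset.univ.filter (fun t : ZMod p => t ≠ 0), s t (l + 1)) = -r := by exact_mod_cast this
    rw [h2]; linarith
  rw [hk, Complex.norm_real]
  by_contra hcon
  push Not at hcon
  have h4 : 4 * (p:ℝ) < (-(k t)) ^ 2 := by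
    rw [Real.norm_eq_abs] at hcon
    have h0 : 0 ≤ 2 * Real.sqrt p := by positivity
    have := pow_lt_pow_left₀ hcon h0 (n := 2) (by norm_num)
    rw [mul_pow, Real.sq_sqrt hpr.le, sq_abs] at this
    linarith
  set R : ℝ := ((-(k t)) ^ 2 / 2 - p) / p with hR
  have hR1 : 1 < R := by rw [hR, lt_div_iff₀ hpr]; linarith
  obtain ⟨m, hm⟩ := pow_unbounded_of_one_lt (4 * (p:ℝ) ^ 2 + 2 * p) hR1
  have h5 := hsum (m + 1) (by omega)
  have h6 := hs3 t (m + 2) h4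
  have hmemt : t ∈ Finset.univ.filter (fun t : ZMod p => t ≠ 0) := Finset.mem_filter.2 ⟨Finset.mem_univ _, ht⟩
  rw [← Finset.add_sum_erase _ _ hmemt] at h5
  have h7 : - (p * (2 * (p:ℝ) ^ (m + 2))) ≤ ∑ x ∈ (Finset.univ.filter (fun t : ZMod p => t ≠ 0)).erase t, s x (m + 1 + 1) := by
    have h8 := Finset.card_nsmul_le_sum ((Finset.univ.filter (fun t : ZMod p => t ≠ 0)).erase t) (fun x => s x (m + 1 + 1))
      (-(2 * (p:ℝ) ^ (m + 2))) (fun x _ => hs2 x (m + 2))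
    refine le_trans ?_ h8
    rw [nsmul_eq_mul]
    have h9 : (((Finset.univ.filter (fun t : ZMod p => t ≠ 0)).erase t).card : ℝ) ≤ p := by
      have := Finset.card_le_univ ((Finset.univ.filter (fun t : ZMod p => t ≠ 0)).erase t)
      rw [ZMod.card] at this
      exact_mod_cast this
    have : 0 < 2 * (p:ℝ) ^ (m + 2) := by positivity
    nlinarith
  have h10 : ((-(k t)) ^ 2 / 2 - p) ^ (m + 2) = R ^ (m + 2) * p ^ (m + 2) := by
    rw [hR, div_pow, div_mul_cancel₀]; positivity
  rw [h10] at h6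
  have h11 : R ^ m ≤ R ^ (m + 2) := pow_le_pow_right₀ hR1.le (by omega)
  have h12 : 0 < (p:ℝ) ^ (m + 2) := by positivity
  simp only [show m + 1 + 1 = m + 2 by ring] at h5 h7
  have : R ^ (m + 2) * p ^ (m + 2) ≤ (4 * (p:ℝ) ^ 2 + 2 * p) * p ^ (m + 2) := by linarith
  have := le_of_mul_le_mul_right this h12
  linarith

end Step

namespace QF

variable {R : Type*} [CommRing R]

/-- `A x` over `R` -/
def mulv (A : Matrix (Fin 4) (Fin 4) ℤ) (x : Fin 4 → R) : Fin 4 → R := (A.map (Int.cast : ℤ → R)).mulVec x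

def dt (c x : Fin 4 → R) : R := ∑ i, c i * x i

lemma sum_Ioi4 (f : Fin 4 → Fin 4 → R) : ∑ i, ∑ j ∈ Finset.Ioi i, f i j =
    f 0 1 + f 0 2 + f 0 3 + f 1 2 + f 1 3 + f 2 3 := by
  have h0 : Finset.Ioi (0 : Fin 4) = {1, 2, 3} := by decide
  have h1 : Finset.Ioi (1 : Fin 4) = {2, 3} := by decide
  have h2 : Finset.Ioi (2 : Fin 4) = {3} := by decide
  have h3 : Finset.Ioi (3 : Fin 4) = ∅ := by decide
  rw [Fin.sum_univ_four, h0, h1, h2, h3]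
  simp
  ring

lemma Qval_four (A : Matrix (Fin 4) (Fin 4) ℤ) (x : Fin 4 → R) : Qval A x =
    ((A 0 0 / 2 : ℤ) : R) * x 0 ^ 2 + ((A 1 1 / 2 : ℤ) : R) * x 1 ^ 2 + ((A 2 2 / 2 : ℤ) : R) * x 2 ^ 2
    + ((A 3 3 / 2 : ℤ) : R) * x 3 ^ 2 + A 0 1 * (x 0 * x 1) + A 0 2 * (x 0 * x 2) + A 0 3 * (x 0 * x 3)
    + A 1 2 * (x 1 * x 2) + A 1 3 * (x 1 * x 3) + A 2 3 * (x 2 * x 3) := by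
  unfold Qval
  rw [sum_Ioi4 (fun i j => ((A i j : ℤ) : R) * (x i * x j)), Fin.sum_univ_four]
  ring

lemma diag_cast {A : Matrix (Fin 4) (Fin 4) ℤ} (hA : IsGram A) (i : Fin 4) :
    ((A i i : ℤ) : R) = 2 * ((A i i / 2 : ℤ) : R) := by
  have := hA.2 i
  have h : A i i = 2 * (A i i / 2) := by omega
  conv_lhs => rw [h]
  push_cast; ring

lemma Qval_add {A : Matrix (Fin 4) (Fin 4) ℤ} (hA : IsGram A) (x y : Fin 4 → R) :
    Qval A (x + y) = Qval A x + Qval A y + dt x (mulv A y) := by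
  have hs : ∀ i j, A i j = A j i := fun i j => hA.1.apply j i
  simp only [Qval_four, dt, mulv, Matrix.mulVec, dotProduct, Fin.sum_univ_four, Matrix.map_apply, Pi.add_apply,
    diag_cast hA]
  rw [hs 1 0, hs 2 0, hs 3 0, hs 2 1, hs 3 1, hs 3 2]
  ring

lemma two_Qval {A : Matrix (Fin 4) (Fin 4) ℤ} (hA : IsGram A) (x : Fin 4 → R) :
    2 * Qval A x = dt x (mulv A x) := by
  have hs : ∀ i j, A i j = A j i := fun i j => hA.1.apply j i
  simp only [Qval_four, dt, mulv, Matrix.mulVec, dotProduct, Fin.sum_univ_four, Matrix.map_apply, Pi.add_apply,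
    diag_cast hA]
  rw [hs 1 0, hs 2 0, hs 3 0, hs 2 1, hs 3 1, hs 3 2]
  ring

lemma Qval_smul (A : Matrix (Fin 4) (Fin 4) ℤ) (r : R) (x : Fin 4 → R) :
    Qval A (r • x) = r ^ 2 * Qval A x := by
  simp only [Qval_four, Pi.smul_apply, smul_eq_mul]
  ring

lemma Qval_map {R' : Type*} [CommRing R'] (f : R →+* R') (A : Matrix (Fin 4) (Fin 4) ℤ) (x : Fin 4 → R) :
    f (Qval A x) = Qval A (fun i => f (x i)) := by
  simp only [Qval_four, map_add, map_mul, map_pow, map_intCast]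

lemma mulv_map {R' : Type*} [CommRing R'] (f : R →+* R') (A : Matrix (Fin 4) (Fin 4) ℤ) (x : Fin 4 → R) (i : Fin 4) :
    f (mulv A x i) = mulv A (fun i => f (x i)) i := by
  simp only [mulv, Matrix.mulVec, dotProduct, Matrix.map_apply, map_sum, map_mul, map_intCast]

lemma mulv_add (A : Matrix (Fin 4) (Fin 4) ℤ) (x y : Fin 4 → R) : mulv A (x + y) = mulv A x + mulv A y :=
  Matrix.mulVec_add _ _ _

lemma mulv_smul (A : Matrix (Fin 4) (Fin 4) ℤ) (r : R) (x : Fin 4 → R) : mulv A (r • x) = r • mulv A x :=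
  Matrix.mulVec_smul _ _ _

lemma dt_add_right (c x y : Fin 4 → R) : dt c (x + y) = dt c x + dt c y := by
  simp [dt, mul_add, Finset.sum_add_distrib]

lemma dt_smul_right (c x : Fin 4 → R) (r : R) : dt c (r • x) = r * dt c x := by
  simp only [dt, Finset.mul_sum, Pi.smul_apply, smul_eq_mul]
  exact Finset.sum_congr rfl (fun i _ => by ring)

lemma dt_add_left (c x y : Fin 4 → R) : dt (x + y) c = dt x c + dt y c := by
  simp [dt, add_mul, Finset.sum_add_distrib]

lemma dt_smul_left (c x : Fin 4 → R) (r : R) : dt (r • c) x = r * dt c x := by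
  simp only [dt, Finset.mul_sum, Pi.smul_apply, smul_eq_mul]
  exact Finset.sum_congr rfl (fun i _ => by ring)

lemma dt_comm (c x : Fin 4 → R) : dt c x = dt x c := by
  simp only [dt]; exact Finset.sum_congr rfl (fun i _ => by ring)

lemma dt_mulv_comm {A : Matrix (Fin 4) (Fin 4) ℤ} (hA : IsGram A) (x y : Fin 4 → R) :
    dt x (mulv A y) = dt y (mulv A x) := by
  have hs : ∀ i j, A i j = A j i := fun i j => hA.1.apply j i
  simp only [dt, mulv, Matrix.mulVec, dotProduct, Fin.sum_univ_four, Matrix.map_apply]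
  rw [hs 1 0, hs 2 0, hs 3 0, hs 2 1, hs 3 1, hs 3 2]
  ring

variable [Fintype R]

/-- Gauss sum -/
noncomputable def G (A : Matrix (Fin 4) (Fin 4) ℤ) (ψ : AddChar R ℂ) (a : R) (c : Fin 4 → R) : ℂ :=
  ∑ x : Fin 4 → R, ψ (a * Qval A x + dt c x)

open Classical in
noncomputable def Ker (A : Matrix (Fin 4) (Fin 4) ℤ) (R : Type*) [CommRing R] [Fintype R] : Finset (Fin 4 → R) :=
  Finset.univ.filter (fun h => mulv A h = 0)

lemma mem_Ker {A : Matrix (Fin 4) (Fin 4) ℤ} {h : Fin 4 → R} : h ∈ Ker A R ↔ mulv A h = 0 := by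
  simp [Ker]

noncomputable def kap (A : Matrix (Fin 4) (Fin 4) ℤ) (R : Type*) [CommRing R] [Fintype R] : ℕ := (Ker A R).card

open Classical in
noncomputable def S (A : Matrix (Fin 4) (Fin 4) ℤ) (ψ : AddChar R ℂ) (n : R) (c : Fin 4 → R) (k : R) : ℂ :=
  ∑ a : Rˣ, ψ (n * a + k * (a⁻¹ : Rˣ)) * G A ψ (-a) c

lemma sum_lin (ψ : AddChar R ℂ) (hψ : ψ.IsPrimitive) (v : Fin 4 → R) [Decidable (v = 0)] :
    ∑ x : Fin 4 → R, ψ (dt x v) = if v = 0 then (Fintype.card R : ℂ) ^ 4 else 0 := by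
  classical
  have : ∀ x : Fin 4 → R, ψ (dt x v) = ∏ i, ψ (x i * v i) := by
    intro x
    simp only [dt, Fin.sum_univ_four, Fin.prod_univ_four, AddChar.map_add_eq_mul]
  simp_rw [this]
  rw [← Fintype.piFinset_univ, ← Finset.prod_univ_sum (fun _ => Finset.univ) (fun i a => ψ (a * v i))]
  simp_rw [AddChar.sum_mulShift _ hψ]
  split_ifs with h
  · simp [h]
  · obtain ⟨i, hi⟩ := Function.ne_iff.1 h
    apply Finset.prod_eq_zero (Finset.mem_univ i)
    rw [if_neg (show v i ≠ 0 from hi)]; simp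

lemma normSq_G {A : Matrix (Fin 4) (Fin 4) ℤ} (hA : IsGram A) (ψ : AddChar R ℂ) (hψ : ψ.IsPrimitive) (a : Rˣ) (c : Fin 4 → R) :
    ((‖G A ψ a c‖ ^ 2 : ℝ) : ℂ) = (Fintype.card R : ℂ) ^ 4 * ∑ h ∈ Ker A R, ψ (a * Qval A h + dt c h) := by
  classical
  have h1 : ((‖G A ψ a c‖ ^ 2 : ℝ) : ℂ) = G A ψ a c * (starRingEnd ℂ) (G A ψ a c) := by
    rw [Complex.mul_conj, Complex.normSq_eq_norm_sq]
  rw [h1]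
  unfold G
  rw [map_sum, Finset.mul_sum]
  have h2 : ∀ x : Fin 4 → R, (∑ y : Fin 4 → R, ψ (a * Qval A y + dt c y)) * (starRingEnd ℂ) (ψ (a * Qval A x + dt c x)) =
      ∑ h : Fin 4 → R, ψ (a * Qval A h + dt c h) * ψ (dt x ((a : R) • mulv A h)) := by
    intro x
    rw [← Equiv.sum_comp (Equiv.addLeft x), Finset.sum_mul]
    apply Finset.sum_congr rfl
    intro h _
    rw [← AddChar.map_neg_eq_conj, ← AddChar.map_add_eq_mul, ← AddChar.map_add_eq_mul]
    congr 1
    simp only [Equiv.coe_addLeft]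
    rw [Qval_add hA, dt_add_right, dt_smul_right]
    ring
  simp_rw [h2]
  rw [Finset.sum_comm]
  simp_rw [← Finset.mul_sum, sum_lin ψ hψ]
  rw [Finset.mul_sum, Ker, Finset.sum_filter]
  apply Finset.sum_congr rfl
  intro h _
  have : ((a : R) • mulv A h = 0) ↔ mulv A h = 0 := by
    constructor
    · intro h0
      have := congrArg (fun v => ((a⁻¹ : Rˣ) : R) • v) h0
      simpa [smul_smul] using this
    · intro h0; rw [h0, smul_zero]
  simp only [this]
  split_ifs
  · ring
  · simp

lemma G_sq_le {A : Matrix (Fin 4) (Fin 4) ℤ} (hA : IsGram A) (ψ : AddChar R ℂ) (hψ : ψ.IsPrimitive) (a : Rˣ) (c : Fin 4 → R) :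
    ‖G A ψ a c‖ ^ 2 ≤ (Fintype.card R : ℝ) ^ 4 * kap A R := by
  have h := normSq_G hA ψ hψ a c
  have h2 : ‖((‖G A ψ a c‖ ^ 2 : ℝ) : ℂ)‖ = ‖G A ψ a c‖ ^ 2 := by
    rw [Complex.norm_real, Real.norm_of_nonneg (by positivity)]
  rw [← h2, h, norm_mul, norm_pow, Complex.norm_natCast]
  gcongr
  refine (norm_sum_le _ _).trans ?_
  rw [kap, Finset.card_eq_sum_ones]
  push_cast
  apply Finset.sum_le_sum
  intro h _
  rw [AddChar.norm_apply]

lemma G_le {A : Matrix (Fin 4) (Fin 4) ℤ} (hA : IsGram A) (ψ : AddChar R ℂ) (hψ : ψ.IsPrimitive) (a : Rˣ) (c : Fin 4 → R) :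
    ‖G A ψ a c‖ ≤ (Fintype.card R : ℝ) ^ 2 * Real.sqrt (kap A R) := by
  have h := G_sq_le hA ψ hψ a c
  apply le_of_sq_le_sq _ (by positivity)
  rw [mul_pow, Real.sq_sqrt (by positivity)]
  linarith

lemma G_ne_zero {A : Matrix (Fin 4) (Fin 4) ℤ} (hA : IsGram A) (ψ : AddChar R ℂ) (hψ : ψ.IsPrimitive) (a : Rˣ) (c : Fin 4 → R)
    (hG : G A ψ a c ≠ 0) (h : Fin 4 → R) (hh : mulv A h = 0) : 2 * dt c h = 0 := by
  classical
  -- the character on the kernel is trivial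
  have hadd : ∀ x y, y ∈ Ker A R → ψ (a * Qval A (x + y) + dt c (x + y)) =
      ψ (a * Qval A x + dt c x) * ψ (a * Qval A y + dt c y) := by
    intro x y hy
    rw [mem_Ker] at hy
    rw [Qval_add hA, hy, dt_add_right, ← AddChar.map_add_eq_mul]
    congr 1
    simp [dt]
    ring
  have htriv : ∀ y, mulv A y = 0 → ψ (a * Qval A y + dt c y) = 1 := by
    intro y hy
    by_contra hne
    apply hG
    have hsum : ∑ h ∈ Ker A R, ψ (a * Qval A h + dt c h) = 0 := by
      have h1 : (∑ h ∈ Ker A R, ψ (a * Qval A h + dt c h)) * ψ (a * Qval A y + dt c y) = ∑ h ∈ Ker A R, ψ (a * Qval A h + dt c h) := by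
        rw [Finset.sum_mul]
        apply Finset.sum_bij' (fun h _ => h + y) (fun h _ => h - y)
        · intro h hh; rw [mem_Ker] at *; rw [mulv_add, hh, hy, add_zero]
        · intro h hh; rw [mem_Ker] at *; rw [sub_eq_add_neg, mulv_add, hh, ← neg_one_smul R y, mulv_smul, hy]; simp
        · intro h _; simp
        · intro h _; simp
        · intro h hh; rw [hadd h y (mem_Ker.2 hy)]
      have h2 : (∑ h ∈ Ker A R, ψ (a * Qval A h + dt c h)) * (ψ (a * Qval A y + dt c y) - 1) = 0 := by
        rw [mul_sub, h1]; ring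
      rcases mul_eq_zero.1 h2 with h3 | h3
      · exact h3
      · exact absurd (sub_eq_zero.1 h3) hne
    have := normSq_G hA ψ hψ a c
    rw [hsum, mul_zero] at this
    have h4 : ‖G A ψ a c‖ ^ 2 = 0 := by exact_mod_cast this
    simpa using h4
  by_contra hne
  apply hψ hne
  ext r
  rw [AddChar.mulShift_apply, AddChar.one_apply]
  have h1 := htriv (r • h) (by rw [mulv_smul, hh, smul_zero])
  have h2 : ψ (a * Qval A (r • h) + dt c (r • h)) * ψ (a * Qval A (r • h) + dt c (r • h)) = 1 := by rw [h1, one_mul]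
  rw [← AddChar.map_add_eq_mul] at h2
  rw [← h2]
  congr 1
  have h3 := two_Qval hA (r • h)
  rw [mulv_smul, hh, smul_zero] at h3
  have h3' : 2 * Qval A (r • h) = 0 := by rw [h3]; simp [dt]
  rw [dt_smul_right]
  linear_combination (-(a : R)) * h3'

end QF

namespace QF

section prod
variable {T R R' : Type*} [CommRing T] [CommRing R] [CommRing R'] [Fintype T] [Fintype R] [Fintype R']

noncomputable def fstChar (e : T ≃+* R × R') (ψ : AddChar T ℂ) : AddChar R ℂ :=
  ψ.compAddMonoidHom ((e.symm : R × R' →+ T).comp (AddMonoidHom.inl R R'))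
noncomputable def sndChar (e : T ≃+* R × R') (ψ : AddChar T ℂ) : AddChar R' ℂ :=
  ψ.compAddMonoidHom ((e.symm : R × R' →+ T).comp (AddMonoidHom.inr R R'))

lemma char_split (e : T ≃+* R × R') (ψ : AddChar T ℂ) (x : T) :
    ψ x = fstChar e ψ (e x).1 * sndChar e ψ (e x).2 := by
  simp only [fstChar, sndChar, AddChar.compAddMonoidHom_apply, AddMonoidHom.comp_apply, AddMonoidHom.inl_apply,
    AddMonoidHom.inr_apply]
  rw [← AddChar.map_add_eq_mul, ← map_add]
  congr 1
  simp

lemma fstChar_prim (e : T ≃+* R × R') (ψ : AddChar T ℂ) (hψ : ψ.IsPrimitive) : (fstChar e ψ).IsPrimitive := by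
  intro a ha h
  have h0 : e.symm (a, 0) ≠ 0 := by
    simp [ha]
  apply hψ h0
  ext x
  have h2 := congrArg (fun f : AddChar R ℂ => f (e x).1) h
  simp only [AddChar.mulShift_apply, AddChar.one_apply] at h2 ⊢
  rw [char_split e, map_mul]
  simp [h2]

lemma sndChar_prim (e : T ≃+* R × R') (ψ : AddChar T ℂ) (hψ : ψ.IsPrimitive) : (sndChar e ψ).IsPrimitive := by
  intro a ha h
  have h0 : e.symm (0, a) ≠ 0 := by
    simp [ha]
  apply hψ h0
  ext x
  have h2 := congrArg (fun f : AddChar R' ℂ => f (e x).2) h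
  simp only [AddChar.mulShift_apply, AddChar.one_apply] at h2 ⊢
  rw [char_split e, map_mul]
  simp [h2]

def vecEquiv (e : T ≃+* R × R') : (Fin 4 → T) ≃ (Fin 4 → R) × (Fin 4 → R') :=
  (Equiv.arrowCongr (Equiv.refl _) e.toEquiv).trans (Equiv.arrowProdEquivProdArrow (Fin 4) (fun _ => R) (fun _ => R'))

lemma vecEquiv_fst (e : T ≃+* R × R') (x : Fin 4 → T) (i : Fin 4) : (vecEquiv e x).1 i = (e (x i)).1 := rfl
lemma vecEquiv_snd (e : T ≃+* R × R') (x : Fin 4 → T) (i : Fin 4) : (vecEquiv e x).2 i = (e (x i)).2 := rfl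

lemma Qval_fst (e : T ≃+* R × R') (A : Matrix (Fin 4) (Fin 4) ℤ) (x : Fin 4 → T) :
    (e (Qval A x)).1 = Qval A (vecEquiv e x).1 := Qval_map ((RingHom.fst R R').comp (e : T →+* R × R')) A x
lemma Qval_snd (e : T ≃+* R × R') (A : Matrix (Fin 4) (Fin 4) ℤ) (x : Fin 4 → T) :
    (e (Qval A x)).2 = Qval A (vecEquiv e x).2 := Qval_map ((RingHom.snd R R').comp (e : T →+* R × R')) A x
lemma mulv_fst (e : T ≃+* R × R') (A : Matrix (Fin 4) (Fin 4) ℤ) (x : Fin 4 → T) (i : Fin 4) :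
    (e (mulv A x i)).1 = mulv A (vecEquiv e x).1 i := mulv_map ((RingHom.fst R R').comp (e : T →+* R × R')) A x i
lemma mulv_snd (e : T ≃+* R × R') (A : Matrix (Fin 4) (Fin 4) ℤ) (x : Fin 4 → T) (i : Fin 4) :
    (e (mulv A x i)).2 = mulv A (vecEquiv e x).2 i := mulv_map ((RingHom.snd R R').comp (e : T →+* R × R')) A x i
lemma dt_fst (e : T ≃+* R × R') (c x : Fin 4 → T) :
    (e (dt c x)).1 = dt (vecEquiv e c).1 (vecEquiv e x).1 := by
  simp [dt, vecEquiv_fst, map_sum, Prod.fst_sum]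
lemma dt_snd (e : T ≃+* R × R') (c x : Fin 4 → T) :
    (e (dt c x)).2 = dt (vecEquiv e c).2 (vecEquiv e x).2 := by
  simp [dt, vecEquiv_snd, map_sum, Prod.snd_sum]

lemma G_prod (e : T ≃+* R × R') (A : Matrix (Fin 4) (Fin 4) ℤ) (ψ : AddChar T ℂ) (a : T) (c : Fin 4 → T) :
    G A ψ a c = G A (fstChar e ψ) (e a).1 (vecEquiv e c).1 * G A (sndChar e ψ) (e a).2 (vecEquiv e c).2 := by
  unfold G
  rw [Finset.sum_mul_sum, ← Fintype.sum_prod_type', ← Equiv.sum_comp (vecEquiv e)]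
  apply Finset.sum_congr rfl
  intro x _
  rw [char_split e ψ]
  simp only [map_add, map_mul, Prod.fst_add, Prod.snd_add, Prod.fst_mul, Prod.snd_mul, Qval_fst, Qval_snd, dt_fst, dt_snd]

lemma S_prod (e : T ≃+* R × R') (A : Matrix (Fin 4) (Fin 4) ℤ) (ψ : AddChar T ℂ) (n : T) (c : Fin 4 → T) (k : T) :
    S A ψ n c k = S A (fstChar e ψ) (e n).1 (vecEquiv e c).1 (e k).1 *
      S A (sndChar e ψ) (e n).2 (vecEquiv e c).2 (e k).2 := by
  classical
  unfold S
  rw [Finset.sum_mul_sum, ← Fintype.sum_prod_type',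
    ← Equiv.sum_comp ((Units.mapEquiv (e : T ≃* R × R')).trans MulEquiv.prodUnits).toEquiv]
  apply Fintype.sum_congr
  intro a
  rw [char_split e ψ, G_prod e]
  simp only [map_add, map_mul, Prod.fst_add, Prod.snd_add, Prod.fst_mul, Prod.snd_mul, map_neg, Prod.fst_neg, Prod.snd_neg]
  have h1 : (((((Units.mapEquiv (e : T ≃* R × R')).trans MulEquiv.prodUnits).toEquiv a).1 : Rˣ) : R) = (e a).1 := rfl
  have h2 : (((((Units.mapEquiv (e : T ≃* R × R')).trans MulEquiv.prodUnits).toEquiv a).2 : R'ˣ) : R') = (e a).2 := rfl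
  have h3 : ((((((Units.mapEquiv (e : T ≃* R × R')).trans MulEquiv.prodUnits).toEquiv a).1)⁻¹ : Rˣ) : R) = (e (a⁻¹ : Tˣ)).1 := rfl
  have h4 : ((((((Units.mapEquiv (e : T ≃* R × R')).trans MulEquiv.prodUnits).toEquiv a).2)⁻¹ : R'ˣ) : R') = (e (a⁻¹ : Tˣ)).2 := rfl
  rw [h1, h2, h3, h4]
  ring

lemma kap_prod (e : T ≃+* R × R') (A : Matrix (Fin 4) (Fin 4) ℤ) : kap A T = kap A R * kap A R' := by
  classical
  unfold kap
  rw [← Finset.card_product]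
  apply Finset.card_bij (fun x _ => vecEquiv e x)
  · intro x hx
    rw [mem_Ker] at hx
    rw [Finset.mem_product, mem_Ker, mem_Ker]
    constructor
    · ext i; rw [← mulv_fst, hx]; simp
    · ext i; rw [← mulv_snd, hx]; simp
  · intro x _ y _ h; exact (vecEquiv e).injective h
  · intro y hy
    rw [Finset.mem_product, mem_Ker, mem_Ker] at hy
    refine ⟨(vecEquiv e).symm y, ?_, by simp⟩
    rw [mem_Ker]
    ext i
    apply e.injective
    apply Prod.ext
    · rw [mulv_fst]; simp [hy.1]
    · rw [mulv_snd]; simp [hy.2]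

end prod

lemma S_le {R : Type*} [CommRing R] [Fintype R] {A : Matrix (Fin 4) (Fin 4) ℤ} (hA : IsGram A) (ψ : AddChar R ℂ) (hψ : ψ.IsPrimitive)
    (n : R) (c : Fin 4 → R) (k : R) :
    ‖S A ψ n c k‖ ≤ (Fintype.card R : ℝ) ^ 3 * Real.sqrt (kap A R) := by
  classical
  unfold S
  refine (norm_sum_le _ _).trans ?_
  have : ∀ a : Rˣ, ‖ψ (n * a + k * (a⁻¹ : Rˣ)) * G A ψ (-a) c‖ ≤ (Fintype.card R : ℝ) ^ 2 * Real.sqrt (kap A R) := by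
    intro a
    rw [norm_mul, AddChar.norm_apply, one_mul]
    have := G_le hA ψ hψ (-a) c
    rwa [Units.val_neg] at this
  refine (Finset.sum_le_sum (fun a _ => this a)).trans ?_
  rw [Finset.sum_const, nsmul_eq_mul]
  have hc : ((Finset.univ : Finset Rˣ).card : ℝ) ≤ Fintype.card R := by
    rw [Finset.card_univ]
    exact_mod_cast Fintype.card_le_of_injective (fun a : Rˣ => (a : R)) Units.val_injective
  calc _ ≤ (Fintype.card R : ℝ) * ((Fintype.card R : ℝ) ^ 2 * Real.sqrt (kap A R)) := by gcongr
    _ = _ := by ring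

section good
variable {p : ℕ} [Fact p.Prime]

noncomputable def qc (p : ℕ) [Fact p.Prime] : MulChar (ZMod p) ℂ := (quadraticChar (ZMod p)).ringHomComp (Int.castRingHom ℂ)

lemma gauss1 (hp : p ≠ 2) (ψ : AddChar (ZMod p) ℂ) (hψ : ψ.IsPrimitive) (w : ZMod p) (hw : w ≠ 0) :
    ∑ x : ZMod p, ψ (w * x ^ 2) = (quadraticChar (ZMod p) w : ℂ) * gaussSum (qc p) ψ := by
  classical
  have hchar : ringChar (ZMod p) ≠ 2 := by rw [ZMod.ringChar_zmod_n]; exact hp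
  have h1 : ∑ x : ZMod p, ψ (w * x ^ 2) = ∑ v : ZMod p, ((quadraticChar (ZMod p) v + 1 : ℤ) : ℂ) * ψ (w * v) := by
    rw [← Finset.sum_fiberwise_of_maps_to (s := Finset.univ) (t := Finset.univ) (g := fun x : ZMod p => x ^ 2) (fun _ _ => Finset.mem_univ _)]
    apply Finset.sum_congr rfl
    intro v _
    rw [← quadraticChar_card_sqrts hchar v]
    rw [Finset.sum_congr rfl (g := fun _ => ψ (w * v))]
    · rw [Finset.sum_const, nsmul_eq_mul]
      congr 2
      simp [Set.toFinset_setOf]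
      
    · intro x hx; rw [(Finset.mem_filter.1 hx).2]
  rw [h1]
  push_cast
  simp_rw [add_mul, one_mul]
  rw [Finset.sum_add_distrib]
  have h2 : ∑ v : ZMod p, ψ (w * v) = 0 := by
    simp_rw [mul_comm w]
    rw [AddChar.sum_mulShift _ hψ, if_neg hw]; simp
  rw [h2, add_zero]
  have h3 := gaussSum_mulShift (qc p) ψ (Units.mk0 w hw)
  have h4 : (quadraticChar (ZMod p) w : ℂ) ^ 2 = 1 := by exact_mod_cast quadraticChar_sq_one hw
  have h5 : gaussSum (qc p) (ψ.mulShift w) = ∑ v : ZMod p, (quadraticChar (ZMod p) v : ℂ) * ψ (w * v) := rfl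
  have h6 : qc p (Units.mk0 w hw : (ZMod p)ˣ) = (quadraticChar (ZMod p) w : ℂ) := rfl
  rw [h6, Units.val_mk0, h5] at h3
  rw [← h3, ← mul_assoc, ← sq, h4, one_mul]

lemma mulv_inj {A : Matrix (Fin 4) (Fin 4) ℤ} (hdet : ((A.det : ℤ) : ZMod p) ≠ 0) {x : Fin 4 → ZMod p} (h : mulv A x = 0) : x = 0 := by
  have hd : (A.map (Int.cast : ℤ → ZMod p)).det ≠ 0 := by
    have := Int.cast_det (R := ZMod p) A
    rw [← this]; exact hdet
  exact Matrix.eq_zero_of_mulVec_eq_zero hd h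

lemma G_zero_indep (hp : p ≠ 2) {A : Matrix (Fin 4) (Fin 4) ℤ} (hA : IsGram A) (hdet : ((A.det : ℤ) : ZMod p) ≠ 0)
    (ψ : AddChar (ZMod p) ℂ) (hψ : ψ.IsPrimitive) (a : ZMod p) (ha : a ≠ 0) :
    G A ψ a 0 = G A ψ 1 0 := by
  classical
  have h2 : (2 : ZMod p) ≠ 0 := by
    have hchar : ringChar (ZMod p) ≠ 2 := by rw [ZMod.ringChar_zmod_n]; exact hp
    exact Ring.two_ne_zero hchar
  haveI : Invertible (2 : ZMod p) := invertibleOfNonzero h2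
  let Q := (A.map (Int.cast : ℤ → ZMod p)).toQuadraticForm'
  have hQ : ∀ x, Q x = 2 * Qval A x := by
    intro x
    rw [two_Qval hA]
    simp only [Q, Matrix.toQuadraticForm', LinearMap.BilinMap.toQuadraticMap_apply, Matrix.toLinearMap₂'_apply', dt, mulv, dotProduct]
  have hsep : (QuadraticMap.associated (R := ZMod p) Q).SeparatingLeft := by
    intro x hx
    have h3 : ∀ y, dt x (mulv A y) = 0 := by
      intro y
      have := hx y
      rw [QuadraticMap.associated_apply, hQ, hQ, hQ, Qval_add hA] at this
      have h4 : (⅟2 : Module.End (ZMod p) (ZMod p)) • (2 * dt x (mulv A y)) = 0 := by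
        rw [← this]; congr 1; ring
      have h5 : (2 : Module.End (ZMod p) (ZMod p)) • ((⅟2 : Module.End (ZMod p) (ZMod p)) • (2 * dt x (mulv A y))) = 0 := by
        rw [h4, smul_zero]
      rw [smul_smul, mul_invOf_self, one_smul] at h5
      exact (mul_eq_zero.1 h5).resolve_left h2
    apply mulv_inj hdet
    ext i
    have := h3 (Pi.single i 1)
    rw [dt_mulv_comm hA] at this
    simpa [dt, Pi.single_apply] using this
  obtain ⟨w, ⟨e⟩⟩ := QuadraticForm.equivalent_weightedSumSquares_units_of_nondegenerate' Q hsep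
  have hfr : Module.finrank (ZMod p) (Fin 4 → ZMod p) = 4 := by simp
  have hG : ∀ a : ZMod p, a ≠ 0 → G A ψ a 0 = ∏ i, ((quadraticChar (ZMod p) (a / 2 * w i) : ℂ) * gaussSum (qc p) ψ) := by
    intro a ha
    have h1 : ∀ i, ((quadraticChar (ZMod p) (a / 2 * w i) : ℂ) * gaussSum (qc p) ψ) = ∑ x : ZMod p, ψ ((a / 2 * w i) * x ^ 2) := by
      intro i; rw [gauss1 hp ψ hψ _ (mul_ne_zero (div_ne_zero ha h2) (w i).ne_zero)]
    simp_rw [h1]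
    rw [Finset.prod_univ_sum, Fintype.piFinset_univ, G, ← Equiv.sum_comp e.toLinearEquiv.toEquiv.symm]
    apply Finset.sum_congr rfl
    intro y _
    have h3 : Qval A (e.toLinearEquiv.toEquiv.symm y) = (1/2) * QuadraticMap.weightedSumSquares (ZMod p) w y := by
      have := e.map_app (e.toLinearEquiv.toEquiv.symm y)
      have h6 : e (e.toLinearEquiv.toEquiv.symm y) = y := e.toLinearEquiv.apply_symm_apply y
      rw [h6, hQ] at this
      rw [this]; field_simp
    rw [h3, QuadraticMap.weightedSumSquares_apply]
    have h4 : dt (0 : Fin 4 → ZMod p) (e.toLinearEquiv.toEquiv.symm y) = 0 := by simp [dt]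
    rw [h4, add_zero, Finset.mul_sum, Finset.mul_sum]
    have h7 : ∀ (s : Finset (Fin (Module.finrank (ZMod p) (Fin 4 → ZMod p)))) (f : Fin (Module.finrank (ZMod p) (Fin 4 → ZMod p)) → ZMod p), ψ (∑ i ∈ s, f i) = ∏ i ∈ s, ψ (f i) := by
      intro s f
      induction s using Finset.induction_on with
      | empty => simp
      | insert a s ha ih => rw [Finset.sum_insert ha, Finset.prod_insert ha, AddChar.map_add_eq_mul, ih]
    rw [h7]
    apply Finset.prod_congr rfl
    intro i _
    congr 1
    rw [Units.smul_def, smul_eq_mul]; ring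
  have hmul : ∀ i, (quadraticChar (ZMod p) (a / 2 * w i) : ℂ) = (quadraticChar (ZMod p) a : ℂ) * (quadraticChar (ZMod p) (1 / 2 * w i) : ℂ) := by
    intro i
    rw [show a / 2 * (w i : ZMod p) = a * (1 / 2 * w i) by ring, map_mul]; push_cast; rfl
  rw [hG a ha, hG 1 one_ne_zero]
  simp_rw [hmul, mul_assoc]
  have h4 : (quadraticChar (ZMod p) a : ℂ) ^ 2 = 1 := by exact_mod_cast quadraticChar_sq_one ha
  have hpow : (quadraticChar (ZMod p) a : ℂ) ^ Module.finrank (ZMod p) (Fin 4 → ZMod p) = 1 := by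
    rw [hfr, show (4:ℕ) = 2 * 2 from rfl, pow_mul, h4, one_pow]
  rw [Finset.prod_mul_distrib, Finset.prod_const, Finset.card_univ, Fintype.card_fin, hpow, one_mul]

lemma kap_one {A : Matrix (Fin 4) (Fin 4) ℤ} (hdet : ((A.det : ℤ) : ZMod p) ≠ 0) : kap A (ZMod p) = 1 := by
  classical
  unfold kap
  rw [Finset.card_eq_one]
  refine ⟨0, ?_⟩
  ext x
  rw [mem_Ker, Finset.mem_singleton]
  constructor
  · exact mulv_inj hdet
  · rintro rfl; simp [mulv]

open Classical in
lemma S_good (hp : 3 ≤ p) {A : Matrix (Fin 4) (Fin 4) ℤ} (hA : IsGram A) (hdet : ((A.det : ℤ) : ZMod p) ≠ 0)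
    (ψ : AddChar (ZMod p) ℂ) (hψ : ψ.IsPrimitive) (n : ZMod p) (hn : n ≠ 0) (c : Fin 4 → ZMod p) (k : ZMod p) :
    ‖S A ψ n c k‖ ≤ 2 * (p : ℝ) ^ 2 * Real.sqrt p := by
  -- solve c = A y
  have hinj : Function.Injective (mulv A : (Fin 4 → ZMod p) → (Fin 4 → ZMod p)) := by
    intro x y hxy
    have : mulv A (x - y) = 0 := by
      rw [sub_eq_add_neg, mulv_add, ← neg_one_smul (ZMod p) y, mulv_smul, hxy]; simp
    exact sub_eq_zero.1 (mulv_inj hdet this)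
  obtain ⟨y, hy⟩ := (Finite.surjective_of_injective hinj) c
  have hG : ∀ a : (ZMod p)ˣ, G A ψ (-a) c = ψ ((a⁻¹ : (ZMod p)ˣ) * Qval A y) * G A ψ 1 0 := by
    intro a
    rw [← G_zero_indep (by omega) hA hdet ψ hψ (-(a : ZMod p)) (neg_ne_zero.2 a.ne_zero)]
    unfold G
    rw [Finset.mul_sum, ← Equiv.sum_comp (Equiv.addRight (((a⁻¹ : (ZMod p)ˣ) : ZMod p) • y))]
    apply Finset.sum_congr rfl
    intro x _
    rw [← AddChar.map_add_eq_mul]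
    congr 1
    simp only [Equiv.coe_addRight]
    rw [Qval_add hA, mulv_smul, dt_smul_right, Qval_smul, dt_add_right, dt_smul_right, ← hy]
    have e1 : dt (mulv A y) x = dt x (mulv A y) := dt_comm _ _
    have e2 : dt (mulv A y) y = 2 * Qval A y := by rw [dt_comm, two_Qval hA]
    have e3 : dt (0 : Fin 4 → ZMod p) x = 0 := by simp [dt]
    rw [e1, e2, e3]
    have e4 : (a : ZMod p) * ((a⁻¹ : (ZMod p)ˣ) : ZMod p) = 1 := a.mul_inv
    linear_combination (- dt x (mulv A y) - ((a⁻¹ : (ZMod p)ˣ) : ZMod p) * Qval A y) * e4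
  have h1 : ∑ a : (ZMod p)ˣ, ψ (n * a + k * (a⁻¹ : (ZMod p)ˣ)) * (ψ ((a⁻¹ : (ZMod p)ˣ) * Qval A y) * G A ψ 1 0) =
      (∑ x : ZMod p, if x = 0 then 0 else ψ (n * x + (k + Qval A y) * x⁻¹)) * G A ψ 1 0 := by
    rw [Finset.sum_mul]
    have : ∀ x : ZMod p, (if x = 0 then 0 else ψ (n * x + (k + Qval A y) * x⁻¹)) * G A ψ 1 0 =
      if x ≠ 0 then ψ (n * x + (k + Qval A y) * x⁻¹) * G A ψ 1 0 else 0 := by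
      intro x; by_cases hx : x = 0 <;> simp [hx]
    simp_rw [this]
    rw [← Finset.sum_filter]
    apply Finset.sum_bij (fun (a : (ZMod p)ˣ) _ => (a : ZMod p))
    · intro a _; exact Finset.mem_filter.2 ⟨Finset.mem_univ _, a.ne_zero⟩
    · intro a _ b _ h; exact Units.ext h
    · intro x hx; exact ⟨Units.mk0 x (Finset.mem_filter.1 hx).2, Finset.mem_univ _, rfl⟩
    · intro a _
      rw [← mul_assoc, ← AddChar.map_add_eq_mul]
      congr 2
      rw [Units.val_inv_eq_inv_val]; ring
  have hS : S A ψ n c k = (∑ x : ZMod p, if x = 0 then 0 else ψ (n * x + (k + Qval A y) * x⁻¹)) * G A ψ 1 0 := by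
    rw [← h1]
    unfold S
    simp_rw [hG]
    congr!
  rw [hS, norm_mul]
  have hG1 : ‖G A ψ 1 0‖ ≤ (p:ℝ) ^ 2 := by
    have := G_le hA ψ hψ 1 0
    rw [kap_one hdet, ZMod.card] at this
    simpa using this
  have hp1 : (1:ℝ) ≤ Real.sqrt p := by
    rw [Real.one_le_sqrt]; exact_mod_cast (by omega : 1 ≤ p)
  have hK : ‖∑ x : ZMod p, if x = 0 then 0 else ψ (n * x + (k + Qval A y) * x⁻¹)‖ ≤ 2 * Real.sqrt p := by
    by_cases hk : k + Qval A y = 0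
    · have h3 : ∑ x : ZMod p, ψ (x * n) = 0 := by
        rw [AddChar.sum_mulShift _ hψ, if_neg hn]; simp
      have h4 : (∑ x : ZMod p, if x = 0 then 0 else ψ (n * x + (k + Qval A y) * x⁻¹)) = -1 := by
        rw [← Finset.add_sum_erase _ _ (Finset.mem_univ (0 : ZMod p))] at h3 ⊢
        rw [if_pos rfl, zero_add, zero_mul, AddChar.map_zero_eq_one] at *
        rw [eq_neg_iff_add_eq_zero, add_comm, ← h3]
        congr 1
        apply Finset.sum_congr rfl
        intro x hx
        rw [if_neg (Finset.ne_of_mem_erase hx), hk, zero_mul, add_zero, mul_comm]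
      rw [h4, norm_neg, norm_one]; linarith
    · have := Step.weil hp ψ hψ ((k + Qval A y) / n) n (div_ne_zero hk hn) hn
      refine le_trans (le_of_eq ?_) this
      congr 1
      apply Finset.sum_congr rfl
      intro x _
      split_ifs
      · rfl
      · congr 1; field_simp
  calc _ ≤ (2 * Real.sqrt p) * (p:ℝ) ^ 2 := by gcongr
    _ = _ := by ring

end good

end QF

namespace QF

/-- local bound -/
noncomputable def bb (m p k : ℕ) : ℝ := if k = 0 then 1 else if k = 1 ∧ ¬ p ∣ m then 2 * (p:ℝ) ^ 2 * Real.sqrt p else (p:ℝ) ^ (3 * k)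

noncomputable def Bf (m q : ℕ) : ℝ := q.factorization.prod (bb m)

lemma bb_nonneg (m p k : ℕ) : 0 ≤ bb m p k := by
  unfold bb; split_ifs <;> positivity

lemma Bf_nonneg (m q : ℕ) : 0 ≤ Bf m q := by
  unfold Bf Finsupp.prod
  exact Finset.prod_nonneg (fun _ _ => bb_nonneg _ _ _)

lemma Bf_one (m : ℕ) : Bf m 1 = 1 := by simp [Bf]

lemma Bf_mul (m : ℕ) {a b : ℕ} (h : a.Coprime b) : Bf m (a * b) = Bf m a * Bf m b := by
  unfold Bf
  rw [Nat.factorization_mul_of_coprime h]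
  apply Finsupp.prod_add_index_of_disjoint
  rw [Nat.support_factorization, Nat.support_factorization]
  exact h.disjoint_primeFactors

lemma Bf_prime_pow (m : ℕ) {p k : ℕ} (hp : p.Prime) : Bf m (p ^ k) = bb m p k := by
  unfold Bf
  rw [hp.factorization_pow, Finsupp.prod_single_index]
  simp [bb]

lemma S_bound {A : Matrix (Fin 4) (Fin 4) ℤ} (hA : IsGram A) (n : ℕ) (m : ℕ) (hm : m = 2 * A.det.natAbs * n) (q : ℕ) :
    ∀ [NeZero q] (ψ : AddChar (ZMod q) ℂ), ψ.IsPrimitive → ∀ (c : Fin 4 → ZMod q) (k : ZMod q),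
    ‖S A ψ (n : ZMod q) c k‖ ≤ Bf m q * Real.sqrt (kap A (ZMod q)) := by
  induction q using Nat.recOnPosPrimePosCoprime with
  | zero => intro h; exact absurd rfl h.out
  | one =>
    intro _ ψ hψ c k
    have := S_le hA ψ hψ (((n:ℕ)) : ZMod 1) c k
    rw [Bf_one]
    simpa using this
  | prime_pow p j hp hj =>
    intro _ ψ hψ c k
    rw [Bf_prime_pow m hp]
    by_cases h : j = 1 ∧ ¬ p ∣ m
    · obtain ⟨rfl, h⟩ := h
      rw [bb, if_neg one_ne_zero, if_pos ⟨rfl, h⟩]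
      haveI : Fact p.Prime := ⟨hp⟩
      have key : ∀ (q : ℕ) (hq : q = p) [NeZero q] (ψ : AddChar (ZMod q) ℂ), ψ.IsPrimitive → ∀ (c : Fin 4 → ZMod q) (k : ZMod q),
          ‖S A ψ (n : ZMod q) c k‖ ≤ 2 * (p:ℝ) ^ 2 * Real.sqrt p * Real.sqrt (kap A (ZMod q)) := by
        rintro q rfl h0 ψ hψ c k
        have hdet : ((A.det : ℤ) : ZMod q) ≠ 0 := by
          rw [Ne, ZMod.intCast_zmod_eq_zero_iff_dvd]
          intro hd
          apply h; rw [hm]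
          exact Dvd.dvd.mul_right (Dvd.dvd.mul_left (Int.natCast_dvd.1 hd) 2) n
        have hn0 : (n : ZMod q) ≠ 0 := by
          rw [Ne, ZMod.natCast_eq_zero_iff]
          intro hd; apply h; rw [hm]; exact Dvd.dvd.mul_left hd _
        have h3 : 3 ≤ q := by
          rcases Nat.lt_or_ge q 3 with h3 | h3
          · have h2 := hp.two_le
            have : q = 2 := by omega
            exfalso; apply h; rw [hm, this, mul_assoc]; exact Dvd.intro _ rfl
          · exact h3
        have := S_good h3 hA hdet ψ hψ n hn0 c k
        have hk := kap_one hdet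
        have h4 : Real.sqrt (kap A (ZMod q)) = 1 := by
          convert Real.sqrt_one
          rw [← Nat.cast_one]
          congr 1
        rw [h4, mul_one]
        convert this
      exact key _ (pow_one p) ψ hψ c k
    · rw [bb, if_neg (by omega), if_neg h]
      have := S_le hA ψ hψ (n : ZMod (p ^ j)) c k
      rw [ZMod.card] at this
      refine this.trans (le_of_eq ?_)
      push_cast; rw [← pow_mul, mul_comm j 3]
  | coprime a b ha hb hab iha ihb =>
    intro _ ψ hψ c k
    haveI : NeZero a := ⟨by omega⟩
    haveI : NeZero b := ⟨by omega⟩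
    let e := ZMod.chineseRemainder hab
    rw [S_prod e, kap_prod e, norm_mul, Bf_mul m hab]
    have h1 := iha (fstChar e ψ) (fstChar_prim e ψ hψ) (vecEquiv e c).1 (e k).1
    have h2 := ihb (sndChar e ψ) (sndChar_prim e ψ hψ) (vecEquiv e c).2 (e k).2
    have h3 : (e (n : ZMod (a * b))).1 = n := by rw [map_natCast]; rfl
    have h4 : (e (n : ZMod (a * b))).2 = n := by rw [map_natCast]; rfl
    rw [h3, h4]
    push_cast
    rw [Real.sqrt_mul (by positivity)]
    calc _ ≤ (Bf m a * Real.sqrt (kap A (ZMod a))) * (Bf m b * Real.sqrt (kap A (ZMod b))) := by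
            gcongr
            exact mul_nonneg (Bf_nonneg _ _) (Real.sqrt_nonneg _)
      _ = _ := by ring

/-- `K^ω(m) ≪ m^δ` -/
lemma omega_bound (K : ℝ) (hK : 1 ≤ K) (δ : ℝ) (hδ : 0 < δ) : ∃ C : ℝ, 0 < C ∧ ∀ m : ℕ, 0 < m →
    K ^ m.primeFactors.card ≤ C * (m:ℝ) ^ δ := by
  obtain ⟨P, hP⟩ := exists_nat_ge (K ^ (1 / δ))
  refine ⟨K ^ P, by positivity, ?_⟩
  intro m hm
  have h1 : K ^ m.primeFactors.card = ∏ p ∈ m.primeFactors, K := by simp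
  rw [h1]
  have h2 : ∀ p ∈ m.primeFactors, K ≤ (if p < P then K else 1) * (p:ℝ) ^ δ := by
    intro p hp
    have hp1 : 1 ≤ (p:ℝ) := by exact_mod_cast (Nat.prime_of_mem_primeFactors hp).one_le
    split_ifs with h
    · have : 1 ≤ (p:ℝ) ^ δ := Real.one_le_rpow hp1 hδ.le
      nlinarith
    · rw [one_mul]
      have h3 : K ^ (1/δ) ≤ p := hP.trans (by exact_mod_cast not_lt.1 h)
      calc K = (K ^ (1/δ)) ^ δ := by rw [← Real.rpow_mul (by linarith)]; simp [hδ.ne']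
        _ ≤ _ := by gcongr
  refine (Finset.prod_le_prod (fun _ _ => by linarith) h2).trans ?_
  rw [Finset.prod_mul_distrib]
  apply mul_le_mul
  · rw [← Finset.prod_filter, Finset.prod_const]
    apply pow_le_pow_right₀ hK
    calc _ ≤ (Finset.range P).card := Finset.card_le_card (fun x hx => Finset.mem_range.2 (Finset.mem_filter.1 hx).2)
      _ = P := by simp
  · rw [Real.finset_prod_rpow _ _ (fun _ _ => by positivity)]
    gcongr
    have := Nat.le_of_dvd hm (Nat.prod_primeFactors_dvd m)
    calc _ = ((∏ p ∈ m.primeFactors, p : ℕ) : ℝ) := by push_cast; rfl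
      _ ≤ _ := by exact_mod_cast this
  · exact Finset.prod_nonneg (fun _ _ => by positivity)
  · positivity

/-- Rankin sum -/
lemma bb_summable (m : ℕ) {p : ℕ} (hp : p.Prime) (ε : ℝ) (hε : 0 < ε) :
    Summable (fun k => bb m p k * ((p:ℝ) ^ k) ^ (-(7/2 + ε))) ∧
    ∑' k, bb m p k * ((p:ℝ) ^ k) ^ (-(7/2 + ε)) ≤ if p ∣ m then 4 else 1 + 6 * (p:ℝ) ^ (-(1 + ε)) := by
  have hp2 : (2:ℝ) ≤ p := by exact_mod_cast hp.two_le
  have hp0 : (0:ℝ) < p := by linarith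
  set x : ℝ := (p:ℝ) ^ (-(1/2 + ε)) with hx
  have hx0 : 0 < x := by positivity
  have hx1 : x ≤ 3/4 := by
    have h1 : x ≤ (p:ℝ) ^ (-(1/2) : ℝ) := by
      rw [hx]; apply Real.rpow_le_rpow_of_exponent_le <;> linarith
    have h2 : (p:ℝ) ^ (-(1/2) : ℝ) = (Real.sqrt p)⁻¹ := by
      rw [Real.rpow_neg hp0.le, Real.sqrt_eq_rpow]
    have h3 : (4/3 : ℝ) ≤ Real.sqrt p := by
      apply Real.le_sqrt_of_sq_le; norm_num; linarith
    rw [h2] at h1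
    calc x ≤ _ := h1
      _ ≤ (4/3 : ℝ)⁻¹ := by gcongr
      _ = 3/4 := by norm_num
  have hpow : ∀ k : ℕ, (p:ℝ) ^ (3 * k) * ((p:ℝ) ^ k) ^ (-(7/2 + ε)) = x ^ k := by
    intro k
    rw [hx, ← Real.rpow_natCast, ← Real.rpow_natCast, ← Real.rpow_mul hp0.le, ← Real.rpow_add hp0, ← Real.rpow_natCast, ← Real.rpow_mul hp0.le]
    congr 1; push_cast; ring
  have hgeo : Summable (fun k : ℕ => x ^ k) := summable_geometric_of_lt_one hx0.le (by linarith)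
  have hgs : ∑' k : ℕ, x ^ k = (1 - x)⁻¹ := tsum_geometric_of_lt_one hx0.le (by linarith)
  have hinv : (1 - x)⁻¹ ≤ 4 := by
    calc (1-x)⁻¹ ≤ (1/4 : ℝ)⁻¹ := by gcongr; linarith
      _ = 4 := by norm_num
  have hge2 : ∀ k : ℕ, bb m p (k+2) * ((p:ℝ) ^ (k+2)) ^ (-(7/2 + ε)) = x ^ (k+2) := by
    intro k
    rw [bb, if_neg (by omega), if_neg (by omega), hpow]
  have hsum : Summable (fun k => bb m p k * ((p:ℝ) ^ k) ^ (-(7/2 + ε))) := by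
    rw [← summable_nat_add_iff 2]
    simp_rw [hge2]
    exact (summable_nat_add_iff 2).2 hgeo
  refine ⟨hsum, ?_⟩
  split_ifs with h
  · have : ∀ k, bb m p k * ((p:ℝ) ^ k) ^ (-(7/2 + ε)) = x ^ k := by
      intro k
      by_cases hk : k = 0
      · simp [hk, bb]
      · rw [bb, if_neg hk, if_neg (by simp [h]), hpow]
    simp_rw [this, hgs]; exact hinv
  · rw [← hsum.sum_add_tsum_nat_add 2]
    simp_rw [hge2, Finset.sum_range_succ]
    have h0 : bb m p 0 * ((p:ℝ) ^ 0) ^ (-(7/2 + ε)) = 1 := by simp [bb]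
    have h1 : bb m p 1 * ((p:ℝ) ^ 1) ^ (-(7/2 + ε)) = 2 * (p:ℝ) ^ (-(1 + ε)) := by
      rw [bb, if_neg one_ne_zero, if_pos ⟨rfl, h⟩, pow_one, Real.sqrt_eq_rpow, ← Real.rpow_natCast, mul_assoc, mul_assoc, ← Real.rpow_add hp0,
        ← Real.rpow_add hp0]
      congr 2; push_cast; ring
    have h2 : ∑' k : ℕ, x ^ (k+2) ≤ 4 * (p:ℝ) ^ (-(1 + ε)) := by
      simp_rw [pow_add]
      rw [tsum_mul_right, hgs]
      have h3 : x ^ 2 ≤ (p:ℝ) ^ (-(1 + ε)) := by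
        rw [hx, ← Real.rpow_natCast, ← Real.rpow_mul hp0.le]
        apply Real.rpow_le_rpow_of_exponent_le
        · linarith
        · push_cast; linarith
      gcongr
    rw [h0, h1, Finset.sum_range_zero]; linarith

lemma rankin (ε : ℝ) (hε : 0 < ε) : ∃ C : ℝ, 0 < C ∧ ∀ m : ℕ, 0 < m → ∀ T : Finset ℕ, (∀ q ∈ T, 0 < q) →
    ∑ q ∈ T, Bf m q * (q:ℝ) ^ (-(7/2 + ε)) ≤ C * 4 ^ m.primeFactors.card := by
  have hs : Summable (fun n : ℕ => 6 * (n:ℝ) ^ (-(1 + ε))) := by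
    apply Summable.mul_left
    rw [Real.summable_nat_rpow]; linarith
  refine ⟨Real.exp (∑' n : ℕ, 6 * (n:ℝ) ^ (-(1 + ε))), Real.exp_pos _, ?_⟩
  intro m hm T hT
  set f : ℕ → ℝ := fun q => if q = 0 then 0 else Bf m q * (q:ℝ) ^ (-(7/2 + ε)) with hf
  have hf0 : ∀ q, 0 ≤ f q := by
    intro q; rw [hf]; dsimp only; split_ifs
    · exact le_rfl
    · exact mul_nonneg (Bf_nonneg _ _) (by positivity)
  have hf1 : f 1 = 1 := by simp [hf, Bf_one]
  have hmul : ∀ {a b : ℕ}, a.Coprime b → f (a * b) = f a * f b := by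
    intro a b hab
    by_cases ha : a = 0
    · simp [hf, ha]
    by_cases hb : b = 0
    · simp [hf, hb]
    simp only [hf, ha, hb, mul_eq_zero, or_self, if_false]
    rw [Bf_mul m hab, Nat.cast_mul, Real.mul_rpow (by positivity) (by positivity)]; ring
  have hfp : ∀ {p : ℕ}, p.Prime → ∀ k, f (p ^ k) = bb m p k * ((p:ℝ) ^ k) ^ (-(7/2 + ε)) := by
    intro p hp k
    simp only [hf]
    rw [if_neg (pow_ne_zero _ hp.ne_zero), Bf_prime_pow m hp]; push_cast; rfl
  have hsum : ∀ {p : ℕ}, p.Prime → Summable (fun k => ‖f (p ^ k)‖) := by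
    intro p hp
    simp_rw [Real.norm_of_nonneg (hf0 _), hfp hp]
    exact (bb_summable m hp ε hε).1
  obtain ⟨M, hM⟩ := T.exists_nat_subset_range
  have hE := EulerProduct.summable_and_hasSum_smoothNumbers_prod_primesBelow_tsum hf1 hmul hsum M
  have h1 : ∑ q ∈ T, Bf m q * (q:ℝ) ^ (-(7/2 + ε)) = ∑ q ∈ T, f q := by
    apply Finset.sum_congr rfl
    intro q hq
    simp only [hf]; rw [if_neg (hT q hq).ne']
  rw [h1]
  have hsub : ∀ q ∈ T, q ∈ Nat.smoothNumbers M := by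
    intro q hq
    rw [Nat.mem_smoothNumbers']
    intro p hp hpq
    exact (Nat.le_of_dvd (hT q hq) hpq).trans_lt (Finset.mem_range.1 (hM hq))
  have h2 : ∑ q ∈ T, f q ≤ ∏ p ∈ M.primesBelow, ∑' k, f (p ^ k) := by
    rw [← hE.2.tsum_eq]
    have : ∑ q ∈ T, f q = ∑ q ∈ T.attach.map ⟨fun q => (⟨q.1, hsub q.1 q.2⟩ : Nat.smoothNumbers M), fun a b h => by
        apply Subtype.ext; exact congrArg (fun z : Nat.smoothNumbers M => (z : ℕ)) h⟩, f q := by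
      rw [Finset.sum_map]; exact (Finset.sum_attach T f).symm
    rw [this]
    exact hE.2.summable.sum_le_tsum _ (fun _ _ => hf0 _)
  refine h2.trans ?_
  have h3 : ∀ p ∈ M.primesBelow, ∑' k, f (p ^ k) ≤ (if p ∣ m then 4 else 1) * Real.exp (6 * (p:ℝ) ^ (-(1 + ε))) := by
    intro p hp
    have hpp := Nat.prime_of_mem_primesBelow hp
    simp_rw [hfp hpp]
    refine (bb_summable m hpp ε hε).2.trans ?_
    have : 6 * (p:ℝ) ^ (-(1 + ε)) + 1 ≤ Real.exp (6 * (p:ℝ) ^ (-(1 + ε))) := Real.add_one_le_exp _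
    have h0 : 0 ≤ 6 * (p:ℝ) ^ (-(1 + ε)) := by positivity
    split_ifs <;> linarith
  refine (Finset.prod_le_prod (fun p hp => tsum_nonneg (fun _ => hf0 _)) h3).trans ?_
  rw [Finset.prod_mul_distrib, mul_comm, ← Real.exp_sum]
  gcongr
  · exact hs.sum_le_tsum _ (fun _ _ => by positivity)
  · rw [← Finset.prod_filter, Finset.prod_const]
    apply pow_le_pow_right₀ (by norm_num)
    apply Finset.card_le_card
    intro p hp
    rw [Finset.mem_filter] at hp
    exact Nat.mem_primeFactors.2 ⟨Nat.prime_of_mem_primesBelow hp.1, hp.2, hm.ne'⟩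

end QF

namespace QF

lemma mulVec_inj_int {A : Matrix (Fin 4) (Fin 4) ℤ} (hdet : A.det ≠ 0) : Function.Injective A.mulVec :=
  Matrix.mulVec_injective_of_det_ne_zero hdet

lemma kap_le {A : Matrix (Fin 4) (Fin 4) ℤ} (hdet : A.det ≠ 0) (q : ℕ) [NeZero q] :
    kap A (ZMod q) ≤ A.det.natAbs := by
  classical
  have hinj : Function.Injective (Matrix.mulVecLin A) := mulVec_inj_int hdet
  let N : Submodule ℤ (Fin 4 → ℤ) := LinearMap.range (Matrix.mulVecLin A)
  let e : (Fin 4 → ℤ) ≃ₗ[ℤ] N := LinearEquiv.ofInjective (Matrix.mulVecLin A) hinj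
  have hc : A.det.natAbs = Nat.card ((Fin 4 → ℤ) ⧸ N) := by
    rw [← Submodule.natAbs_det_equiv N e]
    congr 1
    rw [← LinearMap.det_toLin']
    congr 1
  haveI : Finite ((Fin 4 → ℤ) ⧸ N) := by
    apply Nat.finite_of_card_ne_zero
    rw [← hc]; simpa using hdet
  haveI := Fintype.ofFinite ((Fin 4 → ℤ) ⧸ N)
  have hq : (q:ℤ) ≠ 0 := by exact_mod_cast NeZero.ne q
  rw [hc, Nat.card_eq_fintype_card, ← Finset.card_univ]
  unfold kap
  let lft : (Fin 4 → ZMod q) → (Fin 4 → ℤ) := fun x i => (x i).val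
  have hl : ∀ x : Fin 4 → ZMod q, (fun i => ((lft x i : ℤ) : ZMod q)) = x := by
    intro x; ext i; simp [lft]
  have hdv : ∀ x : Fin 4 → ZMod q, x ∈ Ker A (ZMod q) → ∀ i, (q:ℤ) ∣ A.mulVec (lft x) i := by
    intro x hx i
    rw [mem_Ker] at hx
    rw [← ZMod.intCast_zmod_eq_zero_iff_dvd]
    have := congrFun hx i
    simp only [mulv, Matrix.mulVec, dotProduct, Matrix.map_apply, Pi.zero_apply] at this ⊢
    push_cast
    rw [← this]
    apply Finset.sum_congr rfl
    intro j _
    have h9 : ((lft x j : ℤ) : ZMod q) = x j := congrFun (hl x) j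
    rw [h9]
  apply Finset.card_le_card_of_injOn (fun x => (Submodule.Quotient.mk (fun i => A.mulVec (lft x) i / q) : (Fin 4 → ℤ) ⧸ N)) (fun _ _ => Finset.mem_univ _)
  intro x hx y hy hxy
  have h1 := (Submodule.Quotient.eq N).1 hxy
  obtain ⟨z, hz⟩ := h1
  have h2 : A.mulVec (lft x - lft y) = A.mulVec ((q:ℤ) • z) := by
    rw [Matrix.mulVec_sub, Matrix.mulVec_smul]
    have hz' : A.mulVec z = _ := hz
    rw [hz']
    ext i
    simp only [Pi.sub_apply, Pi.smul_apply, smul_eq_mul]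
    rw [mul_sub, Int.mul_ediv_cancel' (hdv x hx i), Int.mul_ediv_cancel' (hdv y hy i)]
  have h3 := mulVec_inj_int hdet h2
  rw [← hl x, ← hl y]
  ext i
  have h4 := congrFun h3 i
  simp only [Pi.sub_apply, Pi.smul_apply, smul_eq_mul] at h4
  have h5 : lft x i = lft y i + q * z i := by linarith
  rw [h5]; push_cast; simp

lemma prim_eq_shift {R : Type*} [CommRing R] [Finite R] (ψ φ : AddChar R ℂ) (hψ : ψ.IsPrimitive) (hφ : φ.IsPrimitive) :
    ∃ u : Rˣ, φ = ψ.mulShift u := by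
  classical
  haveI := Fintype.ofFinite R
  have hinj := AddChar.to_mulShift_inj_of_isPrimitive hψ
  have hbij : Function.Bijective (fun a : R => ψ.mulShift a) := by
    rw [Fintype.bijective_iff_injective_and_card]
    refine ⟨hinj, ?_⟩
    exact (AddChar.card_eq (α := R)).symm
  obtain ⟨a, ha⟩ := hbij.2 φ
  simp only at ha
  have hu : IsUnit a := by
    by_contra h
    apply AddChar.not_isPrimitive_mulShift ψ h
    rw [ha]; exact hφ
  exact ⟨hu.unit, by rw [← ha]; rfl⟩

lemma S_indep {R : Type*} [CommRing R] [Fintype R] (A : Matrix (Fin 4) (Fin 4) ℤ) (ψ φ : AddChar R ℂ) (hψ : ψ.IsPrimitive) (hφ : φ.IsPrimitive)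
    (n : R) : S A φ n 0 0 = S A ψ n 0 0 := by
  classical
  obtain ⟨u, rfl⟩ := prim_eq_shift ψ φ hψ hφ
  unfold S
  rw [← Equiv.sum_comp (Equiv.mulLeft u) (fun a : Rˣ => ψ (n * a + 0 * (a⁻¹ : Rˣ)) * G A ψ (-a) 0)]
  apply Fintype.sum_congr
  intro a
  unfold G
  simp only [AddChar.mulShift_apply, Equiv.coe_mulLeft, Units.val_mul, zero_mul, add_zero]
  congr 1
  · congr 1; ring
  · apply Finset.sum_congr rfl
    intro x _
    congr 1
    simp [dt]; ring

noncomputable def fS (A : Matrix (Fin 4) (Fin 4) ℤ) (n q : ℕ) : ℂ :=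
  if h : q = 0 then 0 else
    haveI : NeZero q := ⟨h⟩
    S A (ZMod.stdAddChar (N := q)) (n : ZMod q) 0 0 / (q:ℂ) ^ 4

lemma fS_eq (A : Matrix (Fin 4) (Fin 4) ℤ) (n q : ℕ) [NeZero q] : fS A n q = S A (ZMod.stdAddChar (N := q)) (n : ZMod q) 0 0 / (q:ℂ) ^ 4 := by
  unfold fS
  rw [dif_neg (NeZero.ne q)]

lemma fS_zero (A : Matrix (Fin 4) (Fin 4) ℤ) (n : ℕ) : fS A n 0 = 0 := by simp [fS]

lemma fS_one (A : Matrix (Fin 4) (Fin 4) ℤ) (n : ℕ) : fS A n 1 = 1 := by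
  rw [fS_eq]
  have h1 : ∀ x : ZMod 1, ZMod.stdAddChar (N := 1) x = 1 := by
    intro x; rw [Subsingleton.elim x 0, AddChar.map_zero_eq_one]
  unfold S G
  simp [h1]

lemma fS_mul (A : Matrix (Fin 4) (Fin 4) ℤ) (n : ℕ) {a b : ℕ} (h : a.Coprime b) : fS A n (a * b) = fS A n a * fS A n b := by
  by_cases ha : a = 0
  · simp [ha, fS_zero]
  by_cases hb : b = 0
  · simp [hb, fS_zero]
  haveI : NeZero a := ⟨ha⟩
  haveI : NeZero b := ⟨hb⟩
  haveI : NeZero (a * b) := ⟨mul_ne_zero ha hb⟩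
  rw [fS_eq, fS_eq, fS_eq]
  let e := ZMod.chineseRemainder h
  have hψ := ZMod.isPrimitive_stdAddChar (a * b)
  rw [S_prod e]
  have h3 : (e (n : ZMod (a * b))).1 = n := by rw [map_natCast]; rfl
  have h4 : (e (n : ZMod (a * b))).2 = n := by rw [map_natCast]; rfl
  have h5 : (vecEquiv e 0).1 = 0 := by ext i; rw [vecEquiv_fst]; simp
  have h6 : (vecEquiv e 0).2 = 0 := by ext i; rw [vecEquiv_snd]; simp
  rw [h3, h4, h5, h6, map_zero, Prod.fst_zero, Prod.snd_zero]
  rw [S_indep A _ _ (ZMod.isPrimitive_stdAddChar a) (fstChar_prim e _ hψ), S_indep A _ _ (ZMod.isPrimitive_stdAddChar b) (sndChar_prim e _ hψ)]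
  push_cast
  field_simp

lemma fS_bound {A : Matrix (Fin 4) (Fin 4) ℤ} (hA : IsGram A) (n q : ℕ) [NeZero q] :
    ‖fS A n q‖ ≤ Bf (2 * A.det.natAbs * n) q * Real.sqrt (kap A (ZMod q)) * (q:ℝ) ^ (-4 : ℝ) := by
  rw [fS_eq, norm_div, norm_pow, Complex.norm_natCast, div_eq_mul_inv]
  have := S_bound hA n _ rfl q (ZMod.stdAddChar (N := q)) (ZMod.isPrimitive_stdAddChar q) 0 0
  have h2 : (q:ℝ) ^ (-4 : ℝ) = ((q:ℝ) ^ 4)⁻¹ := by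
    rw [Real.rpow_neg (by positivity)]; norm_cast
  rw [h2]
  gcongr

lemma fS_bound' {A : Matrix (Fin 4) (Fin 4) ℤ} (hA : IsGram A) (hdet : A.det ≠ 0) (n q : ℕ) :
    ‖fS A n q‖ ≤ Real.sqrt A.det.natAbs * (Bf (2 * A.det.natAbs * n) q * (q:ℝ) ^ (-4 : ℝ)) := by
  by_cases hq : q = 0
  · rw [hq, fS_zero, norm_zero]
    exact mul_nonneg (Real.sqrt_nonneg _) (mul_nonneg (Bf_nonneg _ _) (by positivity))
  haveI : NeZero q := ⟨hq⟩
  refine (fS_bound hA n q).trans ?_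
  have h1 : Real.sqrt (kap A (ZMod q)) ≤ Real.sqrt A.det.natAbs := by
    apply Real.sqrt_le_sqrt
    exact_mod_cast kap_le hdet q
  have := Bf_nonneg (2 * A.det.natAbs * n) q
  calc _ ≤ Bf (2 * A.det.natAbs * n) q * Real.sqrt A.det.natAbs * (q:ℝ) ^ (-4 : ℝ) := by gcongr
    _ = _ := by ring

lemma fS_summable {A : Matrix (Fin 4) (Fin 4) ℤ} (hA : IsGram A) (hdet : A.det ≠ 0) (n : ℕ) (hn : 0 < n) :
    Summable (fun q => ‖fS A n q‖) := by
  obtain ⟨C, hC, h⟩ := rankin (1/2) (by norm_num)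
  have hm : 0 < 2 * A.det.natAbs * n := by
    have := Int.natAbs_pos.2 hdet; positivity
  have key := h _ hm
  apply summable_of_sum_le (c := Real.sqrt A.det.natAbs * (C * 4 ^ (2 * A.det.natAbs * n).primeFactors.card)) (fun _ => norm_nonneg _)
  intro T
  have h1 : ∑ q ∈ T, ‖fS A n q‖ = ∑ q ∈ T.filter (fun q => 0 < q), ‖fS A n q‖ := by
    symm
    apply Finset.sum_subset (Finset.filter_subset _ _)
    intro q hq hq2
    have : q = 0 := by
      by_contra h0; exact hq2 (Finset.mem_filter.2 ⟨hq, Nat.pos_of_ne_zero h0⟩)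
    rw [this, fS_zero, norm_zero]
  rw [h1]
  refine (Finset.sum_le_sum (fun q _ => fS_bound' hA hdet n q)).trans ?_
  rw [← Finset.mul_sum]
  gcongr
  have := key (T.filter (fun q => 0 < q)) (fun q hq => (Finset.mem_filter.1 hq).2)
  norm_num at this ⊢
  exact this

end QF

namespace QF

lemma sum_surj {G H : Type*} [AddCommGroup G] [AddCommGroup H] [Fintype G] [Fintype H] {M : Type*} [CommRing M]
    (φ : G →+ H) (hφ : Function.Surjective φ) (F : H → M) :
    (Fintype.card H : M) * ∑ x, F (φ x) = Fintype.card G * ∑ y, F y := by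
  have h1 : ∀ y : H, ∑ x, F (φ x) = ∑ x, F (φ x + y) := by
    intro y
    obtain ⟨z, rfl⟩ := hφ y
    rw [← Equiv.sum_comp (Equiv.addRight z)]
    simp
  have h2 : ∑ y : H, ∑ x, F (φ x) = ∑ y : H, ∑ x, F (φ x + y) := Finset.sum_congr rfl (fun y _ => h1 y)
  rw [Finset.sum_const, Finset.card_univ, nsmul_eq_mul, Finset.sum_comm] at h2
  rw [h2]
  have h3 : ∀ x : G, ∑ y, F (φ x + y) = ∑ y, F y := fun x => Equiv.sum_comp (Equiv.addLeft (φ x)) F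
  simp_rw [h3]
  rw [Finset.sum_const, Finset.card_univ, nsmul_eq_mul]

noncomputable def sols (A : Matrix (Fin 4) (Fin 4) ℤ) (n q : ℕ) [NeZero q] : Finset (Fin 4 → ZMod q) :=
  Finset.univ.filter (fun x => Qval A x = n)

noncomputable def gq (A : Matrix (Fin 4) (Fin 4) ℤ) (n q : ℕ) [NeZero q] (a : ZMod q) : ℂ :=
  ∑ x : Fin 4 → ZMod q, ZMod.stdAddChar (N := q) (a * (n - Qval A x))

lemma sum_gq (A : Matrix (Fin 4) (Fin 4) ℤ) (n q : ℕ) [NeZero q] : ∑ a, gq A n q a = q * (sols A n q).card := by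
  unfold gq
  rw [Finset.sum_comm]
  simp_rw [AddChar.sum_mulShift _ (ZMod.isPrimitive_stdAddChar q)]
  rw [sols, Finset.card_filter]
  push_cast
  rw [Finset.mul_sum]
  apply Finset.sum_congr rfl
  intro x _
  simp only [sub_eq_zero, ZMod.card, eq_comm (a := (n : ZMod q))]
  split_ifs <;> simp

lemma sum_gq_units (A : Matrix (Fin 4) (Fin 4) ℤ) (n q : ℕ) [NeZero q] [Fintype (ZMod q)ˣ] :
    ∑ a : (ZMod q)ˣ, gq A n q a = S A (ZMod.stdAddChar (N := q)) (n : ZMod q) 0 0 := by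
  unfold S gq G
  apply Finset.sum_congr (by ext; simp)
  intro a _
  rw [Finset.mul_sum]
  apply Finset.sum_congr rfl
  intro x _
  rw [← AddChar.map_add_eq_mul]
  congr 1
  simp [dt]; ring

lemma gq_mul (A : Matrix (Fin 4) (Fin 4) ℤ) (n p q : ℕ) [NeZero p] [NeZero q] [NeZero (p * q)] (b : ℤ) :
    gq A n (p * q) ((p * b : ℤ) : ZMod (p * q)) = (p:ℂ) ^ 4 * gq A n q (b : ZMod q) := by
  let π := ZMod.castHom (Dvd.intro_left p rfl : q ∣ p * q) (ZMod q)
  have hπ : Function.Surjective π := ZMod.castHom_surjective _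
  let Pr : (Fin 4 → ZMod (p * q)) →+ (Fin 4 → ZMod q) :=
    { toFun := fun x i => π (x i), map_zero' := by ext; simp, map_add' := by intros; ext; simp }
  have hPr : Function.Surjective Pr := by
    intro y
    choose f hf using fun i => hπ (y i)
    exact ⟨f, by ext i; exact hf i⟩
  have h := sum_surj Pr hPr (fun y => ZMod.stdAddChar (N := q) ((b : ZMod q) * (n - Qval A y)))
  have h1 : ∀ x, ZMod.stdAddChar (N := p * q) (((p * b : ℤ) : ZMod (p * q)) * (n - Qval A x)) =
      ZMod.stdAddChar (N := q) ((b : ZMod q) * (n - Qval A (Pr x))) := by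
    intro x
    obtain ⟨Y, hY⟩ := ZMod.intCast_surjective ((n : ZMod (p * q)) - Qval A x)
    have h2 : (n : ZMod q) - Qval A (Pr x) = (Y : ZMod q) := by
      have := congrArg π hY
      rw [map_intCast, map_sub, map_natCast, Qval_map] at this
      rw [this]; rfl
    rw [← hY, h2, ← Int.cast_mul, ← Int.cast_mul, ZMod.stdAddChar_coe, ZMod.stdAddChar_coe]
    congr 1
    have hp : (p:ℂ) ≠ 0 := by exact_mod_cast NeZero.ne p
    have hq : (q:ℂ) ≠ 0 := by exact_mod_cast NeZero.ne q
    push_cast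
    field_simp
  unfold gq
  simp_rw [h1]
  simp only [Fintype.card_fun, Fintype.card_fin, ZMod.card] at h
  have hq : (q:ℂ) ≠ 0 := by exact_mod_cast NeZero.ne q
  push_cast at h
  apply mul_left_cancel₀ (pow_ne_zero 4 hq)
  rw [h]; ring

open Classical in
lemma T_rec (A : Matrix (Fin 4) (Fin 4) ℤ) (n p q : ℕ) [Fact p.Prime] (k : ℕ) (hq : q = p ^ k) [NeZero q] [NeZero (p * q)] :
    ∑ a, gq A n (p * q) a = S A (ZMod.stdAddChar (N := p * q)) (n : ZMod (p * q)) 0 0 + (p:ℂ) ^ 4 * ∑ b, gq A n q b := by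
  have hp : p.Prime := Fact.out
  rw [← sum_gq_units, Finset.mul_sum, ← Finset.sum_filter_add_sum_filter_not Finset.univ (fun a : ZMod (p * q) => IsUnit a)]
  congr 1
  · symm
    apply Finset.sum_bij (fun (a : (ZMod (p * q))ˣ) _ => (a : ZMod (p * q)))
    · intro a _; exact Finset.mem_filter.2 ⟨Finset.mem_univ _, a.isUnit⟩
    · intro a _ b _ h; exact Units.ext h
    · intro x hx; exact ⟨(Finset.mem_filter.1 hx).2.unit, Finset.mem_univ _, rfl⟩
    · intro a _; rfl
  · symm
    have hunit : ∀ x : ℕ, IsUnit ((x : ℕ) : ZMod (p * q)) ↔ ¬ p ∣ x := by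
      intro x
      rw [ZMod.isUnit_iff_coprime, hq, ← pow_succ', Nat.coprime_pow_right_iff (by omega), Nat.coprime_comm, hp.coprime_iff_not_dvd]
    apply Finset.sum_bij (fun (b : ZMod q) _ => ((p * (b.val : ℤ) : ℤ) : ZMod (p * q)))
    · intro b _
      refine Finset.mem_filter.2 ⟨Finset.mem_univ _, ?_⟩
      have := hunit (p * b.val)
      push_cast at this ⊢
      rw [this]; simp
    · intro a _ b _ h
      rw [← sub_eq_zero, ← Int.cast_sub, ZMod.intCast_zmod_eq_zero_iff_dvd] at h
      push_cast at h
      rw [← mul_sub] at h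
      have h2 : (q:ℤ) ∣ (a.val : ℤ) - b.val := Int.dvd_of_mul_dvd_mul_left (by exact_mod_cast hp.ne_zero) h
      have h3 := (ZMod.intCast_zmod_eq_zero_iff_dvd _ q).2 h2
      push_cast at h3
      simpa [sub_eq_zero] using h3
    · intro x hx
      have h1 := (Finset.mem_filter.1 hx).2
      have h2 := (hunit x.val).not
      rw [ZMod.natCast_zmod_val, not_not] at h2
      obtain ⟨y, hy⟩ := h2.1 h1
      have hlt := ZMod.val_lt x
      have hyq : y < q := by
        rw [hy] at hlt
        exact Nat.lt_of_mul_lt_mul_left hlt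
      refine ⟨(y : ZMod q), Finset.mem_univ _, ?_⟩
      rw [ZMod.val_natCast, Nat.mod_eq_of_lt hyq]
      conv_rhs => rw [← ZMod.natCast_zmod_val x, hy]
      push_cast; rfl
    · intro b _
      rw [gq_mul]
      simp

lemma local_sum (A : Matrix (Fin 4) (Fin 4) ℤ) (n p : ℕ) [Fact p.Prime] (k : ℕ) :
    ∀ (q : ℕ) [NeZero q], q = p ^ k → ((sols A n q).card : ℂ) / (q:ℂ) ^ 3 = ∑ j ∈ Finset.range (k+1), fS A n (p ^ j) := by
  have hp : p.Prime := Fact.out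
  haveI : NeZero p := ⟨hp.ne_zero⟩
  induction k with
  | zero =>
    intro q _ hq
    rw [pow_zero] at hq
    subst hq
    have : (sols A n 1) = Finset.univ := by
      unfold sols
      rw [Finset.filter_true_of_mem]
      intro x _; exact Subsingleton.elim _ _
    rw [this, Finset.card_univ]
    simp [fS_one]
  | succ k ih =>
    intro q' _ hq
    obtain ⟨q, hq0⟩ : ∃ q, q = p ^ k := ⟨_, rfl⟩
    have : q' = p * q := by rw [hq, hq0]; ring
    subst this
    haveI : NeZero q := ⟨by rw [hq0]; exact pow_ne_zero _ hp.ne_zero⟩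
    rw [Finset.sum_range_succ, ← ih q hq0, ← hq, fS_eq]
    have h := T_rec A n p q k hq0
    rw [sum_gq, sum_gq] at h
    have hpc : (p:ℂ) ≠ 0 := by exact_mod_cast NeZero.ne p
    have hqc : (q:ℂ) ≠ 0 := by exact_mod_cast NeZero.ne q
    have h2 : S A (ZMod.stdAddChar (N := p * q)) (n : ZMod (p * q)) 0 0 = ((p * q : ℕ) : ℂ) * (sols A n (p * q)).card - (p:ℂ) ^ 4 * (q * (sols A n q).card) := by
      rw [h]; ring
    rw [h2]
    push_cast
    field_simp
    ring

/-- smooth solutions mod p -/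
noncomputable def smooth (A : Matrix (Fin 4) (Fin 4) ℤ) (n p : ℕ) [NeZero p] : Finset (Fin 4 → ZMod p) :=
  Finset.univ.filter (fun x => Qval A x = n ∧ mulv A x ≠ 0)

lemma fiber_card {p q : ℕ} [NeZero p] [NeZero q] (h : p ∣ q) (c : ZMod p) :
    p * (Finset.univ.filter (fun x : ZMod q => ZMod.castHom h (ZMod p) x = c)).card = q := by
  have := sum_surj (M := ℤ) (ZMod.castHom h (ZMod p)).toAddMonoidHom (ZMod.castHom_surjective h) (fun y => if y = c then 1 else 0)
  simp only [ZMod.card, RingHom.toAddMonoidHom_eq_coe, AddMonoidHom.coe_coe, Finset.sum_ite_eq', Finset.mem_univ, if_true, mul_one] at this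
  rw [Finset.sum_boole] at this
  exact_mod_cast this

lemma fiber_count {A : Matrix (Fin 4) (Fin 4) ℤ} (hA : IsGram A) (n p q k : ℕ) [Fact p.Prime] [NeZero p] [NeZero q] (hq : q = p ^ (k+1)) (h : p ∣ q)
    (x0 : Fin 4 → ZMod p) (hx0 : Qval A x0 = n) (i : Fin 4) (hi : mulv A x0 i ≠ 0) :
    p ^ (3 * k) ≤ ((sols A n q).filter (fun x => (fun j => ZMod.castHom h (ZMod p) (x j)) = x0)).card := by
  classical
  have hp : p.Prime := Fact.out
  set π := ZMod.castHom h (ZMod p) with hπ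
  have hfib : ∀ c : ZMod p, (Finset.univ.filter (fun x : ZMod q => π x = c)).card = p ^ k := by
    intro c
    have := fiber_card h c
    have this := this.trans (hq.trans (pow_succ' p k))
    exact Nat.eq_of_mul_eq_mul_left hp.pos this
  have hunit : ∀ u : ZMod q, π u ≠ 0 → IsUnit u := by
    intro u hu
    rw [← ZMod.natCast_zmod_val u] at hu ⊢
    rw [map_natCast, Ne, ZMod.natCast_eq_zero_iff] at hu
    rw [ZMod.isUnit_iff_coprime]
    have : Nat.Coprime (u.val) (p ^ (k+1)) := by
      rw [Nat.coprime_pow_right_iff (by omega), Nat.coprime_comm, hp.coprime_iff_not_dvd]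
      exact hu
    rwa [← hq] at this
  let W : Finset (Fin 4 → ZMod q) := Fintype.piFinset (fun j => Finset.univ.filter (fun x : ZMod q => π x = x0 j))
  let W' : Finset (Fin 4 → ZMod q) := Fintype.piFinset (fun j => Finset.univ.filter (fun x : ZMod q => π x = Function.update x0 i (n : ZMod p) j))
  let V : Finset (Fin 4 → ZMod q) := Fintype.piFinset (fun j => if j = i then {(n : ZMod q)} else Finset.univ.filter (fun x : ZMod q => π x = x0 j))
  let Ψ : (Fin 4 → ZMod q) → (Fin 4 → ZMod q) := fun x => Function.update x i (Qval A x)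
  have memW : ∀ x, x ∈ W ↔ ∀ j, π (x j) = x0 j := by intro x; simp [W]
  have memW' : ∀ x, x ∈ W' ↔ ∀ j, π (x j) = Function.update x0 i (n : ZMod p) j := by intro x; simp [W']
  have hQ : ∀ x ∈ W, π (Qval A x) = n := by
    intro x hx
    rw [Qval_map, ← hx0]
    congr 1
    ext j; exact (memW x).1 hx j
  have hmaps : ∀ x ∈ W, Ψ x ∈ W' := by
    intro x hx
    rw [memW']
    intro j
    by_cases hj : j = i
    · subst hj; simp only [Ψ, Function.update_self]; exact hQ x hx
    · simp only [Ψ, Function.update_of_ne hj]; exact (memW x).1 hx j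
  have hinj : Set.InjOn Ψ W := by
    intro x hx y hy hxy
    have hx' := (memW x).1 hx
    have hy' := (memW y).1 hy
    have hQeq : Qval A x = Qval A y := by
      have := congrFun hxy i; simpa [Ψ] using this
    have hoth : ∀ j, j ≠ i → x j = y j := by
      intro j hj; have := congrFun hxy j; simpa [Ψ, hj] using this
    set t := y i - x i with ht
    have hy2 : y = x + t • Pi.single i (1 : ZMod q) := by
      ext j
      by_cases hj : j = i
      · subst hj; simp [ht]
      · simp [hj, hoth j hj]
    have hpt : π t = 0 := by rw [ht, map_sub, hx', hy', sub_self]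
    have h1 : dt x (mulv A (Pi.single i (1 : ZMod q))) = mulv A x i := by
      rw [dt_mulv_comm hA]; simp [dt, Pi.single_apply]
    have h2 : t * (mulv A x i + t * Qval A (Pi.single i (1 : ZMod q))) = 0 := by
      rw [hy2, Qval_add hA, mulv_smul, dt_smul_right, Qval_smul, h1] at hQeq
      linear_combination -hQeq
    have h3 : IsUnit (mulv A x i + t * Qval A (Pi.single i (1 : ZMod q))) := by
      apply hunit
      rw [map_add, map_mul, hpt, zero_mul, add_zero, mulv_map]
      have : (fun j => π (x j)) = x0 := by ext j; exact hx' j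
      rw [this]; exact hi
    have ht0 : t = 0 := by
      rw [mul_comm] at h2
      exact (h3.mul_right_eq_zero).1 h2
    rw [hy2, ht0]; simp
  have hcard : W.card = W'.card := by
    simp only [W, W', Fintype.card_piFinset, hfib]
  have hsurj : Set.SurjOn Ψ W W' := Finset.surjOn_of_injOn_of_card_le Ψ hmaps hinj hcard.ge
  have hV : V.card = p ^ (3 * k) := by
    simp only [V, Fintype.card_piFinset]
    rw [← Finset.mul_prod_erase Finset.univ _ (Finset.mem_univ i), if_pos rfl, Finset.card_singleton, one_mul]
    rw [Finset.prod_congr rfl (g := fun _ => p ^ k)]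
    · rw [Finset.prod_const, Finset.card_erase_of_mem (Finset.mem_univ i), Finset.card_univ, Fintype.card_fin, ← pow_mul]
      congr 1; omega
    · intro j hj
      rw [if_neg (Finset.ne_of_mem_erase hj), hfib]
  rw [← hV]
  have hVW : ∀ v ∈ V, v ∈ W' ∧ v i = n := by
    intro v hv
    have hv' : ∀ j, v j ∈ (if j = i then {(n : ZMod q)} else Finset.univ.filter (fun x : ZMod q => π x = x0 j)) := Fintype.mem_piFinset.1 hv
    have hvi : v i = n := by have := hv' i; simpa using this
    refine ⟨?_, hvi⟩
    rw [memW']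
    intro j
    by_cases hj : j = i
    · subst hj; rw [hvi]; simp
    · have := hv' j
      rw [if_neg hj] at this
      simpa [hj] using this
  apply Finset.card_le_card_of_surjOn Ψ
  intro v hv
  obtain ⟨h1, h2⟩ := hVW v hv
  obtain ⟨x, hx, hxv⟩ := hsurj h1
  refine ⟨x, ?_, hxv⟩
  have hxW := (memW x).1 hx
  rw [Finset.mem_coe, Finset.mem_filter]
  constructor
  · rw [sols, Finset.mem_filter]
    refine ⟨Finset.mem_univ _, ?_⟩
    have := congrFun hxv i
    simp only [Ψ, Function.update_self] at this
    rw [this, h2]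
  · ext j; exact hxW j

lemma sols_ge {A : Matrix (Fin 4) (Fin 4) ℤ} (hA : IsGram A) (n p q k : ℕ) [Fact p.Prime] [NeZero p] [NeZero q] (hq : q = p ^ (k+1)) :
    (smooth A n p).card * p ^ (3 * k) ≤ (sols A n q).card := by
  classical
  have h : p ∣ q := by rw [hq]; exact dvd_pow_self p (by omega)
  have h1 : ∑ x0 ∈ smooth A n p, ((sols A n q).filter (fun x => (fun j => ZMod.castHom h (ZMod p) (x j)) = x0)).card ≤ (sols A n q).card := by
    rw [← Finset.card_biUnion]
    · apply Finset.card_le_card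
      intro x hx
      rw [Finset.mem_biUnion] at hx
      obtain ⟨x0, _, h2⟩ := hx
      exact (Finset.mem_filter.1 h2).1
    · intro a _ b _ hab
      rw [Function.onFun, Finset.disjoint_left]
      intro x hx hy
      exact hab ((Finset.mem_filter.1 hx).2.symm.trans (Finset.mem_filter.1 hy).2)
  refine le_trans ?_ h1
  rw [← smul_eq_mul, ← Finset.sum_const]
  apply Finset.sum_le_sum
  intro x0 hx0
  rw [smooth, Finset.mem_filter] at hx0
  obtain ⟨i, hi⟩ := Function.ne_iff.1 hx0.2.2
  exact fiber_count hA n p q k hq h x0 hx0.2.1 i hi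

end QF

namespace QF

lemma smooth_count {A : Matrix (Fin 4) (Fin 4) ℤ} (hA : IsGram A) (n p : ℕ) [Fact p.Prime] [NeZero p] (hp5 : 5 ≤ p)
    (x0 : Fin 4 → ZMod p) (hx0 : x0 ∈ smooth A n p) : p * (p - 1) * (p - 3) ≤ (smooth A n p).card := by
  classical
  have hp : p.Prime := Fact.out
  rw [smooth, Finset.mem_filter] at hx0
  obtain ⟨_, hQ0, hs⟩ := hx0
  obtain ⟨i, hi⟩ := Function.ne_iff.1 hs
  simp only [Pi.zero_apply] at hi
  let l : (Fin 4 → ZMod p) → ZMod p := fun z => dt x0 (mulv A z)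
  have l_add : ∀ x y, l (x + y) = l x + l y := by intro x y; simp only [l]; rw [mulv_add, dt_add_right]
  have l_smul : ∀ (r : ZMod p) x, l (r • x) = r * l x := by intro r x; simp only [l]; rw [mulv_smul, dt_smul_right]
  have l_i : l (Pi.single i 1) = mulv A x0 i := by
    simp only [l]; rw [dt_mulv_comm hA]; simp [dt, Pi.single_apply]
  have l_x0 : l x0 = 2 * n := by simp only [l]; rw [← two_Qval hA, hQ0]
  let Z : Finset (Fin 4 → ZMod p) := Finset.univ.filter (fun z => l z ≠ 0 ∧ Qval A z ≠ 0)
  -- first step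
  have step1 : ∀ w, l w ≠ 0 → p - 3 ≤ (Finset.univ.filter (fun t : ZMod p => w + t • x0 ∈ Z)).card := by
    intro w hw
    let P : Polynomial (ZMod p) := (Polynomial.C (n : ZMod p) * Polynomial.X ^ 2 + Polynomial.C (l w) * Polynomial.X + Polynomial.C (Qval A w)) *
      (Polynomial.C (2 * n : ZMod p) * Polynomial.X + Polynomial.C (l w))
    have hP1 : (Polynomial.C (n : ZMod p) * Polynomial.X ^ 2 + Polynomial.C (l w) * Polynomial.X + Polynomial.C (Qval A w)) ≠ 0 := by
      intro h
      have := congrArg (fun P => Polynomial.coeff P 1) h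
      simp [Polynomial.coeff_X_pow] at this
      exact hw this
    have hP2 : (Polynomial.C (2 * n : ZMod p) * Polynomial.X + Polynomial.C (l w)) ≠ 0 := by
      intro h
      have := congrArg (fun P => Polynomial.coeff P 0) h
      simp only [Polynomial.coeff_add, Polynomial.coeff_C_mul, Polynomial.coeff_X_zero, Polynomial.coeff_C_zero, Polynomial.coeff_zero, mul_zero, zero_add] at this
      exact hw this
    have hP : P ≠ 0 := mul_ne_zero hP1 hP2
    have hdeg : P.natDegree ≤ 3 := by
      refine (Polynomial.natDegree_mul_le).trans ?_
      have h1 := Polynomial.natDegree_quadratic_le (a := (n : ZMod p)) (b := l w) (c := Qval A w)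
      have h2 := Polynomial.natDegree_linear_le (a := (2 * n : ZMod p)) (b := l w)
      omega
    have hbad : (Finset.univ.filter (fun t : ZMod p => ¬ (w + t • x0 ∈ Z))) ⊆ P.roots.toFinset := by
      intro t ht
      rw [Finset.mem_filter] at ht
      rw [Multiset.mem_toFinset, Polynomial.mem_roots hP, Polynomial.IsRoot.def]
      have h2 : ¬ (l (w + t • x0) ≠ 0 ∧ Qval A (w + t • x0) ≠ 0) := by simpa [Z] using ht.2
      rw [l_add, l_smul, l_x0, Qval_add hA, mulv_smul, dt_smul_right, Qval_smul, hQ0, dt_mulv_comm hA] at h2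
      have h3 : dt (mulv A x0) w = l w := by
        simp only [l]; rw [dt_comm, dt_mulv_comm hA, dt_comm] 
      simp only [P, Polynomial.eval_mul, Polynomial.eval_add, Polynomial.eval_C, Polynomial.eval_pow, Polynomial.eval_X]
      by_contra hne
      apply h2
      have hne := mul_ne_zero_iff.1 hne
      refine ⟨?_, ?_⟩
      · intro h; apply hne.2; rw [← h]; ring
      · intro h; apply hne.1; rw [← h]
        first | (rw [h3]; ring) | ring | (simp only [l]; ring) | (have h4 := dt_mulv_comm hA w x0; simp only [l] at *; linear_combination 0) | skip
    have hb3 : (Finset.univ.filter (fun t : ZMod p => ¬ (w + t • x0 ∈ Z))).card ≤ 3 :=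
      (Finset.card_le_card hbad).trans ((Multiset.toFinset_card_le _).trans ((Polynomial.card_roots' P).trans hdeg))
    have htot := Finset.card_filter_add_card_filter_not (s := (Finset.univ : Finset (ZMod p))) (fun t : ZMod p => w + t • x0 ∈ Z)
    rw [Finset.card_univ, ZMod.card] at htot
    omega
  have step2 : ∀ w, (p - 1) * (p - 3) ≤ ∑ s : ZMod p, (Finset.univ.filter (fun t : ZMod p => (w + s • Pi.single i 1) + t • x0 ∈ Z)).card := by
    intro w
    have hs1 : (Finset.univ.filter (fun s : ZMod p => ¬ l (w + s • Pi.single i 1) ≠ 0)).card ≤ 1 := by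
      rw [Finset.card_le_one]
      intro a ha b hb
      simp only [Finset.mem_filter, not_not, l_add, l_smul, l_i] at ha hb
      have : (a - b) * mulv A x0 i = 0 := by linear_combination ha.2 - hb.2
      rcases mul_eq_zero.1 this with h | h
      · exact sub_eq_zero.1 h
      · exact absurd h hi
    have htot := Finset.card_filter_add_card_filter_not (s := (Finset.univ : Finset (ZMod p))) (fun s : ZMod p => l (w + s • Pi.single i 1) ≠ 0)
    rw [Finset.card_univ, ZMod.card] at htot
    calc (p - 1) * (p - 3) ≤ (Finset.univ.filter (fun s : ZMod p => l (w + s • Pi.single i 1) ≠ 0)).card * (p - 3) := by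
            apply Nat.mul_le_mul_right; omega
      _ = ∑ s ∈ (Finset.univ.filter (fun s : ZMod p => l (w + s • Pi.single i 1) ≠ 0)), (p - 3) := by rw [Finset.sum_const, smul_eq_mul]
      _ ≤ ∑ s ∈ (Finset.univ.filter (fun s : ZMod p => l (w + s • Pi.single i 1) ≠ 0)), (Finset.univ.filter (fun t : ZMod p => (w + s • Pi.single i 1) + t • x0 ∈ Z)).card := by
            apply Finset.sum_le_sum
            intro s hs
            exact step1 _ (Finset.mem_filter.1 hs).2
      _ ≤ _ := Finset.sum_le_sum_of_subset (Finset.filter_subset _ _)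
  have step3 : p ^ 4 * ((p - 1) * (p - 3)) ≤ p ^ 2 * Z.card := by
    calc p ^ 4 * ((p - 1) * (p - 3)) = ∑ w : Fin 4 → ZMod p, (p - 1) * (p - 3) := by
            rw [Finset.sum_const, Finset.card_univ, smul_eq_mul]; simp [ZMod.card]
      _ ≤ ∑ w : Fin 4 → ZMod p, ∑ s : ZMod p, (Finset.univ.filter (fun t : ZMod p => (w + s • Pi.single i 1) + t • x0 ∈ Z)).card :=
            Finset.sum_le_sum (fun w _ => step2 w)
      _ = ∑ s : ZMod p, ∑ t : ZMod p, ∑ w : Fin 4 → ZMod p, (if (w + s • Pi.single i 1) + t • x0 ∈ Z then 1 else 0) := by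
            rw [Finset.sum_comm]
            apply Finset.sum_congr rfl
            intro s _
            simp_rw [Finset.card_filter]
            rw [Finset.sum_comm]
      _ = ∑ s : ZMod p, ∑ t : ZMod p, Z.card := by
            apply Finset.sum_congr rfl; intro s _
            apply Finset.sum_congr rfl; intro t _
            rw [← Equiv.sum_comp (Equiv.addRight (-(s • (Pi.single i (1 : ZMod p) : Fin 4 → ZMod p) + t • x0)))]
            have : ∀ w : Fin 4 → ZMod p, (Equiv.addRight (-(s • (Pi.single i (1 : ZMod p) : Fin 4 → ZMod p) + t • x0))) w + s • Pi.single i 1 + t • x0 = w := by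
              intro w; simp only [Equiv.coe_addRight]; abel
            simp_rw [this]
            simp
      _ = _ := by
            simp [ZMod.card]; ring
  have step4 : Z.card ≤ p * (smooth A n p).card := by
    apply Finset.card_le_mul_card_image_of_maps_to (f := fun z => x0 + (-(l z / Qval A z)) • z)
    · intro z hz
      obtain ⟨_, hz1, hz2⟩ := Finset.mem_filter.1 hz
      rw [smooth, Finset.mem_filter]
      refine ⟨Finset.mem_univ _, ?_, ?_⟩
      · rw [Qval_add hA, mulv_smul, dt_smul_right, Qval_smul, hQ0]
        have : dt x0 (mulv A z) = l z := rfl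
        rw [this]; field_simp; ring
      · rw [mulv_add, mulv_smul]
        intro h
        have h1 := congrArg (dt z) h
        rw [dt_add_right, dt_smul_right, ← two_Qval hA] at h1
        have h2 : dt z (mulv A x0) = l z := dt_mulv_comm hA _ _
        rw [h2] at h1
        have h3 : dt z (0 : Fin 4 → ZMod p) = 0 := by simp [dt]
        rw [h3] at h1
        apply hz1
        field_simp at h1
        linear_combination -h1
    · intro y _
      have : (Z.filter (fun z => x0 + (-(l z / Qval A z)) • z = y)) ⊆ Finset.univ.image (fun r : ZMod p => r • (x0 - y)) := by
        intro z hz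
        rw [Finset.mem_filter] at hz
        obtain ⟨hz0, hzy⟩ := hz
        obtain ⟨_, hz1, hz2⟩ := Finset.mem_filter.1 hz0
        rw [Finset.mem_image]
        refine ⟨Qval A z / l z, Finset.mem_univ _, ?_⟩
        rw [← hzy]
        have : x0 - (x0 + (-(l z / Qval A z)) • z) = (l z / Qval A z) • z := by
          rw [neg_smul]; abel
        rw [this, smul_smul]
        have : Qval A z / l z * (l z / Qval A z) = 1 := by field_simp
        rw [this, one_smul]
      refine (Finset.card_le_card this).trans (Finset.card_image_le.trans ?_)
      rw [Finset.card_univ, ZMod.card]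
  have hpp : 0 < p := hp.pos
  have : p ^ 3 * (p * (p - 1) * (p - 3)) ≤ p ^ 3 * (smooth A n p).card := by
    calc p ^ 3 * (p * (p - 1) * (p - 3)) = p ^ 4 * ((p - 1) * (p - 3)) := by ring
      _ ≤ p ^ 2 * Z.card := step3
      _ ≤ p ^ 2 * (p * (smooth A n p).card) := Nat.mul_le_mul_left _ step4
      _ = _ := by ring
  exact Nat.le_of_mul_le_mul_left this (by positivity)

lemma smooth_nonempty {A : Matrix (Fin 4) (Fin 4) ℤ} {n : ℕ} (h : StrongLocalSolubility A n) (p : ℕ) [Fact p.Prime] [NeZero p] :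
    ∃ x0, x0 ∈ smooth A n p := by
  obtain ⟨x, h1, h2⟩ := h.2 p Fact.out
  refine ⟨fun i => (x i : ZMod p), ?_⟩
  rw [smooth, Finset.mem_filter]
  refine ⟨Finset.mem_univ _, ?_, ?_⟩
  · have hd : (p:ℤ) ∣ (p:ℤ) ^ (if p = 2 then 3 else 1) := dvd_pow_self _ (by split_ifs <;> norm_num)
    have h3 := (ZMod.intCast_eq_intCast_iff _ _ p).2 (h1.of_dvd hd)
    have h4 := Qval_map (Int.castRingHom (ZMod p)) A x
    simp only [eq_intCast] at h4
    rw [← h4, h3]; simp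
  · intro h3
    apply h2
    intro i
    rw [← ZMod.intCast_zmod_eq_zero_iff_dvd]
    have h4 := mulv_map (Int.castRingHom (ZMod p)) A x i
    simp only [eq_intCast] at h4
    have h5 : mulv A x i = A.mulVec x i := by
      have : A.map (Int.cast : ℤ → ℤ) = A := by ext; simp
      simp only [mulv, this]
    rw [← h5, h4, h3]; simp

lemma beta_ge {A : Matrix (Fin 4) (Fin 4) ℤ} (hA : IsGram A) (hdet : A.det ≠ 0) (n p : ℕ) (hn : 0 < n) [Fact p.Prime] [NeZero p] :
    ((smooth A n p).card : ℝ) / (p:ℝ) ^ 3 ≤ ‖∑' k, fS A n (p ^ k)‖ := by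
  have hp : p.Prime := Fact.out
  have hs : Summable (fun k => fS A n (p ^ k)) := by
    have := (fS_summable hA hdet n hn).comp_injective (Nat.pow_right_injective hp.two_le)
    exact this.of_norm
  have ht := (hs.hasSum.tendsto_sum_nat.comp (Filter.tendsto_add_atTop_nat 2)).norm
  refine ge_of_tendsto' ht ?_
  intro k
  simp only [Function.comp]
  haveI : NeZero (p ^ (k+1)) := ⟨pow_ne_zero _ hp.ne_zero⟩
  have h1 := local_sum A n p (k+1) (p ^ (k+1)) rfl
  rw [← h1, norm_div, norm_pow, Complex.norm_natCast, Complex.norm_natCast]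
  have h2 := sols_ge hA n p (p ^ (k+1)) k rfl
  have hp0 : (0:ℝ) < p := by exact_mod_cast hp.pos
  have hpk : (0:ℝ) < ((p ^ (k+1) : ℕ) : ℝ) ^ 3 := by push_cast; positivity
  rw [div_le_div_iff₀ (by positivity) hpk]
  have h3 : ((smooth A n p).card : ℝ) * (p:ℝ) ^ (3 * k) ≤ (sols A n (p ^ (k+1))).card := by exact_mod_cast h2
  calc _ = (((smooth A n p).card : ℝ) * (p:ℝ) ^ (3 * k)) * (p:ℝ) ^ 3 := by push_cast; ring
    _ ≤ _ := by gcongr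

lemma beta_bad {A : Matrix (Fin 4) (Fin 4) ℤ} (hA : IsGram A) (hdet : A.det ≠ 0) (n p : ℕ) (hn : 0 < n) (hp : p.Prime)
    (hs : StrongLocalSolubility A n) :
    (1/27 : ℝ) ≤ ‖∑' k, fS A n (p ^ k)‖ := by
  haveI : Fact p.Prime := ⟨hp⟩
  haveI : NeZero p := ⟨hp.ne_zero⟩
  refine le_trans ?_ (beta_ge hA hdet n p hn)
  obtain ⟨x0, hx0⟩ := smooth_nonempty hs p
  have hp0 : (0:ℝ) < p := by exact_mod_cast hp.pos
  rw [div_le_div_iff₀ (by norm_num) (by positivity)]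
  by_cases h5 : 5 ≤ p
  · have h1 := smooth_count hA n p h5 x0 hx0
    obtain ⟨r, rfl⟩ := Nat.exists_eq_add_of_le h5
    have h2 : (5 + r) * (4 + r) * (2 + r) ≤ (smooth A n (5 + r)).card := by
      have e1 : 5 + r - 1 = 4 + r := by omega
      have e2 : 5 + r - 3 = 2 + r := by omega
      rw [e1, e2] at h1; exact h1
    have h3 : ((5 + r) * (4 + r) * (2 + r) : ℝ) ≤ (smooth A n (5 + r)).card := by exact_mod_cast h2
    push_cast
    have hr : (0:ℝ) ≤ r := by positivity
    nlinarith [mul_nonneg hr hr, mul_nonneg hr (mul_nonneg hr hr)]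
  · have h1 : (1:ℝ) ≤ (smooth A n p).card := by
      exact_mod_cast Finset.card_pos.2 ⟨x0, hx0⟩
    have h3 : p ≤ 3 := by
      by_contra h
      have : p = 4 := by omega
      rw [this] at hp; revert hp; decide
    have h4 : (p:ℝ) ≤ 3 := by exact_mod_cast h3
    have : (p:ℝ) ^ 3 ≤ 3 ^ 3 := by gcongr
    linarith

lemma kap_unit {A : Matrix (Fin 4) (Fin 4) ℤ} (q : ℕ) [NeZero q] (h : IsUnit ((A.det : ℤ) : ZMod q)) : kap A (ZMod q) = 1 := by
  classical
  unfold kap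
  rw [Finset.card_eq_one]
  refine ⟨0, ?_⟩
  ext x
  rw [mem_Ker, Finset.mem_singleton]
  constructor
  · intro hx
    have hdet : (A.map (Int.cast : ℤ → ZMod q)).det = ((A.det : ℤ) : ZMod q) := by
      have := (RingHom.map_det (Int.castRingHom (ZMod q)) A)
      simpa using this.symm
    have hu : IsUnit (A.map (Int.cast : ℤ → ZMod q)) := by
      rw [Matrix.isUnit_iff_isUnit_det, hdet]; exact h
    exact (Matrix.mulVec_injective_of_isUnit hu) (by rw [Matrix.mulVec_zero]; exact hx)
  · rintro rfl; simp [mulv]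

lemma beta_good {A : Matrix (Fin 4) (Fin 4) ℤ} (hA : IsGram A) (hdet : A.det ≠ 0) (n p : ℕ) (hn : 0 < n) (hp : p.Prime)
    (hpm : ¬ p ∣ 2 * A.det.natAbs * n) :
    1 - 6 * (p:ℝ) ^ (-(1 + 1/2) : ℝ) ≤ ‖∑' k, fS A n (p ^ k)‖ := by
  have hs : Summable (fun k => ‖fS A n (p ^ k)‖) := (fS_summable hA hdet n hn).comp_injective (Nat.pow_right_injective hp.two_le)
  set m := 2 * A.det.natAbs * n
  obtain ⟨hb1, hb2⟩ := bb_summable m hp (1/2) (by norm_num)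
  rw [if_neg hpm] at hb2
  have hf : ∀ k, ‖fS A n (p ^ k)‖ ≤ bb m p k * ((p:ℝ) ^ k) ^ (-(7/2 + 1/2) : ℝ) := by
    intro k
    haveI : NeZero (p ^ k) := ⟨pow_ne_zero _ hp.ne_zero⟩
    refine (fS_bound hA n (p ^ k)).trans ?_
    rw [kap_unit, Bf_prime_pow _ hp]
    · push_cast; norm_num
      exact le_rfl
    · have h1 : IsUnit ((A.det.natAbs : ℕ) : ZMod (p ^ k)) := by
        rw [ZMod.isUnit_iff_coprime]
        apply Nat.Coprime.pow_right
        rw [Nat.coprime_comm, hp.coprime_iff_not_dvd]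
        intro h; apply hpm; exact Dvd.dvd.mul_right (Dvd.dvd.mul_left h 2) n
      rcases Int.natAbs_eq A.det with h | h
      · rw [h]; simpa using h1
      · rw [h]; simpa using h1
  rw [hs.of_norm.tsum_eq_zero_add, pow_zero, fS_one]
  have hs' := (summable_nat_add_iff 1).2 hs
  have hb' := (summable_nat_add_iff 1).2 hb1
  have h1 : ‖∑' k, fS A n (p ^ (k+1))‖ ≤ 6 * (p:ℝ) ^ (-(1 + 1/2) : ℝ) := by
    refine (norm_tsum_le_tsum_norm hs').trans ?_
    refine (hs'.tsum_le_tsum (fun k => hf (k+1)) hb').trans ?_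
    rw [hb1.tsum_eq_zero_add] at hb2
    have h0 : bb m p 0 * ((p:ℝ) ^ 0) ^ (-(7/2 + 1/2) : ℝ) = 1 := by simp [bb]
    rw [h0] at hb2
    linarith
  have h2 : ‖(1:ℂ)‖ - ‖-∑' k, fS A n (p ^ (k+1))‖ ≤ ‖1 - -∑' k, fS A n (p ^ (k+1))‖ := norm_sub_norm_le _ _
  rw [norm_neg, norm_one, sub_neg_eq_add] at h2
  linarith

lemma sing_series : ∃ c : ℝ, 0 < c ∧ ∀ (A : Matrix (Fin 4) (Fin 4) ℤ) (n : ℕ), IsGram A → A.det ≠ 0 → 0 < n → StrongLocalSolubility A n →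
    c * (1/27 : ℝ) ^ (3 * (2 * A.det.natAbs * n)).primeFactors.card ≤ ‖∑' q, fS A n q‖ := by
  have hs : Summable (fun n : ℕ => 12 * (n:ℝ) ^ (-(1 + 1/2) : ℝ)) := by
    apply Summable.mul_left
    rw [Real.summable_nat_rpow]; norm_num
  refine ⟨Real.exp (-∑' n : ℕ, 12 * (n:ℝ) ^ (-(1 + 1/2) : ℝ)), Real.exp_pos _, ?_⟩
  intro A n hA hdet hn hsol
  set m := 3 * (2 * A.det.natAbs * n)
  have hm : m ≠ 0 := by
    have := Int.natAbs_pos.2 hdet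
    simp only [m]; positivity
  have hE := (EulerProduct.eulerProduct (fS_one A n) (fun h => fS_mul A n h) (fS_summable hA hdet n hn) (fS_zero A n)).norm
  refine ge_of_tendsto' hE ?_
  intro M
  rw [norm_prod]
  have h1 : ∀ p ∈ M.primesBelow, (if p ∣ m then (1/27 : ℝ) else 1) * Real.exp (-(12 * (p:ℝ) ^ (-(1 + 1/2) : ℝ))) ≤ ‖∑' k, fS A n (p ^ k)‖ := by
    intro p hp
    have hpp := Nat.prime_of_mem_primesBelow hp
    split_ifs with h
    · refine le_trans ?_ (beta_bad hA hdet n p hn hpp hsol)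
      have : Real.exp (-(12 * (p:ℝ) ^ (-(1 + 1/2) : ℝ))) ≤ 1 := by
        rw [Real.exp_le_one_iff]
        have : 0 ≤ (p:ℝ) ^ (-(1 + 1/2) : ℝ) := by positivity
        linarith
      linarith
    · rw [one_mul]
      have hp5 : 5 ≤ p := by
        by_contra h5
        have h2 := hpp.two_le
        have : p = 2 ∨ p = 3 ∨ p = 4 := by omega
        rcases this with rfl | rfl | rfl
        · apply h; simp only [m]; exact ⟨3 * (A.det.natAbs * n), by ring⟩
        · apply h; simp only [m]; exact Dvd.intro _ rfl
        · revert hpp; decide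
      refine le_trans ?_ (beta_good hA hdet n p hn hpp (fun h2 => h (Dvd.dvd.mul_left h2 3)))
      have hp5' : (5:ℝ) ≤ p := by exact_mod_cast hp5
      set t := 6 * (p:ℝ) ^ (-(1 + 1/2) : ℝ) with ht
      have ht0 : 0 ≤ t := by positivity
      have ht1 : t ≤ 0.6 := by
        have h3 : (p:ℝ) ^ (-(1 + 1/2) : ℝ) = ((p:ℝ) * Real.sqrt p)⁻¹ := by
          rw [Real.rpow_neg (by positivity), Real.rpow_add (by positivity), Real.rpow_one, Real.sqrt_eq_rpow]
        have h4 : (2:ℝ) ≤ Real.sqrt p := Real.le_sqrt_of_sq_le (by linarith)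
        rw [ht, h3]
        have : ((p:ℝ) * Real.sqrt p)⁻¹ ≤ (5 * 2 : ℝ)⁻¹ := by gcongr
        linarith
      have h5 : 12 * (p:ℝ) ^ (-(1 + 1/2) : ℝ) = 2 * t := by rw [ht]; ring
      rw [h5, Real.exp_neg]
      have h6 := Real.quadratic_le_exp_of_nonneg (show 0 ≤ 2 * t by linarith)
      rw [inv_le_comm₀ (Real.exp_pos _) (by linarith)]
      refine le_trans ?_ h6
      rw [inv_le_iff_one_le_mul₀ (by linarith)]
      nlinarith [mul_nonneg ht0 ht0, mul_nonneg ht0 (mul_nonneg ht0 ht0), mul_nonneg ht0 (sub_nonneg.2 ht1), mul_nonneg (mul_nonneg ht0 ht0) (sub_nonneg.2 ht1)]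
  refine le_trans ?_ (Finset.prod_le_prod (fun p _ => by positivity) h1)
  rw [Finset.prod_mul_distrib, ← Real.exp_sum, mul_comm]
  gcongr
  · rw [← Finset.prod_filter, Finset.prod_const]
    apply pow_le_pow_of_le_one (by norm_num) (by norm_num)
    apply Finset.card_le_card
    intro p hp
    rw [Finset.mem_filter] at hp
    exact Nat.mem_primeFactors.2 ⟨Nat.prime_of_mem_primesBelow hp.1, hp.2, hm⟩
  · rw [Finset.sum_neg_distrib, neg_le_neg_iff]
    exact hs.sum_le_tsum _ (fun _ _ => by positivity)

end QF

namespace QF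
open MeasureTheory

/-- sum over a finite set of lattice points of a product is at most the product of sums -/
lemma pi_sum_le (f : Fin 4 → ℤ → ℝ) (hf : ∀ i j, 0 ≤ f i j) (hs : ∀ i, Summable (f i)) (s : Finset (Fin 4 → ℤ)) :
    ∑ x ∈ s, ∏ i, f i (x i) ≤ ∏ i, ∑' j, f i j := by
  classical
  have h1 : s ⊆ Fintype.piFinset (fun i => s.image (fun x => x i)) := by
    intro x hx
    rw [Fintype.mem_piFinset]
    intro i
    exact Finset.mem_image_of_mem _ hx
  calc _ ≤ ∑ x ∈ Fintype.piFinset (fun i => s.image (fun x => x i)), ∏ i, f i (x i) :=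
        Finset.sum_le_sum_of_subset_of_nonneg h1 (fun x _ _ => Finset.prod_nonneg (fun i _ => hf i _))
    _ = ∏ i, ∑ j ∈ s.image (fun x => x i), f i j := (Finset.prod_univ_sum _ _).symm
    _ ≤ _ := Finset.prod_le_prod (fun i _ => Finset.sum_nonneg (fun j _ => hf i j))
        (fun i _ => (hs i).sum_le_tsum _ (fun j _ => hf i j))

lemma pi_summable (f : Fin 4 → ℤ → ℝ) (hf : ∀ i j, 0 ≤ f i j) (hs : ∀ i, Summable (f i)) :
    Summable (fun x : Fin 4 → ℤ => ∏ i, f i (x i)) :=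
  summable_of_sum_le (fun x => Finset.prod_nonneg (fun i _ => hf i _)) (fun s => pi_sum_le f hf hs s)

lemma exp_sq_summable (a : ℝ) (ha : 0 < a) : Summable (fun j : ℤ => Real.exp (-a * (j:ℝ) ^ 2)) := by
  have h := summable_int_iff_summable_nat_and_neg (f := fun j : ℤ => Real.exp (-a * (j:ℝ) ^ 2))
  rw [h]
  have : Summable (fun j : ℕ => Real.exp (-a * (j:ℝ) ^ 2)) := by
    have h2 : Summable (fun j : ℕ => (Real.exp (-a)) ^ j) :=
      summable_geometric_of_lt_one (Real.exp_pos _).le (by rw [Real.exp_lt_one_iff]; linarith)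
    refine Summable.of_nonneg_of_le (fun j => (Real.exp_pos _).le) (fun j => ?_) h2
    rw [← Real.exp_nat_mul]
    apply Real.exp_le_exp.2
    have : (j:ℝ) ≤ (j:ℝ) ^ 2 := by exact_mod_cast Nat.le_self_pow (by norm_num) j
    nlinarith
  constructor <;> simpa using this

/-- squared euclidean norm -/
def nsq (w : Fin 4 → ℝ) : ℝ := ∑ i, w i ^ 2

lemma nsq_nonneg (w : Fin 4 → ℝ) : 0 ≤ nsq w := Finset.sum_nonneg (fun i _ => sq_nonneg _)

lemma nsq_summable (a : ℝ) (ha : 0 < a) : Summable (fun x : Fin 4 → ℤ => Real.exp (-a * nsq (fun i => (x i : ℝ)))) := by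
  refine (pi_summable (fun _ j => Real.exp (-a * (j:ℝ) ^ 2)) (fun _ _ => (Real.exp_pos _).le) (fun _ => exp_sq_summable a ha)).congr ?_
  intro x
  rw [← Real.exp_sum, nsq, Finset.mul_sum]

lemma nsq_add_ge (x v : Fin 4 → ℝ) : nsq x / 2 - nsq v ≤ nsq (x + v) := by
  simp only [nsq, Fin.sum_univ_four, Pi.add_apply]
  nlinarith [sq_nonneg (x 0 + 2 * v 0), sq_nonneg (x 1 + 2 * v 1), sq_nonneg (x 2 + 2 * v 2), sq_nonneg (x 3 + 2 * v 3)]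

lemma nsq_mulVec_le (P : Matrix (Fin 4) (Fin 4) ℝ) : ∃ K : ℝ, 0 < K ∧ ∀ w, nsq (P.mulVec w) ≤ K * nsq w := by
  refine ⟨∑ i, ∑ j, P i j ^ 2 + 1, by positivity, fun w => ?_⟩
  have h1 : ∀ i, (P.mulVec w i) ^ 2 ≤ (∑ j, P i j ^ 2) * nsq w := by
    intro i
    have := Finset.sum_mul_sq_le_sq_mul_sq Finset.univ (fun j => P i j) w
    simpa [Matrix.mulVec, dotProduct, nsq] using this
  calc nsq (P.mulVec w) ≤ ∑ i, (∑ j, P i j ^ 2) * nsq w := Finset.sum_le_sum (fun i _ => h1 i)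
    _ = (∑ i, ∑ j, P i j ^ 2) * nsq w := by rw [Finset.sum_mul]
    _ ≤ _ := by nlinarith [nsq_nonneg w]

lemma nsq_mulVec_ge (P : Matrix (Fin 4) (Fin 4) ℝ) (hP : P.det ≠ 0) : ∃ K : ℝ, 0 < K ∧ ∀ w, K * nsq w ≤ nsq (P.mulVec w) := by
  obtain ⟨K, hK, h⟩ := nsq_mulVec_le P⁻¹
  refine ⟨1 / K, by positivity, fun w => ?_⟩
  have h1 := h (P.mulVec w)
  rw [Matrix.mulVec_mulVec, Matrix.nonsing_inv_mul _ (isUnit_iff_ne_zero.2 hP), Matrix.one_mulVec] at h1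
  rw [div_mul_eq_mul_div, one_mul, div_le_iff₀ hK]; linarith

abbrev ic (x : Fin 4 → ℤ) : Fin 4 → ℝ := fun i => (x i : ℝ)

lemma gauss_summable (P : Matrix (Fin 4) (Fin 4) ℝ) (hP : P.det ≠ 0) (a : ℝ) (ha : 0 < a) (v : Fin 4 → ℝ) :
    Summable (fun x : Fin 4 → ℤ => Real.exp (-a * nsq (P.mulVec (ic x + v)))) := by
  obtain ⟨K, hK, h⟩ := nsq_mulVec_ge P hP
  refine Summable.of_nonneg_of_le (fun _ => (Real.exp_pos _).le) (fun x => ?_) ((nsq_summable (a * K / 2) (by positivity)).mul_left (Real.exp (a * K * nsq v)))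
  rw [← Real.exp_add]
  apply Real.exp_le_exp.2
  have h1 := h (ic x + v)
  have h2 := nsq_add_ge (ic x) v
  have h3 : a * (K * (nsq (ic x) / 2 - nsq v)) ≤ a * nsq (P.mulVec (ic x + v)) := by
    apply mul_le_mul_of_nonneg_left _ ha.le
    exact (mul_le_mul_of_nonneg_left h2 hK.le).trans h1
  have h4 : nsq (ic x) = nsq (fun i => (x i : ℝ)) := rfl
  rw [h4] at h3
  nlinarith

/-- unit cubes -/
def cube (k : Fin 4 → ℤ) : Set (Fin 4 → ℝ) := {x | ∀ i, x i ∈ Set.Ioc ((k i : ℝ)) ((k i : ℝ) + 1)}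

lemma cube_meas (k) : MeasurableSet (cube k) := by
  have : cube k = Set.univ.pi (fun i => Set.Ioc ((k i : ℝ)) ((k i : ℝ) + 1)) := by ext; simp [cube]
  rw [this]
  exact MeasurableSet.univ_pi (fun i => measurableSet_Ioc)

lemma cube_disj : Pairwise (Function.onFun Disjoint cube) := by
  intro k l hkl
  rw [Function.onFun, Set.disjoint_left]
  intro x hk hl
  apply hkl
  funext i
  have h1 := hk i
  have h2 := hl i
  have h3 : (k i : ℝ) < l i + 1 := lt_of_lt_of_le h1.1 h2.2
  have h4 : (l i : ℝ) < k i + 1 := lt_of_lt_of_le h2.1 h1.2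
  have h5 : k i < l i + 1 := by exact_mod_cast h3
  have h6 : l i < k i + 1 := by exact_mod_cast h4
  omega

lemma cube_union : ⋃ k, cube k = Set.univ := by
  rw [Set.eq_univ_iff_forall]
  intro x
  rw [Set.mem_iUnion]
  refine ⟨fun i => ⌈x i⌉ - 1, fun i => ?_⟩
  push_cast
  constructor
  · linarith [Int.ceil_lt_add_one (x i)]
  · linarith [Int.le_ceil (x i)]

lemma cube_integral {E : Type*} [NormedAddCommGroup E] [NormedSpace ℝ E] (h : (Fin 4 → ℝ) → E) (k : Fin 4 → ℤ) :
    ∫ x in cube k, h x = ∫ x in cube 0, h (x + ic k) := by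
  have h1 := MeasurePreserving.setIntegral_preimage_emb (measurePreserving_add_right (volume : Measure (Fin 4 → ℝ)) (ic k)) (measurableEmbedding_addRight _) h (cube k)
  rw [← h1]
  congr 2
  ext x
  simp only [cube, Set.mem_preimage, Set.mem_setOf_eq, Pi.add_apply, Pi.zero_apply, Set.mem_Ioc, Int.cast_zero]
  refine forall_congr' (fun i => ?_)
  constructor
  · rintro ⟨a, b⟩; constructor <;> linarith
  · rintro ⟨a, b⟩; constructor <;> linarith

lemma mF_apply (n : Fin 4 → ℤ) (x : Fin 4 → ℝ) :
    UnitAddTorus.mFourier n (fun i => (x i : UnitAddCircle)) = Complex.exp (2 * Real.pi * Complex.I * ∑ i, (n i : ℂ) * x i) := by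
  simp only [UnitAddTorus.mFourier, ContinuousMap.coe_mk]
  rw [Finset.mul_sum, Complex.exp_sum]
  apply Finset.prod_congr rfl
  intro i _
  rw [fourier_coe_apply]
  congr 1; push_cast; ring

lemma mF_shift (n k : Fin 4 → ℤ) (x : Fin 4 → ℝ) :
    UnitAddTorus.mFourier n (fun i => ((x + ic k) i : UnitAddCircle)) = UnitAddTorus.mFourier n (fun i => (x i : UnitAddCircle)) := by
  congr 1
  funext i
  simp only [Pi.add_apply, ic]
  have := AddCircle.coe_add_period (1:ℝ) (x i)
  rw [AddCircle.coe_add]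
  have : ((k i : ℝ) : UnitAddCircle) = 0 := by
    rw [AddCircle.coe_eq_zero_iff]; exact ⟨k i, by simp⟩
  rw [this, add_zero]

/-- Poisson summation in dimension 4 -/
lemma poisson_gen (h : (Fin 4 → ℝ) → ℂ) (hIntg : Integrable h)
    (hcont : Continuous h) (F : C((Fin 4 → ℝ), ℂ)) (hF : ∀ v, HasSum (fun k : Fin 4 → ℤ => h (v + ic k)) (F v))
    (a : (Fin 4 → ℤ) → ℂ)
    (ha : ∀ c : Fin 4 → ℤ, ∫ x, Complex.exp (2 * Real.pi * Complex.I * ∑ i, ((-c) i : ℂ) * x i) * h x = a c) (hsum : Summable a) (v : Fin 4 → ℝ) :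
    HasSum (fun c : Fin 4 → ℤ => a c * Complex.exp (2 * Real.pi * Complex.I * ∑ i, (c i : ℂ) * v i)) (F v) := by
  let π : C((Fin 4 → ℝ), UnitAddTorus (Fin 4)) := ⟨fun x i => (x i : UnitAddCircle), by
    apply continuous_pi; intro i; exact (AddCircle.continuous_mk' 1).comp (continuous_apply i)⟩
  have hq : Topology.IsQuotientMap π := by
    have : IsOpenQuotientMap (Pi.map (fun (i : Fin 4) (x : ℝ) => (x : UnitAddCircle))) :=
      IsOpenQuotientMap.piMap (fun i => QuotientAddGroup.isOpenQuotientMap_mk)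
    exact this.isQuotientMap
  have hper : ∀ v k, F (v + ic k) = F v := by
    intro v k
    have h1 := hF (v + ic k)
    have h2 := hF v
    have h3 := (Equiv.addLeft k).hasSum_iff.2 h2
    refine h1.unique ?_
    convert h3 using 2 with l
    simp only [Function.comp, Equiv.coe_addLeft]
    congr 1
    funext i; simp [ic]; ring
  have hfac : Function.FactorsThrough F π := by
    intro x y hxy
    have : ∀ i, ∃ k : ℤ, x i = y i + k := by
      intro i
      have h1 := congrFun hxy i
      simp only [π, ContinuousMap.coe_mk] at h1
      have h2 : ((x i - y i : ℝ) : UnitAddCircle) = 0 := by rw [AddCircle.coe_sub]; exact sub_eq_zero.2 h1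
      obtain ⟨k, hk⟩ := (AddCircle.coe_eq_zero_iff _).1 h2
      refine ⟨k, ?_⟩
      simp at hk; linarith
    choose k hk using this
    have : x = y + ic k := by funext i; simp [ic, hk i]
    rw [this, hper]
  let f := hq.lift F hfac
  have hf : ∀ x : Fin 4 → ℝ, f (fun i => (x i : UnitAddCircle)) = F x := by
    intro x
    have := hq.lift_comp F hfac
    exact congrArg (fun g => g x) this
  have hcoef : UnitAddTorus.mFourierCoeff f = a := by
    funext c
    rw [UnitAddTorus.mFourierCoeff_eq_integral f c 0]
    have hc0 : {x : Fin 4 → ℝ | ∀ i, x i ∈ Set.Ioc ((0 : Fin 4 → ℝ) i) ((0 : Fin 4 → ℝ) i + 1)} = cube 0 := by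
      ext; simp [cube]
    rw [hc0]
    simp_rw [hf, smul_eq_mul]
    let g : (Fin 4 → ℝ) → ℂ := fun x => UnitAddTorus.mFourier (-c) (fun i => (x i : UnitAddCircle)) * h x
    have hgint : Integrable g := by
      refine hIntg.bdd_mul (c := 1) ?_ (Filter.Eventually.of_forall fun x => ?_)
      · exact ((UnitAddTorus.mFourier (-c)).continuous.comp π.continuous).aestronglyMeasurable
      · exact (ContinuousMap.norm_coe_le_norm (UnitAddTorus.mFourier (-c)) _).trans (le_of_eq UnitAddTorus.mFourier_norm)
    have hga : ∫ x, g x = a c := by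
      rw [← ha c]
      congr 1; funext x
      simp only [g, mF_apply]
    have h1 := hasSum_integral_iUnion (f := g) (μ := volume) cube_meas cube_disj (by rw [cube_union]; exact hgint.integrableOn)
    have h2 := (hasSum_integral_iUnion (f := fun x => ‖g x‖) (μ := volume) cube_meas cube_disj (by rw [cube_union]; exact hgint.norm.integrableOn)).summable
    rw [cube_union, setIntegral_univ, hga] at h1
    have e1 : ∀ (k : Fin 4 → ℤ) x, g (x + ic k) = UnitAddTorus.mFourier (-c) (fun i => (x i : UnitAddCircle)) * h (x + ic k) := by
      intro k x
      simp only [g]; rw [mF_shift]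
    have h3 := hasSum_integral_of_summable_integral_norm (μ := volume.restrict (cube 0)) (F := fun (k : Fin 4 → ℤ) x => g (x + ic k))
      (fun k => (hgint.comp_add_right (ic k)).integrableOn) (by
        refine h2.congr ?_
        intro k
        rw [cube_integral]) 
    have h4 : (fun k => ∫ x in cube k, g x) = fun k => ∫ x in cube 0, g (x + ic k) := by
      funext k; rw [cube_integral]
    rw [h4] at h1
    rw [h1.unique h3]
    congr 1; funext x
    simp_rw [e1]
    rw [tsum_mul_left, (hF x).tsum_eq]
  have := UnitAddTorus.hasSum_mFourier_series_apply_of_summable (f := f) (by rw [hcoef]; exact hsum) (fun i => (v i : UnitAddCircle))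
  rw [hf, hcoef] at this
  convert this using 2 with c
  rw [mF_apply, smul_eq_mul]

end QF

namespace QF
open MeasureTheory

lemma nsq_continuous (P : Matrix (Fin 4) (Fin 4) ℝ) : Continuous (fun x => nsq (P.mulVec x)) := by
  unfold nsq Matrix.mulVec dotProduct
  fun_prop

lemma norm_gauss (τ : ℂ) (s : ℝ) : ‖Complex.exp (-(Real.pi * τ * s))‖ = Real.exp (-(Real.pi * τ.re) * s) := by
  rw [Complex.norm_exp]
  congr 1
  simp [Complex.mul_re]

/-- integral of shifted gaussians -/
lemma gauss_integral (P : Matrix (Fin 4) (Fin 4) ℝ) (hP : P.det ≠ 0) (τ : ℂ) (hτ : 0 < τ.re) (d : Fin 4 → ℝ) :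
    Integrable (fun x : Fin 4 → ℝ => Complex.exp (-(Real.pi * τ * nsq (P.mulVec x)))) ∧
    ∫ x : Fin 4 → ℝ, Complex.exp (2 * Real.pi * Complex.I * ∑ i, (d i : ℂ) * x i) * Complex.exp (-(Real.pi * τ * nsq (P.mulVec x)))
      = (|P.det|⁻¹ : ℝ) * (τ⁻¹) ^ 2 * Complex.exp (-(Real.pi * τ⁻¹ * nsq ((P⁻¹).transpose.mulVec d))) := by
  have hu : IsUnit P.det := isUnit_iff_ne_zero.2 hP
  have hπ := Real.pi_pos
  have hb : 0 < ((Real.pi : ℂ) * τ).re := by simp [Complex.mul_re]; positivity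
  have hτ0 : τ ≠ 0 := by intro h; rw [h] at hτ; simp at hτ
  let e : (Fin 4 → ℝ) ≃L[ℝ] (Fin 4 → ℝ) :=
    (Matrix.toLinearEquiv' P (Matrix.invertibleOfIsUnitDet P hu)).toContinuousLinearEquiv
  have he : ∀ x, e x = P.mulVec x := fun x => rfl
  have hmap : Measure.map e volume = ENNReal.ofReal |P.det⁻¹| • (volume : Measure (Fin 4 → ℝ)) :=
    Real.map_matrix_volume_pi_eq_smul_volume_pi hP
  set d' := (P⁻¹).transpose.mulVec d with hd'
  have hdd : ∀ x : Fin 4 → ℝ, ∑ i, d i * x i = ∑ i, d' i * (P.mulVec x) i := by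
    intro x
    have : dotProduct d' (P.mulVec x) = dotProduct d x := by
      rw [hd', Matrix.mulVec_transpose, ← Matrix.dotProduct_mulVec, Matrix.mulVec_mulVec, Matrix.nonsing_inv_mul _ hu, Matrix.one_mulVec]
    exact this.symm
  have hint0 : ∀ d : Fin 4 → ℝ, Integrable (fun w : Fin 4 → ℝ => Complex.exp (-(Real.pi * τ) * ∑ i, (w i : ℂ) ^ 2 + ∑ i, (2 * Real.pi * Complex.I * d i) * w i)) :=
    fun d => GaussianFourier.integrable_cexp_neg_mul_sum_add hb (fun i => 2 * Real.pi * Complex.I * d i)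
  constructor
  · have h1 : Integrable (fun w : Fin 4 → ℝ => Complex.exp (-(Real.pi * τ) * ∑ i, (w i : ℂ) ^ 2 + ∑ i, (2 * Real.pi * Complex.I * (0 : ℝ)) * w i)) (Measure.map e.toHomeomorph volume) := by
      have h3 : Measure.map (e.toHomeomorph) volume = ENNReal.ofReal |P.det⁻¹| • (volume : Measure (Fin 4 → ℝ)) := hmap
      rw [h3]
      exact (hint0 (fun _ => 0)).smul_measure (by simp)
    rw [e.toHomeomorph.measurableEmbedding.integrable_map_iff] at h1
    refine h1.congr (Filter.Eventually.of_forall fun x => ?_)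
    simp only [Function.comp, nsq]
    congr 1
    have : (e.toHomeomorph x) = P.mulVec x := rfl
    rw [this]; push_cast; simp
  · have h2 := e.toHomeomorph.measurableEmbedding.integral_map (μ := volume) (fun w : Fin 4 → ℝ => Complex.exp (-(Real.pi * τ) * ∑ i, (w i : ℂ) ^ 2 + ∑ i, (2 * Real.pi * Complex.I * d' i) * w i))
    have h3 : Measure.map (e.toHomeomorph) volume = ENNReal.ofReal |P.det⁻¹| • (volume : Measure (Fin 4 → ℝ)) := hmap
    rw [h3, integral_smul_measure, GaussianFourier.integral_cexp_neg_mul_sum_add hb] at h2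
    have h4 : ∀ x, (e.toHomeomorph x) = P.mulVec x := fun x => rfl
    simp_rw [h4] at h2
    have h5 : ∫ x : Fin 4 → ℝ, Complex.exp (2 * Real.pi * Complex.I * ∑ i, (d i : ℂ) * x i) * Complex.exp (-(Real.pi * τ * nsq (P.mulVec x)))
       = ∫ x : Fin 4 → ℝ, Complex.exp (-(Real.pi * τ) * ∑ i, ((P.mulVec x i : ℝ) : ℂ) ^ 2 + ∑ i, (2 * Real.pi * Complex.I * d' i) * (P.mulVec x i : ℝ)) := by
      congr 1; funext x
      rw [← Complex.exp_add]
      congr 1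
      have := congrArg (fun r : ℝ => (r : ℂ)) (hdd x)
      push_cast at this
      rw [this]
      simp only [nsq]
      push_cast
      rw [Finset.mul_sum]
      simp only [mul_assoc]
      ring
    rw [h5, ← h2]
    rw [ENNReal.toReal_ofReal (abs_nonneg _), abs_inv]
    have h6 : ((Real.pi : ℂ) / (Real.pi * τ)) = τ⁻¹ := by
      have : (Real.pi : ℂ) ≠ 0 := by exact_mod_cast hπ.ne'
      field_simp
    rw [h6]
    have h7 : ((Fintype.card (Fin 4) : ℂ) / 2) = ((2 : ℕ) : ℂ) := by simp; norm_num
    rw [h7, Complex.cpow_natCast, Complex.real_smul, ← mul_assoc]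
    congr 2
    simp only [nsq]
    push_cast
    rw [Finset.mul_sum, Finset.sum_div, ← Finset.sum_neg_distrib]
    apply Finset.sum_congr rfl
    intro i _
    have : (Real.pi : ℂ) ≠ 0 := by exact_mod_cast hπ.ne'
    have hI := Complex.I_sq
    field_simp
    linear_combination (4 * (d' i : ℂ) ^ 2) * hI

lemma poisson (P : Matrix (Fin 4) (Fin 4) ℝ) (hP : P.det ≠ 0) (τ : ℂ) (hτ : 0 < τ.re) (v : Fin 4 → ℝ) :
    HasSum (fun c : Fin 4 → ℤ => ((|P.det|⁻¹ : ℝ) * (τ⁻¹) ^ 2 * Complex.exp (-(Real.pi * τ⁻¹ * nsq ((P⁻¹).transpose.mulVec (ic c))))) *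
        Complex.exp (2 * Real.pi * Complex.I * ∑ i, (c i : ℂ) * v i))
      (∑' x : Fin 4 → ℤ, Complex.exp (-(Real.pi * τ * nsq (P.mulVec (v + ic x))))) := by
  have hπ := Real.pi_pos
  have hτ0 : τ ≠ 0 := by intro h; rw [h] at hτ; simp at hτ
  have hcs := nsq_continuous P
  have hsumm : ∀ v, Summable (fun x : Fin 4 → ℤ => Complex.exp (-(Real.pi * τ * nsq (P.mulVec (v + ic x))))) := by
    intro v
    apply Summable.of_norm
    simp_rw [norm_gauss, add_comm v]
    exact gauss_summable P hP _ (by positivity) v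
  have hcont : Continuous (fun v : Fin 4 → ℝ => ∑' x : Fin 4 → ℤ, Complex.exp (-(Real.pi * τ * nsq (P.mulVec (v + ic x))))) := by
    obtain ⟨K, hK, h⟩ := nsq_mulVec_ge P hP
    rw [continuous_iff_continuousAt]
    intro v0
    have hopen : IsOpen {v : Fin 4 → ℝ | nsq v < nsq v0 + 1} := by
      apply isOpen_lt _ continuous_const
      unfold nsq; fun_prop
    refine ContinuousOn.continuousAt (s := {v : Fin 4 → ℝ | nsq v < nsq v0 + 1}) ?_ (hopen.mem_nhds (show nsq v0 < nsq v0 + 1 by linarith))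
    refine continuousOn_tsum (u := fun x => Real.exp (Real.pi * τ.re * K * (nsq v0 + 1)) * Real.exp (-(Real.pi * τ.re * K / 2) * nsq (fun i => (x i : ℝ)))) ?_ ?_ ?_
    · intro x
      refine Continuous.continuousOn ?_
      have : Continuous (fun v : Fin 4 → ℝ => nsq (P.mulVec (v + ic x))) := hcs.comp (continuous_id.add continuous_const)
      fun_prop
    · exact (nsq_summable (Real.pi * τ.re * K / 2) (by positivity)).mul_left (Real.exp (Real.pi * τ.re * K * (nsq v0 + 1)))
    · intro x v hv
      rw [norm_gauss, ← Real.exp_add]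
      apply Real.exp_le_exp.2
      have h1 := h (ic x + v)
      have h2 := nsq_add_ge (ic x) v
      have hv' : nsq v < nsq v0 + 1 := hv
      rw [add_comm v]
      have h3 : K * (nsq (ic x) / 2 - (nsq v0 + 1)) ≤ nsq (P.mulVec (ic x + v)) :=
        (mul_le_mul_of_nonneg_left (by linarith) hK.le).trans h1
      have h4 := mul_le_mul_of_nonneg_left h3 (mul_pos hπ hτ).le
      have h5 : nsq (ic x) = nsq (fun i => (x i : ℝ)) := rfl
      rw [h5] at h4
      nlinarith
  have hPt : ((P⁻¹).transpose).det ≠ 0 := by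
    rw [Matrix.det_transpose, Matrix.det_nonsing_inv]
    simpa using hP
  have hre : 0 < (τ⁻¹).re := by
    rw [Complex.inv_re]
    exact div_pos hτ (Complex.normSq_pos.2 hτ0)
  refine poisson_gen (fun x => Complex.exp (-(Real.pi * τ * nsq (P.mulVec x)))) (gauss_integral P hP τ hτ 0).1 (by fun_prop) ⟨_, hcont⟩ (fun v => (hsumm v).hasSum) _ ?_ ?_ v
  · intro c
    have h1 := (gauss_integral P hP τ hτ (ic (-c))).2
    have h2 : nsq ((P⁻¹).transpose.mulVec (ic (-c))) = nsq ((P⁻¹).transpose.mulVec (ic c)) := by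
      have : ic (-c) = - ic c := by funext i; simp [ic]
      rw [this, Matrix.mulVec_neg]; simp [nsq]
    rw [h2] at h1
    rw [← h1]
    simp [ic]
  · apply Summable.mul_left
    apply Summable.of_norm
    simp_rw [norm_gauss]
    have := gauss_summable _ hPt (Real.pi * (τ⁻¹).re) (by positivity) 0
    simpa using this

end QF

namespace QF
open MeasureTheory

lemma exists_P (A : Matrix (Fin 4) (Fin 4) ℤ) (h : PosDefQF A) :
    ∃ P : Matrix (Fin 4) (Fin 4) ℝ, P.transpose * P = A.map (Int.cast : ℤ → ℝ) ∧ P.det ≠ 0 := by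
  open scoped MatrixOrder in
  obtain ⟨y, hy, e⟩ := CStarAlgebra.isStrictlyPositive_iff_eq_star_mul_self.mp (Matrix.PosDef.isStrictlyPositive h)
  refine ⟨y, ?_, ?_⟩
  · rw [e, Matrix.star_eq_conjTranspose, Matrix.conjTranspose_eq_transpose_of_trivial]
  · rw [Matrix.isUnit_iff_isUnit_det] at hy
    exact hy.ne_zero

/-- splitting integers by residue classes -/
noncomputable def resEquiv (q : ℕ) [NeZero q] : (Fin 4 → ZMod q) × (Fin 4 → ℤ) ≃ (Fin 4 → ℤ) where
  toFun p := fun i => ((p.1 i).val : ℤ) + q * p.2 i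
  invFun x := (fun i => (x i : ZMod q), fun i => x i / q)
  left_inv p := by
    have hq : (q : ℤ) ≠ 0 := by exact_mod_cast NeZero.ne q
    ext i
    · simp
    · simp only
      rw [Int.add_mul_ediv_left _ _ hq, Int.ediv_eq_zero_of_lt (by positivity) (by exact_mod_cast ZMod.val_lt _), zero_add]
  right_inv x := by
    funext i
    simp only
    rw [ZMod.val_intCast, Int.emod_add_mul_ediv]

lemma theta_w (P : Matrix (Fin 4) (Fin 4) ℝ) (hP : P.det ≠ 0) (τ : ℂ) (hτ : 0 < τ.re) (q : ℕ) [NeZero q]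
    (w : (Fin 4 → ZMod q) → ℂ) :
    HasSum (fun c : Fin 4 → ℤ => ((|P.det|⁻¹ : ℝ) * ((q^2 * τ)⁻¹) ^ 2 * Complex.exp (-(Real.pi * (q^2 * τ)⁻¹ * nsq ((P⁻¹).transpose.mulVec (ic c))))) *
        ∑ r : Fin 4 → ZMod q, w r * ZMod.stdAddChar (dt (fun i => (c i : ZMod q)) r))
      (∑' x : Fin 4 → ℤ, w (fun i => (x i : ZMod q)) * Complex.exp (-(Real.pi * τ * nsq (P.mulVec (ic x))))) := by
  have hq : (0 : ℝ) < q := by exact_mod_cast Nat.pos_of_ne_zero (NeZero.ne q)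
  have hqτ : 0 < ((q:ℂ)^2 * τ).re := by
    have : ((q:ℂ)^2 * τ) = (((q:ℝ)^2 : ℝ) : ℂ) * τ := by push_cast; ring
    rw [this, Complex.re_ofReal_mul]; positivity
  have hsx : Summable (fun x : Fin 4 → ℤ => w (fun i => (x i : ZMod q)) * Complex.exp (-(Real.pi * τ * nsq (P.mulVec (ic x))))) := by
    apply Summable.of_norm
    have h0 := (gauss_summable P hP (Real.pi * τ.re) (by have := Real.pi_pos; positivity) 0).mul_left (∑ r, ‖w r‖)
    refine Summable.of_nonneg_of_le (fun _ => norm_nonneg _) (fun x => ?_) h0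
    rw [norm_mul, norm_gauss, add_zero]
    refine mul_le_mul_of_nonneg_right ?_ (Real.exp_pos _).le
    exact Finset.single_le_sum (f := fun r => ‖w r‖) (fun _ _ => norm_nonneg _) (Finset.mem_univ _)
  have h1 : (∑' x : Fin 4 → ℤ, w (fun i => (x i : ZMod q)) * Complex.exp (-(Real.pi * τ * nsq (P.mulVec (ic x)))))
      = ∑ r : Fin 4 → ZMod q, w r * ∑' z : Fin 4 → ℤ, Complex.exp (-(Real.pi * (q^2*τ) * nsq (P.mulVec ((fun i => ((r i).val : ℝ) / q) + ic z)))) := by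
    rw [← (resEquiv q).tsum_eq]
    have hs2 := (resEquiv q).summable_iff.2 hsx
    have hs3 := hs2.tsum_prod
    simp only [Function.comp] at hs3
    rw [hs3, tsum_fintype]
    apply Finset.sum_congr rfl
    intro r _
    rw [← tsum_mul_left]
    congr 1; funext z
    congr 1
    · congr 1; funext i; simp [resEquiv]
    · congr 2
      have : ic (resEquiv q (r, z)) = (q:ℝ) • ((fun i => ((r i).val : ℝ) / q) + ic z) := by
        funext i
        simp only [ic, resEquiv, Equiv.coe_fn_mk, Pi.smul_apply, Pi.add_apply, smul_eq_mul]
        push_cast; field_simp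
      rw [this, Matrix.mulVec_smul]
      have h2 : ∀ v : Fin 4 → ℝ, nsq ((q:ℝ) • v) = (q:ℝ)^2 * nsq v := by
        intro v; simp only [nsq, Pi.smul_apply, smul_eq_mul, Finset.mul_sum]
        apply Finset.sum_congr rfl; intros; ring
      rw [h2]; push_cast; ring
  rw [h1]
  have h2 : ∀ r : Fin 4 → ZMod q, HasSum (fun c : Fin 4 → ℤ => w r * (((|P.det|⁻¹ : ℝ) * ((q^2 * τ)⁻¹) ^ 2 * Complex.exp (-(Real.pi * (q^2 * τ)⁻¹ * nsq ((P⁻¹).transpose.mulVec (ic c))))) * ZMod.stdAddChar (dt (fun i => (c i : ZMod q)) r)))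
      (w r * ∑' z : Fin 4 → ℤ, Complex.exp (-(Real.pi * (q^2*τ) * nsq (P.mulVec ((fun i => ((r i).val : ℝ) / q) + ic z))))) := by
    intro r
    apply HasSum.mul_left
    have h3 := poisson P hP (q^2*τ) hqτ (fun i => ((r i).val : ℝ) / q)
    convert h3 using 2 with c
    congr 1
    have : dt (fun i => (c i : ZMod q)) r = ((∑ i, c i * (r i).val : ℤ) : ZMod q) := by
      simp [dt, Fin.sum_univ_four]
    rw [this, ZMod.stdAddChar_coe]
    congr 1
    push_cast
    rw [mul_div_assoc, Finset.sum_div]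
    congr 2
    apply Finset.sum_congr rfl; intros; ring
  have h3 := hasSum_sum (s := Finset.univ) (fun r _ => h2 r)
  convert h3 using 2 with c
  rw [Finset.mul_sum]
  apply Finset.sum_congr rfl; intros; ring

end QF

namespace QF
open MeasureTheory

lemma theta_one_le : ∃ C : ℝ, 0 < C ∧ ∀ m : ℝ, 0 < m → m ≤ 1 → ∑' j : ℤ, 2 * Real.exp (-(m/32) * (j:ℝ)^2) ≤ C * m ^ (-(1/2) : ℝ) := by
  have hπ := Real.pi_pos
  have hπ3 := Real.pi_gt_three
  set K := ∑' j : ℤ, Real.exp (-1 * (j:ℝ)^2) with hK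
  have hK0 : 0 ≤ K := tsum_nonneg (fun _ => (Real.exp_pos _).le)
  refine ⟨2 * (32 * Real.pi) ^ (1/2 : ℝ) * (K + 1), by positivity, fun m hm hm1 => ?_⟩
  rw [tsum_mul_left]
  set a := m / (32 * Real.pi) with ha
  have ha0 : 0 < a := by positivity
  have h1 := Real.tsum_exp_neg_mul_int_sq ha0
  have h2 : ∀ j : ℤ, Real.exp (-(m/32) * (j:ℝ)^2) = Real.exp (-Real.pi * a * (j:ℝ)^2) := by
    intro j; congr 1; rw [ha]; field_simp
  simp_rw [h2]
  rw [h1]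
  have h3 : ∑' n : ℤ, Real.exp (-Real.pi / a * (n:ℝ)^2) ≤ K := by
    have hge : 1 ≤ Real.pi / a := by
      rw [le_div_iff₀ ha0, ha, one_mul, div_le_iff₀ (by positivity)]; nlinarith
    refine Summable.tsum_le_tsum (fun j => ?_) ?_ (exp_sq_summable 1 one_pos)
    · apply Real.exp_le_exp.2
      have : -Real.pi / a * (j:ℝ)^2 = -(Real.pi / a * (j:ℝ)^2) := by ring
      rw [this]
      nlinarith [sq_nonneg (j:ℝ)]
    · have := exp_sq_summable (Real.pi / a) (by positivity)
      refine this.congr (fun j => ?_)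
      congr 1; ring
  have h4 : 1 / a ^ (1/2 : ℝ) = (32 * Real.pi) ^ (1/2 : ℝ) * m ^ (-(1/2) : ℝ) := by
    rw [ha, Real.div_rpow hm.le (by positivity), Real.rpow_neg hm.le]
    field_simp
  rw [h4]
  have h5 : 0 ≤ (32 * Real.pi) ^ (1/2 : ℝ) * m ^ (-(1/2) : ℝ) := by positivity
  calc _ ≤ 2 * ((32 * Real.pi) ^ (1/2 : ℝ) * m ^ (-(1/2) : ℝ) * (K+1)) := by
        gcongr; linarith
    _ = _ := by ring

lemma floor_weight (m : ℝ) (hm : 0 < m) (hm1 : m ≤ 1) (t : ℝ) :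
    Real.exp (-(1/4) * t^2) ≤ 2 * Real.exp (-(m/32) * ((⌊2 * t / Real.sqrt m⌋ : ℤ) : ℝ)^2) := by
  set u := 2 * t / Real.sqrt m with hu
  have hs : 0 < Real.sqrt m := Real.sqrt_pos.2 hm
  have ht : t = u * Real.sqrt m / 2 := by rw [hu]; field_simp
  have ht2 : t^2 = u^2 * m / 4 := by rw [ht]; nlinarith [Real.sq_sqrt hm.le]
  set j : ℝ := ((⌊u⌋ : ℤ) : ℝ)
  have h1 : j ≤ u := Int.floor_le u
  have h2 : u < j + 1 := Int.lt_floor_add_one u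
  have h3 : j^2 ≤ 2 * u^2 + 2 := by nlinarith [sq_nonneg (u - (u - j)), sq_nonneg (u + (u-j))]
  have h4 : (2:ℝ) = Real.exp (Real.log 2) := (Real.exp_log (by norm_num)).symm
  rw [h4, ← Real.exp_add]
  apply Real.exp_le_exp.2
  have := Real.log_two_gt_d9
  rw [ht2]
  have h5 : m * j^2 ≤ m * (2 * u^2 + 2) := mul_le_mul_of_nonneg_left h3 hm.le
  nlinarith

lemma orth_ext (v : Fin 4 → ℝ) (hv : 0 < nsq v) :
    ∃ O : Fin 4 → ((Fin 4 → ℝ) →ₗ[ℝ] ℝ), (∀ w, ∑ i, (O i w)^2 = nsq w) ∧ ∀ w, O 0 w = dt v w / Real.sqrt (nsq v) := by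
  let V : EuclideanSpace ℝ (Fin 4) := WithLp.toLp 2 v
  have hV : ‖V‖ = Real.sqrt (nsq v) := by
    show ‖(WithLp.toLp 2 v : EuclideanSpace ℝ (Fin 4))‖ = _
    rw [EuclideanSpace.norm_eq]; simp [nsq]
  have hs : 0 < Real.sqrt (nsq v) := Real.sqrt_pos.2 hv
  let e : EuclideanSpace ℝ (Fin 4) := (Real.sqrt (nsq v))⁻¹ • V
  have he : ‖e‖ = 1 := by
    simp only [e]
    rw [norm_smul, hV, Real.norm_of_nonneg (by positivity)]; field_simp
  have hor : Orthonormal ℝ (Set.restrict ({0} : Set (Fin 4)) (fun _ => e)) := by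
    constructor
    · intro i; exact he
    · intro i j hij
      exact absurd (Subsingleton.elim i j) hij
  obtain ⟨b, hb⟩ := hor.exists_orthonormalBasis_extension_of_card_eq (by simp)
  refine ⟨fun i => (innerₛₗ ℝ (b i)).comp (WithLp.linearEquiv 2 ℝ (Fin 4 → ℝ)).symm.toLinearMap, ?_, ?_⟩
  · intro w
    have := b.sum_sq_norm_inner_right (WithLp.toLp 2 w : EuclideanSpace ℝ (Fin 4))
    have h2 : ‖(WithLp.toLp 2 w : EuclideanSpace ℝ (Fin 4))‖^2 = nsq w := by
      rw [EuclideanSpace.norm_eq, Real.sq_sqrt (Finset.sum_nonneg (fun i _ => sq_nonneg _))]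
      simp [nsq]
    rw [h2] at this
    rw [← this]
    apply Finset.sum_congr rfl
    intro i _
    rw [Real.norm_eq_abs, sq_abs]
    rfl
  · intro w
    have hb0 := hb 0 rfl
    have : (innerₛₗ ℝ (b 0)) (WithLp.toLp 2 w : EuclideanSpace ℝ (Fin 4)) = inner ℝ e (WithLp.toLp 2 w : EuclideanSpace ℝ (Fin 4)) := by rw [hb0]; rfl
    refine Eq.trans this ?_
    simp only [e]
    rw [inner_smul_left]
    simp only [V, PiLp.inner_apply, dt, div_eq_inv_mul, RCLike.inner_apply, conj_trivial]
    congr 1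
    apply Finset.sum_congr rfl; intros; exact mul_comm _ _

lemma code_sum (s : Finset (Fin 4 → ℤ)) (a : (Fin 4 → ℤ) → (Fin 4 → ℤ)) (ha : Set.InjOn a s)
    (g : (Fin 4 → ℤ) → ℝ) (f : Fin 4 → ℤ → ℝ) (hf : ∀ i j, 0 ≤ f i j) (hs : ∀ i, Summable (f i))
    (hg : ∀ x ∈ s, g x ≤ ∏ i, f i (a x i)) : ∑ x ∈ s, g x ≤ ∏ i, ∑' j, f i j := by
  classical
  calc _ ≤ ∑ x ∈ s, ∏ i, f i (a x i) := Finset.sum_le_sum hg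
    _ = ∑ y ∈ s.image a, ∏ i, f i (y i) := by rw [Finset.sum_image ha]
    _ ≤ _ := pi_sum_le f hf hs _

lemma pack1 : ∃ C : ℝ, 0 < C ∧ ∀ (R : Matrix (Fin 4) (Fin 4) ℝ) (Λ : AddSubgroup (Fin 4 → ℤ)),
    (∀ x ∈ Λ, x ≠ 0 → 1 ≤ nsq (R.mulVec (ic x))) → ∀ s : Finset (Fin 4 → ℤ), (∀ x ∈ s, x ∈ Λ) →
    ∑ x ∈ s, Real.exp (-(1/4) * nsq (R.mulVec (ic x))) ≤ C := by
  refine ⟨(∑' j : ℤ, 2 * Real.exp (-(1/32) * (j:ℝ)^2))^4 + 1, by positivity, ?_⟩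
  intro R Λ hΛ s hs
  have h := code_sum s (fun x i => ⌊2 * (R.mulVec (ic x) i) / Real.sqrt 1⌋) ?_ (fun x => Real.exp (-(1/4) * nsq (R.mulVec (ic x))))
    (fun i j => 2 * Real.exp (-(1/32) * (j:ℝ)^2)) (fun _ _ => by positivity) (fun _ => (exp_sq_summable (1/32) (by norm_num)).mul_left 2) ?_
  · refine h.trans ?_
    rw [Finset.prod_const]; simp
  · intro x hx y hy hxy
    by_contra hne
    have h1 := hΛ (x - y) (Λ.sub_mem (hs x hx) (hs y hy)) (sub_ne_zero.2 hne)
    have h2 : ic (x - y) = ic x - ic y := by funext i; simp [ic]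
    rw [h2, Matrix.mulVec_sub] at h1
    have h3 : ∀ i, ((R.mulVec (ic x) - R.mulVec (ic y)) i)^2 < 1/4 := by
      intro i
      have h4 := congrFun hxy i
      simp only [Real.sqrt_one, div_one] at h4
      have := Int.abs_sub_lt_one_of_floor_eq_floor h4
      rw [abs_lt] at this
      simp only [Pi.sub_apply]
      nlinarith [this.1, this.2]
    simp only [nsq, Fin.sum_univ_four] at h1
    linarith [h3 0, h3 1, h3 2, h3 3]
  · intro x hx
    calc _ = ∏ i, Real.exp (-(1/4) * (R.mulVec (ic x) i)^2) := by
          rw [← Real.exp_sum, nsq, Finset.mul_sum]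
      _ ≤ _ := Finset.prod_le_prod (fun _ _ => (Real.exp_pos _).le) (fun i _ => floor_weight 1 one_pos le_rfl _)

lemma pack2 : ∃ C : ℝ, 0 < C ∧ ∀ (R : Matrix (Fin 4) (Fin 4) ℝ) (Λ : AddSubgroup (Fin 4 → ℤ)) (m : ℝ), 0 < m → m ≤ 1 →
    (∀ x ∈ Λ, x ≠ 0 → m ≤ nsq (R.mulVec (ic x))) → ∀ v : Fin 4 → ℝ, 0 < nsq v → nsq v ≤ 1 →
    (∀ x ∈ Λ, ∃ k : ℤ, dt v (R.mulVec (ic x)) = k) →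
    ∀ s : Finset (Fin 4 → ℤ), (∀ x ∈ s, x ∈ Λ) →
    ∑ x ∈ s, Real.exp (-(1/4) * nsq (R.mulVec (ic x))) ≤ C * m ^ (-(3/2) : ℝ) := by
  obtain ⟨C, hC, hth⟩ := theta_one_le
  set K := ∑' j : ℤ, Real.exp (-(1/4) * (j:ℝ)^2) with hK
  have hK0 : 0 ≤ K := tsum_nonneg (fun _ => (Real.exp_pos _).le)
  refine ⟨(K + 1) * C^3, by positivity, ?_⟩
  intro R Λ m hm hm1 hΛ v hv hv1 hk s hs
  obtain ⟨O, hO, hO0⟩ := orth_ext v hv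
  have hsv : 0 < Real.sqrt (nsq v) := Real.sqrt_pos.2 hv
  have hsm : 0 < Real.sqrt m := Real.sqrt_pos.2 hm
  have hflo : ∀ x ∈ Λ, dt v (R.mulVec (ic x)) = (⌊dt v (R.mulVec (ic x))⌋ : ℤ) := by
    intro x hx
    obtain ⟨k, hk⟩ := hk x hx
    rw [hk, Int.floor_intCast]
  have h := code_sum s (fun x i => if i = 0 then ⌊dt v (R.mulVec (ic x))⌋ else ⌊2 * (O i (R.mulVec (ic x))) / Real.sqrt m⌋) ?_ (fun x => Real.exp (-(1/4) * nsq (R.mulVec (ic x))))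
    (fun i j => if i = 0 then Real.exp (-(1/4) * (j:ℝ)^2) else 2 * Real.exp (-(m/32) * (j:ℝ)^2)) (fun i _ => by split_ifs <;> positivity)
    (fun i => by
      by_cases hi : i = 0
      · simp only [hi, if_true]; exact exp_sq_summable (1/4) (by norm_num)
      · simp only [hi, if_false]; exact (exp_sq_summable (m/32) (by positivity)).mul_left 2) ?_
  · refine h.trans ?_
    rw [Fin.prod_univ_four]
    have e1 : (1 : Fin 4) ≠ 0 := by decide
    have e2 : (2 : Fin 4) ≠ 0 := by decide
    have e3 : (3 : Fin 4) ≠ 0 := by decide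
    simp only [e1, e2, e3, if_true, if_false]
    have h1 := hth m hm hm1
    set T := ∑' j : ℤ, 2 * Real.exp (-(m/32) * (j:ℝ)^2)
    have hT0 : 0 ≤ T := tsum_nonneg (fun _ => by positivity)
    have h2 : m ^ (-(3/2) : ℝ) = (m ^ (-(1/2) : ℝ))^3 := by
      rw [← Real.rpow_natCast, ← Real.rpow_mul hm.le]; norm_num
    rw [h2]
    have h3 : T^3 ≤ (C * m ^ (-(1/2) : ℝ))^3 := pow_le_pow_left₀ hT0 h1 3
    have h4 : 0 ≤ T^3 := by positivity
    calc K * T * T * T = K * T^3 := by ring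
      _ ≤ (K+1) * (C * m ^ (-(1/2) : ℝ))^3 := by nlinarith
      _ = _ := by ring
  · intro x hx y hy hxy
    by_contra hne
    have h1 := hΛ (x - y) (Λ.sub_mem (hs x hx) (hs y hy)) (sub_ne_zero.2 hne)
    have h2 : ic (x - y) = ic x - ic y := by funext i; simp [ic]
    rw [h2, Matrix.mulVec_sub, ← hO] at h1
    have h0 : O 0 (R.mulVec (ic x) - R.mulVec (ic y)) = 0 := by
      have h4 := congrFun hxy 0
      simp only [if_true] at h4
      rw [map_sub, hO0, hO0, hflo x (hs x hx), hflo y (hs y hy), h4, sub_self]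
    have h3 : ∀ i, i ≠ 0 → (O i (R.mulVec (ic x) - R.mulVec (ic y)))^2 < m/4 := by
      intro i hi
      have h4 := congrFun hxy i
      simp only [hi, if_false] at h4
      have := Int.abs_sub_lt_one_of_floor_eq_floor h4
      rw [← sub_div, abs_div, abs_of_pos hsm, div_lt_one hsm, ← mul_sub, ← map_sub, abs_mul, abs_two] at this
      have h5 : (2 * |O i (R.mulVec (ic x) - R.mulVec (ic y))|)^2 < (Real.sqrt m)^2 :=
        pow_lt_pow_left₀ this (by positivity) two_ne_zero
      rw [Real.sq_sqrt hm.le, mul_pow, sq_abs] at h5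
      linarith
    rw [Fin.sum_univ_four, h0] at h1
    linarith [h3 1 (by decide), h3 2 (by decide), h3 3 (by decide)]
  · intro x hx
    calc _ = ∏ i, Real.exp (-(1/4) * (O i (R.mulVec (ic x)))^2) := by
          rw [← Real.exp_sum, ← Finset.mul_sum, hO]
      _ ≤ _ := by
          refine Finset.prod_le_prod (fun _ _ => (Real.exp_pos _).le) (fun i _ => ?_)
          by_cases hi : i = 0
          · simp only [hi, if_true]
            rw [← hflo x (hs x hx), hO0]
            apply Real.exp_le_exp.2
            rw [div_pow, Real.sq_sqrt hv.le]
            have : (dt v (R.mulVec (ic x)))^2 ≤ (dt v (R.mulVec (ic x)))^2 / nsq v := by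
              rw [le_div_iff₀ hv]; nlinarith [sq_nonneg (dt v (R.mulVec (ic x)))]
            linarith
          · simp only [hi, if_false]
            exact floor_weight m hm hm1 _

end QF

namespace QF
open MeasureTheory

lemma nsq_dot (w : Fin 4 → ℝ) : nsq w = w ⬝ᵥ w := by simp [nsq, dotProduct, sq]

lemma dt_dot {R : Type*} [CommRing R] (v w : Fin 4 → R) : dt v w = v ⬝ᵥ w := rfl

lemma ic_dt (v w : Fin 4 → ℤ) : ((dt v w : ℤ) : ℝ) = ic v ⬝ᵥ ic w := by
  simp [dt, dotProduct]

lemma ic_mulVec (A : Matrix (Fin 4) (Fin 4) ℤ) (x : Fin 4 → ℤ) :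
    ic (A.mulVec x) = (A.map (Int.cast : ℤ → ℝ)).mulVec (ic x) := by
  funext i; simp [ic, Matrix.mulVec, dotProduct]

lemma ic_ne_zero {x : Fin 4 → ℤ} (hx : x ≠ 0) : ic x ≠ 0 := by
  intro h; apply hx; funext i
  have := congrFun h i
  simpa [ic] using this

lemma nsq_pos {w : Fin 4 → ℝ} (hw : w ≠ 0) : 0 < nsq w := by
  rw [nsq_dot]
  have h0 : 0 ≤ w ⬝ᵥ w := by rw [← nsq_dot]; exact nsq_nonneg w
  refine lt_of_le_of_ne h0 (fun h => hw ?_)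
  exact dotProduct_self_eq_zero.1 h.symm

section
variable {A B : Matrix (Fin 4) (Fin 4) ℤ} {P : Matrix (Fin 4) (Fin 4) ℝ} {N : ℕ}

lemma nsqP (hPA : P.transpose * P = A.map (Int.cast : ℤ → ℝ)) (x : Fin 4 → ℤ) :
    nsq (P.mulVec (ic x)) = ((dt x (A.mulVec x) : ℤ) : ℝ) := by
  rw [ic_dt, ic_mulVec, ← hPA, ← Matrix.mulVec_mulVec, nsq_dot, Matrix.dotProduct_mulVec (ic x), Matrix.vecMul_transpose]

lemma nsqP_pos (hP : P.det ≠ 0) {x : Fin 4 → ℤ} (hx : x ≠ 0) : 0 < nsq (P.mulVec (ic x)) := by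
  apply nsq_pos
  intro h
  exact ic_ne_zero hx (Matrix.eq_zero_of_mulVec_eq_zero hP h)

lemma det_invT (hP : P.det ≠ 0) : (P⁻¹).transpose.det ≠ 0 := by
  rw [Matrix.det_transpose, Matrix.det_nonsing_inv, Ring.inverse_eq_inv']
  exact inv_ne_zero hP

lemma nsqF (hPA : P.transpose * P = A.map (Int.cast : ℤ → ℝ)) (hP : P.det ≠ 0)
    (hAB : A * B = (N : ℤ) • 1) (c : Fin 4 → ℤ) :
    N * nsq ((P⁻¹).transpose.mulVec (ic c)) = ((dt c (B.mulVec c) : ℤ) : ℝ) := by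
  have hu : IsUnit P.det := isUnit_iff_ne_zero.2 hP
  have h1 : (A.map (Int.cast : ℤ → ℝ)) * (B.map (Int.cast : ℤ → ℝ)) = (N : ℝ) • 1 := by
    have := congrArg (fun M : Matrix (Fin 4) (Fin 4) ℤ => M.map (Int.castRingHom ℝ)) hAB
    simp only [Matrix.map_mul] at this
    refine this.trans ?_
    ext i j
    simp only [Matrix.map_apply, Matrix.smul_apply, Matrix.one_apply]
    by_cases h : i = j <;> simp [h]
  have h2 : B.map (Int.cast : ℤ → ℝ) = (N : ℝ) • (P⁻¹ * (P⁻¹).transpose) := by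
    have h3 : P⁻¹ * (P⁻¹).transpose * (A.map (Int.cast : ℤ → ℝ)) = 1 := by
      rw [← hPA, Matrix.transpose_nonsing_inv]
      rw [Matrix.mul_assoc, ← Matrix.mul_assoc (P.transpose⁻¹), Matrix.nonsing_inv_mul _ (by rw [Matrix.det_transpose]; exact hu), Matrix.one_mul,
        Matrix.nonsing_inv_mul _ hu]
    calc _ = P⁻¹ * (P⁻¹).transpose * (A.map (Int.cast : ℤ → ℝ)) * (B.map (Int.cast : ℤ → ℝ)) := by rw [h3, Matrix.one_mul]
      _ = _ := by rw [Matrix.mul_assoc, h1, Matrix.mul_smul, Matrix.mul_one]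
  rw [ic_dt, ic_mulVec, h2, Matrix.smul_mulVec, dotProduct_smul, smul_eq_mul, ← Matrix.mulVec_mulVec,
    Matrix.dotProduct_mulVec, nsq_dot, ← Matrix.mulVec_transpose]

lemma pairing (hP : P.det ≠ 0) (h c : Fin 4 → ℤ) :
    dt (P.mulVec (ic h)) ((P⁻¹).transpose.mulVec (ic c)) = ((dt h c : ℤ) : ℝ) := by
  have hu : IsUnit P.det := isUnit_iff_ne_zero.2 hP
  rw [ic_dt, dt_dot, Matrix.dotProduct_mulVec, Matrix.vecMul_transpose, Matrix.mulVec_mulVec,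
    Matrix.nonsing_inv_mul _ hu, Matrix.one_mulVec]

lemma castv_mulVec {q : ℕ} (A : Matrix (Fin 4) (Fin 4) ℤ) (x : Fin 4 → ℤ) :
    mulv A (fun i => (x i : ZMod q)) = fun i => ((A.mulVec x i : ℤ) : ZMod q) := by
  funext i; simp [mulv, Matrix.mulVec, dotProduct]

lemma castv_dt {q : ℕ} (x y : Fin 4 → ℤ) :
    dt (fun i => (x i : ZMod q)) (fun i => (y i : ZMod q)) = ((dt x y : ℤ) : ZMod q) := by
  simp [dt]

/-- the lattice dual to the kernel mod q -/
def Lq (A : Matrix (Fin 4) (Fin 4) ℤ) (q : ℕ) : AddSubgroup (Fin 4 → ℤ) where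
  carrier := {c | ∀ h : Fin 4 → ZMod q, mulv A h = 0 → dt (fun i => (c i : ZMod q)) h = 0}
  zero_mem' := by intro h hh; simp [dt]
  add_mem' := by
    intro a b ha hb h hh
    have := congrArg₂ (· + ·) (ha h hh) (hb h hh)
    simp only [dt, add_zero, ← Finset.sum_add_distrib, ← add_mul] at this
    simpa [dt] using this
  neg_mem' := by
    intro a ha h hh
    have := congrArg Neg.neg (ha h hh)
    simpa [dt] using this

/-- the lattice lifting the kernel mod q -/
def Mq (A : Matrix (Fin 4) (Fin 4) ℤ) (q : ℕ) : AddSubgroup (Fin 4 → ℤ) where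
  carrier := {x | mulv A (fun i => (x i : ZMod q)) = 0}
  zero_mem' := by simp [mulv]; exact Matrix.mulVec_zero _
  add_mem' := by
    intro a b ha hb
    have := mulv_add A (fun i => (a i : ZMod q)) (fun i => (b i : ZMod q))
    simp only [Set.mem_setOf_eq] at ha hb ⊢
    rw [ha, hb, add_zero] at this
    rw [← this]; congr 1; funext i; simp
  neg_mem' := by
    intro a ha
    have := mulv_smul A (-1 : ZMod q) (fun i => (a i : ZMod q))
    simp only [Set.mem_setOf_eq] at ha ⊢
    rw [ha, smul_zero] at this
    rw [← this]; congr 1; funext i; simp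

lemma Lq_lower (hPA : P.transpose * P = A.map (Int.cast : ℤ → ℝ)) (hP : P.det ≠ 0) (hN : 0 < N)
    (hAB : A * B = (N : ℤ) • 1) (q : ℕ) (hq : 0 < q) (c : Fin 4 → ℤ) (hc : c ∈ Lq A q) (hc0 : c ≠ 0) :
    ((Nat.gcd q N : ℕ) : ℝ) / N ≤ nsq ((P⁻¹).transpose.mulVec (ic c)) := by
  set g := Nat.gcd q N with hg
  have hgpos : 0 < g := Nat.gcd_pos_of_pos_left _ hq
  obtain ⟨q', hq'⟩ : g ∣ q := Nat.gcd_dvd_left _ _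
  obtain ⟨N', hN'⟩ : g ∣ N := Nat.gcd_dvd_right _ _
  have hNr : (0:ℝ) < N := by exact_mod_cast hN
  have hF := nsqF hPA hP hAB c
  have hFpos := nsqP_pos (P := (P⁻¹).transpose) (det_invT hP) hc0
  have hABc : A.mulVec (B.mulVec c) = (N : ℤ) • c := by
    rw [Matrix.mulVec_mulVec, hAB, Matrix.smul_mulVec, Matrix.one_mulVec]
  have hmem : mulv A (fun i => ((((q' : ℤ) • B.mulVec c) i : ℤ) : ZMod q)) = 0 := by
    rw [castv_mulVec, Matrix.mulVec_smul, hABc]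
    funext i
    simp only [Pi.smul_apply, smul_eq_mul, Pi.zero_apply]
    rw [ZMod.intCast_zmod_eq_zero_iff_dvd]
    refine ⟨N' * c i, ?_⟩
    rw [hN', hq']; push_cast; ring
  have h2 := hc _ hmem
  rw [castv_dt, ZMod.intCast_zmod_eq_zero_iff_dvd] at h2
  have h3 : dt c ((q' : ℤ) • B.mulVec c) = q' * dt c (B.mulVec c) := dt_smul_right _ _ _
  rw [h3, hq'] at h2
  have hq'0 : (q' : ℤ) ≠ 0 := by
    rintro h; have : q' = 0 := by exact_mod_cast h
    rw [this] at hq'; omega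
  have h4 : (g : ℤ) ∣ dt c (B.mulVec c) := by
    push_cast at h2
    rw [mul_comm] at h2
    exact (mul_dvd_mul_iff_left hq'0).1 h2
  have h5 : 0 < dt c (B.mulVec c) := by
    have : (0:ℝ) < ((dt c (B.mulVec c) : ℤ) : ℝ) := by rw [← hF]; positivity
    exact_mod_cast this
  have h6 := Int.le_of_dvd h5 h4
  have h7 : ((g : ℕ) : ℝ) ≤ ((dt c (B.mulVec c) : ℤ) : ℝ) := by exact_mod_cast h6
  rw [div_le_iff₀ hNr, mul_comm, hF]; exact h7

lemma Mq_lower (hPA : P.transpose * P = A.map (Int.cast : ℤ → ℝ)) (hP : P.det ≠ 0) (hN : 0 < N)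
    (hB : IsGram B) (hBA : B * A = (N : ℤ) • 1) (q : ℕ) (hq : 0 < q) (x : Fin 4 → ℤ) (hx : x ∈ Mq A q) (hx0 : x ≠ 0) :
    (1 : ℝ) / (Nat.gcd q N : ℕ) ≤ nsq (P.mulVec (ic x)) / q^2 := by
  set g := Nat.gcd q N with hg
  have hgpos : 0 < g := Nat.gcd_pos_of_pos_left _ hq
  have hq0 : (q : ℤ) ≠ 0 := by exact_mod_cast hq.ne'
  have h1 : ∀ i, (q : ℤ) ∣ A.mulVec x i := by
    intro i
    have := congrFun (show mulv A (fun i => (x i : ZMod q)) = 0 from hx) i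
    rw [castv_mulVec] at this
    exact (ZMod.intCast_zmod_eq_zero_iff_dvd _ _).1 this
  choose w hw using h1
  have hw' : A.mulVec x = (q : ℤ) • w := by funext i; rw [hw i]; simp
  have h2 : (q : ℤ) • B.mulVec w = (N : ℤ) • x := by
    rw [← Matrix.mulVec_smul, ← hw', Matrix.mulVec_mulVec, hBA, Matrix.smul_mulVec, Matrix.one_mulVec]
  have h3 : (N : ℤ) * dt w x = q * dt w (B.mulVec w) := by
    rw [← dt_smul_right, ← dt_smul_right, h2]
  have h4 : dt x (A.mulVec x) = q * dt w x := by
    rw [hw', dt_smul_right, dt_comm]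
  have h5 := nsqP hPA x
  have h6 := nsqP_pos hP hx0
  have hqr : (0:ℝ) < q := by exact_mod_cast hq
  rw [h4] at h5; push_cast at h5
  have h7 : 0 < dt w x := by
    rw [h5] at h6
    have := pos_of_mul_pos_right h6 hqr.le
    exact_mod_cast this
  have h8 : (q : ℤ) ∣ (g : ℤ) * dt w x := by
    have e : (g : ℤ) = Int.gcd (q : ℤ) (N : ℤ) := by simp [hg]
    rw [e, mul_comm, Int.gcd_eq_gcd_ab, mul_add]
    refine dvd_add ⟨dt w x * Int.gcdA q N, by ring⟩ ⟨dt w (B.mulVec w) * Int.gcdB q N, ?_⟩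
    linear_combination (Int.gcdB q N) * h3
  have h9 := Int.le_of_dvd (by positivity) h8
  have h10 : ((q:ℕ):ℝ) ≤ (g:ℝ) * ((dt w x : ℤ) : ℝ) := by exact_mod_cast h9
  have hgr : (0:ℝ) < g := by exact_mod_cast hgpos
  rw [h5, div_le_div_iff₀ hgr (by positivity)]
  nlinarith

end

end QF

namespace QF
open MeasureTheory

noncomputable def Fc (P : Matrix (Fin 4) (Fin 4) ℝ) (c : Fin 4 → ℤ) : ℝ := nsq ((P⁻¹).transpose.mulVec (ic c))

noncomputable def TL (A : Matrix (Fin 4) (Fin 4) ℤ) (P : Matrix (Fin 4) (Fin 4) ℝ) (q : ℕ) (s : ℝ) : ℝ :=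
  ∑' c, (Lq A q : Set (Fin 4 → ℤ)).indicator (fun c => Real.exp (-(Real.pi * s) * Fc P c)) c

lemma Fc_summable (P : Matrix (Fin 4) (Fin 4) ℝ) (hP : P.det ≠ 0) (s : ℝ) (hs : 0 < s) :
    Summable (fun c => Real.exp (-(Real.pi * s) * Fc P c)) := by
  have := gauss_summable ((P⁻¹).transpose) (det_invT hP) (Real.pi * s) (by positivity) 0
  simpa [Fc] using this

lemma TL_summable (A : Matrix (Fin 4) (Fin 4) ℤ) (P : Matrix (Fin 4) (Fin 4) ℝ) (hP : P.det ≠ 0) (q : ℕ) (s : ℝ) (hs : 0 < s) :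
    Summable (fun c => (Lq A q : Set (Fin 4 → ℤ)).indicator (fun c => Real.exp (-(Real.pi * s) * Fc P c)) c) :=
  (Fc_summable P hP s hs).indicator _

lemma ker_sum (A : Matrix (Fin 4) (Fin 4) ℤ) (q : ℕ) [NeZero q] (c : Fin 4 → ℤ) :
    ∑ r : Fin 4 → ZMod q, (if mulv A r = 0 then (1:ℂ) else 0) * ZMod.stdAddChar (dt (fun i => (c i : ZMod q)) r) =
      (Lq A q : Set (Fin 4 → ℤ)).indicator (fun _ => (kap A (ZMod q) : ℂ)) c := by
  classical
  have h0 : ∑ r : Fin 4 → ZMod q, (if mulv A r = 0 then (1:ℂ) else 0) * ZMod.stdAddChar (dt (fun i => (c i : ZMod q)) r) =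
      ∑ r ∈ Ker A (ZMod q), ZMod.stdAddChar (dt (fun i => (c i : ZMod q)) r) := by
    simp_rw [ite_mul, one_mul, zero_mul]
    rw [← Finset.sum_filter]
    apply Finset.sum_congr _ (fun _ _ => rfl)
    ext x; simp [mem_Ker]
  rw [h0]
  by_cases hc : c ∈ Lq A q
  · rw [Set.indicator_of_mem (show c ∈ (Lq A q : Set (Fin 4 → ℤ)) from hc)]
    rw [Finset.sum_congr rfl (g := fun _ => (1:ℂ))]
    · simp [kap]
    · intro r hr
      rw [hc r (mem_Ker.1 hr), AddChar.map_zero_eq_one]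
  · rw [Set.indicator_of_notMem (show c ∉ (Lq A q : Set (Fin 4 → ℤ)) from hc)]
    have : ∃ h : Fin 4 → ZMod q, mulv A h = 0 ∧ dt (fun i => (c i : ZMod q)) h ≠ 0 := by
      by_contra hcon
      push Not at hcon
      exact hc hcon
    obtain ⟨h, hh, hne⟩ := this
    have h1 : (ZMod.stdAddChar (dt (fun i => (c i : ZMod q)) h) : ℂ) ≠ 1 := by
      intro h2
      exact hne (ZMod.injective_stdAddChar (by rw [h2, AddChar.map_zero_eq_one]))
    have h2 : ∑ r ∈ Ker A (ZMod q), (ZMod.stdAddChar (dt (fun i => (c i : ZMod q)) r) : ℂ) =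
       ZMod.stdAddChar (dt (fun i => (c i : ZMod q)) h) * ∑ r ∈ Ker A (ZMod q), (ZMod.stdAddChar (dt (fun i => (c i : ZMod q)) r) : ℂ) := by
      rw [Finset.mul_sum]
      symm
      refine Finset.sum_bij' (fun r _ => h + r) (fun r _ => r - h) ?_ ?_ ?_ ?_ ?_
      · intro r hr; rw [mem_Ker] at hr ⊢; rw [mulv_add, hh, hr, add_zero]
      · intro r hr; rw [mem_Ker] at hr ⊢
        have := mulv_add A (r - h) h
        rw [sub_add_cancel, hr, hh, add_zero] at this; exact this.symm
      · intro r _; simp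
      · intro r _; simp
      · intro r _; rw [dt_add_right, AddChar.map_add_eq_mul]
    have h3 : ((1:ℂ) - ZMod.stdAddChar (dt (fun i => (c i : ZMod q)) h)) * ∑ r ∈ Ker A (ZMod q), (ZMod.stdAddChar (dt (fun i => (c i : ZMod q)) r) : ℂ) = 0 := by
      linear_combination h2
    exact (mul_eq_zero.1 h3).resolve_left (sub_ne_zero.2 (Ne.symm h1))

lemma TM_eq (A : Matrix (Fin 4) (Fin 4) ℤ) (P : Matrix (Fin 4) (Fin 4) ℝ) (hP : P.det ≠ 0) (q : ℕ) [NeZero q] :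
    ∑' x, (Mq A q : Set (Fin 4 → ℤ)).indicator (fun x => Real.exp (-(Real.pi * 8) * (nsq (P.mulVec (ic x)) / q^2))) x =
      |P.det|⁻¹ / 64 * kap A (ZMod q) * TL A P q (1/8) := by
  have hq : (0 : ℝ) < q := by exact_mod_cast Nat.pos_of_ne_zero (NeZero.ne q)
  have hqc : (q : ℂ) ≠ 0 := by exact_mod_cast (NeZero.ne q)
  classical
  have h := (theta_w P hP (((8 / q^2 : ℝ)) : ℂ) (by rw [Complex.ofReal_re]; positivity) q (fun r => if mulv A r = 0 then (1:ℂ) else 0)).tsum_eq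
  simp_rw [ker_sum] at h
  have e : ((q:ℂ)^2 * ((8 / q^2 : ℝ) : ℂ))⁻¹ = ((1/8 : ℝ) : ℂ) := by push_cast; field_simp
  rw [e] at h
  apply Complex.ofReal_injective
  rw [Complex.ofReal_tsum]
  refine Eq.trans ?_ (h.symm.trans ?_)
  · apply tsum_congr
    intro x
    by_cases hx : x ∈ Mq A q
    · rw [Set.indicator_of_mem (show x ∈ (Mq A q : Set (Fin 4 → ℤ)) from hx), if_pos (show mulv A (fun i => (x i : ZMod q)) = 0 from hx)]
      push_cast; rw [one_mul]; congr 1; field_simp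
    · rw [Set.indicator_of_notMem (show x ∉ (Mq A q : Set (Fin 4 → ℤ)) from hx), if_neg (show ¬ mulv A (fun i => (x i : ZMod q)) = 0 from hx)]
      simp
  · rw [TL, ← tsum_mul_left, Complex.ofReal_tsum]
    apply tsum_congr
    intro c
    by_cases hc : c ∈ Lq A q
    · rw [Set.indicator_of_mem (show c ∈ (Lq A q : Set (Fin 4 → ℤ)) from hc), Set.indicator_of_mem (show c ∈ (Lq A q : Set (Fin 4 → ℤ)) from hc)]
      rw [Fc]; push_cast
      have : Complex.exp (-(Real.pi * (1/8) * (nsq ((P⁻¹).transpose.mulVec (ic c)) : ℂ))) = Complex.exp (-(Real.pi * (1/8)) * (nsq ((P⁻¹).transpose.mulVec (ic c)) : ℂ)) := by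
        congr 1; ring
      rw [this]; ring
    · rw [Set.indicator_of_notMem (show c ∉ (Lq A q : Set (Fin 4 → ℤ)) from hc), Set.indicator_of_notMem (show c ∉ (Lq A q : Set (Fin 4 → ℤ)) from hc)]
      simp

lemma tsum_ind_le (Λ : AddSubgroup (Fin 4 → ℤ)) (f g : (Fin 4 → ℤ) → ℝ) (hf : ∀ x, 0 ≤ f x) (hfg : ∀ x, f x ≤ g x) (K : ℝ)
    (hK : ∀ s : Finset (Fin 4 → ℤ), (∀ x ∈ s, x ∈ Λ) → ∑ x ∈ s, g x ≤ K) :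
    ∑' x, (Λ : Set (Fin 4 → ℤ)).indicator f x ≤ K := by
  classical
  apply Real.tsum_le_of_sum_le
  · intro x; exact Set.indicator_nonneg (fun x _ => hf x) x
  · intro s
    have : ∑ x ∈ s, (Λ : Set (Fin 4 → ℤ)).indicator f x = ∑ x ∈ s.filter (· ∈ Λ), f x := by
      rw [Finset.sum_filter]
      apply Finset.sum_congr rfl
      intro x _
      simp [Set.indicator_apply]
    rw [this]
    refine (Finset.sum_le_sum (fun x _ => hfg x)).trans (hK _ ?_)
    intro x hx; exact (Finset.mem_filter.1 hx).2

lemma kap_pos (A : Matrix (Fin 4) (Fin 4) ℤ) (q : ℕ) [NeZero q] : 1 ≤ kap A (ZMod q) := by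
  apply Finset.card_pos.2
  exact ⟨0, mem_Ker.2 (Matrix.mulVec_zero _)⟩

lemma nsq_smul (t : ℝ) (w : Fin 4 → ℝ) : nsq (t • w) = t^2 * nsq w := by
  simp [nsq, mul_pow, Finset.mul_sum]

lemma main_lattice : ∃ C : ℝ, 0 < C ∧ ∀ (A B : Matrix (Fin 4) (Fin 4) ℤ) (P : Matrix (Fin 4) (Fin 4) ℝ) (N : ℕ),
    P.transpose * P = A.map (Int.cast : ℤ → ℝ) → P.det ≠ 0 → 0 < N → IsGram B → A * B = (N : ℤ) • 1 → B * A = (N : ℤ) • 1 → 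
    ∀ (q : ℕ) [NeZero q], Real.sqrt (kap A (ZMod q)) * TL A P q (1/8) ≤ C * (|P.det| + Real.sqrt |P.det| * (N:ℝ)^(3/4 : ℝ)) := by
  obtain ⟨C1, hC1, p1⟩ := pack1
  obtain ⟨C2, hC2, p2⟩ := pack2
  refine ⟨64 * C1 + C1 + 8 * C2, by positivity, ?_⟩
  intro A B P N hPA hP hN hB hAB hBA q _
  have hq : 0 < q := Nat.pos_of_ne_zero (NeZero.ne q)
  have hqr : (0 : ℝ) < q := by exact_mod_cast hq
  have hNr : (0 : ℝ) < N := by exact_mod_cast hN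
  set g := Nat.gcd q N with hg
  have hgpos : 0 < g := Nat.gcd_pos_of_pos_left _ hq
  have hgr : (0 : ℝ) < g := by exact_mod_cast hgpos
  have hg1 : (1:ℝ) ≤ g := by exact_mod_cast hgpos
  have hgN : (g:ℝ) ≤ N := by exact_mod_cast Nat.le_of_dvd hN (Nat.gcd_dvd_right _ _)
  have hd : 0 < |P.det| := abs_pos.2 hP
  have hdet : A.det ≠ 0 := by
    intro h
    have := congrArg Matrix.det hPA
    rw [Matrix.det_mul, Matrix.det_transpose] at this
    have h2 : (A.map (Int.cast : ℤ → ℝ)).det = ((A.det : ℤ) : ℝ) := (Int.cast_det A).symm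
    rw [h2, h] at this
    simp at this; exact hP this
  have hD : |P.det|^2 = (A.det.natAbs : ℝ) := by
    have := congrArg Matrix.det hPA
    rw [Matrix.det_mul, Matrix.det_transpose] at this
    have h2 : (A.map (Int.cast : ℤ → ℝ)).det = ((A.det : ℤ) : ℝ) := (Int.cast_det A).symm
    rw [h2] at this
    rw [Nat.cast_natAbs, sq_abs, sq, this, Int.cast_abs, abs_of_nonneg]
    rw [← this]; exact mul_self_nonneg _
  have hκ1 : (1:ℝ) ≤ kap A (ZMod q) := by exact_mod_cast kap_pos A q
  have hκD : (kap A (ZMod q) : ℝ) ≤ |P.det|^2 := by rw [hD]; exact_mod_cast kap_le hdet q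
  set κ : ℝ := ((kap A (ZMod q) : ℕ) : ℝ) with hκ
  have hsκ : Real.sqrt κ ≤ |P.det| := by
    rw [← Real.sqrt_sq hd.le]; exact Real.sqrt_le_sqrt hκD
  have hTL0 : 0 ≤ TL A P q (1/8) := tsum_nonneg (fun x => Set.indicator_nonneg (fun _ _ => (Real.exp_pos _).le) x)
  set T := TL A P q (1/8) with hT
  have hTM := TM_eq A P hP q
  rw [← hT, ← hκ] at hTM
  set U := ∑' x, (Mq A q : Set (Fin 4 → ℤ)).indicator (fun x => Real.exp (-(Real.pi * 8) * (nsq (P.mulVec (ic x)) / q^2))) x with hU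
  have hUT : κ * T = 64 * |P.det| * U := by rw [hTM]; field_simp
  have hπ := Real.pi_gt_three
  -- comparison of theta series with packing sums
  have cL : ∀ K, (∀ s : Finset (Fin 4 → ℤ), (∀ x ∈ s, x ∈ Lq A q) → ∑ x ∈ s, Real.exp (-(1/4) * nsq ((P⁻¹).transpose.mulVec (ic x))) ≤ K) → T ≤ K := by
    intro K hK
    refine tsum_ind_le (Lq A q) _ _ (fun _ => (Real.exp_pos _).le) (fun x => ?_) K hK
    apply Real.exp_le_exp.2
    have := nsq_nonneg ((P⁻¹).transpose.mulVec (ic x))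
    rw [Fc]; nlinarith
  have hR : ∀ x : Fin 4 → ℤ, ((q:ℝ)⁻¹ • P).mulVec (ic x) = (q:ℝ)⁻¹ • P.mulVec (ic x) := fun x => Matrix.smul_mulVec _ _ _
  have hR2 : ∀ x : Fin 4 → ℤ, nsq (((q:ℝ)⁻¹ • P).mulVec (ic x)) = nsq (P.mulVec (ic x)) / q^2 := by
    intro x; rw [hR, nsq_smul, inv_pow]; field_simp
  have cM : ∀ K, (∀ s : Finset (Fin 4 → ℤ), (∀ x ∈ s, x ∈ Mq A q) → ∑ x ∈ s, Real.exp (-(1/4) * nsq (((q:ℝ)⁻¹ • P).mulVec (ic x))) ≤ K) → U ≤ K := by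
    intro K hK
    refine tsum_ind_le (Mq A q) _ _ (fun _ => (Real.exp_pos _).le) (fun x => ?_) K hK
    apply Real.exp_le_exp.2
    rw [hR2]
    have := nsq_nonneg (P.mulVec (ic x))
    have : 0 ≤ nsq (P.mulVec (ic x)) / q^2 := by positivity
    nlinarith
  have hpos2 : 0 ≤ Real.sqrt |P.det| * (N:ℝ)^(3/4 : ℝ) := by positivity
  by_cases hM : ∀ x ∈ Mq A q, x ≠ 0 → 1 ≤ nsq (((q:ℝ)⁻¹ • P).mulVec (ic x))
  · have hU1 : U ≤ C1 := cM C1 (fun s hs => p1 _ (Mq A q) hM s hs)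
    have h1 : Real.sqrt κ ≤ κ := by
      rw [Real.sqrt_le_iff]; exact ⟨by linarith, by nlinarith⟩
    calc Real.sqrt κ * T ≤ κ * T := mul_le_mul_of_nonneg_right h1 hTL0
      _ = 64 * |P.det| * U := hUT
      _ ≤ 64 * |P.det| * C1 := by gcongr
      _ ≤ _ := by nlinarith [mul_pos hC1 hd, mul_pos hC2 hd, mul_nonneg hC1.le hpos2, mul_nonneg hC2.le hpos2]
  by_cases hL : ∀ x ∈ Lq A q, x ≠ 0 → 1 ≤ nsq ((P⁻¹).transpose.mulVec (ic x))
  · have hT1 : T ≤ C1 := cL C1 (fun s hs => p1 _ (Lq A q) hL s hs)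
    calc Real.sqrt κ * T ≤ |P.det| * C1 := by gcongr
      _ ≤ _ := by nlinarith [mul_pos hC1 hd, mul_pos hC2 hd, mul_nonneg hC1.le hpos2, mul_nonneg hC2.le hpos2]
  push Not at hM hL
  obtain ⟨x0, hx0, hx0n, hx01⟩ := hM
  obtain ⟨c0, hc0, hc0n, hc01⟩ := hL
  have hIntg : ∀ x ∈ Mq A q, ∀ c ∈ Lq A q, ∃ k : ℤ, dt (((q:ℝ)⁻¹ • P).mulVec (ic x)) ((P⁻¹).transpose.mulVec (ic c)) = k := by
    intro x hx c hc
    have h1 := hc _ hx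
    rw [castv_dt, ZMod.intCast_zmod_eq_zero_iff_dvd] at h1
    obtain ⟨k, hk⟩ := h1
    refine ⟨k, ?_⟩
    rw [hR, dt_smul_left, pairing hP, dt_comm, hk]; push_cast; field_simp
  have hTL : T ≤ C2 * ((g:ℝ)/N) ^ (-(3/2) : ℝ) := by
    apply cL
    intro s hs
    refine p2 _ (Lq A q) ((g:ℝ)/N) (by positivity) (by rw [div_le_one hNr]; exact hgN) (fun c hc hc0 => Lq_lower hPA hP hN hAB q hq c hc hc0)
      (((q:ℝ)⁻¹ • P).mulVec (ic x0)) ?_ hx01.le (fun c hc => hIntg x0 hx0 c hc) s hs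
    rw [hR2]
    have := nsqP_pos hP hx0n
    positivity
  have hUM : U ≤ C2 * ((1:ℝ)/g) ^ (-(3/2) : ℝ) := by
    apply cM
    intro s hs
    refine p2 _ (Mq A q) ((1:ℝ)/g) (by positivity) (by rw [div_le_one hgr]; exact hg1) (fun c hc hc0 => ?_)
      ((P⁻¹).transpose.mulVec (ic c0)) (nsqP_pos (det_invT hP) hc0n) hc01.le (fun x hx => ?_) s hs
    · rw [hR2]; exact Mq_lower hPA hP hN hB hBA q hq c hc hc0
    · obtain ⟨k, hk⟩ := hIntg x hx c0 hc0
      exact ⟨k, by rw [dt_comm]; exact hk⟩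
  have hU0 : 0 ≤ U := tsum_nonneg (fun x => Set.indicator_nonneg (fun _ _ => (Real.exp_pos _).le) x)
  have hprod : ((g:ℝ)/N) ^ (-(3/2) : ℝ) * ((1:ℝ)/g) ^ (-(3/2) : ℝ) = ((N:ℝ)^(3/4 : ℝ))^2 := by
    rw [← Real.mul_rpow (by positivity) (by positivity), ← Real.rpow_natCast, ← Real.rpow_mul hNr.le]
    have : (g:ℝ)/N * (1/g) = (N:ℝ)⁻¹ := by field_simp
    rw [this, Real.inv_rpow hNr.le, Real.rpow_neg hNr.le, inv_inv]; norm_num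
  have hsq : (Real.sqrt κ * T)^2 ≤ (8 * C2 * (Real.sqrt |P.det| * (N:ℝ)^(3/4 : ℝ)))^2 := by
    have : (Real.sqrt κ * T)^2 = 64 * |P.det| * (T * U) := by
      rw [mul_pow, Real.sq_sqrt (by linarith)]
      linear_combination T * hUT
    rw [this]
    have h2 : T * U ≤ (C2 * ((g:ℝ)/N) ^ (-(3/2) : ℝ)) * (C2 * ((1:ℝ)/g) ^ (-(3/2) : ℝ)) := by gcongr
    have h3 : (C2 * ((g:ℝ)/N) ^ (-(3/2) : ℝ)) * (C2 * ((1:ℝ)/g) ^ (-(3/2) : ℝ)) = C2^2 * ((N:ℝ)^(3/4 : ℝ))^2 := by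
      rw [← hprod]; ring
    rw [h3] at h2
    calc _ ≤ 64 * |P.det| * (C2^2 * ((N:ℝ)^(3/4 : ℝ))^2) := by gcongr
      _ = _ := by
        rw [mul_pow, mul_pow, mul_pow, Real.sq_sqrt hd.le]; ring
  have := le_of_sq_le_sq hsq (by positivity)
  nlinarith [mul_pos hC1 hd, mul_pos hC2 hd, mul_nonneg hC1.le hpos2, mul_nonneg hC2.le hpos2]

end QF

namespace QF
open MeasureTheory

lemma Fc_zsmul (P : Matrix (Fin 4) (Fin 4) ℝ) (k : ℤ) (c : Fin 4 → ℤ) : Fc P (k • c) = (k:ℝ)^2 * Fc P c := by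
  have : ic (k • c) = (k:ℝ) • ic c := by funext i; simp [ic]
  rw [Fc, this, Matrix.mulVec_smul, nsq_smul, Fc]

lemma Fc_nonneg (P : Matrix (Fin 4) (Fin 4) ℝ) (c : Fin 4 → ℤ) : 0 ≤ Fc P c := nsq_nonneg _

/-- primitive vectors of a subgroup -/
def LPrim (Λ : AddSubgroup (Fin 4 → ℤ)) (c : Fin 4 → ℤ) : Prop :=
  c ∈ Λ ∧ c ≠ 0 ∧ ∀ (a : ℤ) (d : Fin 4 → ℤ), 0 < a → d ∈ Λ → c = a • d → a = 1

lemma exists_prim (Λ : AddSubgroup (Fin 4 → ℤ)) (c : Fin 4 → ℤ) (hc : c ∈ Λ) (h0 : c ≠ 0) :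
    ∃ (k : ℤ) (d : Fin 4 → ℤ), 0 < k ∧ LPrim Λ d ∧ c = k • d := by
  obtain ⟨i, hi⟩ := Function.ne_iff.1 h0
  have hi' : c i ≠ 0 := hi
  induction hm : (c i).natAbs using Nat.strong_induction_on generalizing c with
  | _ m ih =>
    by_cases hp : LPrim Λ c
    · exact ⟨1, c, one_pos, hp, (one_smul _ _).symm⟩
    · have : ∃ (a : ℤ) (d : Fin 4 → ℤ), 0 < a ∧ d ∈ Λ ∧ c = a • d ∧ a ≠ 1 := by
        by_contra hcon
        push Not at hcon
        exact hp ⟨hc, h0, hcon⟩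
      obtain ⟨a, d, ha, hd, hcd, ha1⟩ := this
      have hci : c i = a * d i := by rw [hcd]; simp
      have hdi : d i ≠ 0 := by rintro h; rw [h, mul_zero] at hci; exact hi' hci
      have hd0 : d ≠ 0 := by rintro h; apply hdi; rw [h]; rfl
      have hlt : (d i).natAbs < m := by
        rw [← hm, hci, Int.natAbs_mul]
        have h1 : 2 ≤ a.natAbs := by omega
        have h2 : 0 < (d i).natAbs := Int.natAbs_pos.2 hdi
        nlinarith
      obtain ⟨k, e, hk, he, hde⟩ := ih _ hlt d hd hd0 hdi hdi rfl
      exact ⟨a * k, e, by positivity, he, by rw [hcd, hde, smul_smul]⟩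

lemma prim_unique (Λ : AddSubgroup (Fin 4 → ℤ)) (c d : Fin 4 → ℤ) (hc : LPrim Λ c) (hd : LPrim Λ d) (m k : ℤ) (hm : 0 < m) (hk : 0 < k)
    (h : m • c = k • d) : m = k ∧ c = d := by
  obtain ⟨g, a, b, hg, hab, ha, hb⟩ : ∃ g a b : ℤ, 0 < g ∧ IsCoprime a b ∧ m = a * g ∧ k = b * g := by
    obtain ⟨g, a, b, hg, hab, ha, hb⟩ := Int.exists_gcd_one' (m := m) (n := k) (Int.gcd_pos_of_ne_zero_left _ hm.ne')
    exact ⟨g, a, b, by exact_mod_cast hg, Int.isCoprime_iff_gcd_eq_one.2 hab, ha, hb⟩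
  have ha0 : 0 < a := by rw [ha] at hm; exact pos_of_mul_pos_left hm hg.le
  have hb0 : 0 < b := by rw [hb] at hk; exact pos_of_mul_pos_left hk hg.le
  have h1 : a • c = b • d := by
    funext i
    have := congrFun h i
    simp only [Pi.smul_apply, smul_eq_mul] at this ⊢
    rw [ha, hb] at this
    have hg' : g ≠ 0 := hg.ne'
    apply mul_left_cancel₀ hg'
    linear_combination this
  obtain ⟨x, y, hxy⟩ := hab
  have hcm := hc.1
  have hdm := hd.1
  have ea : a = 1 := by
    apply hd.2.2 a (x • d + y • c) ha0 (Λ.add_mem (Λ.zsmul_mem hdm x) (Λ.zsmul_mem hcm y))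
    funext i
    have := congrFun h1 i
    simp only [Pi.smul_apply, Pi.add_apply, smul_eq_mul] at this ⊢
    linear_combination (-(d i)) * hxy - y * this
  have eb : b = 1 := by
    apply hc.2.2 b (x • d + y • c) hb0 (Λ.add_mem (Λ.zsmul_mem hdm x) (Λ.zsmul_mem hcm y))
    funext i
    have := congrFun h1 i
    simp only [Pi.smul_apply, Pi.add_apply, smul_eq_mul] at this ⊢
    linear_combination (-(c i)) * hxy + x * this
  refine ⟨by rw [ha, hb, ea, eb], ?_⟩
  rw [ea, eb, one_smul, one_smul] at h1; exact h1

lemma tail_fin (A : Matrix (Fin 4) (Fin 4) ℤ) (P : Matrix (Fin 4) (Fin 4) ℝ) (hP : P.det ≠ 0) (q : ℕ) (J : ℕ) (hJ : 0 < J) (u : ℝ) (hu : (J:ℝ)^2 ≤ 2 * u)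
    (s : Finset (Fin 4 → ℤ)) (hs : ∀ c ∈ s, c ≠ 0 ∧ (2:ℤ) • c ∈ Lq A q) :
    (J:ℝ) * ∑ c ∈ s, Real.exp (-(Real.pi * u) * Fc P c) ≤ TL A P q (1/8) := by
  classical
  have hπ := Real.pi_pos
  have hex : ∀ c : Fin 4 → ℤ, ∃ (k : ℤ) (d : Fin 4 → ℤ), c ∈ s → 0 < k ∧ LPrim (Lq A q) d ∧ (2:ℤ) • c = k • d := by
    intro c
    by_cases hc : c ∈ s
    · obtain ⟨k, d, h⟩ := exists_prim (Lq A q) ((2:ℤ) • c) (hs c hc).2 (by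
        intro h; apply (hs c hc).1; funext i
        have := congrFun h i
        simp at this; exact this)
      exact ⟨k, d, fun _ => h⟩
    · exact ⟨0, 0, fun h => absurd h hc⟩
  choose k d hkd using hex
  have hJ' : (0:ℤ) < J := by exact_mod_cast hJ
  let φ : (Fin 4 → ℤ) × ℕ → (Fin 4 → ℤ) := fun p => (k p.1 * J - p.2) • d p.1
  have hpos : ∀ c ∈ s, ∀ j < J, 0 < k c * J - (j:ℤ) := by
    intro c hc j hj
    have h1 := (hkd c hc).1
    have h2 : (j:ℤ) < J := by exact_mod_cast hj
    nlinarith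
  have hinj : Set.InjOn φ (s ×ˢ Finset.range J : Finset _) := by
    rintro ⟨c, j⟩ h1 ⟨c', j'⟩ h2 h
    simp only [Finset.coe_product, Set.mem_prod, Finset.mem_coe, Finset.mem_range] at h1 h2
    obtain ⟨hc, hj⟩ := h1
    obtain ⟨hc', hj'⟩ := h2
    obtain ⟨e1, e2⟩ := prim_unique _ _ _ (hkd c hc).2.1 (hkd c' hc').2.1 _ _ (hpos c hc j hj) (hpos c' hc' j' hj') h
    have hj1 : (j:ℤ) < J := by exact_mod_cast hj
    have hj2 : (j':ℤ) < J := by exact_mod_cast hj'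
    have hk : k c = k c' := by
      by_contra hne
      rcases lt_or_gt_of_ne hne with hlt | hlt
      · nlinarith
      · nlinarith
    have hjj : j = j' := by rw [hk] at e1; omega
    have hcc : c = c' := by
      have a1 := (hkd c hc).2.2
      have a2 := (hkd c' hc').2.2
      rw [hk, e2, ← a2] at a1
      funext i
      have := congrFun a1 i
      simpa using this
    rw [hcc, hjj]
  have hle : ∀ c ∈ s, ∀ j < J, Real.exp (-(Real.pi * u) * Fc P c) ≤ Real.exp (-(Real.pi * (1/8)) * Fc P (φ (c, j))) := by
    intro c hc j hj
    apply Real.exp_le_exp.2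
    have h1 : Fc P ((2:ℤ) • c) = 4 * Fc P c := by rw [Fc_zsmul]; norm_num
    rw [(hkd c hc).2.2, Fc_zsmul] at h1
    simp only [φ]
    rw [Fc_zsmul]
    have h0 := Fc_nonneg P (d c)
    have h3 : (0:ℝ) ≤ ((k c * J - (j:ℤ) : ℤ) : ℝ) := by exact_mod_cast (hpos c hc j hj).le
    have h4 : ((k c * J - (j:ℤ) : ℤ) : ℝ) ≤ (k c : ℝ) * J := by push_cast; linarith [Nat.cast_nonneg (α := ℝ) j]
    have h5 : ((k c * J - (j:ℤ) : ℤ) : ℝ)^2 ≤ (k c : ℝ)^2 * (2*u) := by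
      calc _ ≤ ((k c : ℝ) * J)^2 := pow_le_pow_left₀ h3 h4 2
        _ = (k c : ℝ)^2 * J^2 := by ring
        _ ≤ _ := by gcongr
    have h6 : ((k c * J - (j:ℤ) : ℤ) : ℝ)^2 * Fc P (d c) ≤ 8 * u * Fc P c := by
      calc _ ≤ (k c : ℝ)^2 * (2*u) * Fc P (d c) := by gcongr
        _ = _ := by linear_combination (2*u) * h1
    nlinarith
  have hmem : ∀ c ∈ s, ∀ j, φ (c, j) ∈ Lq A q := fun c hc j => (Lq A q).zsmul_mem (hkd c hc).2.1.1 _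
  calc (J:ℝ) * ∑ c ∈ s, Real.exp (-(Real.pi * u) * Fc P c) = ∑ p ∈ s ×ˢ Finset.range J, Real.exp (-(Real.pi * u) * Fc P p.1) := by
        rw [Finset.sum_product, Finset.mul_sum]
        apply Finset.sum_congr rfl
        intro c _; simp
    _ ≤ ∑ p ∈ s ×ˢ Finset.range J, (Lq A q : Set (Fin 4 → ℤ)).indicator (fun c => Real.exp (-(Real.pi * (1/8)) * Fc P c)) (φ p) := by
        apply Finset.sum_le_sum
        rintro ⟨c, j⟩ h
        simp only [Finset.mem_product, Finset.mem_range] at h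
        rw [Set.indicator_of_mem (show φ (c, j) ∈ (Lq A q : Set (Fin 4 → ℤ)) from hmem c h.1 j)]
        exact hle c h.1 j h.2
    _ = ∑ y ∈ (s ×ˢ Finset.range J).image φ, (Lq A q : Set (Fin 4 → ℤ)).indicator (fun c => Real.exp (-(Real.pi * (1/8)) * Fc P c)) y := by
        rw [Finset.sum_image hinj]
    _ ≤ TL A P q (1/8) := by
        apply Summable.sum_le_tsum _ (fun x _ => Set.indicator_nonneg (fun _ _ => (Real.exp_pos _).le) x) (TL_summable A P hP q (1/8) (by norm_num))

lemma tail_bound (A : Matrix (Fin 4) (Fin 4) ℤ) (P : Matrix (Fin 4) (Fin 4) ℝ) (hP : P.det ≠ 0) (q : ℕ) (u : ℝ) (hu : 1/2 ≤ u) :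
    ∑' c, ({c : Fin 4 → ℤ | c ≠ 0 ∧ (2:ℤ) • c ∈ Lq A q}).indicator (fun c => Real.exp (-(Real.pi * u) * Fc P c)) c ≤ 2 / Real.sqrt u * TL A P q (1/8) := by
  classical
  have hTL0 : 0 ≤ TL A P q (1/8) := tsum_nonneg (fun x => Set.indicator_nonneg (fun _ _ => (Real.exp_pos _).le) x)
  apply Real.tsum_le_of_sum_le
  · intro x; exact Set.indicator_nonneg (fun x _ => (Real.exp_pos _).le) x
  intro s
  have e : ∑ x ∈ s, ({c : Fin 4 → ℤ | c ≠ 0 ∧ (2:ℤ) • c ∈ Lq A q}).indicator (fun c => Real.exp (-(Real.pi * u) * Fc P c)) x =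
      ∑ x ∈ s.filter (fun c => c ≠ 0 ∧ (2:ℤ) • c ∈ Lq A q), Real.exp (-(Real.pi * u) * Fc P x) := by
    rw [Finset.sum_filter]
    apply Finset.sum_congr rfl
    intro x _
    simp [Set.indicator_apply]
  rw [e]
  have hsu : 0 < Real.sqrt u := Real.sqrt_pos.2 (by linarith)
  set J := ⌊Real.sqrt (2*u)⌋₊ with hJ
  have h1 : 1 ≤ Real.sqrt (2*u) := by rw [Real.one_le_sqrt]; linarith
  have hJ1 : 0 < J := Nat.floor_pos.2 h1
  have hJ2 : (J:ℝ) ≤ Real.sqrt (2*u) := Nat.floor_le (by positivity)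
  have hJ3 : Real.sqrt (2*u) < J + 1 := Nat.lt_floor_add_one _
  have hJ4 : (J:ℝ)^2 ≤ 2 * u := by
    have := pow_le_pow_left₀ (Nat.cast_nonneg J) hJ2 2
    rwa [Real.sq_sqrt (by linarith)] at this
  have h := tail_fin A P hP q J hJ1 u hJ4 (s.filter (fun c => c ≠ 0 ∧ (2:ℤ) • c ∈ Lq A q)) (fun c hc => (Finset.mem_filter.1 hc).2)
  have hJr : (1:ℝ) ≤ J := by exact_mod_cast hJ1
  have hsq : Real.sqrt u ≤ Real.sqrt (2*u) := Real.sqrt_le_sqrt (by linarith)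
  have h5 : Real.sqrt u ≤ 2 * J := by linarith
  set X := ∑ x ∈ s.filter (fun c => c ≠ 0 ∧ (2:ℤ) • c ∈ Lq A q), Real.exp (-(Real.pi * u) * Fc P x) with hX
  have hX0 : 0 ≤ X := Finset.sum_nonneg (fun _ _ => (Real.exp_pos _).le)
  rw [div_mul_eq_mul_div, le_div_iff₀ hsu]
  nlinarith

lemma level_B {A : Matrix (Fin 4) (Fin 4) ℤ} {N : ℕ} (hA : IsGram A) (hdet : A.det ≠ 0) (h : IsLevel A N) :
    ∃ B, IsGram B ∧ A * B = (N : ℤ) • 1 ∧ B * A = (N : ℤ) • 1 := by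
  obtain ⟨hN, ⟨B, hB, hBd⟩, -⟩ := h
  have hinj : Function.Injective (fun M : Matrix (Fin 4) (Fin 4) ℤ => M.map (Int.cast : ℤ → ℚ)) :=
    Matrix.map_injective Int.cast_injective
  have hd : IsUnit (A.map (Int.cast : ℤ → ℚ)).det := by
    have : (A.map (Int.cast : ℤ → ℚ)).det = ((A.det : ℤ) : ℚ) := (Int.cast_det A).symm
    rw [this, isUnit_iff_ne_zero]; exact_mod_cast hdet
  have e : ((N : ℤ) • (1 : Matrix (Fin 4) (Fin 4) ℤ)).map (Int.cast : ℤ → ℚ) = (N : ℚ) • 1 := by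
    ext i j
    simp only [Matrix.map_apply, Matrix.smul_apply, Matrix.one_apply]
    by_cases h : i = j <;> simp [h]
  have m : ∀ X Y : Matrix (Fin 4) (Fin 4) ℤ, (X * Y).map (Int.cast : ℤ → ℚ) = X.map (Int.cast : ℤ → ℚ) * Y.map (Int.cast : ℤ → ℚ) := by
    intro X Y; exact Matrix.map_mul (f := Int.castRingHom ℚ)
  refine ⟨B, ⟨?_, hBd⟩, ?_, ?_⟩
  · apply hinj
    show B.transpose.map (Int.cast : ℤ → ℚ) = B.map (Int.cast : ℤ → ℚ)
    rw [Matrix.transpose_map, hB, Matrix.transpose_smul, Matrix.transpose_nonsing_inv, ← Matrix.transpose_map, hA.1]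
  · apply hinj
    show (A * B).map (Int.cast : ℤ → ℚ) = ((N : ℤ) • (1 : Matrix (Fin 4) (Fin 4) ℤ)).map (Int.cast : ℤ → ℚ)
    rw [e, m, hB, Matrix.mul_smul, Matrix.mul_nonsing_inv _ hd]
  · apply hinj
    show (B * A).map (Int.cast : ℤ → ℚ) = ((N : ℤ) • (1 : Matrix (Fin 4) (Fin 4) ℤ)).map (Int.cast : ℤ → ℚ)
    rw [e, m, hB, Matrix.smul_mul, Matrix.nonsing_inv_mul _ hd]

end QF

namespace QF
open MeasureTheory

noncomputable def ee (t : ℝ) : ℂ := Complex.exp (2 * Real.pi * Complex.I * t)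

lemma ee_add (s t : ℝ) : ee (s + t) = ee s * ee t := by
  rw [ee, ee, ee, ← Complex.exp_add]; congr 1; push_cast; ring

lemma ee_int (k : ℤ) : ee k = 1 := by
  rw [ee]
  have := Complex.exp_int_mul_two_pi_mul_I k
  rw [← this]; congr 1; push_cast; ring

lemma ee_norm (t : ℝ) : ‖ee t‖ = 1 := by
  rw [ee]
  have : (2 * Real.pi * Complex.I * t : ℂ) = ((2 * Real.pi * t : ℝ) : ℂ) * Complex.I := by push_cast; ring
  rw [this, Complex.norm_exp_ofReal_mul_I]

lemma ee_conj (t : ℝ) : (starRingEnd ℂ) (ee t) = ee (-t) := by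
  rw [ee, ee, ← Complex.exp_conj]; congr 1; simp [Complex.conj_ofNat]

lemma ee_continuous : Continuous ee := by unfold ee; fun_prop

lemma ee_zero : ee 0 = 1 := by simp [ee]

lemma ee_std (q : ℕ) [NeZero q] (j : ℤ) : (ZMod.stdAddChar (j : ZMod q) : ℂ) = ee (j / q) := by
  rw [ZMod.stdAddChar_coe, ee]; congr 1; push_cast; ring

noncomputable def gf (A : Matrix (Fin 4) (Fin 4) ℤ) (n : ℕ) (α : ℝ) : ℂ :=
  ∑' x : Fin 4 → ℤ, (Real.exp (-(2 * Real.pi / n) * ((Qval A x : ℤ) : ℝ)) : ℂ) * ee ((((Qval A x : ℤ) : ℝ) - n) * α)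

section
variable {A : Matrix (Fin 4) (Fin 4) ℤ} {P : Matrix (Fin 4) (Fin 4) ℝ} {n : ℕ}

lemma nsq_Q (hA : IsGram A) (hPA : P.transpose * P = A.map (Int.cast : ℤ → ℝ)) (x : Fin 4 → ℤ) :
    nsq (P.mulVec (ic x)) = 2 * ((Qval A x : ℤ) : ℝ) := by
  rw [nsqP hPA]
  have := two_Qval hA x
  have h2 : mulv A x = A.mulVec x := by simp [mulv]; congr 1
  rw [h2] at this
  rw [← this]; push_cast; ring

lemma gf_summable (hA : IsGram A) (hPA : P.transpose * P = A.map (Int.cast : ℤ → ℝ)) (hP : P.det ≠ 0) (hn : 0 < n) :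
    Summable (fun x : Fin 4 → ℤ => Real.exp (-(2 * Real.pi / n) * ((Qval A x : ℤ) : ℝ))) := by
  have hnr : (0:ℝ) < n := by exact_mod_cast hn
  have := gauss_summable P hP (Real.pi / n) (by positivity) 0
  refine this.congr (fun x => ?_)
  rw [add_zero, nsq_Q hA hPA]; congr 1; ring

lemma gf_term_norm (x : Fin 4 → ℤ) (α : ℝ) :
    ‖(Real.exp (-(2 * Real.pi / n) * ((Qval A x : ℤ) : ℝ)) : ℂ) * ee ((((Qval A x : ℤ) : ℝ) - n) * α)‖ = Real.exp (-(2 * Real.pi / n) * ((Qval A x : ℤ) : ℝ)) := by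
  rw [norm_mul, ee_norm, mul_one, Complex.norm_real, Real.norm_of_nonneg (Real.exp_pos _).le]

lemma gf_continuous (hA : IsGram A) (hPA : P.transpose * P = A.map (Int.cast : ℤ → ℝ)) (hP : P.det ≠ 0) (hn : 0 < n) :
    Continuous (gf A n) := by
  apply continuous_tsum _ (gf_summable hA hPA hP hn)
  · intro x α; rw [gf_term_norm]
  · intro x
    exact continuous_const.mul (ee_continuous.comp (by fun_prop))

lemma gf_add_int (α : ℝ) (k : ℤ) : gf A n (α + k) = gf A n α := by
  apply tsum_congr
  intro x
  congr 1
  rw [mul_add, ee_add]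
  have : (((Qval A x : ℤ) : ℝ) - n) * (k:ℝ) = (((Qval A x - n) * k : ℤ) : ℝ) := by push_cast; ring
  rw [this, ee_int, mul_one]

lemma gf_neg (α : ℝ) : gf A n (-α) = (starRingEnd ℂ) (gf A n α) := by
  rw [gf, gf, Complex.conj_tsum]
  apply tsum_congr
  intro x
  rw [map_mul, ee_conj, Complex.conj_ofReal]
  congr 2; ring

lemma gf_integral (hA : IsGram A) (hPA : P.transpose * P = A.map (Int.cast : ℤ → ℝ)) (hP : P.det ≠ 0) (hn : 0 < n)
    (hrep : ¬ Represented A n) : ∫ α in (0:ℝ)..1, gf A n α = 0 := by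
  let f : (Fin 4 → ℤ) → C(ℝ, ℂ) := fun x => ⟨fun α => (Real.exp (-(2 * Real.pi / n) * ((Qval A x : ℤ) : ℝ)) : ℂ) * ee ((((Qval A x : ℤ) : ℝ) - n) * α),
    continuous_const.mul (ee_continuous.comp (by fun_prop))⟩
  have hs : Summable fun i => ‖(f i).restrict (⟨Set.uIcc 0 1, isCompact_uIcc⟩ : TopologicalSpace.Compacts ℝ)‖ := by
    refine Summable.of_nonneg_of_le (fun _ => norm_nonneg _) (fun x => ?_) (gf_summable hA hPA hP hn)
    rw [ContinuousMap.norm_le _ (Real.exp_pos _).le]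
    intro α
    exact (gf_term_norm x _).le
  have h := intervalIntegral.hasSum_intervalIntegral_of_summable_norm hs
  have h0 : ∀ x, ∫ α in (0:ℝ)..1, f x α = 0 := by
    intro x
    simp only [f, ContinuousMap.coe_mk]
    rw [intervalIntegral.integral_const_mul]
    have hk : (Qval A x : ℤ) - n ≠ 0 := fun h => hrep ⟨x, by linarith⟩
    set k : ℤ := (Qval A x : ℤ) - n with hkk
    have e : ∀ α : ℝ, ee ((((Qval A x : ℤ) : ℝ) - n) * α) = Complex.exp ((2 * Real.pi * Complex.I * k) * α) := by
      intro α; rw [ee, hkk]; congr 1; push_cast; ring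
    simp_rw [e]
    rw [integral_exp_mul_complex]
    · have := Complex.exp_int_mul_two_pi_mul_I k
      have e2 : Complex.exp ((2 * Real.pi * Complex.I * k) * ((1:ℝ):ℂ)) = 1 := by
        rw [← this]; congr 1; push_cast; ring
      rw [e2]; simp
    · have : (k:ℂ) ≠ 0 := by exact_mod_cast hk
      have hπ : (Real.pi : ℂ) ≠ 0 := by exact_mod_cast Real.pi_ne_zero
      simp [this, hπ]
  have h1 : (fun x => ∫ α in (0:ℝ)..1, f x α) = fun _ => 0 := funext h0
  rw [h1] at h
  exact (h.unique hasSum_zero)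

lemma gf_theta (hA : IsGram A) (hPA : P.transpose * P = A.map (Int.cast : ℤ → ℝ)) (hP : P.det ≠ 0) (hn : 0 < n)
    (q : ℕ) [NeZero q] (a : ℤ) (β : ℝ) (τ : ℂ) (hτ : τ = (1 / n : ℝ) - Complex.I * β) :
    HasSum (fun c : Fin 4 → ℤ => ee (-(n * (a / q + β))) * (((|P.det|⁻¹ : ℝ) * ((q^2 * τ)⁻¹) ^ 2 * Complex.exp (-(Real.pi * (q^2 * τ)⁻¹ * (Fc P c : ℝ)))) *
        G A (ZMod.stdAddChar (N := q)) (a : ZMod q) (fun i => (c i : ZMod q))))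
      (gf A n (a / q + β)) := by
  have hnr : (0:ℝ) < n := by exact_mod_cast hn
  have hτr : 0 < τ.re := by
    have : τ.re = 1 / n := by
      rw [hτ]; simp [-one_div]
    rw [this]; positivity
  have h := (theta_w P hP τ hτr q (fun r => ZMod.stdAddChar ((a : ZMod q) * Qval A r))).mul_left (ee (-(n * (a / q + β))))
  have h2 : ee (-(n * (a / q + β))) * ∑' x : Fin 4 → ℤ, ZMod.stdAddChar ((a : ZMod q) * Qval A (fun i => (x i : ZMod q))) * Complex.exp (-(Real.pi * τ * nsq (P.mulVec (ic x)))) = gf A n (a / q + β) := by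
    rw [gf, ← tsum_mul_left]
    apply tsum_congr
    intro x
    have e1 : (a : ZMod q) * Qval A (fun i => (x i : ZMod q)) = ((a * Qval A x : ℤ) : ZMod q) := by
      have := Qval_map (Int.castRingHom (ZMod q)) A x
      simp only [eq_intCast] at this
      rw [← this]; push_cast; ring
    rw [e1, ee_std, nsq_Q hA hPA, hτ]
    simp only [ee]
    rw [Complex.ofReal_exp, ← Complex.exp_add, ← Complex.exp_add, ← Complex.exp_add]
    congr 1
    push_cast
    ring_nf
  have h3 : (fun c : Fin 4 → ℤ => ee (-(n * (a / q + β))) * (((|P.det|⁻¹ : ℝ) * ((q^2 * τ)⁻¹) ^ 2 * Complex.exp (-(Real.pi * (q^2 * τ)⁻¹ * (Fc P c : ℝ)))) *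
        G A (ZMod.stdAddChar (N := q)) (a : ZMod q) (fun i => (c i : ZMod q)))) = fun c : Fin 4 → ℤ => ee (-(n * (a / q + β))) * (((|P.det|⁻¹ : ℝ) * ((q^2 * τ)⁻¹) ^ 2 * Complex.exp (-(Real.pi * (q^2 * τ)⁻¹ * nsq ((P⁻¹).transpose.mulVec (ic c))))) *
        ∑ r : Fin 4 → ZMod q, ZMod.stdAddChar ((a : ZMod q) * Qval A r) * ZMod.stdAddChar (dt (fun i => (c i : ZMod q)) r)) := by
    funext c
    rw [G, Fc]
    congr 2
    apply Finset.sum_congr rfl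
    intro r _
    rw [AddChar.map_add_eq_mul]
  rw [← h2, h3]
  exact h

end
end QF

namespace QF
open MeasureTheory

section
variable (g : ℝ → ℂ)

noncomputable def Jf (q r : ℕ) : ℂ := ∫ α in (-(Nat.gcdB q r : ℝ) / q)..((Nat.gcdA q r : ℝ) / r), g α

noncomputable def Hf (q r : ℕ) : ℂ := ∫ β in (0:ℝ)..(1 / ((q:ℝ) * (q + r))), g (-(Nat.gcdB q r : ℝ) / q + β)

def SY (Y : ℕ) : Finset (ℕ × ℕ) := (Finset.Icc 1 Y ×ˢ Finset.Icc 1 Y).filter (fun p => p.1.Coprime p.2 ∧ Y < p.1 + p.2)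

variable {g}

lemma bez (q r : ℕ) (h : q.Coprime r) : (r:ℤ) * Nat.gcdB q r + q * Nat.gcdA q r = 1 := by
  have := Nat.gcd_eq_gcd_ab q r
  rw [h] at this
  push_cast at this; linarith

lemma bez_shift {q r : ℕ} (h : q.Coprime r) (u v u' v' : ℤ) (h1 : (r:ℤ) * u + q * v = 1) (h2 : (r:ℤ) * u' + q * v' = 1) (hq : 0 < q) :
    ∃ k : ℤ, u' = u + q * k ∧ v' = v - r * k := by
  have h3 : (q:ℤ) ∣ r * (u' - u) := ⟨v - v', by linarith⟩
  have h4 : (q:ℤ) ∣ u' - u := by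
    refine IsCoprime.dvd_of_dvd_mul_left ?_ h3
    exact Nat.isCoprime_iff_coprime.2 h
  obtain ⟨k, hk⟩ := h4
  refine ⟨k, by linarith, ?_⟩
  have hq' : (q:ℤ) ≠ 0 := by exact_mod_cast hq.ne'
  apply mul_left_cancel₀ hq'
  have : u' = u + q * k := by linarith
  rw [this] at h2
  linarith

lemma int_shift (hp : ∀ α (k : ℤ), g (α + k) = g α) (a b : ℝ) (k : ℤ) : ∫ α in (a + k)..(b + k), g α = ∫ α in a..b, g α := by
  rw [← intervalIntegral.integral_comp_add_right]
  simp_rw [hp]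

lemma Jf_eq (hp : ∀ α (k : ℤ), g (α + k) = g α) {q r : ℕ} (h : q.Coprime r) (hq : 0 < q) (hr : 0 < r) (u v : ℤ) (h1 : (r:ℤ) * u + q * v = 1) :
    Jf g q r = ∫ α in (-(u : ℝ) / q)..((v : ℝ) / r), g α := by
  obtain ⟨k, hu, hv⟩ := bez_shift h u v _ _ h1 (bez q r h) hq
  have hq' : (q:ℝ) ≠ 0 := by exact_mod_cast hq.ne'
  have hr' : (r:ℝ) ≠ 0 := by exact_mod_cast hr.ne'
  rw [Jf, hu, hv, ← int_shift hp (-(u : ℝ) / q) ((v : ℝ) / r) (-k)]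
  congr 1 <;> push_cast <;> field_simp <;> ring

lemma Jf_split (hc : Continuous g) (hp : ∀ α (k : ℤ), g (α + k) = g α) {q r : ℕ} (h : q.Coprime r) (hq : 0 < q) (hr : 0 < r) :
    Jf g q r = Jf g q (q + r) + Jf g (q + r) r := by
  set u := Nat.gcdB q r with hu
  set v := Nat.gcdA q r with hv
  have hb := bez q r h
  rw [← hu, ← hv] at hb
  rw [Jf_eq hp h hq hr u v hb, Jf_eq hp (by simpa using h) hq (by omega) u (v - u) (by push_cast; linarith),
    Jf_eq hp (by simpa using h) (by omega) hr (u - v) v (by push_cast; linarith)]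
  have : (-((u - v : ℤ) : ℝ)) / ((q + r : ℕ) : ℝ) = ((v - u : ℤ) : ℝ) / ((q + r : ℕ) : ℝ) := by push_cast; ring
  rw [this]
  exact (intervalIntegral.integral_add_adjacent_intervals (hc.intervalIntegrable _ _) (hc.intervalIntegrable _ _)).symm

lemma Jf_H (hc : Continuous g) (hp : ∀ α (k : ℤ), g (α + k) = g α) (hneg : ∀ α, g (-α) = (starRingEnd ℂ) (g α)) {q r : ℕ} (h : q.Coprime r) (hq : 0 < q) (hr : 0 < r) :
    Jf g q r = Hf g q r + (starRingEnd ℂ) (Hf g r q) := by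
  set u := Nat.gcdB q r with hu
  set v := Nat.gcdA q r with hv
  have hb := bez q r h
  rw [← hu, ← hv] at hb
  have hq' : (q:ℝ) ≠ 0 := by exact_mod_cast hq.ne'
  have hr' : (r:ℝ) ≠ 0 := by exact_mod_cast hr.ne'
  have hqr' : (q:ℝ) + r ≠ 0 := by positivity
  have hbr : (r:ℝ) * u + q * v = 1 := by exact_mod_cast hb
  rw [Jf, ← hu, ← hv, ← intervalIntegral.integral_add_adjacent_intervals (b := ((v:ℝ) - u) / (q + r)) (hc.intervalIntegrable _ _) (hc.intervalIntegrable _ _)]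
  congr 1
  · rw [Hf, ← hu]
    rw [intervalIntegral.integral_comp_add_left (fun x => g x)]
    congr 1
    · ring
    · field_simp; linear_combination hbr
  · obtain ⟨k, hk, -⟩ := bez_shift h.symm v u _ _ (by linarith) (bez r q h.symm) hr
    rw [Hf, hk]
    have e : ∀ β : ℝ, g (-((v + r * k : ℤ) : ℝ) / r + β) = (starRingEnd ℂ) (g ((v:ℝ) / r - β)) := by
      intro β
      rw [← hneg, ← hp _ k]
      congr 1; push_cast; field_simp; ring
    simp_rw [e]
    rw [intervalIntegral.intervalIntegral_conj, Complex.conj_conj, intervalIntegral.integral_comp_sub_left (fun x => g x)]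
    congr 1
    · field_simp; linear_combination (-((r:ℝ)+q)) * hbr
    · ring

lemma T_step (hc : Continuous g) (hp : ∀ α (k : ℤ), g (α + k) = g α) (Y : ℕ) (hY : 1 ≤ Y) :
    ∑ p ∈ SY (Y + 1), Jf g p.1 p.2 = ∑ p ∈ SY Y, Jf g p.1 p.2 := by
  classical
  set K := (Finset.Icc 1 Y).filter (fun q => q.Coprime (Y + 1)) with hK
  set M := (SY Y).filter (fun p => Y + 1 < p.1 + p.2) with hM
  have h1 : SY (Y + 1) = M ∪ (K.image (fun q => (q, Y + 1)) ∪ K.image (fun q => (Y + 1, Y + 1 - q))) := by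
    ext ⟨a, b⟩
    simp only [SY, hM, hK, Finset.mem_union, Finset.mem_filter, Finset.mem_product, Finset.mem_Icc, Finset.mem_image, Prod.mk.injEq]
    constructor
    · rintro ⟨⟨⟨ha, ha'⟩, hb, hb'⟩, hco, hs⟩
      by_cases haY : a = Y + 1
      · have hbY : b ≠ Y + 1 := by
          rintro rfl; rw [haY, Nat.coprime_self] at hco; omega
        right; right
        refine ⟨Y + 1 - b, ⟨⟨by omega, by omega⟩, ?_⟩, by omega, by omega⟩
        rw [haY] at hco
        exact (Nat.coprime_self_sub_left (by omega)).2 hco.symm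
      · by_cases hbY : b = Y + 1
        · right; left
          exact ⟨a, ⟨⟨by omega, by omega⟩, by rw [← hbY]; exact hco⟩, rfl, hbY.symm⟩
        · left
          exact ⟨⟨⟨⟨by omega, by omega⟩, by omega, by omega⟩, hco, by omega⟩, hs⟩
    · rintro (⟨⟨⟨⟨h1, h2⟩, h3, h4⟩, h5, h6⟩, h7⟩ | ⟨x, ⟨⟨h1, h2⟩, h3⟩, h4, h5⟩ | ⟨x, ⟨⟨h1, h2⟩, h3⟩, h4, h5⟩)
      · exact ⟨⟨⟨by omega, by omega⟩, by omega, by omega⟩, h5, h7⟩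
      · subst h4; subst h5
        exact ⟨⟨⟨by omega, by omega⟩, by omega, by omega⟩, h3, by omega⟩
      · subst h4; subst h5
        refine ⟨⟨⟨by omega, by omega⟩, by omega, by omega⟩, ?_, by omega⟩
        exact (Nat.coprime_self_sub_right (by omega)).2 h3.symm
  have h2 : SY Y = M ∪ K.image (fun q => (q, Y + 1 - q)) := by
    ext ⟨a, b⟩
    simp only [SY, hM, hK, Finset.mem_union, Finset.mem_filter, Finset.mem_product, Finset.mem_Icc, Finset.mem_image, Prod.mk.injEq]
    constructor
    · rintro ⟨⟨⟨ha, ha'⟩, hb, hb'⟩, hco, hs⟩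
      by_cases hab : Y + 1 < a + b
      · left; exact ⟨⟨⟨⟨ha, ha'⟩, hb, hb'⟩, hco, hs⟩, hab⟩
      · right
        have : Y + 1 = a + b := by omega
        exact ⟨a, ⟨⟨ha, ha'⟩, by rw [this]; simpa using hco⟩, rfl, by omega⟩
    · rintro (⟨h, -⟩ | ⟨x, ⟨⟨h1, h2⟩, h3⟩, h4, h5⟩)
      · exact h
      · subst h4; subst h5
        refine ⟨⟨⟨by omega, by omega⟩, by omega, by omega⟩, ?_, by omega⟩
        exact (Nat.coprime_sub_self_right (by omega)).2 h3
  rw [h1, h2, Finset.sum_union, Finset.sum_union, Finset.sum_union]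
  · rw [Finset.sum_image, Finset.sum_image, Finset.sum_image, ← Finset.sum_add_distrib]
    · congr 1
      apply Finset.sum_congr rfl
      intro x hx
      simp only [hK, Finset.mem_filter, Finset.mem_Icc] at hx
      have := Jf_split hc hp (q := x) (r := Y + 1 - x) ((Nat.coprime_sub_self_right (by omega)).2 hx.2) (by omega) (by omega)
      rw [this]
      congr 2 <;> congr 1 <;> omega
    · intro x hx y hy hxy; simp at hxy; exact hxy.1
    · intro x hx y hy hxy
      simp [hK] at hx hy hxy; omega
    · intro x hx y hy hxy; simp at hxy; exact hxy
  · rw [Finset.disjoint_left]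
    rintro ⟨a, b⟩ ha hb
    simp only [hM, hK, Finset.mem_filter, Finset.mem_image, Prod.mk.injEq, Finset.mem_Icc] at ha hb
    obtain ⟨x, hx, h3, h4⟩ := hb
    omega
  · rw [Finset.disjoint_left]
    rintro ⟨a, b⟩ ha hb
    simp only [hM, hK, Finset.mem_filter, Finset.mem_image, Prod.mk.injEq, Finset.mem_Icc] at ha hb
    obtain ⟨x, hx, h3, h4⟩ := hb
    obtain ⟨y, hy, h5, h6⟩ := ha
    omega
  · rw [Finset.disjoint_left]
    rintro ⟨a, b⟩ ha hb
    simp only [hM, hK, SY, Finset.mem_union, Finset.mem_filter, Finset.mem_image, Prod.mk.injEq, Finset.mem_Icc, Finset.mem_product] at ha hb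
    rcases hb with ⟨x, hx, h3, h4⟩ | ⟨x, hx, h3, h4⟩ <;> omega

lemma farey (hc : Continuous g) (hp : ∀ α (k : ℤ), g (α + k) = g α) (hneg : ∀ α, g (-α) = (starRingEnd ℂ) (g α)) (Y : ℕ) (hY : 1 ≤ Y) :
    ∫ α in (0:ℝ)..1, g α = ((2 * (∑ p ∈ SY Y, Hf g p.1 p.2).re : ℝ) : ℂ) := by
  have h1 : ∑ p ∈ SY Y, Jf g p.1 p.2 = ∫ α in (0:ℝ)..1, g α := by
    induction Y, hY using Nat.le_induction with
    | base =>
      have : SY 1 = {(1, 1)} := by decide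
      rw [this, Finset.sum_singleton, Jf_eq hp (by simp) one_pos one_pos 0 1 (by simp)]
      simp
    | succ Y hY ih => rw [T_step hc hp Y hY, ih]
  rw [← h1]
  have h2 : ∑ p ∈ SY Y, Jf g p.1 p.2 = ∑ p ∈ SY Y, Hf g p.1 p.2 + ∑ p ∈ SY Y, (starRingEnd ℂ) (Hf g p.2 p.1) := by
    rw [← Finset.sum_add_distrib]
    apply Finset.sum_congr rfl
    rintro ⟨a, b⟩ h
    simp only [SY, Finset.mem_filter, Finset.mem_product, Finset.mem_Icc] at h
    exact Jf_H hc hp hneg h.2.1 (by omega) (by omega)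
  have h3 : ∑ p ∈ SY Y, (starRingEnd ℂ) (Hf g p.2 p.1) = ∑ p ∈ SY Y, (starRingEnd ℂ) (Hf g p.1 p.2) := by
    refine Finset.sum_bij' (fun p _ => p.swap) (fun p _ => p.swap) ?_ ?_ ?_ ?_ ?_
    · rintro ⟨a, b⟩ h
      simp only [SY, Finset.mem_filter, Finset.mem_product, Finset.mem_Icc, Prod.swap] at h ⊢
      exact ⟨⟨h.1.2, h.1.1⟩, h.2.1.symm, by omega⟩
    · rintro ⟨a, b⟩ h
      simp only [SY, Finset.mem_filter, Finset.mem_product, Finset.mem_Icc, Prod.swap] at h ⊢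
      exact ⟨⟨h.1.2, h.1.1⟩, h.2.1.symm, by omega⟩
    · intro p _; simp
    · intro p _; simp
    · intro p _; simp
  rw [h2, h3, ← map_sum, Complex.add_conj]

end
end QF

namespace QF
open MeasureTheory

lemma ee_sub_one (t : ℝ) : ‖ee t - 1‖ = 2 * |Real.sin (Real.pi * t)| := by
  have : (2 * Real.pi * Complex.I * t : ℂ) = Complex.I * ((2 * Real.pi * t : ℝ) : ℂ) := by push_cast; ring
  rw [ee, this, Complex.norm_exp_I_mul_ofReal_sub_one, Real.norm_eq_abs, abs_mul, abs_two]
  congr 3; ring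

lemma ee_sub_one_ge (t : ℝ) (h0 : 0 < t) (h1 : t < 1) : 2 / ‖ee t - 1‖ ≤ (1 / t + 1 / (1 - t)) / 2 := by
  have hπ := Real.pi_pos
  have key : ∀ s : ℝ, 0 < s → s ≤ 1/2 → 2 * s ≤ Real.sin (Real.pi * s) := by
    intro s hs hs1
    have := Real.mul_le_sin (x := Real.pi * s) (by positivity) (by nlinarith)
    have e : 2 / Real.pi * (Real.pi * s) = 2 * s := by field_simp
    linarith
  have hge : 4 * min t (1 - t) ≤ ‖ee t - 1‖ := by
    rw [ee_sub_one]
    rcases le_total t (1/2) with h | h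
    · rw [min_eq_left (by linarith)]
      have := key t h0 h
      have h2 := le_abs_self (Real.sin (Real.pi * t))
      linarith
    · rw [min_eq_right (by linarith)]
      have := key (1 - t) (by linarith) (by linarith)
      have e : Real.sin (Real.pi * (1 - t)) = Real.sin (Real.pi * t) := by
        rw [mul_sub, mul_one, Real.sin_pi_sub]
      rw [e] at this
      have h2 := le_abs_self (Real.sin (Real.pi * t))
      linarith
  have hm : 0 < min t (1 - t) := lt_min h0 (by linarith)
  have h3 : 2 / ‖ee t - 1‖ ≤ 2 / (4 * min t (1 - t)) := by
    apply div_le_div_of_nonneg_left (by norm_num) (by positivity) hge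
  refine h3.trans ?_
  have h1t : 0 < 1 - t := by linarith
  rcases le_total t (1 - t) with h | h
  · rw [min_eq_left h]
    have : 0 < 1 / (1 - t) := by positivity
    have e : 2 / (4 * t) = (1 / t) / 2 := by field_simp; norm_num
    rw [e]; linarith
  · rw [min_eq_right h]
    have : 0 < 1 / t := by positivity
    have e : 2 / (4 * (1 - t)) = (1 / (1 - t)) / 2 := by field_simp; norm_num
    rw [e]; linarith

lemma geom_bound (q : ℕ) [NeZero q] (k : ZMod q) (hk : k ≠ 0) (a b : ℕ) (hab : a ≤ b) :
    ‖∑ r ∈ Finset.Ico a b, (ZMod.stdAddChar (-(k * (r : ZMod q))) : ℂ)‖ ≤ q / 2 * (1 / (k.val : ℝ) + 1 / ((q : ℝ) - k.val)) := by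
  have hq : (0 : ℝ) < q := by exact_mod_cast Nat.pos_of_ne_zero (NeZero.ne q)
  have hkv : (0:ℝ) < k.val := by
    have : k.val ≠ 0 := fun h => hk ((ZMod.val_eq_zero k).1 h)
    exact_mod_cast Nat.pos_of_ne_zero this
  have hkq : (k.val : ℝ) < q := by exact_mod_cast ZMod.val_lt k
  set w : ℂ := ZMod.stdAddChar (-k) with hw
  have hwk : (ZMod.stdAddChar k : ℂ) = ee (k.val / q) := by
    have := ee_std q (k.val : ℤ)
    simpa using this
  have hw1 : ‖w‖ = 1 := by rw [hw]; exact AddChar.norm_apply _ _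
  have hnorm : ‖w - 1‖ = ‖ee (k.val / q) - 1‖ := by
    rw [← hwk]
    have h1 : w * ZMod.stdAddChar k = 1 := by rw [hw, ← AddChar.map_add_eq_mul]; simp
    have : w - 1 = -(w * (ZMod.stdAddChar k - 1)) := by rw [mul_sub, h1]; ring
    rw [this, norm_neg, norm_mul, hw1, one_mul]
  have ht0 : 0 < (k.val : ℝ) / q := by positivity
  have ht1 : (k.val : ℝ) / q < 1 := by rw [div_lt_one hq]; exact hkq
  have hb := ee_sub_one_ge _ ht0 ht1
  rw [← hnorm] at hb
  have hwne : 0 < ‖w - 1‖ := by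
    rw [norm_pos_iff, sub_ne_zero, hw]
    intro h
    have := ZMod.injective_stdAddChar (h.trans (AddChar.map_zero_eq_one _).symm)
    exact hk (neg_eq_zero.1 this)
  have e1 : ∀ r : ℕ, (ZMod.stdAddChar (-(k * (r : ZMod q))) : ℂ) = w ^ r := by
    intro r
    rw [hw, ← AddChar.map_nsmul_eq_pow]; congr 1; rw [nsmul_eq_mul]; ring
  simp_rw [e1]
  have hg := geom_sum_Ico_mul w hab
  have h2 : ‖∑ r ∈ Finset.Ico a b, w ^ r‖ * ‖w - 1‖ ≤ 2 := by
    rw [← norm_mul, hg]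
    calc _ ≤ ‖w^b‖ + ‖w^a‖ := norm_sub_le _ _
      _ = 2 := by rw [norm_pow, norm_pow, hw1]; norm_num
  have h3 : ‖∑ r ∈ Finset.Ico a b, w ^ r‖ ≤ 2 / ‖w - 1‖ := by rw [le_div_iff₀ hwne]; exact h2
  refine h3.trans (hb.trans (le_of_eq ?_))
  have : (q:ℝ) - k.val ≠ 0 := by linarith
  field_simp

lemma sum_inv_bound (q : ℕ) [NeZero q] :
    ∑ k ∈ (Finset.univ : Finset (ZMod q)).erase 0, ((q:ℝ) / 2 * (1 / (k.val : ℝ) + 1 / ((q : ℝ) - k.val))) ≤ q * (1 + Real.log q) := by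
  have hq0 := Nat.pos_of_ne_zero (NeZero.ne q)
  have hq : (0 : ℝ) < q := by exact_mod_cast hq0
  have h1 : ∑ k ∈ (Finset.univ : Finset (ZMod q)).erase 0, ((q:ℝ) / 2 * (1 / (k.val : ℝ) + 1 / ((q : ℝ) - k.val))) =
      ∑ j ∈ Finset.Ico 1 q, ((q:ℝ) / 2 * (1 / (j : ℝ) + 1 / ((q : ℝ) - j))) := by
    refine Finset.sum_bij' (fun k _ => k.val) (fun j _ => (j : ZMod q)) ?_ ?_ ?_ ?_ ?_
    · intro k hk
      have hk0 : k ≠ 0 := Finset.ne_of_mem_erase hk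
      have : k.val ≠ 0 := fun h => hk0 ((ZMod.val_eq_zero k).1 h)
      exact Finset.mem_Ico.2 ⟨by omega, ZMod.val_lt k⟩
    · intro j hj
      rw [Finset.mem_Ico] at hj
      refine Finset.mem_erase.2 ⟨?_, Finset.mem_univ _⟩
      intro h
      have := congrArg ZMod.val h
      rw [ZMod.val_natCast_of_lt hj.2, ZMod.val_zero] at this
      omega
    · intro k _; simp
    · intro j hj
      rw [Finset.mem_Ico] at hj
      exact ZMod.val_natCast_of_lt hj.2
    · intro k _; rfl
  rw [h1, ← Finset.mul_sum, Finset.sum_add_distrib]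
  have h2 : ∑ j ∈ Finset.Ico 1 q, 1 / ((q : ℝ) - j) = ∑ j ∈ Finset.Ico 1 q, 1 / (j : ℝ) := by
    refine Finset.sum_bij' (fun j _ => q - j) (fun j _ => q - j) ?_ ?_ ?_ ?_ ?_
    · intro j hj; rw [Finset.mem_Ico] at hj ⊢; omega
    · intro j hj; rw [Finset.mem_Ico] at hj ⊢; omega
    · intro j hj; rw [Finset.mem_Ico] at hj; omega
    · intro j hj; rw [Finset.mem_Ico] at hj; omega
    · intro j hj; rw [Finset.mem_Ico] at hj
      rw [Nat.cast_sub hj.2.le]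
  have h3 : ∑ j ∈ Finset.Ico 1 q, 1 / (j : ℝ) ≤ 1 + Real.log q := by
    have h4 := harmonic_le_one_add_log q
    rw [harmonic_eq_sum_Icc] at h4
    push_cast at h4
    refine le_trans ?_ h4
    simp_rw [one_div]
    apply Finset.sum_le_sum_of_subset_of_nonneg
    · intro j hj; rw [Finset.mem_Ico] at hj; rw [Finset.mem_Icc]; omega
    · intros; positivity
  rw [h2]
  nlinarith

lemma incomplete (q : ℕ) [NeZero q] (f : ZMod q → ℂ) (M : ℝ)
    (hM : ∀ k : ZMod q, ‖∑ x, f x * ZMod.stdAddChar (k * x)‖ ≤ M) (a b : ℕ) (hab : a ≤ b) (hbq : b ≤ a + q) :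
    ‖∑ r ∈ Finset.Ico a b, f (r : ZMod q)‖ ≤ M * (2 + Real.log q) := by
  classical
  have hq0 := Nat.pos_of_ne_zero (NeZero.ne q)
  have hq : (0 : ℝ) < q := by exact_mod_cast hq0
  have hqc : (q : ℂ) ≠ 0 := by exact_mod_cast (NeZero.ne q)
  have hM0 : 0 ≤ M := (norm_nonneg _).trans (hM 0)
  have hinv : ∀ y : ZMod q, f y = (q:ℂ)⁻¹ * ∑ k : ZMod q, (∑ x, f x * ZMod.stdAddChar (k * x)) * ZMod.stdAddChar (-(k * y)) := by
    intro y
    have : ∑ k : ZMod q, (∑ x, f x * (ZMod.stdAddChar (k * x) : ℂ)) * ZMod.stdAddChar (-(k * y)) = ∑ x, f x * ∑ k : ZMod q, (ZMod.stdAddChar (k * (x - y)) : ℂ) := by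
      simp_rw [Finset.sum_mul, Finset.mul_sum]
      rw [Finset.sum_comm]
      apply Finset.sum_congr rfl; intro x _
      apply Finset.sum_congr rfl; intro k _
      rw [mul_assoc, ← AddChar.map_add_eq_mul]; congr 2; ring
    rw [this]
    have h2 : ∀ x, ∑ k : ZMod q, (ZMod.stdAddChar (k * (x - y)) : ℂ) = if x = y then (q:ℂ) else 0 := by
      intro x
      rw [AddChar.sum_mulShift _ (ZMod.isPrimitive_stdAddChar q)]
      simp [sub_eq_zero]
    simp_rw [h2]
    simp
    field_simp
  have h1 : ∑ r ∈ Finset.Ico a b, f (r : ZMod q) = (q:ℂ)⁻¹ * ∑ k : ZMod q, (∑ x, f x * ZMod.stdAddChar (k * x)) * ∑ r ∈ Finset.Ico a b, (ZMod.stdAddChar (-(k * (r : ZMod q))) : ℂ) := by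
    have h0 : ∑ r ∈ Finset.Ico a b, f (r : ZMod q) = ∑ r ∈ Finset.Ico a b, (q:ℂ)⁻¹ * ∑ k : ZMod q, (∑ x, f x * ZMod.stdAddChar (k * x)) * ZMod.stdAddChar (-(k * (r : ZMod q))) :=
      Finset.sum_congr rfl (fun r _ => hinv (r : ZMod q))
    rw [h0, ← Finset.mul_sum, Finset.sum_comm]
    congr 1
    apply Finset.sum_congr rfl; intro k _
    rw [Finset.mul_sum]
  rw [h1, norm_mul, norm_inv, Complex.norm_natCast]
  have h2 : ‖∑ k : ZMod q, (∑ x, f x * ZMod.stdAddChar (k * x)) * ∑ r ∈ Finset.Ico a b, (ZMod.stdAddChar (-(k * (r : ZMod q))) : ℂ)‖ ≤ M * (q + q * (1 + Real.log q)) := by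
    refine (norm_sum_le _ _).trans ?_
    rw [← Finset.add_sum_erase _ _ (Finset.mem_univ (0 : ZMod q)), mul_add]
    apply add_le_add
    · rw [norm_mul]
      apply mul_le_mul (hM 0) _ (norm_nonneg _) hM0
      refine (norm_sum_le _ _).trans ?_
      simp only [zero_mul, neg_zero, AddChar.map_zero_eq_one, norm_one, Finset.sum_const, Nat.card_Ico, nsmul_eq_mul, mul_one]
      have : b - a ≤ q := by omega
      exact_mod_cast this
    · have := sum_inv_bound q
      calc _ ≤ ∑ k ∈ (Finset.univ : Finset (ZMod q)).erase 0, M * ((q:ℝ) / 2 * (1 / (k.val : ℝ) + 1 / ((q : ℝ) - k.val))) := by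
            apply Finset.sum_le_sum
            intro k hk
            rw [norm_mul]
            exact mul_le_mul (hM k) (geom_bound q k (Finset.ne_of_mem_erase hk) a b hab) (norm_nonneg _) hM0
        _ ≤ _ := by rw [← Finset.mul_sum]; exact mul_le_mul_of_nonneg_left this hM0
  calc _ ≤ (q:ℝ)⁻¹ * (M * (q + q * (1 + Real.log q))) := by gcongr
    _ = _ := by field_simp; ring

end QF

namespace QF
open MeasureTheory

lemma lap_aux (a : ℝ) (ha : 0 < a) : Filter.Tendsto (fun t : ℝ => (t / a + 1 / a ^ 2) * Real.exp (-(a * t))) Filter.atTop (nhds 0) := by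
  have h1 := tendsto_rpow_mul_exp_neg_mul_atTop_nhds_zero 1 a ha
  have h0 := tendsto_rpow_mul_exp_neg_mul_atTop_nhds_zero 0 a ha
  have := (h1.mul_const (1 / a)).add (h0.mul_const (1 / a ^ 2))
  simp only [zero_mul, add_zero] at this
  refine this.congr (fun t => ?_)
  rw [Real.rpow_one, Real.rpow_zero, ← neg_mul]; ring

lemma lap_int (a : ℝ) (ha : 0 < a) : IntegrableOn (fun t : ℝ => t * Real.exp (-(a * t))) (Set.Ioi 0) := by
  have hd : ∀ t : ℝ, HasDerivAt (fun t : ℝ => -((t / a + 1 / a ^ 2) * Real.exp (-(a * t)))) (t * Real.exp (-(a * t))) t := by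
    intro t
    have h1 : HasDerivAt (fun t : ℝ => t / a + 1 / a ^ 2) (1 / a) t := ((hasDerivAt_id t).div_const a).add_const _
    have h2 : HasDerivAt (fun t : ℝ => Real.exp (-(a * t))) (Real.exp (-(a * t)) * (-(a * 1))) t := (((hasDerivAt_id t).const_mul a).neg).exp
    refine (h1.mul h2).neg.congr_deriv ?_
    field_simp; ring
  apply integrableOn_Ioi_deriv_of_nonneg (g := fun t : ℝ => -((t / a + 1 / a ^ 2) * Real.exp (-(a * t)))) (l := -0)
  · exact (hd 0).continuousAt.continuousWithinAt
  · intro t _; exact hd t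
  · intro t ht; exact mul_nonneg (le_of_lt ht) (Real.exp_pos _).le
  · exact (lap_aux a ha).neg

lemma norm_lap (z : ℂ) (t : ℝ) : ‖Complex.exp (-(z * t))‖ = Real.exp (-(z.re * t)) := by
  rw [Complex.norm_exp]; congr 1; simp

lemma lap_intC (z : ℂ) (hz : 0 < z.re) : IntegrableOn (fun t : ℝ => (t : ℂ) * Complex.exp (-(z * t))) (Set.Ioi 0) := by
  refine (lap_int z.re hz).mono' ?_ ?_
  · exact (by fun_prop : Continuous (fun t : ℝ => (t : ℂ) * Complex.exp (-(z * t)))).aestronglyMeasurable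
  · refine (ae_restrict_iff' measurableSet_Ioi).2 (Filter.Eventually.of_forall (fun t ht => ?_))
    rw [norm_mul, norm_lap, Complex.norm_real, Real.norm_of_nonneg (le_of_lt ht)]

lemma lap (z : ℂ) (hz : 0 < z.re) : ∫ t in Set.Ioi (0:ℝ), (t : ℂ) * Complex.exp (-(z * t)) = (z⁻¹) ^ 2 := by
  have hz0 : z ≠ 0 := by rintro rfl; simp at hz
  have hd : ∀ t : ℝ, HasDerivAt (fun t : ℝ => -(((t:ℂ) / z + 1 / z ^ 2) * Complex.exp (-(z * t)))) (t * Complex.exp (-(z * t))) t := by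
    intro t
    have h0 : HasDerivAt (fun t : ℝ => (t : ℂ)) 1 t := Complex.ofRealCLM.hasDerivAt
    have h1 : HasDerivAt (fun t : ℝ => (t:ℂ) / z + 1 / z ^ 2) (1 / z) t := (h0.div_const z).add_const _
    have h2 : HasDerivAt (fun t : ℝ => Complex.exp (-(z * t))) (Complex.exp (-(z * t)) * (-(z * 1))) t := ((h0.const_mul z).neg).cexp
    refine (h1.mul h2).neg.congr_deriv ?_
    field_simp; ring
  have := integral_Ioi_of_hasDerivAt_of_tendsto (hd 0).continuousAt.continuousWithinAt (fun t _ => hd t) (lap_intC z hz) (m := 0) ?_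
  · rw [this]; simp
  · rw [tendsto_zero_iff_norm_tendsto_zero]
    have hb : Filter.Tendsto (fun t : ℝ => (1 / ‖z‖ + 1 / ‖z‖ ^ 2) * (z.re + z.re^2) * ((t / z.re + 1 / z.re ^ 2) * Real.exp (-(z.re * t)))) Filter.atTop (nhds 0) := by
      have := (lap_aux z.re hz).const_mul ((1 / ‖z‖ + 1 / ‖z‖ ^ 2) * (z.re + z.re^2))
      rwa [mul_zero] at this
    refine squeeze_zero' (Filter.Eventually.of_forall (fun _ => norm_nonneg _)) ?_ hb
    filter_upwards [Filter.eventually_ge_atTop 0] with t ht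
    rw [norm_neg, norm_mul, norm_lap, ← mul_assoc]
    apply mul_le_mul_of_nonneg_right _ (Real.exp_pos _).le
    have hzn : 0 < ‖z‖ := norm_pos_iff.2 hz0
    refine (norm_add_le _ _).trans ?_
    rw [norm_div, norm_div, norm_pow, Complex.norm_real, Real.norm_of_nonneg ht, norm_one]
    have e : (z.re + z.re^2) * (t / z.re + 1 / z.re ^ 2) = t + z.re * t + 1 / z.re + 1 := by field_simp; ring
    rw [mul_assoc, e]
    have h1 : 0 ≤ z.re * t := by positivity
    have h2 : 0 < 1 / z.re := by positivity
    have h3 : 0 < 1 / ‖z‖ := by positivity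
    have h4 : 0 < 1 / ‖z‖ ^ 2 := by positivity
    have h5 : t / ‖z‖ = 1 / ‖z‖ * t := by ring
    rw [h5]
    nlinarith [mul_nonneg h3.le h1, mul_nonneg h3.le h2.le, mul_nonneg h4.le h1, mul_nonneg h4.le h2.le, mul_nonneg h4.le ht]

noncomputable def I0 : ℂ := ∫ t in Set.Ioi (0:ℝ), ee (-t) * ((1 - Complex.I * t)⁻¹) ^ 2

lemma norm_one_sub (t : ℝ) : ‖((1 - Complex.I * t : ℂ)⁻¹) ^ 2‖ = (1 + t ^ 2)⁻¹ := by
  rw [norm_pow, norm_inv, inv_pow, ← Complex.normSq_eq_norm_sq, Complex.normSq_apply]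
  simp; ring

lemma I0_ne (t : ℝ) : (1 - Complex.I * t : ℂ) ≠ 0 := by
  intro h; have := congrArg Complex.re h; simp at this

lemma I0_cont : Continuous (fun t : ℝ => ((1 - Complex.I * t : ℂ)⁻¹) ^ 2) := by
  apply Continuous.pow
  exact Continuous.inv₀ (by fun_prop) I0_ne

lemma I0_int : Integrable (fun t : ℝ => ee (-t) * ((1 - Complex.I * t)⁻¹) ^ 2) := by
  refine integrable_inv_one_add_sq.mono' ((ee_continuous.comp continuous_neg).mul I0_cont).aestronglyMeasurable (Filter.Eventually.of_forall (fun t => ?_))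
  rw [norm_mul, ee_norm, one_mul, norm_one_sub]

open FourierTransform in
lemma I0_full : ∫ t : ℝ, ee (-t) * ((1 - Complex.I * t)⁻¹) ^ 2 = ((4 * Real.pi ^ 2 * Real.exp (-(2 * Real.pi)) : ℝ) : ℂ) := by
  have hπ := Real.pi_pos
  set f : ℝ → ℂ := (Set.Ioi (0:ℝ)).indicator (fun x => (x : ℂ) * Complex.exp (-((2 * Real.pi : ℂ) * x))) with hf
  have hfi : Integrable f := by
    rw [hf, integrable_indicator_iff measurableSet_Ioi]
    exact lap_intC _ (by simp [hπ])
  have hF : 𝓕 f = fun ξ : ℝ => ((2 * Real.pi : ℂ)⁻¹) ^ 2 * ((1 + Complex.I * ξ)⁻¹) ^ 2 := by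
    funext ξ
    rw [Real.fourier_real_eq_integral_exp_smul]
    have h1 : ∀ v : ℝ, Complex.exp (((-2 * Real.pi * v * ξ : ℝ) : ℂ) * Complex.I) • f v = (Set.Ioi (0:ℝ)).indicator (fun x : ℝ => (x : ℂ) * Complex.exp (-(((2 * Real.pi : ℂ) * (1 + Complex.I * ξ)) * x))) v := by
      intro v
      by_cases hv : v ∈ Set.Ioi (0:ℝ)
      · rw [hf, Set.indicator_of_mem hv, Set.indicator_of_mem hv, smul_eq_mul, mul_left_comm, ← Complex.exp_add]
        congr 2; push_cast; ring
      · rw [hf, Set.indicator_of_notMem hv, Set.indicator_of_notMem hv, smul_zero]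
    simp_rw [h1]
    rw [integral_indicator measurableSet_Ioi, lap _ (by simp [hπ]), mul_inv, mul_pow]
  have hFi : Integrable (𝓕 f) := by
    rw [hF]
    apply Integrable.const_mul
    refine integrable_inv_one_add_sq.mono' ?_ (Filter.Eventually.of_forall (fun t => ?_))
    · have := I0_cont.comp continuous_neg
      refine (this.congr (fun t => ?_)).aestronglyMeasurable
      simp
    · have := norm_one_sub (-t)
      simp only [Complex.ofReal_neg, mul_neg, sub_neg_eq_add] at this
      rw [this]; simp
  have hc : ContinuousAt f 1 := by
    have : f =ᶠ[nhds 1] (fun x : ℝ => (x : ℂ) * Complex.exp (-((2 * Real.pi : ℂ) * x))) := by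
      filter_upwards [Ioi_mem_nhds (show (0:ℝ) < 1 by norm_num)] with x hx
      rw [hf, Set.indicator_of_mem hx]
    exact (continuousAt_congr this).2 (by fun_prop)
  have key := hfi.fourierInv_fourier_eq hFi hc
  rw [Real.fourierInv_eq', hF, ← integral_neg_eq_self] at key
  have h2 : ∀ t : ℝ, Complex.exp (((2 * Real.pi * inner ℝ (-t) (1:ℝ) : ℝ) : ℂ) * Complex.I) • (((2 * Real.pi : ℂ)⁻¹) ^ 2 * ((1 + Complex.I * ((-t : ℝ) : ℂ))⁻¹) ^ 2) =
      ((2 * Real.pi : ℂ)⁻¹) ^ 2 * (ee (-t) * ((1 - Complex.I * t)⁻¹) ^ 2) := by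
    intro t
    have : (((2 * Real.pi * inner ℝ (-t) (1:ℝ) : ℝ) : ℂ) * Complex.I) = 2 * Real.pi * Complex.I * ((-t : ℝ) : ℂ) := by
      simp; ring
    rw [this, smul_eq_mul, ee]
    have e : (1 + Complex.I * ((-t : ℝ) : ℂ)) = 1 - Complex.I * t := by push_cast; ring
    rw [e]; ring
  simp_rw [h2] at key
  rw [integral_const_mul] at key
  have h3 : f 1 = ((Real.exp (-(2 * Real.pi)) : ℝ) : ℂ) := by
    rw [hf, Set.indicator_of_mem (by simp)]; push_cast; ring_nf
  rw [h3] at key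
  have hπc : (Real.pi : ℂ) ≠ 0 := by exact_mod_cast hπ.ne'
  rw [Complex.ofReal_mul, ← key]
  push_cast
  field_simp
  norm_num

lemma I0_pos : 0 < I0.re := by
  have h := I0_full
  rw [← integral_add_compl (measurableSet_Ioi (a := (0:ℝ))) I0_int, Set.compl_Ioi] at h
  have h2 : ∫ t in Set.Iic (0:ℝ), ee (-t) * ((1 - Complex.I * t)⁻¹) ^ 2 = (starRingEnd ℂ) I0 := by
    have := integral_comp_neg_Iic (0:ℝ) (fun t : ℝ => (starRingEnd ℂ) (ee (-t) * ((1 - Complex.I * t)⁻¹) ^ 2))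
    rw [neg_zero] at this
    rw [I0, ← integral_conj, ← this]
    congr 1; funext t
    rw [map_mul, ee_conj]
    simp
    left; ring
  rw [h2] at h
  have h3 := congrArg Complex.re h
  rw [Complex.add_re, Complex.conj_re, Complex.ofReal_re] at h3
  have : (0:ℝ) < 4 * Real.pi ^ 2 * Real.exp (-(2 * Real.pi)) := by positivity
  change I0.re + I0.re = _ at h3
  linarith

/-- the scaled archimedean integrand -/
noncomputable def kern (n : ℕ) (β : ℝ) : ℂ := ee (-(n * β)) * (((1 / n : ℝ) - Complex.I * β : ℂ)⁻¹) ^ 2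

lemma kern_eq (n : ℕ) (hn : 0 < n) (β : ℝ) : kern n β = (n:ℂ) ^ 2 * (ee (-((n:ℝ) * β)) * ((1 - Complex.I * (((n:ℝ) * β : ℝ) : ℂ))⁻¹) ^ 2) := by
  have hnc : (n:ℂ) ≠ 0 := by exact_mod_cast hn.ne'
  rw [kern]
  have : ((1 / n : ℝ) - Complex.I * β : ℂ) = (n:ℂ)⁻¹ * (1 - Complex.I * (((n:ℝ) * β : ℝ) : ℂ)) := by
    push_cast; field_simp
  rw [this, mul_inv, inv_inv]; ring

lemma kern_int (n : ℕ) (hn : 0 < n) : Integrable (kern n) := by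
  have : kern n = fun β => (n:ℂ) ^ 2 * (ee (-((n:ℝ) * β)) * ((1 - Complex.I * (((n:ℝ) * β : ℝ) : ℂ))⁻¹) ^ 2) := funext (kern_eq n hn)
  rw [this]
  exact (I0_int.comp_mul_left' (R := (n:ℝ)) (by exact_mod_cast hn.ne')).const_mul _

lemma kern_integral (n : ℕ) (hn : 0 < n) : ∫ β in Set.Ioi (0:ℝ), kern n β = n * I0 := by
  have : kern n = fun β => (n:ℂ) ^ 2 * (ee (-((n:ℝ) * β)) * ((1 - Complex.I * (((n:ℝ) * β : ℝ) : ℂ))⁻¹) ^ 2) := funext (kern_eq n hn)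
  rw [this, integral_const_mul]
  have hnr : (0:ℝ) < n := by exact_mod_cast hn
  have hnc : (n:ℂ) ≠ 0 := by exact_mod_cast hn.ne'
  have := integral_comp_mul_left_Ioi (fun t : ℝ => ee (-t) * ((1 - Complex.I * (t:ℂ))⁻¹) ^ 2) 0 hnr
  rw [this, mul_zero, ← I0, Complex.real_smul]
  push_cast
  field_simp

end QF

namespace QF
open MeasureTheory

open Classical in
/-- the function whose incomplete sums occur in the Kloosterman refinement -/
noncomputable def fc (A : Matrix (Fin 4) (Fin 4) ℤ) (n q : ℕ) [NeZero q] (c : Fin 4 → ZMod q) (x : ZMod q) : ℂ :=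
  if IsUnit x then (ZMod.stdAddChar ((n : ZMod q) * x⁻¹) : ℂ) * G A (ZMod.stdAddChar (N := q)) (-x⁻¹) c else 0

lemma fc_complete (A : Matrix (Fin 4) (Fin 4) ℤ) (n q : ℕ) [NeZero q] (c : Fin 4 → ZMod q) (k : ZMod q) :
    ∑ x, fc A n q c x * ZMod.stdAddChar (k * x) = S A (ZMod.stdAddChar (N := q)) (n : ZMod q) c k := by
  classical
  have h1 : ∑ u : (ZMod q)ˣ, fc A n q c (u : ZMod q) * ZMod.stdAddChar (k * (u : ZMod q)) = ∑ x, fc A n q c x * ZMod.stdAddChar (k * x) := by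
    apply Finset.sum_of_injOn (fun u : (ZMod q)ˣ => (u : ZMod q))
    · intro a _ b _ h; exact Units.ext h
    · intro a _; simp
    · intro x _ hx
      have : ¬ IsUnit x := by
        rintro ⟨u, rfl⟩; exact hx ⟨u, by simp, rfl⟩
      rw [fc, if_neg this, zero_mul]
    · intro u _; rfl
  rw [← h1]
  unfold S
  rw [← Equiv.sum_comp (Equiv.inv (ZMod q)ˣ)]
  refine Finset.sum_congr (by ext; simp) (fun u _ => ?_)
  rw [fc, if_pos (by simp)]
  simp only [Equiv.inv_apply]
  have : (((u⁻¹ : (ZMod q)ˣ) : ZMod q))⁻¹ = u := by rw [ZMod.inv_coe_unit]; simp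
  rw [this, AddChar.map_add_eq_mul]; ring

lemma fc_inc {A : Matrix (Fin 4) (Fin 4) ℤ} (hA : IsGram A) (n q : ℕ) [NeZero q] (c : Fin 4 → ZMod q) (a b : ℕ) (hab : a ≤ b) (hbq : b ≤ a + q) :
    ‖∑ r ∈ Finset.Ico a b, fc A n q c (r : ZMod q)‖ ≤ Bf (2 * A.det.natAbs * n) q * Real.sqrt (kap A (ZMod q)) * (2 + Real.log q) := by
  apply incomplete q (fc A n q c) _ _ a b hab hbq
  intro k
  rw [fc_complete]
  exact S_bound hA n _ rfl q _ (ZMod.isPrimitive_stdAddChar q) c k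

lemma sum_period (q : ℕ) [NeZero q] (f : ZMod q → ℂ) (a : ℕ) : ∑ r ∈ Finset.Ico a (a + q), f (r : ZMod q) = ∑ x, f x := by
  classical
  have hinj : Set.InjOn (fun r : ℕ => (r : ZMod q)) (Finset.Ico a (a + q)) := by
    intro r hr s hs h
    simp only [Finset.coe_Ico, Set.mem_Ico] at hr hs
    have h1 := (ZMod.natCast_eq_natCast_iff r s q).1 h
    rcases le_total r s with h2 | h2
    · have := (Nat.modEq_iff_dvd' h2).1 h1
      have := Nat.eq_zero_of_dvd_of_lt this (by omega)
      omega
    · have := (Nat.modEq_iff_dvd' h2).1 h1.symm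
      have := Nat.eq_zero_of_dvd_of_lt this (by omega)
      omega
  have : (Finset.Ico a (a + q)).image (fun r : ℕ => (r : ZMod q)) = Finset.univ := by
    rw [← Finset.card_eq_iff_eq_univ, Finset.card_image_of_injOn hinj, ZMod.card]; simp
  rw [← this, Finset.sum_image hinj]

lemma fc_full (A : Matrix (Fin 4) (Fin 4) ℤ) (n q : ℕ) [NeZero q] (c : Fin 4 → ZMod q) (a : ℕ) :
    ∑ r ∈ Finset.Ico a (a + q), fc A n q c (r : ZMod q) = S A (ZMod.stdAddChar (N := q)) (n : ZMod q) c 0 := by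
  rw [sum_period, ← fc_complete]; simp

lemma fc_supp {A : Matrix (Fin 4) (Fin 4) ℤ} (hA : IsGram A) (n q : ℕ) [NeZero q] (c : Fin 4 → ℤ) (x : ZMod q)
    (h : fc A n q (fun i => (c i : ZMod q)) x ≠ 0) : (2:ℤ) • c ∈ Lq A q := by
  have hx : IsUnit x := by
    by_contra hx; exact h (by rw [fc, if_neg hx])
  obtain ⟨u, rfl⟩ := hx
  rw [fc, if_pos u.isUnit] at h
  have h2 := right_ne_zero_of_mul h
  have h3 : (-(u : ZMod q)⁻¹) = ((-u⁻¹ : (ZMod q)ˣ) : ZMod q) := by rw [ZMod.inv_coe_unit]; simp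
  rw [h3] at h2
  intro k hk
  have := G_ne_zero hA _ (ZMod.isPrimitive_stdAddChar q) _ _ h2 k hk
  rw [← this]
  simp [dt, Finset.mul_sum, mul_assoc]

noncomputable def Kk (P : Matrix (Fin 4) (Fin 4) ℝ) (n q : ℕ) (β : ℝ) (c : Fin 4 → ℤ) : ℂ :=
  ee (-(n * β)) * ((|P.det|⁻¹ : ℝ) * (((q:ℂ)^2 * ((1 / n : ℝ) - Complex.I * β))⁻¹) ^ 2 *
    Complex.exp (-(Real.pi * ((q:ℂ)^2 * ((1 / n : ℝ) - Complex.I * β))⁻¹ * (Fc P c : ℝ))))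

lemma gf_fc {A : Matrix (Fin 4) (Fin 4) ℤ} {P : Matrix (Fin 4) (Fin 4) ℝ} {n : ℕ} (hA : IsGram A) (hPA : P.transpose * P = A.map (Int.cast : ℤ → ℝ)) (hP : P.det ≠ 0) (hn : 0 < n)
    (q : ℕ) [NeZero q] (r : ℕ) (h : q.Coprime r) (β : ℝ) :
    HasSum (fun c : Fin 4 → ℤ => Kk P n q β c * fc A n q (fun i => (c i : ZMod q)) (r : ZMod q)) (gf A n (-(Nat.gcdB q r : ℝ) / q + β)) := by
  have hq : (q:ℝ) ≠ 0 := by exact_mod_cast NeZero.ne q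
  have h1 := gf_theta hA hPA hP hn q (-(Nat.gcdB q r)) β _ rfl
  push_cast at h1
  refine h1.congr_fun (fun c => ?_)
  have hmul : (r : ZMod q) * (Nat.gcdB q r : ZMod q) = 1 := by
    have := congrArg (fun z : ℤ => (z : ZMod q)) (bez q r h)
    push_cast at this
    simpa using this
  have hu : IsUnit (r : ZMod q) := IsUnit.of_mul_eq_one _ hmul
  have hinv : (r : ZMod q)⁻¹ = (Nat.gcdB q r : ZMod q) := by
    obtain ⟨u, hu⟩ := hu
    rw [← hu, ZMod.inv_coe_unit]
    rw [← hu] at hmul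
    exact (Units.inv_eq_of_mul_eq_one_right hmul)
  rw [fc, if_pos hu, hinv, Kk]
  have e1 : ee (-((n:ℝ) * (-(Nat.gcdB q r : ℝ) / q + β))) = ee (-((n:ℝ) * β)) * ZMod.stdAddChar ((n : ZMod q) * (Nat.gcdB q r : ZMod q)) := by
    have := ee_std q ((n:ℤ) * Nat.gcdB q r)
    push_cast at this
    rw [this, ← ee_add]; congr 1; field_simp; ring
  rw [e1]
  push_cast
  ring

lemma filter_Ico (p : ℕ → Prop) [DecidablePred p] (hp : ∀ r, p (r + 1) → p r) (a e : ℕ) (hae : a ≤ e) :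
    ∃ b, a ≤ b ∧ b ≤ e ∧ (Finset.Ico a e).filter p = Finset.Ico a b ∧ (b < e → ¬ p b) := by
  have hins : ∀ e, a ≤ e → Finset.Ico a (e + 1) = insert e (Finset.Ico a e) := by
    intro e h; ext x; simp only [Finset.mem_Ico, Finset.mem_insert]; omega
  induction e, hae using Nat.le_induction with
  | base => exact ⟨a, le_rfl, le_rfl, by simp, by simp⟩
  | succ e hae ih =>
    obtain ⟨b, h1, h2, h3, h4⟩ := ih
    rcases h2.lt_or_eq with hb | rfl
    · refine ⟨b, h1, by omega, ?_, fun _ => h4 hb⟩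
      rw [hins e hae, Finset.filter_insert, if_neg, h3]
      intro hpe
      have : ∀ k, p (b + k) → p b := by
        intro k; induction k with
        | zero => exact id
        | succ k ih => intro h; exact ih (hp _ h)
      obtain ⟨k, rfl⟩ := Nat.exists_eq_add_of_lt hb
      exact h4 hb (this (k+1) hpe)
    · by_cases hpb : p b
      · refine ⟨b + 1, by omega, le_rfl, ?_, by simp⟩
        rw [hins b hae, Finset.filter_insert, if_pos hpb, h3]
      · refine ⟨b, h1, by omega, ?_, fun _ => hpb⟩
        rw [hins b hae, Finset.filter_insert, if_neg hpb, h3]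

end QF

namespace QF
open MeasureTheory

lemma det_sq {A : Matrix (Fin 4) (Fin 4) ℤ} {P : Matrix (Fin 4) (Fin 4) ℝ} (hPA : P.transpose * P = A.map (Int.cast : ℤ → ℝ)) :
    |P.det|^2 = (A.det.natAbs : ℝ) := by
  have := congrArg Matrix.det hPA
  rw [Matrix.det_mul, Matrix.det_transpose] at this
  have h2 : (A.map (Int.cast : ℤ → ℝ)).det = ((A.det : ℤ) : ℝ) := (Int.cast_det A).symm
  rw [h2] at this
  rw [Nat.cast_natAbs, sq_abs, sq, this, Int.cast_abs, abs_of_nonneg]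
  rw [← this]; exact mul_self_nonneg _

lemma det_ne {A : Matrix (Fin 4) (Fin 4) ℤ} {P : Matrix (Fin 4) (Fin 4) ℝ} (hPA : P.transpose * P = A.map (Int.cast : ℤ → ℝ)) (hP : P.det ≠ 0) :
    A.det ≠ 0 := by
  intro h
  have := det_sq hPA
  rw [h] at this
  simp at this; exact hP this

lemma sqrt_kap {A : Matrix (Fin 4) (Fin 4) ℤ} {P : Matrix (Fin 4) (Fin 4) ℝ} (hPA : P.transpose * P = A.map (Int.cast : ℤ → ℝ)) (hP : P.det ≠ 0)
    (q : ℕ) [NeZero q] : Real.sqrt (kap A (ZMod q)) ≤ |P.det| := by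
  rw [← Real.sqrt_sq (abs_nonneg P.det), det_sq hPA]
  apply Real.sqrt_le_sqrt
  exact_mod_cast kap_le (det_ne hPA hP) q

noncomputable def uu (n q : ℕ) (β : ℝ) : ℝ := (1 / n) / (q ^ 2 * ((1 / n) ^ 2 + β ^ 2))

lemma normSq_tau (n q : ℕ) (β : ℝ) : Complex.normSq ((q:ℂ)^2 * ((1 / n : ℝ) - Complex.I * β)) = (q:ℝ)^4 * ((1 / n) ^ 2 + β ^ 2) := by
  rw [Complex.normSq_mul, map_pow, Complex.normSq_natCast]
  rw [Complex.normSq_apply]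
  simp
  ring

lemma re_tau (n q : ℕ) (hq : 0 < q) (hn : 0 < n) (β : ℝ) : (((q:ℂ)^2 * ((1 / n : ℝ) - Complex.I * β))⁻¹).re = uu n q β := by
  have hqr : (0:ℝ) < q := by exact_mod_cast hq
  have hnr : (0:ℝ) < n := by exact_mod_cast hn
  rw [Complex.inv_re, normSq_tau]
  have : ((q:ℂ)^2 * ((1 / n : ℝ) - Complex.I * β)).re = (q:ℝ)^2 * (1 / n) := by
    have e : ((q:ℂ)^2) = (((q:ℝ)^2 : ℝ) : ℂ) := by push_cast; rfl
    rw [e, Complex.re_ofReal_mul]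
    simp
  rw [this, uu]
  field_simp

lemma norm_Kk (P : Matrix (Fin 4) (Fin 4) ℝ) (n q : ℕ) (hq : 0 < q) (hn : 0 < n) (β : ℝ) (c : Fin 4 → ℤ) :
    ‖Kk P n q β c‖ = |P.det|⁻¹ * ((q:ℝ)^4 * ((1 / n) ^ 2 + β ^ 2))⁻¹ * Real.exp (-(Real.pi * uu n q β) * Fc P c) := by
  rw [Kk, norm_mul, ee_norm, one_mul, norm_mul, norm_mul, norm_gauss, re_tau n q hq hn, norm_pow, norm_inv, inv_pow,
    ← Complex.normSq_eq_norm_sq, normSq_tau, Complex.norm_real, norm_inv, Real.norm_eq_abs, abs_abs]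

lemma Kk_zero (P : Matrix (Fin 4) (Fin 4) ℝ) (n q : ℕ) (β : ℝ) :
    Kk P n q β 0 = ((|P.det|⁻¹ : ℝ) : ℂ) * ((q:ℂ)^4)⁻¹ * kern n β := by
  have : Fc P 0 = 0 := by simpa using Fc_zsmul P 0 0
  rw [Kk, this, kern]
  generalize ((1 / n : ℝ) - Complex.I * β : ℂ) = τ
  rw [Complex.ofReal_zero, mul_zero, neg_zero, Complex.exp_zero, mul_inv, mul_pow, mul_one]
  ring

lemma tailK (A : Matrix (Fin 4) (Fin 4) ℤ) (P : Matrix (Fin 4) (Fin 4) ℝ) (hP : P.det ≠ 0) (n q : ℕ) (hq : 0 < q) (hn : 0 < n) (β : ℝ)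
    (hu : 1/2 ≤ uu n q β) (v : (Fin 4 → ℤ) → ℂ) (M : ℝ) (hv : ∀ c, ‖v c‖ ≤ M) (hv2 : ∀ c, v c ≠ 0 → (2:ℤ) • c ∈ Lq A q) (s : ℂ)
    (hs : HasSum (fun c => Kk P n q β c * v c) s) :
    ‖s - Kk P n q β 0 * v 0‖ ≤ |P.det|⁻¹ * ((q:ℝ)^4 * ((1 / n) ^ 2 + β ^ 2))⁻¹ * M * (2 / Real.sqrt (uu n q β) * TL A P q (1/8)) := by
  classical
  have hM : 0 ≤ M := (norm_nonneg _).trans (hv 0)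
  have hdet : 0 ≤ |P.det|⁻¹ := by positivity
  set k0 : ℝ := |P.det|⁻¹ * ((q:ℝ)^4 * ((1 / n) ^ 2 + β ^ 2))⁻¹ with hk0
  have hk0' : 0 ≤ k0 := by rw [hk0]; positivity
  have h1 : s - Kk P n q β 0 * v 0 = ∑' c, if c = 0 then 0 else Kk P n q β c * v c := by
    rw [← hs.tsum_eq, hs.summable.tsum_eq_add_tsum_ite 0]; ring
  rw [h1]
  have hsum := (Fc_summable P hP (uu n q β) (by linarith)).indicator {c : Fin 4 → ℤ | c ≠ 0 ∧ (2:ℤ) • c ∈ Lq A q}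
  refine (tsum_of_norm_bounded (hsum.mul_left (k0 * M)).hasSum (fun c => ?_)).trans ?_
  · by_cases hc : c = 0
    · rw [if_pos hc, norm_zero]
      exact mul_nonneg (mul_nonneg hk0' hM) (Set.indicator_nonneg (fun _ _ => (Real.exp_pos _).le) _)
    · rw [if_neg hc]
      by_cases hvc : v c = 0
      · rw [hvc, mul_zero, norm_zero]
        exact mul_nonneg (mul_nonneg hk0' hM) (Set.indicator_nonneg (fun _ _ => (Real.exp_pos _).le) _)
      · have hmem : c ∈ {c : Fin 4 → ℤ | c ≠ 0 ∧ (2:ℤ) • c ∈ Lq A q} := ⟨hc, hv2 c hvc⟩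
        rw [Set.indicator_of_mem hmem, norm_mul, norm_Kk P n q hq hn, ← hk0]
        have := mul_le_mul_of_nonneg_left (hv c) (mul_nonneg hk0' (Real.exp_pos (-(Real.pi * uu n q β) * Fc P c)).le)
        linarith
  · rw [tsum_mul_left]
    exact mul_le_mul_of_nonneg_left (tail_bound A P hP q _ hu) (mul_nonneg hk0' hM)

lemma uu_ge (n q Y : ℕ) (hq : 0 < q) (hn : 0 < n) (hqY : q ≤ Y) (hY : Y = Nat.sqrt n) (β : ℝ) (hβ : 0 < β) (h : β ≤ 1 / (q * ((Y:ℝ) + 1))) :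
    1/2 ≤ uu n q β := by
  have hqr : (0:ℝ) < q := by exact_mod_cast hq
  have hnr : (0:ℝ) < n := by exact_mod_cast hn
  have hqY' : (q:ℝ) ≤ Y := by exact_mod_cast hqY
  have h1 : (Y:ℝ)^2 ≤ n := by rw [hY]; exact_mod_cast Nat.sqrt_le' n
  have h2 : (n:ℝ) ≤ ((Y:ℝ)+1)^2 := by rw [hY]; exact_mod_cast (Nat.lt_succ_sqrt' n).le
  have h3 : (q:ℝ)^2 ≤ n := by nlinarith
  have h4 : (q:ℝ)^2 * (1/n)^2 ≤ 1 / n := by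
    rw [div_pow, one_pow, mul_one_div, div_le_div_iff₀ (by positivity) hnr]; nlinarith
  have h5 : (q:ℝ)^2 * β^2 ≤ 1 / n := by
    have e : (q:ℝ) * β ≤ 1 / ((Y:ℝ) + 1) := by
      rw [le_div_iff₀ (by positivity)] at h ⊢; nlinarith
    have : ((q:ℝ) * β)^2 ≤ (1 / ((Y:ℝ) + 1))^2 := by gcongr
    rw [← mul_pow]
    refine this.trans ?_
    rw [div_pow, one_pow]
    exact one_div_le_one_div_of_le hnr h2
  rw [uu, div_le_div_iff₀ (by norm_num) (by positivity)]
  nlinarith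

lemma two_inv_sqrt (n q : ℕ) (hq : 0 < q) (hn : 0 < n) (β : ℝ) (hβ : 0 < β) :
    ((q:ℝ)^4 * ((1 / n) ^ 2 + β ^ 2))⁻¹ * (2 / Real.sqrt (uu n q β)) ≤ 4 * ((q:ℝ)^3)⁻¹ * Real.sqrt n * (1 / (β + 1 / n)) := by
  have hqr : (0:ℝ) < q := by exact_mod_cast hq
  have hnr : (0:ℝ) < n := by exact_mod_cast hn
  set t := Real.sqrt ((1 / n) ^ 2 + β ^ 2) with ht
  have ht0 : 0 < t := Real.sqrt_pos.2 (by positivity)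
  have ht2 : (1 / (n:ℝ)) ^ 2 + β ^ 2 = t ^ 2 := (Real.sq_sqrt (by positivity)).symm
  set w := Real.sqrt n with hw
  have hw0 : 0 < w := Real.sqrt_pos.2 hnr
  have hw2 : (n:ℝ) = w ^ 2 := (Real.sq_sqrt hnr.le).symm
  have hus : Real.sqrt (uu n q β) = 1 / (w * q * t) := by
    rw [Real.sqrt_eq_iff_mul_self_eq_of_pos (by positivity), uu, ht2, hw2]; field_simp
  rw [hus, ht2]
  have e : ((q:ℝ)^4 * t ^ 2)⁻¹ * (2 / (1 / (w * q * t))) = 2 * ((q:ℝ)^3)⁻¹ * w * (1 / t) := by field_simp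
  rw [e]
  have hle : β + 1 / n ≤ 2 * t := by
    apply abs_le_of_sq_le_sq' _ (by positivity) |>.2
    nlinarith [sq_nonneg (β - 1 / n), sq_nonneg t]
  have : 1 / t ≤ 2 * (1 / (β + 1 / n)) := by
    rw [mul_one_div, div_le_div_iff₀ ht0 (by positivity)]; linarith
  have hc : 0 ≤ 2 * ((q:ℝ)^3)⁻¹ * w := by positivity
  nlinarith [mul_le_mul_of_nonneg_left this hc]

end QF

namespace QF
open MeasureTheory

noncomputable def WW (P : Matrix (Fin 4) (Fin 4) ℝ) (N : ℕ) : ℝ := |P.det| + Real.sqrt |P.det| * (N:ℝ)^(3/4 : ℝ)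

noncomputable def EE (A : Matrix (Fin 4) (Fin 4) ℤ) (n q : ℕ) : ℝ := Bf (2 * A.det.natAbs * n) q * (2 + Real.log q)

lemma EE_nonneg (A : Matrix (Fin 4) (Fin 4) ℤ) (n q : ℕ) : 0 ≤ EE A n q :=
  mul_nonneg (Bf_nonneg _ _) (by have := Real.log_natCast_nonneg q; linarith)

lemma WW_ge (P : Matrix (Fin 4) (Fin 4) ℝ) (N : ℕ) : |P.det| ≤ WW P N := by
  rw [WW]; have : 0 ≤ Real.sqrt |P.det| * (N:ℝ)^(3/4 : ℝ) := by positivity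
  linarith

open Classical in
noncomputable def Psi (A : Matrix (Fin 4) (Fin 4) ℤ) (n q Y : ℕ) (β : ℝ) : ℂ :=
  ∑ r ∈ (Finset.Ico (Y - q + 1) (Y + 1)).filter (fun r => q.Coprime r),
    if β ≤ 1 / ((q:ℝ) * (q + r)) then gf A n (-(Nat.gcdB q r : ℝ) / q + β) else 0

lemma Psi_hasSum {A : Matrix (Fin 4) (Fin 4) ℤ} {P : Matrix (Fin 4) (Fin 4) ℝ} {n : ℕ} (hA : IsGram A) (hPA : P.transpose * P = A.map (Int.cast : ℤ → ℝ)) (hP : P.det ≠ 0) (hn : 0 < n)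
    (q Y : ℕ) [NeZero q] (β : ℝ) (a b : ℕ) (ha : a = Y - q + 1) 
    (hb : (Finset.Ico a (Y + 1)).filter (fun r : ℕ => β ≤ 1 / ((q:ℝ) * (q + r))) = Finset.Ico a b) :
    HasSum (fun c : Fin 4 → ℤ => Kk P n q β c * ∑ r ∈ Finset.Ico a b, fc A n q (fun i => (c i : ZMod q)) (r : ZMod q)) (Psi A n q Y β) := by
  classical
  have h1 : Psi A n q Y β = ∑ r ∈ Finset.Ico a b, if q.Coprime r then gf A n (-(Nat.gcdB q r : ℝ) / q + β) else 0 := by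
    rw [Psi, ← hb, ← ha, Finset.sum_filter, Finset.sum_filter]
    apply Finset.sum_congr rfl
    intro r _
    split_ifs <;> rfl
  rw [h1]
  simp_rw [Finset.mul_sum]
  apply hasSum_sum
  intro r _
  split_ifs with h
  · exact gf_fc hA hPA hP hn q r h β
  · have : ¬ IsUnit (r : ZMod q) := by
      rw [ZMod.isUnit_iff_coprime]; exact fun h' => h h'.symm
    have e : (fun c : Fin 4 → ℤ => Kk P n q β c * fc A n q (fun i => (c i : ZMod q)) (r : ZMod q)) = fun _ => 0 := by
      funext c; rw [fc, if_neg this, mul_zero]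
    rw [e]; exact hasSum_zero

lemma pointwise : ∃ C : ℝ, 0 < C ∧ ∀ (A B : Matrix (Fin 4) (Fin 4) ℤ) (P : Matrix (Fin 4) (Fin 4) ℝ) (N n : ℕ), IsGram A → 
    P.transpose * P = A.map (Int.cast : ℤ → ℝ) → P.det ≠ 0 → 0 < N → IsGram B → A * B = (N : ℤ) • 1 → B * A = (N : ℤ) • 1 → 0 < n →
    ∀ (q Y : ℕ) [NeZero q], q ≤ Y → Y = Nat.sqrt n → ∀ β : ℝ, 0 < β →
    ‖Psi A n q Y β - ((|P.det|⁻¹ : ℝ) : ℂ) * fS A n q * kern n β‖ ≤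
      8 * |P.det|⁻¹ * WW P N * EE A n q * ((q:ℝ)^4)⁻¹ * (1 / (β + 1 / ((q:ℝ) * (q + Y))) ^ 2) +
      C * |P.det|⁻¹ * WW P N * EE A n q * ((q:ℝ)^3)⁻¹ * Real.sqrt n * (Set.Ioc (0:ℝ) 1).indicator (fun β => 1 / (β + 1 / n)) β := by
  classical
  obtain ⟨C, hC, hlat⟩ := main_lattice
  refine ⟨4 * C, by positivity, ?_⟩
  intro A B P N n hA hPA hP hN hB hAB hBA hn q Y _ hqY hY β hβ
  have hq : 0 < q := Nat.pos_of_ne_zero (NeZero.ne q)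
  have hqr : (0:ℝ) < q := by exact_mod_cast hq
  have hq1 : (1:ℝ) ≤ q := by exact_mod_cast hq
  have hnr : (0:ℝ) < n := by exact_mod_cast hn
  have hd : 0 < |P.det| := abs_pos.2 hP
  have hE := EE_nonneg A n q
  have hW := WW_ge P N
  have hW0 : 0 < WW P N := lt_of_lt_of_le hd hW
  have hκ := sqrt_kap hPA hP q
  have hl := hlat A B P N hPA hP hN hB hAB hBA q
  have hlog : 0 ≤ Real.log q := Real.log_natCast_nonneg q
  obtain ⟨b, hab, hbY, hfil, hbp⟩ := filter_Ico (fun r : ℕ => β ≤ 1 / ((q:ℝ) * (q + r))) (by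
    intro r hr
    refine hr.trans ?_
    apply one_div_le_one_div_of_le
    · positivity
    · push_cast; nlinarith) (Y - q + 1) (Y + 1) (by omega)
  set a := Y - q + 1 with ha
  have hsum := Psi_hasSum hA hPA hP hn q Y β a b ha hfil
  set v : (Fin 4 → ℤ) → ℂ := fun c => ∑ r ∈ Finset.Ico a b, fc A n q (fun i => (c i : ZMod q)) (r : ZMod q) with hv
  set M := Bf (2 * A.det.natAbs * n) q * Real.sqrt (kap A (ZMod q)) * (2 + Real.log q) with hM
  have hME : M = EE A n q * Real.sqrt (kap A (ZMod q)) := by rw [hM, EE]; ring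
  have hvM : ∀ c, ‖v c‖ ≤ M := fun c => fc_inc hA n q _ a b hab (by omega)
  have hv2 : ∀ c, v c ≠ 0 → (2:ℤ) • c ∈ Lq A q := by
    intro c hc
    obtain ⟨r, _, hr⟩ := Finset.exists_ne_zero_of_sum_ne_zero hc
    exact fc_supp hA n q c _ hr
  have hind0 : 0 ≤ (Set.Ioc (0:ℝ) 1).indicator (fun β => 1 / (β + 1 / (n:ℝ))) β := by
    apply Set.indicator_nonneg; intro x hx; have := hx.1; positivity
  -- first part
  have part1 : ‖Psi A n q Y β - Kk P n q β 0 * v 0‖ ≤ 4 * C * |P.det|⁻¹ * WW P N * EE A n q * ((q:ℝ)^3)⁻¹ * Real.sqrt n * (Set.Ioc (0:ℝ) 1).indicator (fun β => 1 / (β + 1 / n)) β := by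
    rcases hab.eq_or_lt with hab' | hab'
    · have hv0 : ∀ c, v c = 0 := by intro c; rw [hv]; simp [← hab']
      have : Psi A n q Y β = 0 := by
        have h0 : (fun c : Fin 4 → ℤ => Kk P n q β c * v c) = fun _ => 0 := by funext c; rw [hv0, mul_zero]
        rw [h0] at hsum
        exact hsum.unique hasSum_zero
      rw [this, hv0, mul_zero, sub_zero, norm_zero]
      positivity
    · have hmem : a ∈ (Finset.Ico a (Y + 1)).filter (fun r : ℕ => β ≤ 1 / ((q:ℝ) * (q + r))) := by
        rw [hfil]; simp [hab']
      have hβa := (Finset.mem_filter.1 hmem).2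
      have haY : (q:ℝ) + (a:ℕ) = (Y:ℝ) + 1 := by
        have : q + a = Y + 1 := by omega
        exact_mod_cast this
      rw [haY] at hβa
      have hu := uu_ge n q Y hq hn hqY hY β hβ hβa
      have hβ1 : β ≤ 1 := by
        refine hβa.trans ?_
        rw [div_le_one (by positivity)]
        have : (0:ℝ) ≤ Y := by positivity
        nlinarith
      have h1 := tailK A P hP n q hq hn β hu v M hvM hv2 _ hsum
      refine h1.trans ?_
      rw [Set.indicator_of_mem (show β ∈ Set.Ioc (0:ℝ) 1 from ⟨hβ, hβ1⟩)]
      have h2 := two_inv_sqrt n q hq hn β hβ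
      have e : |P.det|⁻¹ * ((q:ℝ)^4 * ((1 / n) ^ 2 + β ^ 2))⁻¹ * M * (2 / Real.sqrt (uu n q β) * TL A P q (1/8)) = 
          |P.det|⁻¹ * EE A n q * (((q:ℝ)^4 * ((1 / n) ^ 2 + β ^ 2))⁻¹ * (2 / Real.sqrt (uu n q β))) * (Real.sqrt (kap A (ZMod q)) * TL A P q (1/8)) := by
        rw [hME]; ring
      rw [e]
      calc _ ≤ |P.det|⁻¹ * EE A n q * (4 * ((q:ℝ)^3)⁻¹ * Real.sqrt n * (1 / (β + 1 / n))) * (C * WW P N) := by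
            apply mul_le_mul _ hl _ (by positivity)
            · exact mul_le_mul_of_nonneg_left h2 (by positivity)
            · apply mul_nonneg (Real.sqrt_nonneg _)
              exact tsum_nonneg (fun x => Set.indicator_nonneg (fun _ _ => (Real.exp_pos _).le) x)
        _ = _ := by ring
  have hm : ((|P.det|⁻¹ : ℝ) : ℂ) * fS A n q * kern n β = Kk P n q β 0 * S A (ZMod.stdAddChar (N := q)) (n : ZMod q) 0 0 := by
    rw [Kk_zero, fS_eq]; ring
  have hv0 : v 0 = ∑ r ∈ Finset.Ico a b, fc A n q 0 (r : ZMod q) := by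
    rw [hv]
    apply Finset.sum_congr rfl
    intro r _
    congr 1
    funext i; simp
  have part2 : ‖Kk P n q β 0 * v 0 - ((|P.det|⁻¹ : ℝ) : ℂ) * fS A n q * kern n β‖ ≤ 8 * |P.det|⁻¹ * WW P N * EE A n q * ((q:ℝ)^4)⁻¹ * (1 / (β + 1 / ((q:ℝ) * (q + Y))) ^ 2) := by
    rw [hm, ← mul_sub]
    rcases hbY.eq_or_lt with hbY' | hbY'
    · have : v 0 = S A (ZMod.stdAddChar (N := q)) (n : ZMod q) 0 0 := by
        rw [hv0, ← fc_full A n q 0 a]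
        congr 2; omega
      rw [this, sub_self, mul_zero, norm_zero]
      positivity
    · have hβX : 1 / ((q:ℝ) * (q + Y)) ≤ β := by
        have := hbp hbY'
        push Not at this
        refine le_trans ?_ this.le
        apply one_div_le_one_div_of_le (by positivity)
        have : (b:ℝ) ≤ Y := by exact_mod_cast (by omega : b ≤ Y)
        gcongr
      have hS : ‖S A (ZMod.stdAddChar (N := q)) (n : ZMod q) 0 0‖ ≤ M := by
        refine (S_bound hA n _ rfl q _ (ZMod.isPrimitive_stdAddChar q) 0 0).trans ?_
        rw [hM]
        have : 0 ≤ Bf (2 * A.det.natAbs * n) q * Real.sqrt (kap A (ZMod q)) := mul_nonneg (Bf_nonneg _ _) (Real.sqrt_nonneg _)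
        nlinarith
      have h3 : ‖v 0 - S A (ZMod.stdAddChar (N := q)) (n : ZMod q) 0 0‖ ≤ 2 * (EE A n q * WW P N) := by
        refine (norm_sub_le _ _).trans ?_
        have h4 := hvM 0
        have h5 : M ≤ EE A n q * WW P N := by
          rw [hME]; exact mul_le_mul_of_nonneg_left (hκ.trans hW) hE
        linarith
      rw [norm_mul, norm_Kk P n q hq hn]
      have hF : Real.exp (-(Real.pi * uu n q β) * Fc P 0) = 1 := by
        have : Fc P 0 = 0 := by simpa using Fc_zsmul P 0 0
        rw [this]; simp
      rw [hF, mul_one, mul_inv]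
      have hX0 : 0 < 1 / ((q:ℝ) * (q + Y)) := by positivity
      have h6 : ((1 / (n:ℝ)) ^ 2 + β ^ 2)⁻¹ ≤ 4 * (1 / (β + 1 / ((q:ℝ) * (q + Y))) ^ 2) := by
        rw [mul_one_div, inv_eq_one_div, div_le_div_iff₀ (by positivity) (by positivity)]
        have : (0:ℝ) ≤ (1 / (n:ℝ))^2 := by positivity
        nlinarith
      calc _ ≤ |P.det|⁻¹ * (((q:ℝ)^4)⁻¹ * (4 * (1 / (β + 1 / ((q:ℝ) * (q + Y))) ^ 2))) * (2 * (EE A n q * WW P N)) := by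
            gcongr
        _ = _ := by ring
  have := norm_add_le (Psi A n q Y β - Kk P n q β 0 * v 0) (Kk P n q β 0 * v 0 - ((|P.det|⁻¹ : ℝ) : ℂ) * fS A n q * kern n β)
  rw [sub_add_sub_cancel] at this
  linarith

end QF

namespace QF
open MeasureTheory

lemma int_inv_sq (X : ℝ) (hX : 0 < X) : IntegrableOn (fun β : ℝ => 1 / (β + X) ^ 2) (Set.Ioi 0) ∧ ∫ β in Set.Ioi (0:ℝ), 1 / (β + X) ^ 2 = 1 / X := by
  have hd : ∀ x ∈ Set.Ici (0:ℝ), HasDerivAt (fun β : ℝ => -(β + X)⁻¹) (1 / (x + X) ^ 2) x := by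
    intro x hx
    have hx' : 0 ≤ x := hx
    have := (((hasDerivAt_id x).add_const X).inv (by simp only [id]; positivity)).neg
    refine this.congr_deriv ?_
    simp only [id]; ring
  have ht : Filter.Tendsto (fun β : ℝ => -(β + X)⁻¹) Filter.atTop (nhds (-0)) := by
    apply Filter.Tendsto.neg
    exact tendsto_inv_atTop_zero.comp (Filter.tendsto_atTop_add_const_right _ _ Filter.tendsto_id)
  have hc : ContinuousWithinAt (fun β : ℝ => -(β + X)⁻¹) (Set.Ici 0) 0 := (hd 0 Set.self_mem_Ici).continuousAt.continuousWithinAt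
  have hi := integrableOn_Ioi_deriv_of_nonneg hc (fun x hx => hd x (Set.mem_Ici.2 (le_of_lt (Set.mem_Ioi.1 hx)))) (fun x _ => by positivity) ht
  refine ⟨hi, ?_⟩
  rw [integral_Ioi_of_hasDerivAt_of_tendsto hc (fun x hx => hd x (Set.mem_Ici.2 (le_of_lt (Set.mem_Ioi.1 hx)))) hi ht]
  simp

lemma int_inv_lin (n : ℕ) (hn : 0 < n) : IntegrableOn ((Set.Ioc (0:ℝ) 1).indicator (fun β : ℝ => 1 / (β + 1 / (n:ℝ)))) (Set.Ioi 0) ∧ 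
    ∫ β in Set.Ioi (0:ℝ), (Set.Ioc (0:ℝ) 1).indicator (fun β : ℝ => 1 / (β + 1 / (n:ℝ))) β = Real.log (1 + n) := by
  have hnr : (0:ℝ) < n := by exact_mod_cast hn
  have hc : ContinuousOn (fun β : ℝ => 1 / (β + 1 / (n:ℝ))) (Set.Icc 0 1) := by
    apply ContinuousOn.div continuousOn_const (by fun_prop)
    intro x hx
    have := hx.1
    positivity
  constructor
  · apply Integrable.integrableOn
    rw [integrable_indicator_iff measurableSet_Ioc]
    exact (hc.integrableOn_Icc).mono_set Set.Ioc_subset_Icc_self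
  · rw [setIntegral_indicator measurableSet_Ioc]
    have : Set.Ioi (0:ℝ) ∩ Set.Ioc 0 1 = Set.Ioc 0 1 := Set.inter_eq_right.2 Set.Ioc_subset_Ioi_self
    rw [this, ← intervalIntegral.integral_of_le (by norm_num)]
    rw [intervalIntegral.integral_comp_add_right (fun x : ℝ => 1 / x), integral_one_div_of_pos (by positivity) (by positivity)]
    congr 1; field_simp; ring

lemma Hf_sum {A : Matrix (Fin 4) (Fin 4) ℤ} {n : ℕ} (hc : Continuous (gf A n)) (q Y : ℕ) (hq : 0 < q) : IntegrableOn (Psi A n q Y) (Set.Ioi 0) ∧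
    ∫ β in Set.Ioi (0:ℝ), Psi A n q Y β = ∑ r ∈ (Finset.Ico (Y - q + 1) (Y + 1)).filter (fun r => q.Coprime r), Hf (gf A n) q r := by
  classical
  have hqr : (0:ℝ) < q := by exact_mod_cast hq
  have hcr : ∀ r : ℕ, Continuous (fun β : ℝ => gf A n (-(Nat.gcdB q r : ℝ) / q + β)) := fun r => hc.comp (by fun_prop)
  have e : ∀ r : ℕ, (fun β : ℝ => if β ≤ 1 / ((q:ℝ) * (q + r)) then gf A n (-(Nat.gcdB q r : ℝ) / q + β) else 0) = 
      (Set.Iic (1 / ((q:ℝ) * (q + r)))).indicator (fun β : ℝ => gf A n (-(Nat.gcdB q r : ℝ) / q + β)) := by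
    intro r; funext β; rw [Set.indicator_apply]; simp
  have hi : ∀ r : ℕ, IntegrableOn (fun β : ℝ => if β ≤ 1 / ((q:ℝ) * (q + r)) then gf A n (-(Nat.gcdB q r : ℝ) / q + β) else 0) (Set.Ioi 0) := by
    intro r
    rw [e, IntegrableOn, integrable_indicator_iff measurableSet_Iic, IntegrableOn, Measure.restrict_restrict measurableSet_Iic, Set.inter_comm, Set.Ioi_inter_Iic]
    exact ((hcr r).continuousOn.integrableOn_Icc).mono_set Set.Ioc_subset_Icc_self
  have hP : Psi A n q Y = fun β => ∑ r ∈ (Finset.Ico (Y - q + 1) (Y + 1)).filter (fun r => q.Coprime r),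
    if β ≤ 1 / ((q:ℝ) * (q + r)) then gf A n (-(Nat.gcdB q r : ℝ) / q + β) else 0 := by
    funext β; rw [Psi]
  rw [hP]
  constructor
  · exact integrable_finsetSum _ (fun r _ => hi r)
  · rw [integral_finsetSum _ (fun r _ => hi r)]
    apply Finset.sum_congr rfl
    intro r _
    rw [e, setIntegral_indicator measurableSet_Iic, Set.Ioi_inter_Iic, Hf, intervalIntegral.integral_of_le (by positivity)]

lemma perq : ∃ C : ℝ, 0 < C ∧ ∀ (A B : Matrix (Fin 4) (Fin 4) ℤ) (P : Matrix (Fin 4) (Fin 4) ℝ) (N n : ℕ), IsGram A → 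
    P.transpose * P = A.map (Int.cast : ℤ → ℝ) → P.det ≠ 0 → 0 < N → IsGram B → A * B = (N : ℤ) • 1 → B * A = (N : ℤ) • 1 → 0 < n →
    ∀ (q Y : ℕ), 0 < q → q ≤ Y → Y = Nat.sqrt n → 
    ‖∑ r ∈ (Finset.Ico (Y - q + 1) (Y + 1)).filter (fun r => q.Coprime r), Hf (gf A n) q r - ((|P.det|⁻¹ : ℝ) : ℂ) * fS A n q * (n * I0)‖ ≤
      C * (|P.det|⁻¹ * WW P N * Real.sqrt n * (1 + Real.log (1 + n))) * (EE A n q * ((q:ℝ)^3)⁻¹) := by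
  obtain ⟨C, hC, hpt⟩ := pointwise
  refine ⟨16 + C, by positivity, ?_⟩
  intro A B P N n hA hPA hP hN hB hAB hBA hn q Y hq hqY hY
  haveI : NeZero q := ⟨hq.ne'⟩
  have hqr : (0:ℝ) < q := by exact_mod_cast hq
  have hnr : (0:ℝ) < n := by exact_mod_cast hn
  have hcont := gf_continuous hA hPA hP hn
  obtain ⟨hPi, hPe⟩ := Hf_sum hcont q Y hq
  have hX : 0 < 1 / ((q:ℝ) * (q + Y)) := by positivity
  obtain ⟨hi1, he1⟩ := int_inv_sq _ hX
  obtain ⟨hi2, he2⟩ := int_inv_lin n hn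
  have hE := EE_nonneg A n q
  have hd : 0 < |P.det| := abs_pos.2 hP
  have hW0 : 0 < WW P N := lt_of_lt_of_le hd (WW_ge P N)
  rw [← hPe, ← kern_integral n hn, ← integral_const_mul, ← integral_sub hPi ((kern_int n hn).integrableOn.const_mul _)]
  refine (norm_integral_le_of_norm_le ((hi1.const_mul (8 * |P.det|⁻¹ * WW P N * EE A n q * ((q:ℝ)^4)⁻¹)).add 
    (hi2.const_mul (C * |P.det|⁻¹ * WW P N * EE A n q * ((q:ℝ)^3)⁻¹ * Real.sqrt n))) 
    ((ae_restrict_iff' measurableSet_Ioi).2 (Filter.Eventually.of_forall (fun β hβ => ?_)))).trans ?_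
  · exact hpt A B P N n hA hPA hP hN hB hAB hBA hn q Y hqY hY β hβ
  · simp only [Pi.add_apply]
    rw [integral_add (hi1.const_mul _) (hi2.const_mul _), integral_const_mul, integral_const_mul, he1, he2]
    have hYs : (Y:ℝ) ≤ Real.sqrt n := by
      rw [hY]; exact Real.nat_sqrt_le_real_sqrt
    have hqY' : (q:ℝ) ≤ Y := by exact_mod_cast hqY
    have hlog : 0 ≤ Real.log (1 + n) := Real.log_nonneg (by linarith)
    have hs : 0 < Real.sqrt n := Real.sqrt_pos.2 hnr
    rw [one_div_one_div]
    set K := |P.det|⁻¹ * WW P N * EE A n q * ((q:ℝ)^3)⁻¹ with hK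
    have hK0 : 0 ≤ K := by positivity
    have e1 : 8 * |P.det|⁻¹ * WW P N * EE A n q * ((q:ℝ)^4)⁻¹ * ((q:ℝ) * (q + Y)) = K * (8 * (q + Y)) := by
      rw [hK]; field_simp
    have e2 : C * |P.det|⁻¹ * WW P N * EE A n q * ((q:ℝ)^3)⁻¹ * Real.sqrt n * Real.log (1 + n) = K * (C * Real.sqrt n * Real.log (1 + n)) := by
      rw [hK]; ring
    have e3 : (16 + C) * (|P.det|⁻¹ * WW P N * Real.sqrt n * (1 + Real.log (1 + n))) * (EE A n q * ((q:ℝ)^3)⁻¹) = K * ((16 + C) * Real.sqrt n * (1 + Real.log (1 + n))) := by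
      rw [hK]; ring
    rw [e1, e2, e3, ← mul_add]
    apply mul_le_mul_of_nonneg_left _ hK0
    nlinarith [mul_nonneg hs.le hlog, mul_nonneg hC.le hs.le]

end QF

namespace QF
open MeasureTheory

lemma fS_real (A : Matrix (Fin 4) (Fin 4) ℤ) (n q : ℕ) : (starRingEnd ℂ) (fS A n q) = fS A n q := by
  classical
  rcases Nat.eq_zero_or_pos q with rfl | hq
  · rw [fS_zero, map_zero]
  haveI : NeZero q := ⟨hq.ne'⟩
  rw [fS_eq, map_div₀, map_pow, Complex.conj_natCast]
  congr 1
  unfold S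
  rw [map_sum]
  refine Finset.sum_bij (fun a _ => -a) (fun a _ => @Finset.mem_univ _ (_) _) (fun a _ b _ h => neg_injective h) (fun b _ => ⟨-b, @Finset.mem_univ _ (_) _, neg_neg b⟩) (fun a _ => ?_)
  rw [map_mul]

  unfold G
  rw [map_sum]
  simp_rw [← AddChar.map_neg_eq_conj]
  congr 1
  · congr 1; simp
  · apply Finset.sum_congr rfl
    intro x _
    congr 1; simp [dt]

lemma fS_re (A : Matrix (Fin 4) (Fin 4) ℤ) (n q : ℕ) : (((fS A n q).re : ℝ) : ℂ) = fS A n q :=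
  Complex.conj_eq_iff_re.1 (fS_real A n q)

lemma SY_sum (Y : ℕ) (F : ℕ → ℕ → ℂ) : ∑ p ∈ SY Y, F p.1 p.2 = ∑ q ∈ Finset.Icc 1 Y, ∑ r ∈ (Finset.Ico (Y - q + 1) (Y + 1)).filter (fun r => q.Coprime r), F q r := by
  rw [SY, Finset.sum_filter, Finset.sum_product]
  apply Finset.sum_congr rfl
  intro q hq
  rw [Finset.mem_Icc] at hq
  rw [← Finset.sum_filter]
  apply Finset.sum_congr _ (fun _ _ => rfl)
  ext r
  simp only [Finset.mem_filter, Finset.mem_Icc, Finset.mem_Ico]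
  constructor
  · rintro ⟨h1, h2, h3⟩; exact ⟨by omega, h2⟩
  · rintro ⟨h1, h2⟩; exact ⟨by omega, h2, by omega⟩

lemma total : ∃ C : ℝ, 0 < C ∧ ∀ (A B : Matrix (Fin 4) (Fin 4) ℤ) (P : Matrix (Fin 4) (Fin 4) ℝ) (N n : ℕ), IsGram A → 
    P.transpose * P = A.map (Int.cast : ℤ → ℝ) → P.det ≠ 0 → 0 < N → IsGram B → A * B = (N : ℤ) • 1 → B * A = (N : ℤ) • 1 → 0 < n →
    ¬ Represented A n →
    n * ‖∑ q ∈ Finset.Icc 1 (Nat.sqrt n), fS A n q‖ ≤ C * (WW P N * Real.sqrt n * (1 + Real.log (1 + n))) * ∑ q ∈ Finset.Icc 1 (Nat.sqrt n), (EE A n q * ((q:ℝ)^3)⁻¹) := by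
  obtain ⟨C, hC, hpq⟩ := perq
  have hI := I0_pos
  refine ⟨C / I0.re, by positivity, ?_⟩
  intro A B P N n hA hPA hP hN hB hAB hBA hn hrep
  have hd : 0 < |P.det| := abs_pos.2 hP
  have hnr : (0:ℝ) < n := by exact_mod_cast hn
  set Y := Nat.sqrt n with hY
  have hY1 : 1 ≤ Y := Nat.sqrt_pos.2 hn
  have h0 := farey (gf_continuous hA hPA hP hn) (fun α k => gf_add_int α k) (fun α => gf_neg α) Y hY1
  rw [gf_integral hA hPA hP hn hrep, SY_sum] at h0
  have h1 : (∑ q ∈ Finset.Icc 1 Y, ∑ r ∈ (Finset.Ico (Y - q + 1) (Y + 1)).filter (fun r => q.Coprime r), Hf (gf A n) q r).re = 0 := by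
    have := congrArg Complex.re h0
    rw [Complex.zero_re, Complex.ofReal_re] at this
    linarith
  set Φ : ℕ → ℂ := fun q => ∑ r ∈ (Finset.Ico (Y - q + 1) (Y + 1)).filter (fun r => q.Coprime r), Hf (gf A n) q r with hΦ
  have h2 : ‖∑ q ∈ Finset.Icc 1 Y, (Φ q - ((|P.det|⁻¹ : ℝ) : ℂ) * fS A n q * (n * I0))‖ ≤ ∑ q ∈ Finset.Icc 1 Y, C * (|P.det|⁻¹ * WW P N * Real.sqrt n * (1 + Real.log (1 + n))) * (EE A n q * ((q:ℝ)^3)⁻¹) := by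
    refine norm_sum_le_of_le _ (fun q hq => ?_)
    rw [Finset.mem_Icc] at hq
    exact hpq A B P N n hA hPA hP hN hB hAB hBA hn q Y hq.1 hq.2 hY
  rw [Finset.sum_sub_distrib, ← Finset.sum_mul, ← Finset.mul_sum, ← Finset.mul_sum] at h2
  have h3 := (Complex.abs_re_le_norm _).trans h2
  rw [Complex.sub_re, h1, zero_sub, abs_neg] at h3
  have hreal : ∑ q ∈ Finset.Icc 1 Y, fS A n q = ((∑ q ∈ Finset.Icc 1 Y, (fS A n q).re : ℝ) : ℂ) := by
    push_cast
    exact Finset.sum_congr rfl (fun q _ => (fS_re A n q).symm)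
  rw [hreal] at h3 ⊢
  set σ := ∑ q ∈ Finset.Icc 1 Y, (fS A n q).re with hσ
  have e1 : (((|P.det|⁻¹ : ℝ) : ℂ) * (σ : ℂ) * (n * I0)).re = |P.det|⁻¹ * σ * n * I0.re := by
    have : ((|P.det|⁻¹ : ℝ) : ℂ) * (σ : ℂ) * (n * I0) = ((|P.det|⁻¹ * σ * n : ℝ) : ℂ) * I0 := by push_cast; ring
    rw [this, Complex.re_ofReal_mul]
  rw [e1, abs_mul, abs_mul, abs_mul, abs_of_pos hI, abs_of_pos (inv_pos.2 hd), abs_of_pos hnr] at h3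
  rw [Complex.norm_real, Real.norm_eq_abs]
  set Sg := ∑ q ∈ Finset.Icc 1 Y, EE A n q * ((q:ℝ)^3)⁻¹
  have e2 : |P.det|⁻¹ * |σ| * n * I0.re = (|P.det|⁻¹ * I0.re) * (n * |σ|) := by ring
  have e3 : C * (|P.det|⁻¹ * WW P N * Real.sqrt n * (1 + Real.log (1 + n))) * Sg = 
      (|P.det|⁻¹ * I0.re) * (C / I0.re * (WW P N * Real.sqrt n * (1 + Real.log (1 + n))) * Sg) := by
    field_simp
  rw [e2, e3] at h3
  exact le_of_mul_le_mul_left h3 (by positivity)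

end QF

namespace QF
open MeasureTheory

lemma sum_small (δ : ℝ) (hδ : 0 < δ) : ∃ C : ℝ, 0 < C ∧ ∀ m : ℕ, 0 < m → ∀ Y : ℕ, 
    ∑ q ∈ Finset.Icc 1 Y, Bf m q * ((q:ℝ)^3)⁻¹ ≤ C * (Y:ℝ)^(1/2+δ) * 4^m.primeFactors.card := by
  obtain ⟨C, hC, h⟩ := rankin δ hδ
  refine ⟨C, hC, fun m hm Y => ?_⟩
  have h1 := h m hm (Finset.Icc 1 Y) (fun q hq => (Finset.mem_Icc.1 hq).1)
  calc ∑ q ∈ Finset.Icc 1 Y, Bf m q * ((q:ℝ)^3)⁻¹ ≤ ∑ q ∈ Finset.Icc 1 Y, (Y:ℝ)^(1/2+δ) * (Bf m q * (q:ℝ)^(-(7/2+δ))) := by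
        apply Finset.sum_le_sum
        intro q hq
        rw [Finset.mem_Icc] at hq
        have hq0 : (0:ℝ) < q := by exact_mod_cast hq.1
        have e : ((q:ℝ)^3)⁻¹ = (q:ℝ)^(1/2+δ) * (q:ℝ)^(-(7/2+δ)) := by
          rw [← Real.rpow_add hq0, ← Real.rpow_natCast, ← Real.rpow_neg hq0.le]
          congr 1; push_cast; ring
        have h2 : (q:ℝ)^(1/2+δ) ≤ (Y:ℝ)^(1/2+δ) := Real.rpow_le_rpow hq0.le (by exact_mod_cast hq.2) (by positivity)
        have := Bf_nonneg m q
        rw [e, mul_left_comm]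
        gcongr
    _ = (Y:ℝ)^(1/2+δ) * ∑ q ∈ Finset.Icc 1 Y, (Bf m q * (q:ℝ)^(-(7/2+δ))) := by rw [Finset.mul_sum]
    _ ≤ (Y:ℝ)^(1/2+δ) * (C*4^m.primeFactors.card) := by gcongr
    _ = _ := by ring

lemma tail_bd (δ : ℝ) (hδ : 0 < δ) (hδ' : δ < 1/2) : ∃ C : ℝ, 0 < C ∧ ∀ (A : Matrix (Fin 4) (Fin 4) ℤ) (n : ℕ), IsGram A → A.det ≠ 0 → 0 < n →
    ∀ Y : ℕ, ‖(∑' q, fS A n q) - ∑ q ∈ Finset.Icc 1 Y, fS A n q‖ ≤ C * Real.sqrt (A.det.natAbs) * ((Y:ℝ)+1)^(-(1/2-δ)) * 4^(2*A.det.natAbs*n).primeFactors.card := by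
  obtain ⟨C, hC, h⟩ := rankin δ hδ
  refine ⟨C, hC, fun A n hA hdet hn Y => ?_⟩
  set m := 2*A.det.natAbs*n with hm
  have hm0 : 0 < m := by have := Int.natAbs_pos.2 hdet; positivity
  have hs := (fS_summable hA hdet n hn).of_norm.hasSum
  have ht := (hs.sub_const (∑ q ∈ Finset.Icc 1 Y, fS A n q)).norm
  refine le_of_tendsto ht ?_
  filter_upwards [Filter.eventually_ge_atTop (Finset.Icc 1 Y)] with T hT
  have hT' : Finset.Icc 1 Y ⊆ T := hT
  rw [← Finset.sum_sdiff hT', add_sub_cancel_right]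
  have hz : ∑ q ∈ T \ Finset.Icc 1 Y, fS A n q = ∑ q ∈ (T \ Finset.Icc 1 Y).filter (fun q => 0 < q), fS A n q := by
    symm
    apply Finset.sum_filter_of_ne
    intro q _ hq
    rcases Nat.eq_zero_or_pos q with rfl | h0
    · exact absurd (fS_zero A n) hq
    · exact h0
  rw [hz]
  set U := (T \ Finset.Icc 1 Y).filter (fun q => 0 < q) with hU
  have hU0 : ∀ q ∈ U, 0 < q := fun q hq => (Finset.mem_filter.1 hq).2
  have hU1 : ∀ q ∈ U, Y + 1 ≤ q := by
    intro q hq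
    rw [hU, Finset.mem_filter, Finset.mem_sdiff, Finset.mem_Icc] at hq
    omega
  have h1 := h m hm0 U hU0
  calc ‖∑ q ∈ U, fS A n q‖ ≤ ∑ q ∈ U, (Real.sqrt (A.det.natAbs) * ((Y:ℝ)+1)^(-(1/2-δ))) * (Bf m q * (q:ℝ)^(-(7/2+δ))) := by
        refine norm_sum_le_of_le _ (fun q hq => ?_)
        have hq0 : (0:ℝ) < q := by exact_mod_cast hU0 q hq
        have hq1 : (Y:ℝ) + 1 ≤ q := by exact_mod_cast hU1 q hq
        refine (fS_bound' hA hdet n q).trans ?_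
        have e : (q:ℝ)^(-4:ℝ) = (q:ℝ)^(-(1/2-δ)) * (q:ℝ)^(-(7/2+δ)) := by
          rw [← Real.rpow_add hq0]; congr 1; ring
        have h2 : (q:ℝ)^(-(1/2-δ)) ≤ ((Y:ℝ)+1)^(-(1/2-δ)) := Real.rpow_le_rpow_of_nonpos (by positivity) hq1 (by linarith)
        have := Bf_nonneg m q
        rw [e, ← hm]
        calc Real.sqrt (A.det.natAbs) * (Bf m q * ((q:ℝ)^(-(1/2-δ)) * (q:ℝ)^(-(7/2+δ)))) = (Real.sqrt (A.det.natAbs) * (q:ℝ)^(-(1/2-δ))) * (Bf m q * (q:ℝ)^(-(7/2+δ))) := by ring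
          _ ≤ _ := by gcongr
    _ = (Real.sqrt (A.det.natAbs) * ((Y:ℝ)+1)^(-(1/2-δ))) * ∑ q ∈ U, (Bf m q * (q:ℝ)^(-(7/2+δ))) := by rw [Finset.mul_sum]
    _ ≤ (Real.sqrt (A.det.natAbs) * ((Y:ℝ)+1)^(-(1/2-δ))) * (C*4^m.primeFactors.card) := by gcongr
    _ = _ := by ring

lemma log_bd (η : ℝ) (hη : 0 < η) : ∃ C : ℝ, 0 < C ∧ ∀ n : ℕ, 0 < n → 1 + Real.log (1 + n) ≤ C * (n:ℝ)^η := by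
  refine ⟨1 + 2^η/η, by positivity, fun n hn => ?_⟩
  have hn1 : (1:ℝ) ≤ n := by exact_mod_cast hn
  have h1 := Real.log_le_rpow_div (x := 1 + (n:ℝ)) (by positivity) hη
  have h2 : (1 + (n:ℝ))^η ≤ (2 * n)^η := Real.rpow_le_rpow (by positivity) (by linarith) hη.le
  rw [Real.mul_rpow (by norm_num) (by positivity)] at h2
  have h3 : 1 ≤ (n:ℝ)^η := Real.one_le_rpow hn1 hη.le
  have h4 : (1 + (n:ℝ))^η/η ≤ 2^η * (n:ℝ)^η / η := by gcongr
  have : (1 + 2^η/η) * (n:ℝ)^η = (n:ℝ)^η + 2^η * (n:ℝ)^η / η := by ring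
  linarith

end QF

namespace QF
open MeasureTheory

lemma final_ineq (δ : ℝ) (hδ : 0 < δ) (hδ' : δ < 1/2) : ∃ C : ℝ, 0 < C ∧ ∀ (A B : Matrix (Fin 4) (Fin 4) ℤ) (P : Matrix (Fin 4) (Fin 4) ℝ) (N n : ℕ), IsGram A → 
    P.transpose * P = A.map (Int.cast : ℤ → ℝ) → P.det ≠ 0 → 0 < N → IsGram B → A * B = (N : ℤ) • 1 → B * A = (N : ℤ) • 1 → 0 < n →
    StrongLocalSolubility A n → ¬ Represented A n →
    (n:ℝ)^(1/4:ℝ) ≤ C * WW P N * ((n:ℝ)^(2*δ) * (A.det.natAbs:ℝ)^δ) := by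
  obtain ⟨Ct, hCt, htot⟩ := total
  obtain ⟨C1, hC1, hsm⟩ := sum_small δ hδ
  obtain ⟨C2, hC2, htl⟩ := tail_bd δ hδ hδ'
  obtain ⟨CL, hCL, hlog⟩ := log_bd (δ/4) (by positivity)
  obtain ⟨Co, hCo, hom⟩ := omega_bound 108 (by norm_num) δ hδ
  obtain ⟨c, hc, hss⟩ := sing_series
  set K := 2*Ct*C1 + C2 with hK
  have hK0 : 0 < K := by positivity
  refine ⟨c⁻¹ * K * CL^2 * Co * 6^δ, by positivity, ?_⟩
  intro A B P N n hA hPA hP hN hB hAB hBA hn hsls hrep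
  have hdet : A.det ≠ 0 := det_ne hPA hP
  have hD0 : 0 < A.det.natAbs := Int.natAbs_pos.2 hdet
  have hD : (0:ℝ) < A.det.natAbs := by exact_mod_cast hD0
  have hn0 : (0:ℝ) < n := by exact_mod_cast hn
  have hn1 : (1:ℝ) ≤ n := by exact_mod_cast hn
  have hT := htot A B P N n hA hPA hP hN hB hAB hBA hn hrep
  have hS := hss A n hA hdet hn hsls
  have hTl := htl A n hA hdet hn (Nat.sqrt n)
  set Y := Nat.sqrt n with hY
  set m := 2*A.det.natAbs*n with hm
  have hm0 : 0 < m := by positivity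
  have hSm := hsm m hm0 Y
  have hsq : Real.sqrt (A.det.natAbs) = |P.det| := by
    rw [← det_sq hPA, Real.sqrt_sq (abs_nonneg _)]
  have hW : |P.det| ≤ WW P N := WW_ge P N
  have hdp : 0 < |P.det| := abs_pos.2 hP
  have hW0 : 0 < WW P N := hdp.trans_le hW
  set L := 1 + Real.log (1 + n) with hL
  have hL1 : 1 ≤ L := by
    have := Real.log_nonneg (x := 1 + (n:ℝ)) (by linarith)
    rw [hL]; linarith
  have hYs : (Y:ℝ) ≤ Real.sqrt n := by
    apply Real.le_sqrt_of_sq_le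
    exact_mod_cast Nat.sqrt_le' n
  have hYn : Y ≤ n := Nat.sqrt_le_self n
  have hYs' : Real.sqrt n ≤ (Y:ℝ) + 1 := by
    apply Real.sqrt_le_iff.2 ⟨by positivity, ?_⟩
    have := Nat.lt_succ_sqrt' n
    exact_mod_cast this.le
  set w := m.primeFactors.card with hw
  set w3 := (3*m).primeFactors.card with hw3
  have hww : w ≤ w3 := by
    apply Finset.card_le_card
    apply Nat.primeFactors_mono (Dvd.intro_left 3 rfl) (by positivity)
  have h4 : (4:ℝ)^w ≤ 4^w3 := pow_le_pow_right₀ (by norm_num) hww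
  -- sum of EE
  have hEE : ∑ q ∈ Finset.Icc 1 Y, (EE A n q * ((q:ℝ)^3)⁻¹) ≤ 2 * L * (C1 * (n:ℝ)^(1/4+δ/2) * 4^w3) := by
    calc ∑ q ∈ Finset.Icc 1 Y, (EE A n q * ((q:ℝ)^3)⁻¹) ≤ ∑ q ∈ Finset.Icc 1 Y, 2 * L * (Bf m q * ((q:ℝ)^3)⁻¹) := by
          apply Finset.sum_le_sum
          intro q hq
          rw [Finset.mem_Icc] at hq
          have hq0 : (0:ℝ) < q := by exact_mod_cast hq.1
          have hqn : (q:ℝ) ≤ n := by exact_mod_cast hq.2.trans hYn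
          have hl : Real.log q ≤ Real.log (1+n) := Real.log_le_log hq0 (by linarith)
          have hl0 : 0 ≤ Real.log (1+n) := Real.log_nonneg (by linarith)
          have h2 : 2 + Real.log q ≤ 2 * L := by rw [hL]; linarith
          unfold EE
          rw [← hm]
          have := Bf_nonneg m q
          calc Bf m q * (2 + Real.log q) * ((q:ℝ)^3)⁻¹ ≤ Bf m q * (2 * L) * ((q:ℝ)^3)⁻¹ := by gcongr
            _ = _ := by ring
      _ = 2 * L * ∑ q ∈ Finset.Icc 1 Y, Bf m q * ((q:ℝ)^3)⁻¹ := by rw [Finset.mul_sum]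
      _ ≤ 2 * L * (C1 * (Y:ℝ)^(1/2+δ) * 4^w) := by gcongr
      _ ≤ 2 * L * (C1 * (n:ℝ)^(1/4+δ/2) * 4^w3) := by
          have : (Y:ℝ)^(1/2+δ) ≤ (n:ℝ)^(1/4+δ/2) := by
            calc (Y:ℝ)^(1/2+δ) ≤ (Real.sqrt n)^(1/2+δ) := Real.rpow_le_rpow (by positivity) hYs (by positivity)
              _ = (n:ℝ)^(1/4+δ/2) := by
                rw [Real.sqrt_eq_rpow, ← Real.rpow_mul hn0.le]; congr 1; ring
          gcongr
  have hTl' : ((Y:ℝ)+1)^(-(1/2-δ)) ≤ (n:ℝ)^(-1/4+δ/2) := by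
    calc ((Y:ℝ)+1)^(-(1/2-δ)) ≤ (Real.sqrt n)^(-(1/2-δ)) := Real.rpow_le_rpow_of_nonpos (Real.sqrt_pos.2 hn0) hYs' (by linarith)
      _ = _ := by rw [Real.sqrt_eq_rpow, ← Real.rpow_mul hn0.le]; congr 1; ring
  set X := (n:ℝ)^(3/4:ℝ) * (n:ℝ)^(δ/2) with hX
  have eX1 : Real.sqrt n * (n:ℝ)^(1/4+δ/2) = X := by
    rw [hX, Real.sqrt_eq_rpow, ← Real.rpow_add hn0, ← Real.rpow_add hn0]; congr 1; ring
  have eX2 : n * (n:ℝ)^(-1/4+δ/2) = X := by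
    rw [hX, ← Real.rpow_add hn0, ← Real.rpow_one_add' hn0.le (by linarith)]; congr 1; ring
  have hXp : 0 < X := by positivity
  have hA1 : n * ‖∑ q ∈ Finset.Icc 1 Y, fS A n q‖ ≤ 2*Ct*C1 * (WW P N * L^2 * X * 4^w3) := by
    calc _ ≤ _ := hT
      _ ≤ Ct * (WW P N * Real.sqrt n * L) * (2 * L * (C1 * (n:ℝ)^(1/4+δ/2) * 4^w3)) := by gcongr
      _ = 2*Ct*C1 * (WW P N * L^2 * (Real.sqrt n * (n:ℝ)^(1/4+δ/2)) * 4^w3) := by ring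
      _ = _ := by rw [eX1]
  have hA2 : n * ‖(∑' q, fS A n q) - ∑ q ∈ Finset.Icc 1 Y, fS A n q‖ ≤ C2 * (WW P N * L^2 * X * 4^w3) := by
    rw [hsq] at hTl
    have hL2 : 1 ≤ L^2 := one_le_pow₀ hL1
    calc _ ≤ n * (C2 * |P.det| * ((Y:ℝ)+1)^(-(1/2-δ)) * 4^w) := by gcongr
      _ ≤ n * (C2 * WW P N * (n:ℝ)^(-1/4+δ/2) * 4^w3) := by gcongr
      _ = C2 * (WW P N * 1 * (n * (n:ℝ)^(-1/4+δ/2)) * 4^w3) := by ring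
      _ = C2 * (WW P N * 1 * X * 4^w3) := by rw [eX2]
      _ ≤ _ := by gcongr
  have hmain : n * (c * (1/27:ℝ)^w3) ≤ K * (WW P N * L^2 * X * 4^w3) := by
    have htri : ‖∑' q, fS A n q‖ ≤ ‖∑ q ∈ Finset.Icc 1 Y, fS A n q‖ + ‖(∑' q, fS A n q) - ∑ q ∈ Finset.Icc 1 Y, fS A n q‖ := by
      have := norm_add_le (∑ q ∈ Finset.Icc 1 Y, fS A n q) ((∑' q, fS A n q) - ∑ q ∈ Finset.Icc 1 Y, fS A n q)
      rwa [add_sub_cancel] at this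
    have h5 : n * (c * (1/27:ℝ)^w3) ≤ n * (‖∑ q ∈ Finset.Icc 1 Y, fS A n q‖ + ‖(∑' q, fS A n q) - ∑ q ∈ Finset.Icc 1 Y, fS A n q‖) := by
      have := hS.trans htri
      gcongr
    rw [hK]
    linarith
  have h108 : (108:ℝ)^w3 ≤ Co * (6^δ * ((A.det.natAbs:ℝ)^δ * (n:ℝ)^δ)) := by
    have := hom (3*m) (by positivity)
    rw [← hw3] at this
    have e : (((3*m : ℕ)):ℝ) = 6 * (A.det.natAbs * n) := by rw [hm]; push_cast; ring
    rw [e, Real.mul_rpow (by norm_num) (by positivity), Real.mul_rpow (by positivity) (by positivity)] at this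
    exact this
  have hL2 : L^2 ≤ CL^2 * (n:ℝ)^(δ/2) := by
    have h6 := hlog n hn
    calc L^2 ≤ (CL * (n:ℝ)^(δ/4))^2 := by gcongr
      _ = CL^2 * ((n:ℝ)^(δ/4) * (n:ℝ)^(δ/4)) := by ring
      _ = _ := by rw [← Real.rpow_add hn0]; congr 2; ring
  have e27 : (1/27:ℝ)^w3 * 27^w3 = 1 := by rw [← mul_pow]; norm_num
  have e108 : (4:ℝ)^w3 * 27^w3 = 108^w3 := by rw [← mul_pow]; norm_num
  have en : (n:ℝ) = (n:ℝ)^(3/4:ℝ) * (n:ℝ)^(1/4:ℝ) := by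
    rw [← Real.rpow_add hn0]; norm_num
  have h7 : (n:ℝ)^(3/4:ℝ) * (c * (n:ℝ)^(1/4:ℝ)) ≤ (n:ℝ)^(3/4:ℝ) * (K * (WW P N * L^2 * (n:ℝ)^(δ/2) * 108^w3)) := by
    calc (n:ℝ)^(3/4:ℝ) * (c * (n:ℝ)^(1/4:ℝ)) = c * ((n:ℝ)^(3/4:ℝ) * (n:ℝ)^(1/4:ℝ)) := by ring
      _ = c * n * ((1/27:ℝ)^w3 * 27^w3) := by rw [← en, e27, mul_one]
      _ = (n * (c * (1/27:ℝ)^w3)) * 27^w3 := by ring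
      _ ≤ (K * (WW P N * L^2 * X * 4^w3)) * 27^w3 := by gcongr
      _ = (n:ℝ)^(3/4:ℝ) * (K * (WW P N * L^2 * (n:ℝ)^(δ/2) * (4^w3 * 27^w3))) := by rw [hX]; ring
      _ = _ := by rw [e108]
  have h8 := le_of_mul_le_mul_left h7 (by positivity)
  have en2 : (n:ℝ)^(2*δ) = (n:ℝ)^(δ/2) * (n:ℝ)^(δ/2) * (n:ℝ)^δ := by
    rw [← Real.rpow_add hn0, ← Real.rpow_add hn0]; congr 1; ring
  calc (n:ℝ)^(1/4:ℝ) = c⁻¹ * (c * (n:ℝ)^(1/4:ℝ)) := by field_simp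
    _ ≤ c⁻¹ * (K * (WW P N * L^2 * (n:ℝ)^(δ/2) * 108^w3)) := by gcongr
    _ ≤ c⁻¹ * (K * (WW P N * (CL^2 * (n:ℝ)^(δ/2)) * (n:ℝ)^(δ/2) * (Co * (6^δ * ((A.det.natAbs:ℝ)^δ * (n:ℝ)^δ))))) := by gcongr
    _ = _ := by rw [en2]; ring

end QF

namespace QF
open MeasureTheory

lemma det_le_cube {A B : Matrix (Fin 4) (Fin 4) ℤ} {N n : ℕ} (hN : 0 < N) (hAB : A * B = (N : ℤ) • 1) (hBA : B * A = (N : ℤ) • 1)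
    (hS : StrongLocalSolubility A n) : A.det.natAbs ≤ N^3 := by
  have hdd : A.det * B.det = (N:ℤ)^4 := by
    rw [← Matrix.det_mul, hAB, Matrix.det_smul]; simp
  have hN0 : (N:ℤ) ≠ 0 := by exact_mod_cast hN.ne'
  have hB0 : B.det ≠ 0 := by
    intro h; rw [h, mul_zero] at hdd
    exact pow_ne_zero 4 hN0 hdd.symm
  have hent : ∀ i j, (N:ℤ) ∣ B.det * A i j := by
    intro i j
    have h1 : B.det • A = (N:ℤ) • B.adjugate := by
      calc B.det • A = (B.adjugate * B) * A := by rw [Matrix.adjugate_mul, Matrix.smul_mul, Matrix.one_mul]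
        _ = _ := by rw [Matrix.mul_assoc, hBA, Matrix.mul_smul, Matrix.mul_one]
    have h2 := congrFun (congrFun h1 i) j
    simp only [Matrix.smul_apply, smul_eq_mul] at h2
    exact ⟨_, h2⟩
  have hdvd : (N:ℤ) ∣ B.det := by
    obtain ⟨a, b, hab, ha, hb⟩ : ∃ a b : ℤ, IsCoprime a b ∧ (N:ℤ) = (Int.gcd N B.det : ℤ) * a ∧ B.det = (Int.gcd N B.det : ℤ) * b := by
      have hg : 0 < Int.gcd (N:ℤ) B.det := Int.gcd_pos_of_ne_zero_left _ hN0
      refine ⟨(N:ℤ) / (Int.gcd N B.det : ℤ), B.det / (Int.gcd N B.det : ℤ), ?_, ?_, ?_⟩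
      · rw [Int.isCoprime_iff_gcd_eq_one]
        exact Int.gcd_ediv_gcd_ediv_gcd hg
      · rw [Int.mul_ediv_cancel' (Int.gcd_dvd_left ..)]
      · rw [Int.mul_ediv_cancel' (Int.gcd_dvd_right ..)]
    have hg0 : (Int.gcd N B.det : ℤ) ≠ 0 := by
      have : 0 < Int.gcd (N:ℤ) B.det := Int.gcd_pos_of_ne_zero_left _ hN0
      exact_mod_cast this.ne'
    generalize (Int.gcd N B.det : ℤ) = g at ha hb hg0
    have haA : ∀ i j, a ∣ A i j := by
      intro i j
      have := hent i j
      rw [ha, hb, mul_assoc] at this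
      exact hab.dvd_of_dvd_mul_left ((mul_dvd_mul_iff_left hg0).1 this)
    have ha1 : a.natAbs = 1 := by
      by_contra hne
      obtain ⟨p, hp, hpa⟩ := Nat.exists_prime_and_dvd hne
      obtain ⟨x, -, hx⟩ := hS.2 p hp
      apply hx
      intro i
      rw [Matrix.mulVec, dotProduct]
      apply Finset.dvd_sum
      intro j _
      exact Dvd.dvd.mul_right ((Int.natCast_dvd.2 hpa).trans (haA i j)) _
    rw [hb, ha]
    exact mul_dvd_mul_left g ((Int.isUnit_iff_natAbs_eq.2 ha1).dvd)
  have h1 : N ≤ B.det.natAbs := Nat.le_of_dvd (Int.natAbs_pos.2 hB0) (Int.natCast_dvd.1 hdvd)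
  have h2 : A.det.natAbs * B.det.natAbs = N^4 := by
    rw [← Int.natAbs_mul, hdd, Int.natAbs_pow, Int.natAbs_natCast]
  have h3 : A.det.natAbs * N ≤ N^3 * N := by
    calc A.det.natAbs * N ≤ A.det.natAbs * B.det.natAbs := Nat.mul_le_mul_left _ h1
      _ = N^3 * N := by rw [h2]; ring
  exact Nat.le_of_mul_le_mul_right h3 hN

lemma four_pow (a b : ℝ) : (a + b)^4 ≤ 8 * (a^4 + b^4) := by
  nlinarith [sq_nonneg (a-b), sq_nonneg (a+b), sq_nonneg (a^2-b^2), mul_nonneg (sq_nonneg (a-b)) (sq_nonneg (a+b)), mul_nonneg (sq_nonneg (a-b)) (sq_nonneg a), mul_nonneg (sq_nonneg (a-b)) (sq_nonneg b), sq_nonneg ((a-b)^2)]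

lemma arith (ε C δ N D n d : ℝ) (hε : 0 < ε) (hC : 0 < C) (hδ : 0 < δ) (h1 : 56 * δ ≤ ε) (h2 : 16 * δ ≤ 1)
    (hN : 1 ≤ N) (hD : 1 ≤ D) (hn : 1 ≤ n) (hd : 0 < d) (hdD : d^2 = D) (hDN : D ≤ N^3)
    (h : n^(1/4:ℝ) ≤ C * (d + Real.sqrt d * N^(3/4:ℝ)) * (n^(2*δ) * D^δ))
    (hb : (16*C^4+1)^2 * max (N ^ ((5:ℝ)/2 + ε) * D ^ ((5:ℝ)/4 + ε)) (N ^ ((3:ℝ) + ε) * D ^ ((1:ℝ) + ε)) ≤ n) : False := by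
  have hN0 : 0 < N := by linarith
  have hD0 : 0 < D := by linarith
  have hn0 : 0 < n := by linarith
  set M0 := max (N^((5:ℝ)/2) * D^((5:ℝ)/4)) (N^3 * D) with hM0
  have hM0p : 0 < M0 := lt_max_of_lt_right (by positivity)
  set G := N * D with hG
  have hG1 : 1 ≤ G := one_le_mul_of_one_le_of_one_le hN hD
  have hG0 : 0 < G := by linarith
  have hM : max (N ^ ((5:ℝ)/2 + ε) * D ^ ((5:ℝ)/4 + ε)) (N ^ ((3:ℝ) + ε) * D ^ ((1:ℝ) + ε)) = M0 * G^ε := by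
    rw [hM0, max_mul_of_nonneg _ _ (by positivity), hG, Real.mul_rpow hN0.le hD0.le, Real.rpow_add hN0, Real.rpow_add hN0,
      Real.rpow_add hD0, Real.rpow_add hD0, Real.rpow_one]
    congr 1
    · ring
    · rw [show N^(3:ℝ) = N^3 by exact_mod_cast Real.rpow_natCast N 3]; ring
  rw [hM] at hb
  -- M0 ≤ G^3
  have hMG : M0 ≤ G^(3:ℝ) := by
    rw [hG, Real.mul_rpow hN0.le hD0.le]
    apply max_le
    · gcongr <;> first | assumption | norm_num
    · rw [show N^(3:ℝ) = N^3 by exact_mod_cast Real.rpow_natCast N 3]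
      gcongr
      calc D = D^(1:ℝ) := (Real.rpow_one D).symm
        _ ≤ D^(3:ℝ) := by gcongr <;> first | assumption | norm_num
  -- D^2
  have hD2 : D^2 ≤ M0 := by
    have h3 : D^((3:ℝ)/4) ≤ N^((5:ℝ)/2) := by
      calc D^((3:ℝ)/4) ≤ (N^3)^((3:ℝ)/4) := by gcongr
        _ = N^((9:ℝ)/4) := by rw [← Real.rpow_natCast, ← Real.rpow_mul hN0.le]; norm_num
        _ ≤ _ := Real.rpow_le_rpow_of_exponent_le hN (by norm_num)
    refine le_trans ?_ (le_max_left _ _)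
    calc D^2 = D^((3:ℝ)/4) * D^((5:ℝ)/4) := by
          rw [← Real.rpow_add hD0, ← Real.rpow_natCast]; norm_num
      _ ≤ _ := by gcongr
  have hND : N^3 * D ≤ M0 := le_max_right _ _
  -- fourth power
  have e1 : (n^(1/4:ℝ))^4 = n := by rw [← Real.rpow_natCast, ← Real.rpow_mul hn0.le]; norm_num
  have e2 : (n^(2*δ))^4 = n^(8*δ) := by rw [← Real.rpow_natCast, ← Real.rpow_mul hn0.le]; congr 1; push_cast; ring
  have e3 : (D^δ)^4 = D^(4*δ) := by rw [← Real.rpow_natCast, ← Real.rpow_mul hD0.le]; congr 1; push_cast; ring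
  have e4 : (d + Real.sqrt d * N^(3/4:ℝ))^4 ≤ 16 * M0 := by
    have h5 := four_pow d (Real.sqrt d * N^(3/4:ℝ))
    have e5 : d^4 = D^2 := by rw [← hdD]; ring
    have e6 : (Real.sqrt d * N^(3/4:ℝ))^4 = N^3 * D := by
      rw [mul_pow, show (Real.sqrt d)^4 = ((Real.sqrt d)^2)^2 by ring, Real.sq_sqrt hd.le, hdD, ← Real.rpow_natCast, ← Real.rpow_mul hN0.le]
      rw [show (3/4:ℝ) * ((4:ℕ):ℝ) = ((3:ℕ):ℝ) by norm_num, Real.rpow_natCast]; ring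
    rw [e5, e6] at h5
    linarith
  have h6 : n ≤ 16 * C^4 * M0 * (n^(8*δ) * G^(4*δ)) := by
    calc n = (n^(1/4:ℝ))^4 := e1.symm
      _ ≤ (C * (d + Real.sqrt d * N^(3/4:ℝ)) * (n^(2*δ) * D^δ))^4 := by gcongr
      _ = C^4 * (d + Real.sqrt d * N^(3/4:ℝ))^4 * (n^(8*δ) * D^(4*δ)) := by rw [← e2, ← e3]; ring
      _ ≤ C^4 * (16 * M0) * (n^(8*δ) * G^(4*δ)) := by
          have : D ≤ G := by rw [hG]; exact le_mul_of_one_le_left hD0.le hN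
          gcongr
      _ = _ := by ring
  have h7 : n^(1-8*δ) ≤ 16 * C^4 * M0 * G^(4*δ) := by
    have e : n = n^(8*δ) * n^(1-8*δ) := by rw [← Real.rpow_add hn0]; simp
    have : n^(8*δ) * n^(1-8*δ) ≤ n^(8*δ) * (16 * C^4 * M0 * G^(4*δ)) := by
      rw [← e]; linarith
    exact le_of_mul_le_mul_left this (by positivity)
  have hκ : 0 ≤ 1 - 8*δ := by linarith
  set K := (16*C^4+1)^2 with hK
  have hK1 : 1 ≤ K := one_le_pow₀ (by have : 0 < C^4 := by positivity
                                      linarith)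
  have hKs : 16*C^4+1 ≤ K^(1-8*δ) := by
    calc 16*C^4+1 = K^(1/2:ℝ) := by rw [hK, ← Real.sqrt_eq_rpow, Real.sqrt_sq (by positivity)]
      _ ≤ _ := Real.rpow_le_rpow_of_exponent_le hK1 (by linarith)
  have h8 : K^(1-8*δ) * (M0^(1-8*δ) * G^(ε*(1-8*δ))) ≤ 16 * C^4 * M0 * G^(4*δ) := by
    refine le_trans ?_ h7
    rw [Real.rpow_mul hG0.le, ← Real.mul_rpow (by positivity) (by positivity), ← Real.mul_rpow (by positivity) (by positivity)]
    exact Real.rpow_le_rpow (by positivity) hb hκ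
  have h9 : M0 * G^(4*δ) ≤ M0^(1-8*δ) * G^(ε*(1-8*δ)) := by
    have e : M0 = M0^(1-8*δ) * M0^(8*δ) := by rw [← Real.rpow_add hM0p]; simp
    have h10 : M0^(8*δ) ≤ G^(24*δ) := by
      calc M0^(8*δ) ≤ (G^(3:ℝ))^(8*δ) := by gcongr
        _ = _ := by rw [← Real.rpow_mul hG0.le]; congr 1; ring
    calc M0 * G^(4*δ) = M0^(1-8*δ) * (M0^(8*δ) * G^(4*δ)) := by rw [← mul_assoc, ← e]
      _ ≤ M0^(1-8*δ) * (G^(24*δ) * G^(4*δ)) := by gcongr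
      _ = M0^(1-8*δ) * G^(28*δ) := by rw [← Real.rpow_add hG0]; congr 2; ring
      _ ≤ _ := by
          have : 28 * δ ≤ ε*(1-8*δ) := by nlinarith
          gcongr
  have h11 : 0 < M0 * G^(4*δ) := by positivity
  have h12 : (16*C^4+1) * (M0 * G^(4*δ)) ≤ K^(1-8*δ) * (M0^(1-8*δ) * G^(ε*(1-8*δ))) := by gcongr
  linarith

end QF

open QF in
/-- Rouse, Theorem 1, second part. -/
theorem strong_local_solubility_implies_represented :
    ∀ ε : ℝ, 0 < ε → ∃ C : ℝ, 0 < C ∧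
      ∀ (A : Matrix (Fin 4) (Fin 4) ℤ) (N n : ℕ),
        IsGram A → IsPrimitiveQF A → PosDefQF A → IsLevel A N →
        0 < n → StrongLocalSolubility A n →
        C * max ((N : ℝ) ^ ((5:ℝ)/2 + ε) * (A.det : ℝ) ^ ((5:ℝ)/4 + ε))
            ((N : ℝ) ^ ((3:ℝ) + ε) * (A.det : ℝ) ^ ((1:ℝ) + ε)) ≤ (n : ℝ) →
        Represented A n := by
  intro ε hε
  have hδ : 0 < min (ε/56) (1/16) := by positivity
  obtain ⟨C, hC, hf⟩ := final_ineq (min (ε/56) (1/16)) hδ (lt_of_le_of_lt (min_le_right _ _) (by norm_num))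
  have hδ1 := min_le_left (ε/56) (1/16)
  have hδ2 := min_le_right (ε/56) (1/16)
  generalize min (ε/56) (1/16) = δ at *
  refine ⟨(16*C^4+1)^2, by positivity, ?_⟩
  intro A N n hA _ hpd hlev hn hS hb
  by_contra hrep
  obtain ⟨P, hPA, hP⟩ := exists_P A hpd
  have hdet : A.det ≠ 0 := det_ne hPA hP
  obtain ⟨B, hB, hAB, hBA⟩ := level_B hA hdet hlev
  have hN : 0 < N := hlev.1
  have hcube := det_le_cube hN hAB hBA hS
  have hdpos : (0:ℝ) < (A.det : ℝ) := by
    have h1 := hpd.det_pos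
    have h2 : (A.map (Int.cast : ℤ → ℝ)).det = (A.det : ℝ) := by
      exact (Int.cast_det A).symm
    rwa [h2] at h1
  have hdz : 0 < A.det := by exact_mod_cast hdpos
  have hnat : (A.det.natAbs : ℝ) = (A.det : ℝ) := by
    rw [Nat.cast_natAbs, abs_of_pos hdz]
  have h := hf A B P N n hA hPA hP hN hB hAB hBA hn hS hrep
  rw [hnat] at h
  unfold WW at h
  refine arith ε C δ N A.det n |P.det| hε hC hδ (by linarith) (by linarith) (by exact_mod_cast hN) (by exact_mod_cast hdz) (by exact_mod_cast hn) (abs_pos.2 hP)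
    ?_ ?_ h hb
  · rw [det_sq hPA, hnat]
  · rw [← hnat]; exact_mod_cast hcube
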